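/- Let n ≥ 2 be an integer, α ∈ (0,n), β > 0 and A > 0, and assume α < β and β > 1. Then there exists a mass m_* = m_*(n,α,β,A) > 0 such that for every m > m_*, the ball B[m] is an L¹-local minimizer at mass m of E_{α,β,A}. -/

import Mathlib

open MeasureTheory Metric Filter ENNReal

noncomputable section

/-- The Lebesgue density of `E` at `x` equals `d`. -/
def HasDensity {n : ℕ} (E : Set (EuclideanSpace ℝ (Fin n)))
    (x : EuclideanSpace ℝ (Fin n)) (d : ℝ) : Prop :=
  Filter.Tendsto
    (fun r : ℝ => (volume (E ∩ Metric.ball x r)).toReal / (volume (Metric.ball x r)).toReal)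
    (nhdsWithin 0 (Set.Ioi 0)) (nhds d)

/-- The essential boundary of `E`: points where `E` has neither density 0 nor density 1. -/
def essBoundary {n : ℕ} (E : Set (EuclideanSpace ℝ (Fin n))) :
    Set (EuclideanSpace ℝ (Fin n)) :=
  {x | ¬ HasDensity E x 0 ∧ ¬ HasDensity E x 1}

/-- The perimeter of `E`: the `(n-1)`-dimensional Hausdorff measure of the essential
boundary of `E`. -/
def perimeter {n : ℕ} (E : Set (EuclideanSpace ℝ (Fin n))) : ℝ≥0∞ :=
  μH[(n : ℝ) - 1] (essBoundary E)

/-- The Riesz energy `V_α(E) = ∫_{E×E} |x-y|^(α-n) dx dy`. -/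
def rieszEnergy {n : ℕ} (α : ℝ) (E : Set (EuclideanSpace ℝ (Fin n))) : ℝ≥0∞ :=
  ∫⁻ x in E, ∫⁻ y in E, ENNReal.ofReal (‖x - y‖ ^ (α - (n : ℝ)))

/-- The potential energy `U_{β,A}(E) = A ∫_E |x|^β dx`. -/
def potEnergy {n : ℕ} (β A : ℝ) (E : Set (EuclideanSpace ℝ (Fin n))) : ℝ≥0∞ :=
  ∫⁻ x in E, ENNReal.ofReal (A * ‖x‖ ^ β)

/-- The total energy `E_{α,β,A} = P + V_α + U_{β,A}`. -/
def totalEnergy {n : ℕ} (α β A : ℝ) (E : Set (EuclideanSpace ℝ (Fin n))) : ℝ≥0∞ :=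
  perimeter E + rieszEnergy α E + potEnergy β A E

/-- `E` is a minimizer of `E_{α,β,A}` at mass `m`. -/
def IsMinimizer {n : ℕ} (α β A m : ℝ) (E : Set (EuclideanSpace ℝ (Fin n))) : Prop :=
  MeasurableSet E ∧ volume E = ENNReal.ofReal m ∧
    ∀ F : Set (EuclideanSpace ℝ (Fin n)), MeasurableSet F → volume F = ENNReal.ofReal m →
      totalEnergy α β A E ≤ totalEnergy α β A F

/-- The unit ball of `ℝⁿ` centered at the origin. -/
def unitBall (n : ℕ) : Set (EuclideanSpace ℝ (Fin n)) := Metric.ball 0 1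

/-- `B[m]`: the open ball centered at `0` with volume `m`. -/
def ballOfVolume (n : ℕ) (m : ℝ) : Set (EuclideanSpace ℝ (Fin n)) :=
  Metric.ball 0 ((m / (volume (unitBall n)).toReal) ^ (1 / (n : ℝ)))

/-- `E` is an `L¹`-local minimizer of `E_{α,β,A}` at mass `m`: there is `ε > 0` such that
`E` minimizes the energy among sets of the same mass within symmetric difference `< ε`. -/
def IsL1LocalMin {n : ℕ} (α β A m : ℝ) (E : Set (EuclideanSpace ℝ (Fin n))) : Prop :=
  MeasurableSet E ∧ volume E = ENNReal.ofReal m ∧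
    ∃ ε : ℝ, 0 < ε ∧ ∀ F : Set (EuclideanSpace ℝ (Fin n)), MeasurableSet F →
      volume F = ENNReal.ofReal m → volume (symmDiff E F) < ENNReal.ofReal ε →
        totalEnergy α β A E ≤ totalEnergy α β A F


/-- Euclidean space abbreviation. -/
abbrev Eu (n : ℕ) := EuclideanSpace ℝ (Fin n)

theorem exists_kappa (m : ℕ) : ∃ κ : ℝ≥0∞, κ ≠ 0 ∧ κ ≠ ∞ ∧
    (μH[(m : ℝ)] : Measure (Eu m)) = κ • volume := by
  have h : (Module.finrank ℝ (Eu m) : ℝ) = m := by simp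
  have : (μH[(m : ℝ)] : Measure (Eu m)).IsAddHaarMeasure := by
    rw [← h]; infer_instance
  refine ⟨Measure.addHaarScalarFactor (μH[(m : ℝ)] : Measure (Eu m)) volume, ?_, by simp, ?_⟩
  · have := Measure.addHaarScalarFactor_pos_of_isAddHaarMeasure (μH[(m : ℝ)] : Measure (Eu m)) volume
    simpa using this.ne'
  · exact Measure.isAddLeftInvariant_eq_smul _ _

/-- the Hausdorff normalisation constant. -/
def kap (m : ℕ) : ℝ≥0∞ := (exists_kappa m).choose
theorem kap_ne_zero (m) : kap m ≠ 0 := (exists_kappa m).choose_spec.1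
theorem kap_ne_top (m) : kap m ≠ ∞ := (exists_kappa m).choose_spec.2.1
theorem hausdorff_eq (m) : (μH[(m : ℝ)] : Measure (Eu m)) = kap m • volume :=
  (exists_kappa m).choose_spec.2.2

/-- Orthogonal splitting along a unit vector `v`. -/
structure Spl {m : ℕ} (v : Eu (m+1)) where
  io : Eu m →ₗ[ℝ] Eu (m+1)
  pr : Eu (m+1) →ₗ[ℝ] Eu m
  ht : Eu (m+1) →ₗ[ℝ] ℝ
  mp : MeasurePreserving (fun p : Eu m × ℝ => io p.1 + p.2 • v) volume volume
  pr_io : ∀ z, pr (io z) = z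
  pr_v : pr v = 0
  ht_io : ∀ z, ht (io z) = 0
  ht_v : ht v = 1
  dec : ∀ x, io (pr x) + ht x • v = x
  nsq : ∀ x, ‖x‖ ^ 2 = ‖pr x‖ ^ 2 + ht x ^ 2

theorem exists_spl {m : ℕ} (v : Eu (m+1)) (hv : ‖v‖ = 1) : Nonempty (Spl v) := by
  obtain ⟨b, hb⟩ : ∃ b : OrthonormalBasis (Fin (m+1)) ℝ (Eu (m+1)), b 0 = v := by
    have hc : Module.finrank ℝ (Eu (m+1)) = Fintype.card (Fin (m+1)) := by simp
    have := Orthonormal.exists_orthonormalBasis_extension_of_card_eq (𝕜 := ℝ) hc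
      (v := fun _ => v) (s := {0}) (by
        rw [orthonormal_iff_ite]
        rintro ⟨i, hi⟩ ⟨j, hj⟩
        simp only [Set.mem_singleton_iff] at hi hj
        subst hi hj
        simp [hv])
    obtain ⟨b, hb⟩ := this
    exact ⟨b, hb 0 rfl⟩
  have hmp := (volume_preserving_piFinSuccAbove (fun _ : Fin (m+1) => ℝ) 0)
  let io : Eu m →ₗ[ℝ] Eu (m+1) :=
    { toFun := fun z => b.repr.symm (WithLp.toLp 2 (Fin.cons 0 (WithLp.ofLp z)))
      map_add' := by
        intro x y
        rw [← map_add]; congr 1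
        ext i; refine Fin.cases ?_ (fun i => ?_) i <;> simp
      map_smul' := by
        intro c x
        rw [RingHom.id_apply, ← map_smul]; congr 1
        ext i; refine Fin.cases ?_ (fun i => ?_) i <;> simp }
  let pr : Eu (m+1) →ₗ[ℝ] Eu m :=
    { toFun := fun x => WithLp.toLp 2 (fun i => b.repr x i.succ)
      map_add' := by intro x y; ext i; simp
      map_smul' := by intro c x; ext i; simp }
  let ht : Eu (m+1) →ₗ[ℝ] ℝ :=
    { toFun := fun x => b.repr x 0
      map_add' := by intro x y; simp
      map_smul' := by intro c x; simp }
  have hbv : b.repr v = EuclideanSpace.single 0 1 := by rw [← hb, b.repr_self]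
  have key : ∀ (z : Eu m) (t : ℝ), io z + t • v =
      b.repr.symm (WithLp.toLp 2 (Fin.cons t (WithLp.ofLp z))) := by
    intro z t
    apply b.repr.injective
    simp only [map_add, map_smul, hbv, LinearIsometryEquiv.apply_symm_apply, io,
      LinearMap.coe_mk, AddHom.coe_mk]
    ext i; refine Fin.cases ?_ (fun i => ?_) i <;> simp
  refine ⟨⟨io, pr, ht, ?_, ?_, ?_, ?_, ?_, ?_, ?_⟩⟩
  · have h1 := (hmp.symm).comp (Measure.measurePreserving_swap (μ := (volume : Measure (Fin m → ℝ))) (ν := (volume : Measure ℝ)))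
    have h2 := (EuclideanSpace.volume_preserving_symm_measurableEquiv_toLp (Fin m)).symm
    have h3 : MeasurePreserving (fun z : Eu m => WithLp.ofLp z) volume volume := PiLp.volume_preserving_ofLp (Fin m)
    have h4 : MeasurePreserving (Prod.map (fun z : Eu m => WithLp.ofLp z) (id : ℝ → ℝ)) (volume : Measure (Eu m × ℝ)) volume := h3.prod (MeasurePreserving.id _)
    have h5 : MeasurePreserving (fun z : Fin (m+1) → ℝ => (WithLp.toLp 2 z : Eu (m+1))) volume volume := PiLp.volume_preserving_toLp (Fin (m+1))
    have h6 := (b.measurePreserving_repr_symm).comp (h5.comp (h1.comp h4))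
    convert h6 using 1
    ext1 p
    rw [key]
    simp only [Function.comp]
    congr 2
    ext i; refine Fin.cases ?_ (fun i => ?_) i <;> simp [MeasurableEquiv.piFinSuccAbove, Fin.insertNthEquiv]
  · intro z; ext i; simp [pr, io]
  · ext i; simp [pr, hbv]
  · intro z; simp [ht, io]
  · simp [ht, hbv]
  · intro x
    rw [key]
    apply b.repr.injective
    simp only [LinearIsometryEquiv.apply_symm_apply, pr, ht, LinearMap.coe_mk, AddHom.coe_mk]
    ext i; refine Fin.cases ?_ (fun i => ?_) i <;> simp
  · intro x
    rw [← b.repr.norm_map x, EuclideanSpace.norm_sq_eq, EuclideanSpace.norm_sq_eq, Fin.sum_univ_succ]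
    simp [pr, ht, add_comm]


namespace Spl
variable {m : ℕ} {v : Eu (m+1)}

/-- the splitting for the opposite direction. -/
def neg (S : Spl v) : Spl (-v) where
  io := S.io
  pr := S.pr
  ht := -S.ht
  mp := by
    have h1 : MeasurePreserving (Prod.map (id : Eu m → Eu m) (fun t : ℝ => -t)) (volume : Measure (Eu m × ℝ)) volume :=
      (MeasurePreserving.id _).prod (Measure.measurePreserving_neg _)
    have := S.mp.comp h1
    convert this using 1
    ext1 p; simp
  pr_io := S.pr_io
  pr_v := by simp [S.pr_v]
  ht_io := by simp [S.ht_io]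
  ht_v := by simp [S.ht_v]
  dec := by intro x; simpa using S.dec x
  nsq := by intro x; simpa using S.nsq x

theorem norm_pr_le (S : Spl v) (x) : ‖S.pr x‖ ≤ ‖x‖ := by
  have := S.nsq x
  nlinarith [norm_nonneg x, norm_nonneg (S.pr x), sq_nonneg (S.ht x)]

theorem abs_ht_le (S : Spl v) (x) : |S.ht x| ≤ ‖x‖ := by
  have := S.nsq x
  rw [← sq_abs (S.ht x)] at this
  nlinarith [norm_nonneg x, abs_nonneg (S.ht x), sq_nonneg ‖S.pr x‖]

theorem lip_pr (S : Spl v) : LipschitzWith 1 S.pr := by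
  apply LipschitzWith.of_dist_le_mul
  intro x y
  rw [dist_eq_norm, dist_eq_norm, ← map_sub]; simpa using S.norm_pr_le (x - y)

theorem continuous_ht (S : Spl v) : Continuous S.ht := S.ht.continuous_of_finiteDimensional
theorem continuous_pr (S : Spl v) : Continuous S.pr := S.pr.continuous_of_finiteDimensional
theorem continuous_io (S : Spl v) : Continuous S.io := S.io.continuous_of_finiteDimensional

theorem norm_add_le (S : Spl v) (z : Eu m) (t : ℝ) : ‖S.io z + t • v‖ ≤ ‖z‖ + |t| := by
  have := S.nsq (S.io z + t • v)
  simp only [map_add, map_smul, S.pr_io, S.pr_v, S.ht_io, S.ht_v, smul_zero, add_zero, zero_add, smul_eq_mul, mul_one] at this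
  rw [← sq_abs t] at this
  nlinarith [norm_nonneg (S.io z + t • v), norm_nonneg z, abs_nonneg t, mul_nonneg (norm_nonneg z) (abs_nonneg t)]

theorem null_pr (S : Spl v) {Z : Set (Eu m)} (hZ : volume Z = 0) : volume (S.pr ⁻¹' Z) = 0 := by
  obtain ⟨M, hZM, hM, hM0⟩ := exists_measurable_superset_of_null hZ
  refine measure_mono_null (Set.preimage_mono hZM) ?_
  rw [← S.mp.measure_preimage (S.continuous_pr.measurable hM).nullMeasurableSet]
  have : (fun p : Eu m × ℝ => S.io p.1 + p.2 • v) ⁻¹' (S.pr ⁻¹' M) = M ×ˢ Set.univ := by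
    ext p; simp [S.pr_io, S.pr_v]
  rw [this, Measure.volume_eq_prod, Measure.prod_prod, hM0, zero_mul]

theorem vol_box (S : Spl v) {M : Set (Eu m)} (hM : MeasurableSet M) {J : Set ℝ} (hJ : MeasurableSet J) :
    volume (S.pr ⁻¹' M ∩ S.ht ⁻¹' J) = volume M * volume J := by
  rw [← S.mp.measure_preimage ((S.continuous_pr.measurable hM).inter (S.continuous_ht.measurable hJ)).nullMeasurableSet]
  have : (fun p : Eu m × ℝ => S.io p.1 + p.2 • v) ⁻¹' (S.pr ⁻¹' M ∩ S.ht ⁻¹' J) = M ×ˢ J := by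
    ext p; simp [S.pr_io, S.pr_v, S.ht_io, S.ht_v]
  rw [this, Measure.volume_eq_prod, Measure.prod_prod]

theorem null_up (S : Spl v) {F N G D : Set (Eu (m+1))} (hF : MeasurableSet F) (hN : MeasurableSet N)
    (hN0 : volume N = 0) {r0 : ℝ} (hr0 : 0 < r0) {th : ℝ≥0∞}
    (hth : th * volume (ball (0 : Eu (m+1)) 5) < volume (closedBall (0 : Eu m) 1) / 2)
    (hG : ∀ x ∈ G, ∀ r, 0 < r → r < r0 → volume (F ∩ ball x r) ≤ th * volume (ball x r))
    (hD : D ⊆ F ∪ N) {η : ℝ} (hη : 0 < η) :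
    volume {z : Eu m | ∃ s : ℝ, S.io z + s • v ∈ G ∧
      ∀ τ, 0 < τ → τ < η → S.io z + (s + τ) • v ∈ D} = 0 := by
  set W : ℤ → Set (Eu m) := fun j => {z : Eu m | ∃ s : ℝ, (j * (η/2) ≤ s ∧ s < (j+1) * (η/2)) ∧ S.io z + s • v ∈ G ∧
      ∀ τ, 0 < τ → τ < η → S.io z + (s + τ) • v ∈ D} with hW
  have hsub : {z : Eu m | ∃ s : ℝ, S.io z + s • v ∈ G ∧
      ∀ τ, 0 < τ → τ < η → S.io z + (s + τ) • v ∈ D} ⊆ ⋃ j, W j := by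
    rintro z ⟨s, h1, h2⟩
    rw [Set.mem_iUnion]
    refine ⟨⌊s / (η/2)⌋, s, ⟨?_, ?_⟩, h1, h2⟩
    · have := Int.floor_le (s / (η/2))
      rwa [le_div_iff₀ (by positivity)] at this
    · have := Int.lt_floor_add_one (s / (η/2))
      rwa [div_lt_iff₀ (by positivity)] at this
  refine measure_mono_null hsub (measure_iUnion_null fun j => ?_)
  by_contra hpos
  have hne : (ae (volume.restrict (W j))).NeBot := by
    rw [ae_neBot]
    intro h
    exact hpos (Measure.restrict_eq_zero.1 h)
  obtain ⟨z0, hz0⟩ := (Besicovitch.ae_tendsto_measure_inter_div (volume : Measure (Eu m)) (W j)).exists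
  have hhalf : ∀ᶠ r in nhdsWithin (0:ℝ) (Set.Ioi 0), (1/2 : ℝ≥0∞) < volume (W j ∩ closedBall z0 r) / volume (closedBall z0 r) := by
    refine hz0.eventually (lt_mem_nhds ?_)
    exact ENNReal.half_lt_self one_ne_zero one_ne_top
  have hsm : ∀ᶠ r in nhdsWithin (0:ℝ) (Set.Ioi 0), 0 < r ∧ 5 * r < r0 ∧ r < η/2 := by
    have h1 : ∀ᶠ r in nhdsWithin (0:ℝ) (Set.Ioi 0), r < min (r0/5) (η/2) :=
      nhdsWithin_le_nhds (gt_mem_nhds (by positivity))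
    filter_upwards [h1, self_mem_nhdsWithin] with r h1 h2
    refine ⟨h2, ?_, h1.trans_le (min_le_right _ _)⟩
    have := h1.trans_le (min_le_left _ _); linarith
  obtain ⟨r, hr, hrpos, hr5, hrη⟩ := (hhalf.and hsm).exists
  have hcb0 : volume (closedBall z0 r) ≠ 0 := (measure_closedBall_pos _ _ hrpos).ne'
  have hcbt : volume (closedBall z0 r) ≠ ∞ := measure_closedBall_lt_top.ne
  have hvol : volume (closedBall z0 r) / 2 ≤ volume (W j ∩ closedBall z0 r) := by
    have := (ENNReal.lt_div_iff_mul_lt (Or.inl hcb0) (Or.inl hcbt)).1 hr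
    rw [ENNReal.div_eq_inv_mul]; simpa using this.le
  -- set of witnesses
  set Ws : Set ℝ := {s | ∃ z ∈ closedBall z0 r, (j * (η/2) ≤ s ∧ s < (j+1) * (η/2)) ∧ S.io z + s • v ∈ G ∧
      ∀ τ, 0 < τ → τ < η → S.io z + (s + τ) • v ∈ D} with hWs
  have hWne : Ws.Nonempty := by
    have : (W j ∩ closedBall z0 r).Nonempty := by
      apply nonempty_of_measure_ne_zero (μ := volume)
      intro h0; rw [h0] at hvol
      have : volume (closedBall z0 r) / 2 ≠ 0 := by simp [hcb0]
      exact this (le_antisymm hvol bot_le)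
    obtain ⟨z, ⟨s, h⟩, hz⟩ := this
    exact ⟨s, z, hz, h⟩
  have hWb : BddAbove Ws := ⟨(j+1) * (η/2), by rintro s ⟨z, hz, h, _⟩; exact h.2.le⟩
  obtain ⟨s1, hs1, hs1lt⟩ := exists_lt_of_lt_csSup hWne (show sSup Ws - r < sSup Ws by linarith)
  obtain ⟨z1, hz1, hb1, hg1, hd1⟩ := hs1
  set Sg := sSup Ws with hSg
  have hSg1 : s1 ≤ Sg := le_csSup hWb ⟨z1, hz1, hb1, hg1, hd1⟩
  have hSub : (j+1) * (η/2) ≥ Sg := csSup_le hWne (by rintro s ⟨z, hz, h, _⟩; exact h.2.le)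
  set x1 := S.io z1 + s1 • v with hx1
  have hcyl : (W j ∩ closedBall z0 r) ×ˢ Set.Ioo Sg (Sg + r) ⊆
      (fun p : Eu m × ℝ => S.io p.1 + p.2 • v) ⁻¹' ((F ∪ N) ∩ ball x1 (5*r)) := by
    rintro ⟨z, t⟩ ⟨⟨⟨s, hb, hg, hd⟩, hz⟩, ht1, ht2⟩
    have hs : s ≤ Sg := le_csSup hWb ⟨z, hz, hb, hg, hd⟩
    simp only at ht1 ht2 hz
    refine ⟨?_, ?_⟩
    · have := hd (t - s) (by linarith) (by nlinarith [hb.1])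
      rw [add_sub_cancel] at this
      exact hD this
    · rw [mem_ball, dist_eq_norm]
      have e : S.io z + t • v - x1 = S.io (z - z1) + (t - s1) • v := by
        rw [hx1, map_sub, sub_smul]; abel
      simp only
      rw [e]
      refine (S.norm_add_le _ _).trans_lt ?_
      have h1 : ‖z - z1‖ ≤ 2 * r := by
        rw [← dist_eq_norm]
        have := dist_triangle_right z z1 z0
        rw [mem_closedBall] at hz hz1; linarith
      have h2 : |t - s1| ≤ 2 * r := by
        rw [abs_le]; constructor <;> linarith
      linarith
  have hge : volume (closedBall z0 r) / 2 * ENNReal.ofReal r ≤ volume (F ∩ ball x1 (5*r)) := by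
    calc _ ≤ volume (W j ∩ closedBall z0 r) * volume (Set.Ioo Sg (Sg + r)) := by
            rw [Real.volume_Ioo]; simp only [add_sub_cancel_left]; gcongr
      _ = volume ((W j ∩ closedBall z0 r) ×ˢ Set.Ioo Sg (Sg + r)) := by
            rw [Measure.volume_eq_prod, Measure.prod_prod]
      _ ≤ _ := measure_mono hcyl
      _ = volume ((F ∪ N) ∩ ball x1 (5*r)) :=
            S.mp.measure_preimage ((hF.union hN).inter measurableSet_ball).nullMeasurableSet
      _ ≤ volume (F ∩ ball x1 (5*r)) + volume N := by
            refine (measure_mono ?_).trans (measure_union_le _ _)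
            rw [Set.union_inter_distrib_right]
            exact Set.union_subset_union le_rfl Set.inter_subset_left
      _ = _ := by rw [hN0, add_zero]
  have hle := hge.trans (hG x1 hg1 (5*r) (by positivity) hr5)
  rw [mul_comm 5 r, Measure.addHaar_ball_mul_of_pos _ _ hrpos] at hle
  have hcbr := Measure.addHaar_closedBall_mul_of_pos (volume : Measure (Eu m)) z0 hrpos 1
  rw [mul_one] at hcbr
  rw [hcbr] at hle
  simp only [finrank_euclideanSpace, Fintype.card_fin] at hle
  set a := volume (ball (0 : Eu (m+1)) 5)
  set b := volume (closedBall (0 : Eu m) 1)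
  have e1 : ENNReal.ofReal (r ^ m) * b / 2 * ENNReal.ofReal r = ENNReal.ofReal (r ^ (m+1)) * (b / 2) := by
    rw [pow_succ, ENNReal.ofReal_mul (by positivity), div_eq_mul_inv, div_eq_mul_inv]; ring
  have e2 : th * (ENNReal.ofReal (r ^ (m+1)) * a) = ENNReal.ofReal (r ^ (m+1)) * (th * a) := by ring
  rw [e1, e2] at hle
  have hp : ENNReal.ofReal (r ^ (m+1)) ≠ 0 := by
    rw [Ne, ENNReal.ofReal_eq_zero, not_le]; positivity
  rw [ENNReal.mul_le_mul_iff_right hp ENNReal.ofReal_ne_top] at hle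
  exact absurd hth (not_lt.2 hle)
end Spl


/-- one-sided contradiction used in the Baire argument on lines. -/
theorem line_aux {a b : ℝ} {C0 C1 G J : Set ℝ} (hcov : Set.Icc a b ⊆ C0 ∪ C1)
    (hGC : Disjoint G C1) (hJ : J.OrdConnected) (hJo : IsOpen J)
    (hT : closure (C0 ∩ Set.Icc a b) ∩ closure (C1 ∩ Set.Icc a b) ∩ J ⊆ G)
    {t0 : ℝ} (ht0 : t0 ∈ closure (C0 ∩ Set.Icc a b) ∩ closure (C1 ∩ Set.Icc a b) ∩ J)
    (hup : ∀ s ∈ G, ∀ η > 0, ∃ τ, 0 < τ ∧ τ < η ∧ s + τ ∉ C1)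
    (hdn : ∀ s ∈ G, ∀ η > 0, ∃ τ, 0 < τ ∧ τ < η ∧ s - τ ∉ C1) : False := by
  obtain ⟨⟨h0, h1⟩, hj⟩ := ht0
  obtain ⟨t1, ht1J, ht1C, ht1ab⟩ := mem_closure_iff.1 h1 J hJo hj
  set K := closure (C0 ∩ Set.Icc a b) with hK
  have hKc : IsClosed K := isClosed_closure
  have hKab : K ⊆ Set.Icc a b := closure_minimal Set.inter_subset_right isClosed_Icc
  have ht1K : t1 ∉ K := by
    intro h
    have : t1 ∈ G := hT ⟨⟨h, subset_closure ⟨ht1C, ht1ab⟩⟩, ht1J⟩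
    exact Set.disjoint_left.1 hGC this ht1C
  have hnK : ∀ t ∈ Set.Icc a b, t ∉ K → t ∈ C1 := by
    intro t ht hk
    rcases hcov ht with h | h
    · exact absurd (show t ∈ K from subset_closure ⟨h, ht⟩) hk
    · exact h
  have hne : t0 ≠ t1 := by rintro rfl; exact ht1K h0
  rcases lt_or_gt_of_ne hne with hlt | hlt
  · set s := sSup (K ∩ Set.Icc t0 t1) with hs
    have hcpt : IsCompact (K ∩ Set.Icc t0 t1) := isCompact_Icc.inter_left hKc
    have hsm : s ∈ K ∩ Set.Icc t0 t1 := hcpt.sSup_mem ⟨t0, h0, le_rfl, hlt.le⟩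
    have hst1 : s < t1 := lt_of_le_of_ne hsm.2.2 (by rintro h; rw [h] at hsm; exact ht1K hsm.1)
    have hab : ∀ t, s < t → t < t1 → t ∈ C1 ∧ t ∈ Set.Icc a b := by
      intro t h1 h2
      have hm : t ∈ Set.Icc a b := ⟨(hKab hsm.1).1.trans h1.le, h2.le.trans ht1ab.2⟩
      refine ⟨hnK t hm fun hk => ?_, hm⟩
      exact absurd (le_csSup hcpt.bddAbove ⟨hk, hsm.2.1.trans h1.le, h2.le⟩) (not_le.2 h1)
    have hsT : s ∈ closure (C1 ∩ Set.Icc a b) := by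
      have : s ∈ closure (Set.Ioo s t1) := by rw [closure_Ioo hst1.ne]; exact ⟨le_rfl, hst1.le⟩
      exact closure_mono (fun t ht => hab t ht.1 ht.2) this
    have hsG : s ∈ G := hT ⟨⟨hsm.1, hsT⟩, hJ.out hj ht1J hsm.2⟩
    obtain ⟨τ, h1, h2, h3⟩ := hup s hsG (t1 - s) (by linarith)
    exact h3 (hab _ (by linarith) (by linarith)).1
  · set s := sInf (K ∩ Set.Icc t1 t0) with hs
    have hcpt : IsCompact (K ∩ Set.Icc t1 t0) := isCompact_Icc.inter_left hKc
    have hsm : s ∈ K ∩ Set.Icc t1 t0 := hcpt.sInf_mem ⟨t0, h0, hlt.le, le_rfl⟩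
    have hst1 : t1 < s := lt_of_le_of_ne hsm.2.1 (by rintro h; rw [← h] at hsm; exact ht1K hsm.1)
    have hab : ∀ t, t1 < t → t < s → t ∈ C1 ∧ t ∈ Set.Icc a b := by
      intro t h1 h2
      have hm : t ∈ Set.Icc a b := ⟨ht1ab.1.trans h1.le, h2.le.trans (hKab hsm.1).2⟩
      refine ⟨hnK t hm fun hk => ?_, hm⟩
      exact absurd (csInf_le hcpt.bddBelow ⟨hk, h1.le, h2.le.trans hsm.2.2⟩) (not_le.2 h2)
    have hsT : s ∈ closure (C1 ∩ Set.Icc a b) := by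
      have : s ∈ closure (Set.Ioo t1 s) := by rw [closure_Ioo hst1.ne]; exact ⟨hst1.le, le_rfl⟩
      exact closure_mono (fun t ht => hab t ht.1 ht.2) this
    have hsG : s ∈ G := hT ⟨⟨hsm.1, hsT⟩, hJ.out ht1J hj hsm.2⟩
    obtain ⟨τ, h1, h2, h3⟩ := hdn s hsG (s - t1) (by linarith)
    exact h3 (hab _ (by linarith) (by linarith)).1

theorem line_baire {a b : ℝ} {C0 C1 : Set ℝ} {G H : ℕ → Set ℝ}
    (hG : ∀ k, IsClosed (G k)) (hH : ∀ k, IsClosed (H k))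
    (hCG : C0 ⊆ ⋃ k, G k) (hCH : C1 ⊆ ⋃ k, H k)
    (hGC : ∀ k, Disjoint (G k) C1) (hHC : ∀ k, Disjoint (H k) C0)
    (hcov : Set.Icc a b ⊆ C0 ∪ C1)
    (hup : ∀ k, ∀ s ∈ G k, ∀ η > 0, ∃ τ, 0 < τ ∧ τ < η ∧ s + τ ∉ C1)
    (hdn : ∀ k, ∀ s ∈ G k, ∀ η > 0, ∃ τ, 0 < τ ∧ τ < η ∧ s - τ ∉ C1)
    (hup' : ∀ k, ∀ s ∈ H k, ∀ η > 0, ∃ τ, 0 < τ ∧ τ < η ∧ s + τ ∉ C0)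
    (hdn' : ∀ k, ∀ s ∈ H k, ∀ η > 0, ∃ τ, 0 < τ ∧ τ < η ∧ s - τ ∉ C0)
    {p q : ℝ} (hp : p ∈ Set.Icc a b) (hq : q ∈ Set.Icc a b) (hp0 : p ∈ C0) (hq1 : q ∈ C1) : False := by
  set T := closure (C0 ∩ Set.Icc a b) ∩ closure (C1 ∩ Set.Icc a b) with hT
  have hTc : IsClosed T := isClosed_closure.inter isClosed_closure
  have hK0 : closure (C0 ∩ Set.Icc a b) ⊆ Set.Icc a b := closure_minimal Set.inter_subset_right isClosed_Icc
  have hTne : T.Nonempty := by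
    have hpc : IsPreconnected (Set.Icc a b) := isPreconnected_Icc
    rw [isPreconnected_closed_iff] at hpc
    have := hpc (closure (C0 ∩ Set.Icc a b)) (closure (C1 ∩ Set.Icc a b)) isClosed_closure isClosed_closure
      (fun t ht => (hcov ht).elim (fun h => Or.inl (subset_closure ⟨h, ht⟩)) (fun h => Or.inr (subset_closure ⟨h, ht⟩)))
      ⟨p, hp, subset_closure ⟨hp0, hp⟩⟩ ⟨q, hq, subset_closure ⟨hq1, hq⟩⟩
    exact this.mono Set.inter_subset_right
  have : Nonempty T := hTne.to_subtype
  have : CompleteSpace T := hTc.completeSpace_coe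
  obtain ⟨i, t, ht⟩ := nonempty_interior_of_iUnion_of_closed
    (f := fun i : ℕ ⊕ ℕ => (Subtype.val ⁻¹' (Sum.elim G H i) : Set T))
    (by
      rintro (i | i)
      · exact (hG i).preimage continuous_subtype_val
      · exact (hH i).preimage continuous_subtype_val)
    (by
      ext ⟨t, ht⟩
      simp only [Set.mem_iUnion, Set.mem_preimage, Set.mem_univ, iff_true]
      rcases hcov (hK0 ht.1) with h | h
      · obtain ⟨k, hk⟩ := Set.mem_iUnion.1 (hCG h); exact ⟨Sum.inl k, hk⟩
      · obtain ⟨k, hk⟩ := Set.mem_iUnion.1 (hCH h); exact ⟨Sum.inr k, hk⟩)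
  obtain ⟨e, he, hball⟩ := Metric.mem_nhds_iff.1 (mem_interior_iff_mem_nhds.1 ht)
  set J := ball (t : ℝ) e with hJ
  have hJo : J.OrdConnected := (convex_ball _ _).ordConnected
  have hsub : ∀ s ∈ T ∩ J, s ∈ Sum.elim G H i := by
    rintro s ⟨h1, h2⟩
    exact hball (show (⟨s, h1⟩ : T) ∈ ball t e from h2)
  have htJ : (t : ℝ) ∈ J := mem_ball_self he
  rcases i with i | i
  · exact line_aux hcov (hGC i) hJo isOpen_ball hsub ⟨t.2, htJ⟩ (hup i) (hdn i)
  · refine line_aux (C0 := C1) (C1 := C0) (by rwa [Set.union_comm]) (hHC i) hJo isOpen_ball (J := J) (G := H i) ?_ (t0 := t) ⟨⟨t.2.2, t.2.1⟩, htJ⟩ (hup' i) (hdn' i)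
    rintro s ⟨⟨h1, h2⟩, h3⟩
    exact hsub s ⟨⟨h2, h1⟩, h3⟩


/-- density zero points -/
def dz {n : ℕ} (F : Set (Eu n)) : Set (Eu n) := {x | HasDensity F x 0}

theorem ratio_compl {n : ℕ} {F : Set (Eu n)} (hF : MeasurableSet F) (x : Eu n) {r : ℝ} (hr : 0 < r) :
    (volume (F ∩ ball x r)).toReal / (volume (ball x r)).toReal
    + (volume (Fᶜ ∩ ball x r)).toReal / (volume (ball x r)).toReal = 1 := by
  have h0 : (volume (ball x r)).toReal ≠ 0 :=
    (ENNReal.toReal_pos (measure_ball_pos _ _ hr).ne' measure_ball_lt_top.ne).ne'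
  rw [← add_div, div_eq_one_iff_eq h0, ← ENNReal.toReal_add]
  · congr 1
    rw [Set.inter_comm, Set.inter_comm Fᶜ, ← Set.sdiff_eq]
    exact measure_inter_add_sdiff _ hF
  · exact measure_ne_top_of_subset Set.inter_subset_right measure_ball_lt_top.ne
  · exact measure_ne_top_of_subset Set.inter_subset_right measure_ball_lt_top.ne

theorem hasDensity_one_iff {n : ℕ} {F : Set (Eu n)} (hF : MeasurableSet F) (x : Eu n) :
    HasDensity F x 1 ↔ x ∈ dz Fᶜ := by
  have key : ∀ F : Set (Eu n), MeasurableSet F → ∀ d, HasDensity F x d → HasDensity Fᶜ x (1 - d) := by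
    intro F hF d h
    have := (tendsto_const_nhds (x := (1:ℝ))).sub h
    refine this.congr' ?_
    filter_upwards [self_mem_nhdsWithin] with r hr
    linarith [ratio_compl hF x hr]
  constructor
  · intro h
    have := key F hF 1 h
    simpa [dz] using this
  · intro h
    have := key Fᶜ hF.compl 0 h
    simpa using this

theorem dz_disj {n : ℕ} {F : Set (Eu n)} (hF : MeasurableSet F) {x : Eu n} (h : x ∈ dz F) (h' : x ∈ dz Fᶜ) : False := by
  have := tendsto_nhds_unique h ((hasDensity_one_iff hF x).2 h')
  norm_num at this

theorem mem_dz_of_not_mem {n : ℕ} {F : Set (Eu n)} (hF : MeasurableSet F) {x : Eu n} (h : x ∉ essBoundary F) :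
    x ∈ dz F ∨ x ∈ dz Fᶜ := by
  rw [← hasDensity_one_iff hF]
  by_contra hc
  push Not at hc
  exact h hc

theorem ae_mem_dz {n : ℕ} {F : Set (Eu n)} (hF : MeasurableSet F) : ∀ᵐ x, x ∉ F → x ∈ dz F := by
  filter_upwards [Besicovitch.ae_tendsto_measure_inter_div_of_measurableSet (volume : Measure (Eu n)) hF] with x hx hxF
  rw [Set.indicator_of_notMem hxF] at hx
  have h2 := (ENNReal.tendsto_toReal (by simp)).comp hx
  refine Tendsto.congr' ?_ h2
  filter_upwards [self_mem_nhdsWithin] with r hr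
  simp only [Function.comp, ENNReal.toReal_div]
  have hs : volume (sphere x r) = 0 := Measure.addHaar_sphere_of_ne_zero _ _ (ne_of_gt hr)
  have e1 : ∀ F : Set (Eu n), volume (F ∩ closedBall x r) = volume (F ∩ ball x r) := by
    intro F
    apply le_antisymm _ (measure_mono (Set.inter_subset_inter_right _ ball_subset_closedBall))
    rw [← ball_union_sphere, Set.inter_union_distrib_left]
    refine (measure_union_le _ _).trans ?_
    rw [measure_mono_null Set.inter_subset_right hs, add_zero]
  have e2 : volume (closedBall x r) = volume (ball x r) := by simpa using e1 Set.univ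
  rw [e1, e2]

/-- threshold -/
def th1 (m : ℕ) : ℝ≥0∞ := min (1/2) (volume (closedBall (0 : Eu m) 1) / (4 * volume (ball (0 : Eu (m+1)) 5)))

theorem th1_pos (m) : 0 < th1 m := by
  apply lt_min (by simp)
  apply ENNReal.div_pos (measure_closedBall_pos _ _ one_pos).ne'
  exact ENNReal.mul_ne_top (by simp) measure_ball_lt_top.ne

theorem th1_lt (m) : th1 m < 1 := (min_le_left _ _).trans_lt (by simp)

theorem th1_mul (m) : th1 m * volume (ball (0 : Eu (m+1)) 5) < volume (closedBall (0 : Eu m) 1) / 2 := by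
  have ha : volume (ball (0 : Eu (m+1)) 5) ≠ 0 := (measure_ball_pos _ _ (by norm_num)).ne'
  have ha' : volume (ball (0 : Eu (m+1)) 5) ≠ ∞ := measure_ball_lt_top.ne
  have hb : volume (closedBall (0 : Eu m) 1) ≠ 0 := (measure_closedBall_pos _ _ one_pos).ne'
  have hb' : volume (closedBall (0 : Eu m) 1) ≠ ∞ := measure_closedBall_lt_top.ne
  refine (mul_le_mul_left (min_le_right _ _) _).trans_lt ?_
  have : volume (closedBall (0 : Eu m) 1) / (4 * volume (ball (0 : Eu (m+1)) 5)) * volume (ball (0 : Eu (m+1)) 5)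
      = volume (closedBall (0 : Eu m) 1) / 2 / 2 := by
    rw [div_eq_mul_inv, ENNReal.mul_inv (by simp) (by simp), mul_assoc, mul_assoc, ENNReal.inv_mul_cancel ha ha', mul_one,
      div_eq_mul_inv, div_eq_mul_inv, mul_assoc, ← ENNReal.mul_inv (by simp) (by simp)]
    norm_num
  rw [this]
  exact ENNReal.half_lt_self (by simp [hb]) (by simp [ENNReal.div_eq_top, hb'])

/-- uniform low density set -/
def gk {m : ℕ} (F : Set (Eu (m+1))) (k : ℕ) : Set (Eu (m+1)) :=
  closure {x | ∀ r : ℝ, 0 < r → r < 1/((k:ℝ)+1) → volume (F ∩ ball x r) ≤ th1 m / 2^(m+1) * volume (ball x r)}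

theorem gk_bound {m : ℕ} {F : Set (Eu (m+1))} {k : ℕ} {x : Eu (m+1)} (hx : x ∈ gk F k) {r : ℝ} (hr : 0 < r)
    (hr' : r < 1/(2*((k:ℝ)+1))) : volume (F ∩ ball x r) ≤ th1 m * volume (ball x r) := by
  obtain ⟨y, hy, hd⟩ := Metric.mem_closure_iff.1 hx r hr
  have h1 : ball x r ⊆ ball y (2*r) := by
    apply ball_subset_ball'; linarith
  have h2 := hy (2*r) (by positivity) (by
    rw [lt_div_iff₀ (by positivity)] at hr' ⊢; linarith)
  refine (measure_mono (Set.inter_subset_inter_right _ h1)).trans (h2.trans ?_)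
  have e := Measure.addHaar_ball_mul_of_pos (volume : Measure (Eu (m+1))) y (show (0:ℝ) < 2 by norm_num) r
  rw [e, Measure.addHaar_ball_center _ x]
  simp only [finrank_euclideanSpace, Fintype.card_fin]
  rw [ENNReal.ofReal_pow (by norm_num), show ENNReal.ofReal 2 = 2 by simp, ← mul_assoc,
    ENNReal.div_mul_cancel (by simp) (by simp)]

theorem dz_subset {m : ℕ} {F : Set (Eu (m+1))} : dz F ⊆ ⋃ k, gk F k := by
  intro x hx
  have hpos : 0 < (th1 m / 2^(m+1)).toReal := by
    apply ENNReal.toReal_pos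
    · exact (ENNReal.div_pos (th1_pos m).ne' (by simp)).ne'
    · exact ENNReal.div_ne_top ((th1_lt m).trans one_lt_top).ne (by simp)
  have h1 := hx.eventually (gt_mem_nhds hpos)
  rw [eventually_nhdsWithin_iff, Metric.eventually_nhds_iff] at h1
  obtain ⟨e, he, h⟩ := h1
  obtain ⟨k, hk⟩ := exists_nat_one_div_lt he
  refine Set.mem_iUnion.2 ⟨k, subset_closure ?_⟩
  intro r hr hr'
  have := h (y := r) (by rw [Real.dist_eq, sub_zero, abs_of_pos hr]; exact hr'.trans hk) hr
  have h0 : 0 < (volume (ball x r)).toReal :=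
    (ENNReal.toReal_pos (measure_ball_pos _ _ hr).ne' measure_ball_lt_top.ne)
  rw [div_lt_iff₀ h0, ← ENNReal.toReal_mul] at this
  refine ((ENNReal.toReal_lt_toReal ?_ ?_).1 this).le
  · exact measure_ne_top_of_subset Set.inter_subset_right measure_ball_lt_top.ne
  · exact ENNReal.mul_ne_top (ENNReal.div_ne_top ((th1_lt m).trans one_lt_top).ne (by simp)) measure_ball_lt_top.ne

theorem gk_disj {m : ℕ} {F : Set (Eu (m+1))} (hF : MeasurableSet F) (k : ℕ) : Disjoint (gk F k) (dz Fᶜ) := by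
  rw [Set.disjoint_left]
  intro x hx hx'
  have h := (hasDensity_one_iff hF x).2 hx'
  have hlt : (th1 m).toReal < 1 := by
    rw [← ENNReal.toReal_one]
    exact (ENNReal.toReal_lt_toReal ((th1_lt m).trans one_lt_top).ne (by simp)).2 (th1_lt m)
  have h1 := h.eventually (lt_mem_nhds hlt)
  have h2 : ∀ᶠ r in nhdsWithin (0:ℝ) (Set.Ioi 0), r < 1/(2*((k:ℝ)+1)) := nhdsWithin_le_nhds (gt_mem_nhds (by positivity))
  obtain ⟨r, hr1, hr2, hr3⟩ := (h1.and (h2.and self_mem_nhdsWithin)).exists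
  have hr3 : 0 < r := hr3
  have h0 : 0 < (volume (ball x r)).toReal :=
    (ENNReal.toReal_pos (measure_ball_pos _ _ hr3).ne' measure_ball_lt_top.ne)
  rw [lt_div_iff₀ h0, ← ENNReal.toReal_mul] at hr1
  refine absurd (gk_bound hx hr3 hr2) (not_le.2 ?_)
  refine (ENNReal.toReal_lt_toReal ?_ ?_).1 hr1
  · exact ENNReal.mul_ne_top ((th1_lt m).trans one_lt_top).ne measure_ball_lt_top.ne
  · exact measure_ne_top_of_subset Set.inter_subset_right measure_ball_lt_top.ne

theorem dz_compl_subset {n : ℕ} {F : Set (Eu n)} (hF : MeasurableSet F) :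
    ∃ N, MeasurableSet N ∧ volume N = 0 ∧ dz Fᶜ ⊆ F ∪ N := by
  obtain ⟨N, h1, h2, h3⟩ := exists_measurable_superset_of_null (ae_iff.1 (ae_mem_dz hF))
  refine ⟨N, h2, h3, fun x hx => ?_⟩
  by_cases hxF : x ∈ F
  · exact Or.inl hxF
  · refine Or.inr (h1 ?_)
    intro h
    exact dz_disj hF (h hxF) hx

/-- good upward property for almost every line -/
theorem ae_up {m : ℕ} {v : Eu (m+1)} (S : Spl v) {F : Set (Eu (m+1))} (hF : MeasurableSet F) :
    ∀ᵐ z, ∀ k, ∀ s : ℝ, S.io z + s • v ∈ gk F k → ∀ η > 0, ∃ τ, 0 < τ ∧ τ < η ∧ S.io z + (s + τ) • v ∉ dz Fᶜ := by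
  obtain ⟨N, h1, h2, h3⟩ := dz_compl_subset hF
  have key : ∀ k j : ℕ, ∀ᵐ z, ¬ ∃ s : ℝ, S.io z + s • v ∈ gk F k ∧
      ∀ τ, 0 < τ → τ < 1/((j:ℝ)+1) → S.io z + (s + τ) • v ∈ dz Fᶜ := by
    intro k j
    rw [ae_iff]
    simp only [not_not]
    exact S.null_up hF h1 h2 (r0 := 1/(2*((k:ℝ)+1))) (by positivity) (th1_mul m)
      (fun x hx r hr hr' => gk_bound hx hr hr') h3 (by positivity)
  have key2 := ae_all_iff.2 fun k => ae_all_iff.2 fun j => key k j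
  filter_upwards [key2] with z hz k s hs η hη
  obtain ⟨j, hj⟩ := exists_nat_one_div_lt hη
  have := hz k j
  push Not at this
  obtain ⟨τ, h1, h2, h3⟩ := this s hs
  exact ⟨τ, h1, h2.trans hj, h3⟩

theorem ae_line {m : ℕ} {v : Eu (m+1)} (S : Spl v) {F : Set (Eu (m+1))} (hF : MeasurableSet F) :
    ∀ᵐ z, ∀ a b : ℝ, (∀ t ∈ Set.Icc a b, S.io z + t • v ∉ essBoundary F) →
      ∀ p ∈ Set.Icc a b, ∀ q ∈ Set.Icc a b, S.io z + p • v ∈ dz F → S.io z + q • v ∈ dz Fᶜ → False := by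
  have e1 := ae_up S hF
  have e2 := ae_up S hF.compl
  have e3 := ae_up S.neg hF
  have e4 := ae_up S.neg hF.compl
  rw [compl_compl] at e2 e4
  filter_upwards [e1, e2, e3, e4] with z h1 h2 h3 h4 a b hab p hp q hq hp0 hq1
  have hc : Continuous fun t : ℝ => S.io z + t • v := by fun_prop
  have fix : ∀ {A D : Set (Eu (m+1))}, (∀ s : ℝ, S.neg.io z + s • (-v) ∈ A → ∀ η > 0, ∃ τ, 0 < τ ∧ τ < η ∧ S.neg.io z + (s + τ) • (-v) ∉ D) →
      ∀ s : ℝ, S.io z + s • v ∈ A → ∀ η > 0, ∃ τ, 0 < τ ∧ τ < η ∧ S.io z + (s - τ) • v ∉ D := by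
    intro A D h s hs η hη
    obtain ⟨τ, a1, a2, a3⟩ := h (-s) (by simpa [Spl.neg] using hs) η hη
    refine ⟨τ, a1, a2, ?_⟩
    convert a3 using 2
    show _ = S.io z + (-s + τ) • (-v)
    module
  refine line_baire (a := a) (b := b) (C0 := {t | S.io z + t • v ∈ dz F}) (C1 := {t | S.io z + t • v ∈ dz Fᶜ})
    (G := fun k => {t | S.io z + t • v ∈ gk F k}) (H := fun k => {t | S.io z + t • v ∈ gk Fᶜ k})
    (fun k => isClosed_closure.preimage hc) (fun k => isClosed_closure.preimage hc)
    ?_ ?_ ?_ ?_ ?_ (fun k s hs => h1 k s hs) (fun k => fix (h3 k)) (fun k s hs => h2 k s hs) (fun k => fix (h4 k)) hp hq hp0 hq1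
  · intro t ht; simpa using dz_subset ht
  · intro t ht; simpa using dz_subset ht
  · intro k; rw [Set.disjoint_left]; intro t ht; exact Set.disjoint_left.1 (gk_disj hF k) ht
  · intro k; rw [Set.disjoint_left]; intro t ht
    have := gk_disj hF.compl k
    rw [compl_compl] at this
    exact Set.disjoint_left.1 this ht
  · intro t ht; exact mem_dz_of_not_mem hF (hab t ht)

/-- For a.e. `x`, if `x` and `x + h v` are separated by `F` then the segment meets the essential boundary. -/
theorem ae_cross {m : ℕ} {v : Eu (m+1)} (S : Spl v) {F : Set (Eu (m+1))} (hF : MeasurableSet F) {h : ℝ} (hh : 0 ≤ h) :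
    ∀ᵐ x, ¬ (x ∈ F ↔ x + h • v ∈ F) → ∃ t ∈ Set.Icc 0 h, x + t • v ∈ essBoundary F := by
  have e1 : ∀ᵐ x : Eu (m+1), S.pr x ∈ {z | ∀ a b : ℝ, (∀ t ∈ Set.Icc a b, S.io z + t • v ∉ essBoundary F) →
      ∀ p ∈ Set.Icc a b, ∀ q ∈ Set.Icc a b, S.io z + p • v ∈ dz F → S.io z + q • v ∈ dz Fᶜ → False} := by
    rw [ae_iff]
    have := ae_iff.1 (ae_line S hF)
    exact S.null_pr this
  have e2 := ae_mem_dz hF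
  have e3 := ae_mem_dz hF.compl
  have e4 : ∀ᵐ x : Eu (m+1), x + h • v ∉ F → x + h • v ∈ dz F :=
    (measurePreserving_add_right volume (h • v)).quasiMeasurePreserving.ae e2
  have e5 : ∀ᵐ x : Eu (m+1), x + h • v ∉ Fᶜ → x + h • v ∈ dz Fᶜ :=
    (measurePreserving_add_right volume (h • v)).quasiMeasurePreserving.ae e3
  filter_upwards [e1, e2, e3, e4, e5] with x h1 h2 h3 h4 h5 hne
  by_contra hcon
  push Not at hcon
  have key : ∀ t : ℝ, S.io (S.pr x) + (S.ht x + t) • v = x + t • v := by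
    intro t
    conv_rhs => rw [← S.dec x]
    module
  have h1' := h1 (S.ht x) (S.ht x + h) (by
    intro t ht
    have := hcon (t - S.ht x) ⟨by linarith [ht.1], by linarith [ht.2]⟩
    rwa [← key, add_sub_cancel] at this)
  have k0 := key 0
  rw [add_zero, zero_smul, add_zero] at k0
  have m1 : S.ht x ∈ Set.Icc (S.ht x) (S.ht x + h) := ⟨le_rfl, by linarith⟩
  have m2 : S.ht x + h ∈ Set.Icc (S.ht x) (S.ht x + h) := ⟨by linarith, le_rfl⟩
  by_cases hx : x ∈ F
  · have hx2 : x + h • v ∉ F := fun h' => hne ⟨fun _ => h', fun _ => hx⟩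
    refine h1' _ m2 _ m1 ?_ ?_
    · rw [key]; exact h4 hx2
    · rw [k0]; exact h3 (by simpa using hx)
  · have hx2 : x + h • v ∈ F := by
      by_contra h'; exact hne ⟨fun h => absurd h hx, fun h => absurd h h'⟩
    refine h1' _ m1 _ m2 ?_ ?_
    · rw [k0]; exact h2 hx
    · rw [key]; exact h5 (by simpa using hx2)


theorem exists_cells (n : ℕ) {d : ℝ} (hd : 0 < d) : ∃ Q : ℕ → Set (Eu n), (∀ i, MeasurableSet (Q i)) ∧
    Pairwise (Function.onFun Disjoint Q) ∧ (⋃ i, Q i) = Set.univ ∧ ∀ i, ∀ x ∈ Q i, ∀ y ∈ Q i, dist x y ≤ d := by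
  let f : ℕ → Set (Eu n) := fun i => ball (TopologicalSpace.denseSeq (Eu n) i) (d/2)
  refine ⟨disjointed f, fun i => MeasurableSet.disjointed (fun i => measurableSet_ball) i, disjoint_disjointed f, ?_, ?_⟩
  · rw [iUnion_disjointed]
    refine Set.eq_univ_of_forall fun x => ?_
    obtain ⟨i, hi⟩ := (TopologicalSpace.denseRange_denseSeq (Eu n)).exists_dist_lt x (show 0 < d/2 by positivity)
    exact Set.mem_iUnion.2 ⟨i, hi⟩
  · intro i x hx y hy
    have h1 := disjointed_subset f i hx
    have h2 := disjointed_subset f i hy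
    simp only [f, mem_ball] at h1 h2
    have := dist_triangle_right x y (TopologicalSpace.denseSeq (Eu n) i)
    linarith

theorem Spl.norm_v {m : ℕ} {v : Eu (m+1)} (S : Spl v) : ‖v‖ = 1 := by
  have := S.nsq v
  rw [S.pr_v, S.ht_v] at this
  simp only [norm_zero] at this
  nlinarith [norm_nonneg v]

theorem cover_bound {m : ℕ} {v : Eu (m+1)} (S : Spl v) (T : Set (Eu (m+1))) {h d : ℝ} (hd : 0 < d)
    (φ : Eu (m+1) → ℝ≥0∞) (hφm : Measurable φ) (η : ℝ≥0∞) (hφ : ∀ x y, dist x y ≤ h + d → φ x ≤ φ y + η) :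
    ∫⁻ x in {x | ∃ t ∈ Set.Icc 0 h, x + t • v ∈ T}, φ x ≤
      (kap m)⁻¹ * ENNReal.ofReal (h + d) * ∫⁻ y in T, (φ y + η) ∂μH[(m:ℝ)] := by
  obtain ⟨Q, hQm, hQd, hQu, hQ⟩ := exists_cells (m+1) hd
  have hsub : {x | ∃ t ∈ Set.Icc 0 h, x + t • v ∈ T} ⊆ ⋃ i, {x | ∃ t ∈ Set.Icc 0 h, x + t • v ∈ T ∩ Q i} := by
    rintro x ⟨t, ht, hx⟩
    obtain ⟨i, hi⟩ := Set.mem_iUnion.1 (hQu.symm ▸ Set.mem_univ (x + t • v))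
    exact Set.mem_iUnion.2 ⟨i, t, ht, hx, hi⟩
  have cell : ∀ i, ∫⁻ x in {x | ∃ t ∈ Set.Icc 0 h, x + t • v ∈ T ∩ Q i}, φ x ≤
      (kap m)⁻¹ * ENNReal.ofReal (h + d) * ∫⁻ y in Q i, (φ y + η) ∂(μH[(m:ℝ)]).restrict T := by
    intro i
    rcases (T ∩ Q i).eq_empty_or_nonempty with he | ⟨y0, hy0⟩
    · rw [he]; simp
    have hc1 : ∀ x ∈ {x | ∃ t ∈ Set.Icc 0 h, x + t • v ∈ T ∩ Q i}, ∀ y ∈ T ∩ Q i, φ x ≤ φ y + η := by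
      rintro x ⟨t, ht, hx⟩ y hy
      apply hφ
      calc dist x y ≤ dist x (x + t • v) + dist (x + t • v) y := dist_triangle _ _ _
        _ ≤ h + d := by
          refine add_le_add ?_ (hQ i _ hx.2 _ hy.2)
          simp [norm_smul, S.norm_v, abs_of_nonneg ht.1, ht.2]
    set c := ⨅ y ∈ T ∩ Q i, φ y + η with hc
    have hM := measurableSet_toMeasurable (volume : Measure (Eu m)) (S.pr '' (T ∩ Q i))
    have hvM : volume (toMeasurable volume (S.pr '' (T ∩ Q i))) ≤ (kap m)⁻¹ * μH[(m:ℝ)] (T ∩ Q i) := by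
      rw [measure_toMeasurable]
      have h1 := S.lip_pr.hausdorffMeasure_image_le (d := (m:ℝ)) (by positivity) (T ∩ Q i)
      rw [hausdorff_eq] at h1
      simp only [Measure.smul_apply, smul_eq_mul, ENNReal.coe_one, ENNReal.one_rpow, one_mul] at h1
      rwa [← ENNReal.mul_le_iff_le_inv (kap_ne_zero m) (kap_ne_top m)]
    have hbox : {x | ∃ t ∈ Set.Icc 0 h, x + t • v ∈ T ∩ Q i} ⊆
        S.pr ⁻¹' (toMeasurable volume (S.pr '' (T ∩ Q i))) ∩
        S.ht ⁻¹' (Set.Icc (sInf (S.ht '' (T ∩ Q i)) - h) (sInf (S.ht '' (T ∩ Q i)) + d)) := by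
      rintro x ⟨t, ht, hx⟩
      have hdist : ∀ y ∈ T ∩ Q i, |S.ht (x + t • v) - S.ht y| ≤ d := by
        intro y hy
        rw [← map_sub]
        refine (S.abs_ht_le _).trans ?_
        rw [← dist_eq_norm]; exact hQ i _ hx.2 _ hy.2
      have hbdd : BddBelow (S.ht '' (T ∩ Q i)) := by
        refine ⟨S.ht (x + t • v) - d, ?_⟩
        rintro _ ⟨y, hy, rfl⟩
        linarith [(abs_le.1 (hdist y hy)).2]
      have hx1 : S.ht (x + t • v) = S.ht x + t := by simp [S.ht_v]
      refine ⟨subset_toMeasurable _ _ ⟨x + t • v, hx, by simp [S.pr_v]⟩, ?_, ?_⟩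
      · have := csInf_le hbdd (Set.mem_image_of_mem S.ht hx)
        rw [hx1] at this; linarith [ht.2]
      · have : S.ht (x + t • v) - d ≤ sInf (S.ht '' (T ∩ Q i)) := by
          apply le_csInf (Set.Nonempty.image _ ⟨y0, hy0⟩)
          rintro _ ⟨y, hy, rfl⟩
          linarith [(abs_le.1 (hdist y hy)).2]
        rw [hx1] at this; linarith [ht.1]
    calc _ ≤ ∫⁻ x in {x | ∃ t ∈ Set.Icc 0 h, x + t • v ∈ T ∩ Q i}, c :=
          setLIntegral_mono measurable_const fun x hx => le_iInf₂ (hc1 x hx)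
      _ = c * volume {x | ∃ t ∈ Set.Icc 0 h, x + t • v ∈ T ∩ Q i} := by rw [setLIntegral_const]
      _ ≤ c * ((kap m)⁻¹ * μH[(m:ℝ)] (T ∩ Q i) * ENNReal.ofReal (h + d)) := by
          gcongr
          refine (measure_mono hbox).trans ?_
          rw [S.vol_box hM measurableSet_Icc, Real.volume_Icc]
          gcongr
          linarith
      _ = (kap m)⁻¹ * ENNReal.ofReal (h + d) * ∫⁻ y in T ∩ Q i, c ∂μH[(m:ℝ)] := by
          rw [setLIntegral_const]; ring
      _ ≤ _ := by
          rw [Measure.restrict_restrict (hQm i), Set.inter_comm (Q i) T]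
          refine mul_le_mul_right ?_ _
          exact setLIntegral_mono (hφm.add measurable_const) fun y hy => iInf₂_le y hy
  calc _ ≤ ∫⁻ x in ⋃ i, {x | ∃ t ∈ Set.Icc 0 h, x + t • v ∈ T ∩ Q i}, φ x := lintegral_mono_set hsub
    _ ≤ ∑' i, ∫⁻ x in {x | ∃ t ∈ Set.Icc 0 h, x + t • v ∈ T ∩ Q i}, φ x := lintegral_iUnion_le _ _
    _ ≤ ∑' i, (kap m)⁻¹ * ENNReal.ofReal (h + d) * ∫⁻ y in Q i, (φ y + η) ∂(μH[(m:ℝ)]).restrict T :=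
        ENNReal.tsum_le_tsum cell
    _ = (kap m)⁻¹ * ENNReal.ofReal (h + d) * ∑' i, ∫⁻ y in Q i, (φ y + η) ∂(μH[(m:ℝ)]).restrict T := by
        rw [ENNReal.tsum_mul_left]
    _ = _ := by
        rw [← lintegral_iUnion hQm hQd, hQu, Measure.restrict_univ]


/-- indicator of `F` as a real function -/
def chi {n : ℕ} (F : Set (Eu n)) : Eu n → ℝ := F.indicator fun _ => 1

theorem chi_nonneg {n : ℕ} (F : Set (Eu n)) (x) : 0 ≤ chi F x := Set.indicator_nonneg (by simp) x
theorem chi_le_one {n : ℕ} (F : Set (Eu n)) (x) : chi F x ≤ 1 := by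
  unfold chi Set.indicator; split_ifs <;> norm_num
theorem chi_meas {n : ℕ} {F : Set (Eu n)} (hF : MeasurableSet F) : Measurable (chi F) :=
  measurable_const.indicator hF
theorem chi_of_mem {n : ℕ} {F : Set (Eu n)} {x} (h : x ∈ F) : chi F x = 1 := Set.indicator_of_mem h _
theorem chi_of_notMem {n : ℕ} {F : Set (Eu n)} {x} (h : x ∉ F) : chi F x = 0 := Set.indicator_of_notMem h _

theorem chi_diff_le {m : ℕ} {v : Eu (m+1)} (S : Spl v) {F : Set (Eu (m+1))} (hF : MeasurableSet F) {h : ℝ} (hh : 0 ≤ h) :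
    ∀ᵐ y, ‖chi F (y + h • v) - chi F y‖ₑ ≤
      {x | ∃ t ∈ Set.Icc 0 h, x + t • v ∈ essBoundary F}.indicator (fun _ => 1) y := by
  filter_upwards [ae_cross S hF hh] with y hy
  by_cases hc : (y ∈ F ↔ y + h • v ∈ F)
  · have : chi F (y + h • v) = chi F y := by
      by_cases h1 : y ∈ F
      · rw [chi_of_mem h1, chi_of_mem (hc.1 h1)]
      · rw [chi_of_notMem h1, chi_of_notMem (fun h => h1 (hc.2 h))]
    rw [this]; simp
  · rw [Set.indicator_of_mem (show y ∈ {x | ∃ t ∈ Set.Icc 0 h, x + t • v ∈ essBoundary F} from hy hc)]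
    rw [← ofReal_norm, ← ENNReal.ofReal_one, Real.norm_eq_abs]
    apply ENNReal.ofReal_le_ofReal
    rw [abs_le]
    constructor <;> linarith [chi_nonneg F y, chi_nonneg F (y + h • v), chi_le_one F y, chi_le_one F (y + h • v)]

theorem weighted_diff {m : ℕ} {v : Eu (m+1)} (S : Spl v) {F : Set (Eu (m+1))} (hF : MeasurableSet F) {h d : ℝ} (hh : 0 ≤ h)
    (hd : 0 < d) (φ : Eu (m+1) → ℝ≥0∞) (hφm : Measurable φ) (η : ℝ≥0∞) (hφ : ∀ x y, dist x y ≤ h + d → φ x ≤ φ y + η) :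
    ∫⁻ y, ‖chi F (y + h • v) - chi F y‖ₑ * φ y ≤
      (kap m)⁻¹ * ENNReal.ofReal (h + d) * ∫⁻ y in essBoundary F, (φ y + η) ∂μH[(m:ℝ)] := by
  refine le_trans ?_ (cover_bound S (essBoundary F) hd φ hφm η hφ)
  refine le_trans (lintegral_mono_ae ?_) (lintegral_indicator_le _ _)
  filter_upwards [chi_diff_le S hF hh] with y hy
  refine (mul_le_mul_left hy _).trans ?_
  by_cases hm : y ∈ {x | ∃ t ∈ Set.Icc 0 h, x + t • v ∈ essBoundary F}
  · rw [Set.indicator_of_mem hm, Set.indicator_of_mem hm, one_mul]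
  · rw [Set.indicator_of_notMem hm, Set.indicator_of_notMem hm, zero_mul]

theorem perimeter_eq {m : ℕ} (F : Set (Eu (m+1))) : perimeter F = μH[(m:ℝ)] (essBoundary F) := by
  unfold perimeter; congr 2; push_cast; ring

/-- translation bound -/
theorem translation_bound {m : ℕ} {F : Set (Eu (m+1))} (hF : MeasurableSet F) (z : Eu (m+1)) {d : ℝ} (hd : 0 < d) :
    ∫⁻ y, ‖chi F (y + z) - chi F y‖ₑ ≤ (kap m)⁻¹ * ENNReal.ofReal (‖z‖ + d) * perimeter F := by
  by_cases hz : z = 0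
  · simp [hz]
  have hn : ‖z‖ ≠ 0 := norm_ne_zero_iff.2 hz
  obtain ⟨S⟩ := exists_spl (‖z‖⁻¹ • z) (by simp [norm_smul, hn])
  have := weighted_diff S hF (norm_nonneg z) hd (fun _ => 1) measurable_const 0 (by simp)
  rw [smul_smul, mul_inv_cancel₀ hn, one_smul] at this
  simpa [perimeter_eq] using this

open scoped Convolution in
theorem mollify {m : ℕ} {F : Set (Eu (m+1))} (hF : MeasurableSet F) (hP : perimeter F ≠ ∞) {ε : ℝ} (hε : 0 < ε) :
    ∃ f : Eu (m+1) → ℝ, ContDiff ℝ 1 f ∧ (∀ x, 0 ≤ f x) ∧ (∀ x, f x ≤ 1) ∧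
      kap m * ∫⁻ x, ‖fderiv ℝ f x‖ₑ ≤ perimeter F ∧
      ∫⁻ x, ‖f x - chi F x‖ₑ ≤ (kap m)⁻¹ * ENNReal.ofReal (ε + ε) * perimeter F := by
  let b : ContDiffBump (0 : Eu (m+1)) := ⟨ε/2, ε, by positivity, by linarith⟩
  set ρ := b.normed volume with hρ
  have hρc : Continuous ρ := b.continuous_normed
  have hρ0 : ∀ x, 0 ≤ ρ x := b.nonneg_normed
  have hρi : Integrable ρ := b.integrable_normed
  have hρ1 : ∫ x, ρ x = 1 := b.integral_normed
  have hρl : ∫⁻ x, ENNReal.ofReal (ρ x) = 1 := by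
    rw [← ofReal_integral_eq_lintegral_ofReal hρi (Eventually.of_forall hρ0), hρ1, ENNReal.ofReal_one]
  have hρs : ∀ x, ε ≤ ‖x‖ → ρ x = 0 := by
    intro x hx
    by_contra h
    have : x ∈ Function.support ρ := h
    rw [hρ, b.support_normed_eq] at this
    simp [b] at this
    linarith
  have hchi : LocallyIntegrable (chi F) volume := by
    refine (locallyIntegrable_const (1:ℝ)).mono (chi_meas hF).aestronglyMeasurable (Eventually.of_forall fun x => ?_)
    rw [Real.norm_of_nonneg (chi_nonneg F x)]; simpa using chi_le_one F x
  set f : Eu (m+1) → ℝ := (chi F ⋆[ContinuousLinearMap.lsmul ℝ ℝ, volume] ρ) with hf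
  have hfC : ContDiff ℝ 1 f := b.hasCompactSupport_normed.contDiff_convolution_right _ hchi b.contDiff_normed
  have hfx : ∀ x, f x = ∫ y, chi F y * ρ (x - y) := fun x => by simp [hf, convolution_def]
  have hInt0 : ∀ (g : Eu (m+1) → ℝ) , Measurable g → (∀ x, |g x| ≤ 1) → ∀ x, Integrable fun y => g y * ρ (x - y) := by
    intro g hg hg1 x
    refine Integrable.bdd_mul (c := 1) (hρi.comp_sub_left x) hg.aestronglyMeasurable (Eventually.of_forall hg1)
  have habs : ∀ x, |chi F x| ≤ 1 := fun x => by rw [abs_of_nonneg (chi_nonneg F x)]; exact chi_le_one F x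
  have hmF := chi_meas hF
  refine ⟨f, hfC, fun x => ?_, fun x => ?_, ?_, ?_⟩
  · rw [hfx]; exact integral_nonneg fun y => mul_nonneg (chi_nonneg F y) (hρ0 _)
  · rw [hfx, ← hρ1, ← integral_sub_left_eq_self ρ volume x]
    refine integral_mono (hInt0 _ hmF habs x) (hρi.comp_sub_left x) fun y => ?_
    exact mul_le_of_le_one_left (hρ0 _) (chi_le_one F y)
  · -- derivative bound
    have hdiff : ∀ x v (h : ℝ), ‖f (x + h • v) - f x‖ₑ ≤ ∫⁻ y, ‖chi F (y + h • v) - chi F y‖ₑ * ENNReal.ofReal (ρ (x - y)) := by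
      intro x v h
      have e1 : f (x + h • v) = ∫ y, chi F (y + h • v) * ρ (x - y) := by
        rw [hfx, ← integral_add_right_eq_self _ (h • v)]
        congr 1; ext y; congr 2; abel
      have hm2 : Measurable fun y => chi F (y + h • v) := hmF.comp (measurable_id.add_const _)
      rw [e1, hfx, ← integral_sub (hInt0 _ hm2 (fun y => habs _) x) (hInt0 _ hmF habs x)]
      refine (enorm_integral_le_lintegral_enorm _).trans (le_of_eq ?_)
      congr 1; ext y
      rw [← sub_mul, enorm_mul, ← ofReal_norm (ρ _), Real.norm_of_nonneg (hρ0 _)]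
    set I : Eu (m+1) → ℝ≥0∞ := fun x => ∫⁻ y in essBoundary F, ENNReal.ofReal (ρ (x - y)) ∂μH[(m:ℝ)] with hI
    have hunif : UniformContinuous ρ := b.hasCompactSupport_normed.uniformContinuous_of_continuous hρc
    have hbd : ∀ x v, ‖v‖ = 1 → ∀ η > 0, ‖fderiv ℝ f x v‖ₑ ≤ (kap m)⁻¹ * (ENNReal.ofReal (1 + η) * (I x + ENNReal.ofReal η * perimeter F)) := by
      intro x v hv η hη
      obtain ⟨S⟩ := exists_spl v hv
      obtain ⟨δ, hδ, hu⟩ := Metric.uniformContinuous_iff.1 hunif η hη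
      have hlim : Tendsto (fun h : ℝ => ‖h⁻¹ • (f (x + h • v) - f x)‖ₑ) (nhdsWithin 0 (Set.Ioi 0)) (nhds ‖fderiv ℝ f x v‖ₑ) := by
        have h1 : HasFDerivAt f (fderiv ℝ f x) x := (hfC.differentiable (by simp) x).hasFDerivAt
        have h2 := h1.hasLineDerivAt v
        exact h2.tendsto_slope_zero_right.enorm
      refine le_of_tendsto hlim ?_
      have hs : ∀ᶠ h in nhdsWithin (0:ℝ) (Set.Ioi 0), h < δ / (1 + η) := nhdsWithin_le_nhds (gt_mem_nhds (by positivity))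
      filter_upwards [hs, self_mem_nhdsWithin] with h h1 h2
      have h2 : 0 < h := h2
      rw [lt_div_iff₀ (by positivity)] at h1
      have hw := weighted_diff S hF (h := h) (d := h * η) h2.le (by positivity) (fun y => ENNReal.ofReal (ρ (x - y)))
        (by fun_prop) (ENNReal.ofReal η) (by
          intro y y' hyy
          rw [← ENNReal.ofReal_add (hρ0 _) hη.le]
          apply ENNReal.ofReal_le_ofReal
          have := hu (a := x - y) (b := x - y') (by rw [dist_sub_left]; linarith)
          rw [Real.dist_eq] at this
          linarith [(abs_lt.1 this).2])
      have hw2 := (hdiff x v h).trans hw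
      rw [lintegral_add_right _ measurable_const, setLIntegral_const, ← perimeter_eq] at hw2
      rw [enorm_smul]
      have e : ‖h⁻¹‖ₑ = (ENNReal.ofReal h)⁻¹ := by
        rw [← ofReal_norm, Real.norm_of_nonneg (by positivity), ENNReal.ofReal_inv_of_pos h2]
      rw [e]
      rw [show h + h * η = h * (1 + η) by ring, ENNReal.ofReal_mul h2.le] at hw2
      calc _ ≤ (ENNReal.ofReal h)⁻¹ * _ := mul_le_mul_right hw2 _
        _ = ((ENNReal.ofReal h)⁻¹ * ENNReal.ofReal h) * ((kap m)⁻¹ * (ENNReal.ofReal (1 + η) * (I x + ENNReal.ofReal η * perimeter F))) := by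
            simp only [hI]; ring
        _ = _ := by rw [ENNReal.inv_mul_cancel (by simpa using h2) ENNReal.ofReal_ne_top, one_mul]
    have hbd2 : ∀ x v, ‖v‖ = 1 → ‖fderiv ℝ f x v‖ₑ ≤ (kap m)⁻¹ * I x := by
      intro x v hv
      have hlim : Tendsto (fun η : ℝ => (kap m)⁻¹ * (ENNReal.ofReal (1 + η) * (I x + ENNReal.ofReal η * perimeter F)))
          (nhdsWithin 0 (Set.Ioi 0)) (nhds ((kap m)⁻¹ * (ENNReal.ofReal (1 + 0) * (I x + ENNReal.ofReal 0 * perimeter F)))) := by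
        refine ENNReal.Tendsto.const_mul ?_ (Or.inr (by simp [kap_ne_zero]))
        have c1 : Tendsto (fun η : ℝ => ENNReal.ofReal (1 + η)) (nhdsWithin 0 (Set.Ioi 0)) (nhds (ENNReal.ofReal (1 + 0))) :=
          (ENNReal.tendsto_ofReal ((continuous_const.add continuous_id).tendsto 0)).mono_left nhdsWithin_le_nhds
        have c2 : Tendsto (fun η : ℝ => ENNReal.ofReal η) (nhdsWithin 0 (Set.Ioi 0)) (nhds (ENNReal.ofReal 0)) :=
          (ENNReal.tendsto_ofReal (continuous_id.tendsto 0)).mono_left nhdsWithin_le_nhds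
        refine ENNReal.Tendsto.mul c1 (Or.inl (by simp)) (tendsto_const_nhds.add (ENNReal.Tendsto.mul_const c2 (Or.inr hP))) (Or.inr (by simp))
      have := ge_of_tendsto hlim (by
        filter_upwards [self_mem_nhdsWithin] with η hη using hbd x v hv η hη)
      simpa using this
    have hbd3 : ∀ x, ‖fderiv ℝ f x‖ₑ ≤ (kap m)⁻¹ * I x := by
      intro x
      by_cases ht : (kap m)⁻¹ * I x = ∞
      · rw [ht]; exact le_top
      rw [← ofReal_norm]
      apply ENNReal.ofReal_le_of_le_toReal
      refine ContinuousLinearMap.opNorm_le_of_unit_norm ENNReal.toReal_nonneg fun v hv => ?_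
      rw [← toReal_enorm]
      exact ENNReal.toReal_mono ht (hbd2 x v hv)
    have : IsFiniteMeasure ((μH[(m:ℝ)] : Measure (Eu (m+1))).restrict (essBoundary F)) := by
      constructor; rw [Measure.restrict_apply_univ, ← perimeter_eq]; exact hP.lt_top
    have hIint : ∫⁻ x, I x = perimeter F := by
      rw [hI, lintegral_lintegral_swap]
      · have : ∀ y, ∫⁻ x, ENNReal.ofReal (ρ (x - y)) = 1 := by
          intro y; rw [lintegral_sub_right_eq_self (fun x => ENNReal.ofReal (ρ x)) y, hρl]
        simp_rw [this]
        rw [setLIntegral_const, one_mul, perimeter_eq]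
      · fun_prop
    calc _ ≤ kap m * ∫⁻ x, (kap m)⁻¹ * I x := by gcongr with x; exact hbd3 x
      _ = kap m * ((kap m)⁻¹ * perimeter F) := by
        rw [lintegral_const_mul' _ _ (by simp [kap_ne_zero]), hIint]
      _ = _ := by rw [← mul_assoc, ENNReal.mul_inv_cancel (kap_ne_zero m) (kap_ne_top m), one_mul]
  · have h1 : ∀ x, f x - chi F x = ∫ z, (chi F (x - z) - chi F x) * ρ z := by
      intro x
      have e1 : f x = ∫ z, chi F (x - z) * ρ z := by
        rw [hfx, ← integral_sub_left_eq_self _ volume x]; simp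
      have i1 : Integrable fun z => chi F (x - z) * ρ z := by
        refine Integrable.bdd_mul (c := 1) hρi ?_ (Eventually.of_forall fun z => habs _)
        exact (hmF.comp (measurable_const.sub measurable_id)).aestronglyMeasurable
      simp_rw [sub_mul]
      rw [integral_sub i1 (hρi.const_mul _), integral_const_mul, hρ1, mul_one, e1]
    calc _ ≤ ∫⁻ x, ∫⁻ z, ‖chi F (x - z) - chi F x‖ₑ * ENNReal.ofReal (ρ z) := by
          refine lintegral_mono fun x => ?_
          simp only
          rw [h1]
          refine (enorm_integral_le_lintegral_enorm _).trans (le_of_eq ?_)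
          congr 1; ext y
          rw [enorm_mul, ← ofReal_norm (ρ _), Real.norm_of_nonneg (hρ0 _)]
      _ = ∫⁻ z, ∫⁻ x, ‖chi F (x - z) - chi F x‖ₑ * ENNReal.ofReal (ρ z) := by
          rw [lintegral_lintegral_swap]
          refine Measurable.aemeasurable ?_
          have a1 : Measurable fun p : Eu (m+1) × Eu (m+1) => chi F (p.1 - p.2) := hmF.comp (measurable_fst.sub measurable_snd)
          have a2 : Measurable fun p : Eu (m+1) × Eu (m+1) => chi F p.1 := hmF.comp measurable_fst
          have a3 : Measurable fun p : Eu (m+1) × Eu (m+1) => ρ p.2 := hρc.measurable.comp measurable_snd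
          exact ((a1.sub a2).enorm).mul a3.ennreal_ofReal
      _ ≤ ∫⁻ z, ENNReal.ofReal (ρ z) * ((kap m)⁻¹ * ENNReal.ofReal (ε + ε) * perimeter F) := by
          refine lintegral_mono fun z => ?_
          simp only
          rw [lintegral_mul_const' _ _ ENNReal.ofReal_ne_top, mul_comm]
          by_cases hz : ε ≤ ‖z‖
          · rw [hρs z hz]; simp
          refine mul_le_mul_right ?_ _
          have := translation_bound hF (-z) hε
          rw [norm_neg] at this
          simp_rw [← sub_eq_add_neg] at this
          refine this.trans ?_
          gcongr
          linarith
      _ = _ := by rw [lintegral_mul_const _ (by fun_prop), hρl, one_mul]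


theorem norm_sub_sq_polar {n : ℕ} (x y : Eu n) (hx : x ≠ 0) (hy : y ≠ 0) :
    ‖x - y‖ ^ 2 = (‖x‖ - ‖y‖) ^ 2 + ‖x‖ * ‖y‖ * ‖‖x‖⁻¹ • x - ‖y‖⁻¹ • y‖ ^ 2 := by
  have h1 : ‖x‖ ≠ 0 := norm_ne_zero_iff.2 hx
  have h2 : ‖y‖ ≠ 0 := norm_ne_zero_iff.2 hy
  rw [norm_sub_sq_real, norm_sub_sq_real, norm_smul, norm_smul, real_inner_smul_left, real_inner_smul_right]
  simp only [norm_inv, norm_norm]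
  field_simp
  ring

theorem normalize_lip {n : ℕ} (x y : Eu n) (hx : 1 ≤ ‖x‖) (hy : 1 ≤ ‖y‖) :
    ‖‖x‖⁻¹ • x - ‖y‖⁻¹ • y‖ ≤ ‖x - y‖ := by
  have hx0 : x ≠ 0 := by rintro rfl; simp at hx; linarith
  have hy0 : y ≠ 0 := by rintro rfl; simp at hy; linarith
  have := norm_sub_sq_polar x y hx0 hy0
  have h3 : 1 ≤ ‖x‖ * ‖y‖ := one_le_mul_of_one_le_of_one_le hx hy
  apply le_of_sq_le_sq _ (norm_nonneg _)
  nlinarith [sq_nonneg (‖x‖ - ‖y‖), sq_nonneg ‖‖x‖⁻¹ • x - ‖y‖⁻¹ • y‖]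

/-- radial projection -/
def nrm {n : ℕ} (x : Eu n) : Eu n := ‖x‖⁻¹ • x

theorem nrm_meas {n : ℕ} : Measurable (nrm : Eu n → Eu n) := by
  unfold nrm; fun_prop

theorem nrm_smul {n : ℕ} (x : Eu n) {t : ℝ} (ht : 0 < t) : nrm (t • x) = nrm x := by
  unfold nrm
  rw [norm_smul, Real.norm_of_nonneg ht.le, smul_smul]
  congr 1
  field_simp

theorem lint_pow (m : ℕ) : ∫⁻ t in Set.Ioo (0:ℝ) 1, ENNReal.ofReal (t ^ m) = ((m:ℝ≥0∞) + 1)⁻¹ := by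
  rw [← ofReal_integral_eq_lintegral_ofReal]
  · rw [← integral_Ioc_eq_integral_Ioo, ← intervalIntegral.integral_of_le zero_le_one, integral_pow]
    simp only [one_pow, zero_pow (Nat.succ_ne_zero m), sub_zero, one_div]
    rw [ENNReal.ofReal_inv_of_pos (by positivity), ENNReal.ofReal_add (by positivity) (by positivity)]
    simp
  · exact ((continuous_id.pow m).integrableOn_Icc).mono_set Set.Ioo_subset_Icc_self
  · filter_upwards [ae_restrict_mem measurableSet_Ioo] with t ht
    exact pow_nonneg ht.1.le m

open scoped Pointwise in
theorem cone_piece {m : ℕ} {ν : Eu (m+1)} (S : Spl ν) {T : Set (Eu (m+1))} (hT : MeasurableSet T) {d : ℝ} (hd1 : d < 1)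
    (hT1 : ∀ x ∈ T, ‖x‖ = 1) (hTd : ∀ x ∈ T, ‖x - ν‖ ≤ d) :
    μH[(m:ℝ)] T ≤ kap m * ((m:ℝ≥0∞) + 1) * volume (nrm ⁻¹' T ∩ ball (0 : Eu (m+1)) (1 - d^2/2)⁻¹) := by
  rcases T.eq_empty_or_nonempty with rfl | ⟨x0, hx0⟩
  · simp
  have hd0 : 0 ≤ d := (norm_nonneg _).trans (hTd x0 hx0)
  have hdp : 0 < 1 - d^2/2 := by nlinarith
  have hht : ∀ x ∈ T, 1 - d^2/2 ≤ S.ht x := by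
    intro x hx
    have h1 := S.nsq x
    have h2 := S.nsq (x - ν)
    rw [hT1 x hx] at h1
    simp only [map_sub, S.pr_v, S.ht_v, sub_zero] at h2
    have h3 := hTd x hx
    have h4 : ‖x - ν‖^2 ≤ d^2 := by gcongr
    nlinarith
  let g : Eu m → Eu (m+1) := fun z => nrm (S.io z + ν)
  have hge : ∀ z, 1 ≤ ‖S.io z + ν‖ := by
    intro z
    have := S.abs_ht_le (S.io z + ν)
    simpa [S.ht_io, S.ht_v] using this
  have hg : LipschitzWith 1 g := by
    apply LipschitzWith.of_dist_le_mul
    intro x y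
    rw [dist_eq_norm, dist_eq_norm]
    refine (normalize_lip _ _ (hge x) (hge y)).trans ?_
    rw [add_sub_add_right_eq_sub, ← map_sub]
    simpa using S.norm_add_le (x - y) 0
  set Z : Set (Eu m) := g ⁻¹' T with hZ
  have hZm : MeasurableSet Z := hg.continuous.measurable hT
  have himg : T ⊆ g '' Z := by
    intro x hx
    have hpos : 0 < S.ht x := hdp.trans_le (hht x hx)
    have e : S.io ((S.ht x)⁻¹ • S.pr x) + ν = (S.ht x)⁻¹ • x := by
      have e0 := congrArg (fun y => (S.ht x)⁻¹ • y) (S.dec x)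
      rw [← e0, smul_add, smul_smul, inv_mul_cancel₀ hpos.ne', one_smul, map_smul]
    have e2 : g ((S.ht x)⁻¹ • S.pr x) = x := by
      show nrm _ = _
      rw [e, nrm_smul _ (inv_pos.2 hpos), nrm, hT1 x hx]; simp
    exact ⟨_, by rw [hZ, Set.mem_preimage, e2]; exact hx, e2⟩
  have h1 : μH[(m:ℝ)] T ≤ kap m * volume Z := by
    refine (measure_mono himg).trans ?_
    have := hg.hausdorffMeasure_image_le (d := (m:ℝ)) (by positivity) Z
    rw [hausdorff_eq] at this
    simpa using this
  -- the cone
  set C : Set (Eu (m+1)) := S.ht ⁻¹' Set.Ioo 0 1 ∩ nrm ⁻¹' T with hC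
  have hCm : MeasurableSet C := (S.continuous_ht.measurable measurableSet_Ioo).inter (nrm_meas hT)
  have hvC : volume C = volume Z * ((m:ℝ≥0∞) + 1)⁻¹ := by
    rw [← S.mp.measure_preimage hCm.nullMeasurableSet, Measure.volume_eq_prod,
      Measure.prod_apply_symm (S.mp.measurable hCm)]
    have : ∀ t : ℝ, volume ((fun z : Eu m => (z, t)) ⁻¹' ((fun p : Eu m × ℝ => S.io p.1 + p.2 • ν) ⁻¹' C)) =
        (Set.Ioo (0:ℝ) 1).indicator (fun t => ENNReal.ofReal (t ^ m) * volume Z) t := by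
      intro t
      by_cases ht : t ∈ Set.Ioo (0:ℝ) 1
      · rw [Set.indicator_of_mem ht]
        have e : ((fun z : Eu m => (z, t)) ⁻¹' ((fun p : Eu m × ℝ => S.io p.1 + p.2 • ν) ⁻¹' C)) = t • Z := by
          ext z
          rw [Set.mem_smul_set_iff_inv_smul_mem₀ ht.1.ne']
          have e3 : nrm (S.io z + t • ν) = g (t⁻¹ • z) := by
            show _ = nrm _
            rw [← nrm_smul (S.io (t⁻¹ • z) + ν) ht.1, map_smul, smul_add, smul_smul, mul_inv_cancel₀ ht.1.ne', one_smul]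
          simp only [hC, Set.mem_preimage, Set.mem_inter_iff, map_add, S.ht_io, map_smul, S.ht_v, smul_eq_mul, mul_one, zero_add, hZ, e3]
          exact ⟨fun h => h.2, fun h => ⟨ht, h⟩⟩
        rw [e, Measure.addHaar_smul_of_nonneg _ ht.1.le]
        simp
      · rw [Set.indicator_of_notMem ht]
        convert measure_empty (μ := (volume : Measure (Eu m)))
        ext z
        simp only [hC, Set.mem_preimage, Set.mem_inter_iff, map_add, S.ht_io, map_smul, S.ht_v, smul_eq_mul, mul_one, zero_add]
        simp only [Set.mem_empty_iff_false, iff_false]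
        exact fun h => ht h.1
    simp_rw [this]
    rw [lintegral_indicator measurableSet_Ioo, lintegral_mul_const _ (by fun_prop), lint_pow, mul_comm]
  have hCs : C ⊆ nrm ⁻¹' T ∩ ball (0 : Eu (m+1)) (1 - d^2/2)⁻¹ := by
    rintro x ⟨h1, h2⟩
    refine ⟨h2, ?_⟩
    have h3 := hht _ h2
    rw [nrm, map_smul, smul_eq_mul] at h3
    have hxp : 0 < ‖x‖ := by
      by_contra hx
      have : ‖x‖ = 0 := le_antisymm (not_lt.1 hx) (norm_nonneg _)
      rw [this] at h3; simp at h3; linarith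
    rw [mem_ball_zero_iff, lt_inv_comm₀ hxp hdp]
    refine lt_of_le_of_lt h3 ?_
    exact mul_lt_of_lt_one_right (inv_pos.2 hxp) h1.2
  have h2 : volume Z = ((m:ℝ≥0∞) + 1) * volume C := by
    rw [hvC, mul_comm, mul_assoc, ENNReal.inv_mul_cancel (by simp) (by simp), mul_one]
  rw [h2, ← mul_assoc] at h1
  exact h1.trans (by gcongr)

theorem sphere_one_le (m : ℕ) : μH[(m:ℝ)] (sphere (0 : Eu (m+1)) 1) ≤
    kap m * ((m:ℝ≥0∞) + 1) * volume (ball (0 : Eu (m+1)) 1) := by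
  have key : ∀ d : ℝ, 0 < d → d < 1 → μH[(m:ℝ)] (sphere (0 : Eu (m+1)) 1) ≤
    kap m * ((m:ℝ≥0∞) + 1) * (ENNReal.ofReal (((1 - d^2/2)⁻¹)^(m+1)) * volume (ball (0 : Eu (m+1)) 1)) := by
    intro d hd hd1
    obtain ⟨Q, hQm, hQd, hQu, hQ⟩ := exists_cells (m+1) hd
    have hsub : sphere (0 : Eu (m+1)) 1 ⊆ ⋃ i, (sphere (0 : Eu (m+1)) 1 ∩ Q i) := by
      rw [← Set.inter_iUnion, hQu, Set.inter_univ]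
    refine (measure_mono hsub).trans ((measure_iUnion_le _).trans ?_)
    have hcell : ∀ i, μH[(m:ℝ)] (sphere (0 : Eu (m+1)) 1 ∩ Q i) ≤
        kap m * ((m:ℝ≥0∞) + 1) * volume (nrm ⁻¹' (sphere (0 : Eu (m+1)) 1 ∩ Q i) ∩ ball (0 : Eu (m+1)) (1 - d^2/2)⁻¹) := by
      intro i
      rcases (sphere (0 : Eu (m+1)) 1 ∩ Q i).eq_empty_or_nonempty with he | ⟨ν, hν⟩
      · rw [he]; simp
      obtain ⟨S⟩ := exists_spl ν (by simpa using hν.1)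
      refine cone_piece S (isClosed_sphere.measurableSet.inter (hQm i)) hd1 (fun x hx => by simpa using hx.1) ?_
      intro x hx; rw [← dist_eq_norm]; exact hQ i x hx.2 ν hν.2
    refine (ENNReal.tsum_le_tsum hcell).trans ?_
    rw [ENNReal.tsum_mul_left]
    have hdp : 0 < 1 - d^2/2 := by nlinarith
    have e := Measure.addHaar_ball_mul_of_pos (volume : Measure (Eu (m+1))) 0 (inv_pos.2 hdp) 1
    simp only [finrank_euclideanSpace, Fintype.card_fin, mul_one] at e
    rw [← e]
    refine mul_le_mul_right ?_ _
    rw [← measure_iUnion]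
    · exact measure_mono (Set.iUnion_subset fun i => Set.inter_subset_right)
    · intro i j hij
      have := hQd hij
      simp only [Function.onFun, Set.disjoint_left] at this ⊢
      rintro x ⟨⟨_, h1⟩, _⟩ ⟨⟨_, h2⟩, _⟩
      exact this h1 h2
    · intro i
      exact (nrm_meas (isClosed_sphere.measurableSet.inter (hQm i))).inter measurableSet_ball
  have hlim : Tendsto (fun d : ℝ => kap m * ((m:ℝ≥0∞) + 1) * (ENNReal.ofReal (((1 - d^2/2)⁻¹)^(m+1)) * volume (ball (0 : Eu (m+1)) 1)))
      (nhdsWithin 0 (Set.Ioi 0)) (nhds (kap m * ((m:ℝ≥0∞) + 1) * (ENNReal.ofReal (((1 - (0:ℝ)^2/2)⁻¹)^(m+1)) * volume (ball (0 : Eu (m+1)) 1)))) := by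
    refine ENNReal.Tendsto.const_mul (ENNReal.Tendsto.mul_const ?_ (Or.inr measure_ball_lt_top.ne)) (Or.inr ?_)
    · refine (ENNReal.tendsto_ofReal ?_).mono_left nhdsWithin_le_nhds
      have : ContinuousAt (fun d : ℝ => ((1 - d^2/2)⁻¹)^(m+1)) 0 := by
        refine ContinuousAt.pow (ContinuousAt.inv₀ (by fun_prop) (by norm_num)) _
      exact this
    · exact ENNReal.mul_ne_top (kap_ne_top m) (by simp)
  have := ge_of_tendsto hlim (by
    have hs : ∀ᶠ h in nhdsWithin (0:ℝ) (Set.Ioi 0), h < 1 := nhdsWithin_le_nhds (gt_mem_nhds one_pos)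
    filter_upwards [hs, self_mem_nhdsWithin] with d h1 h2 using key d h2 h1)
  simpa using this

theorem essBoundary_ball {n : ℕ} {R : ℝ} : essBoundary (ball (0 : Eu n) R) ⊆ sphere 0 R := by
  rintro x ⟨h0, h1⟩
  rw [mem_sphere_zero_iff_norm]
  by_contra hne
  rcases lt_or_gt_of_ne hne with h | h
  · apply h1
    refine tendsto_const_nhds.congr' ?_
    have hs : ∀ᶠ r in nhdsWithin (0:ℝ) (Set.Ioi 0), r < R - ‖x‖ := nhdsWithin_le_nhds (gt_mem_nhds (by linarith))
    filter_upwards [hs, self_mem_nhdsWithin] with r h2 h3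
    have : ball (0 : Eu n) R ∩ ball x r = ball x r := by
      apply Set.inter_eq_right.2
      apply ball_subset_ball'
      rw [dist_zero_right]; linarith
    rw [this, div_self]
    exact (ENNReal.toReal_pos (measure_ball_pos _ _ h3).ne' measure_ball_lt_top.ne).ne'
  · apply h0
    refine tendsto_const_nhds.congr' ?_
    have hs : ∀ᶠ r in nhdsWithin (0:ℝ) (Set.Ioi 0), r < ‖x‖ - R := nhdsWithin_le_nhds (gt_mem_nhds (by linarith))
    filter_upwards [hs, self_mem_nhdsWithin] with r h2 h3
    have : ball (0 : Eu n) R ∩ ball x r = ∅ := by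
      apply Set.disjoint_iff_inter_eq_empty.1
      apply ball_disjoint_ball
      rw [dist_comm, dist_zero_right]; linarith
    rw [this]; simp

open scoped Pointwise in
theorem perimeter_ball_le (m : ℕ) {R : ℝ} (hR : 0 < R) : perimeter (ball (0 : Eu (m+1)) R) ≤
    kap m * ((m:ℝ≥0∞) + 1) * volume (ball (0 : Eu (m+1)) 1) * ENNReal.ofReal (R ^ m) := by
  rw [perimeter_eq]
  refine (measure_mono essBoundary_ball).trans ?_
  have e : sphere (0 : Eu (m+1)) R = R • sphere (0 : Eu (m+1)) 1 := by
    rw [smul_sphere' hR.ne']; simp [abs_of_pos hR]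
  rw [e, Measure.hausdorffMeasure_smul₀ (by positivity) hR.ne', ENNReal.smul_def, smul_eq_mul, mul_comm]
  have e2 : ((‖R‖₊ ^ (m:ℝ) : NNReal) : ℝ≥0∞) = ENNReal.ofReal (R ^ m) := by
    rw [NNReal.rpow_natCast, ENNReal.ofReal, Real.toNNReal_pow hR.le]
    congr 2
    ext; simp [abs_of_pos hR, hR.le]
  rw [e2]
  gcongr
  exact sphere_one_le m


/-! ## Section C0: the orthogonal group -/

instance contStar (m : ℕ) : ContinuousStar (Eu (m+1) →L[ℝ] Eu (m+1)) :=
  ⟨(ContinuousLinearMap.adjoint : (Eu (m+1) →L[ℝ] Eu (m+1)) ≃ₗᵢ⋆[ℝ] _).continuous⟩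

abbrev Gr (m : ℕ) := unitary (Eu (m+1) →L[ℝ] Eu (m+1))

instance gr_topgroup (m : ℕ) : IsTopologicalGroup (Gr m) := inferInstance

theorem gr_norm_map {m : ℕ} (g : Gr m) (x : Eu (m+1)) : ‖(g : Eu (m+1) →L[ℝ] Eu (m+1)) x‖ = ‖x‖ :=
  Unitary.norm_map g x

theorem unitary_compact {H : Type} [NormedAddCommGroup H] [InnerProductSpace ℝ H] [CompleteSpace H]
    [ContinuousStar (H →L[ℝ] H)] [ProperSpace (H →L[ℝ] H)] : CompactSpace (unitary (H →L[ℝ] H)) := by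
  have hcl : IsClosed ((unitary (H →L[ℝ] H) : Submonoid _) : Set (H →L[ℝ] H)) := isClosed_unitary
  have hb : Bornology.IsBounded ((unitary (H →L[ℝ] H) : Submonoid _) : Set (H →L[ℝ] H)) := by
    refine (Metric.isBounded_iff_subset_closedBall 0).2 ⟨1, fun a ha => ?_⟩
    rw [mem_closedBall_zero_iff]
    refine ContinuousLinearMap.opNorm_le_bound _ zero_le_one fun x => ?_
    rw [one_mul]
    exact (Unitary.norm_map ⟨a, ha⟩ x).le
  exact isCompact_iff_compactSpace.1 (Metric.isCompact_of_isClosed_isBounded hcl hb)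

instance gr_compact (m : ℕ) : CompactSpace (Gr m) := unitary_compact

instance gr_borel (m : ℕ) : BorelSpace (Gr m) := inferInstance

/-- normalised Haar measure -/
def hg (m : ℕ) : Measure (Gr m) := Measure.haarMeasure ⊤

instance hg_prob (m : ℕ) : IsProbabilityMeasure (hg m) := by
  constructor
  have := Measure.haarMeasure_self (K₀ := (⊤ : TopologicalSpace.PositiveCompacts (Gr m)))
  simpa [hg] using this

instance hg_inv (m : ℕ) : (hg m).IsMulLeftInvariant := by unfold hg; infer_instance

/-- the (right) action by the inverse -/
def ac {m : ℕ} (g : Gr m) : Eu (m+1) →L[ℝ] Eu (m+1) := ((star g : Gr m) : Eu (m+1) →L[ℝ] Eu (m+1))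

theorem ac_norm {m : ℕ} (g : Gr m) (x : Eu (m+1)) : ‖ac g x‖ = ‖x‖ := gr_norm_map _ _

theorem ac_mul {m : ℕ} (h g : Gr m) (x : Eu (m+1)) : ac (h * g) x = ac g (ac h x) := by
  simp [ac]

theorem ac_cont {m : ℕ} : Continuous fun q : Gr m × Eu (m+1) => ac q.1 q.2 := by
  have h1 : Continuous fun q : Gr m × Eu (m+1) => ((star q.1 : Gr m) : Eu (m+1) →L[ℝ] Eu (m+1)) :=
    continuous_subtype_val.comp (continuous_star.comp continuous_fst)
  exact h1.clm_apply continuous_snd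

theorem ac_isom {m : ℕ} (g : Gr m) : Isometry (ac g) :=
  AddMonoidHomClass.isometry_of_norm _ (ac_norm g)

theorem ac_star {m : ℕ} (g : Gr m) (x : Eu (m+1)) : ac (star g) (ac g x) = x := by
  rw [← ac_mul]; simp [ac]

theorem ac_star' {m : ℕ} (g : Gr m) (x : Eu (m+1)) : ac g (ac (star g) x) = x := by
  rw [← ac_mul]; simp [ac]

def acE {m : ℕ} (g : Gr m) : Eu (m+1) ≃ᵢ Eu (m+1) where
  toFun := ac g
  invFun := ac (star g)
  left_inv := ac_star g
  right_inv := ac_star' g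
  isometry_toFun := ac_isom g

theorem ac_mp {m : ℕ} (g : Gr m) : MeasurePreserving (ac g) (volume : Measure (Eu (m+1))) volume := by
  let L : Eu (m+1) ≃ₗᵢ[ℝ] Eu (m+1) :=
    LinearIsometryEquiv.mk (LinearEquiv.ofBijective (ac g : Eu (m+1) →ₗ[ℝ] Eu (m+1)) (acE g).bijective) (ac_norm g)
  exact L.measurePreserving

theorem ac_emb {m : ℕ} (g : Gr m) : MeasurableEmbedding (ac g) :=
  (acE g).toHomeomorph.measurableEmbedding

theorem lint_ac {m : ℕ} (g : Gr m) (f : Eu (m+1) → ℝ≥0∞) : ∫⁻ x, f (ac g x) = ∫⁻ x, f x :=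
  (ac_mp g).lintegral_comp_emb (ac_emb g) f

theorem lint_gr_mul {m : ℕ} (h : Gr m) (f : Gr m → ℝ≥0∞) : ∫⁻ g, f (h * g) ∂(hg m) = ∫⁻ g, f g ∂(hg m) :=
  lintegral_mul_left_eq_self f h

def e1 (m : ℕ) : Eu (m+1) := EuclideanSpace.single 0 1
def e2 (m : ℕ) : Eu (m+1) := EuclideanSpace.single (Fin.last m) 1

theorem e1_norm (m : ℕ) : ‖e1 m‖ = 1 := by simp [e1]
theorem e2_norm (m : ℕ) : ‖e2 m‖ = 1 := by simp [e2]
theorem e12 {m : ℕ} (hm : 1 ≤ m) : inner ℝ (e1 m) (e2 m) = 0 := by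
  have : (0 : Fin (m+1)) ≠ Fin.last m := by
    intro h; have := congrArg Fin.val h; simp at this; omega
  simp [e1, e2, EuclideanSpace.inner_single_left, this]

theorem gr_of_basis {m : ℕ} (b : OrthonormalBasis (Fin (m+1)) ℝ (Eu (m+1))) :
    ∃ h : Gr m, ∀ i, ac h (EuclideanSpace.single i 1) = b i := by
  let L : Eu (m+1) ≃ₗᵢ[ℝ] Eu (m+1) := (EuclideanSpace.basisFun (Fin (m+1)) ℝ).equiv b (Equiv.refl _)
  refine ⟨star (Unitary.linearIsometryEquiv.symm L), fun i => ?_⟩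
  have : L (EuclideanSpace.basisFun (Fin (m+1)) ℝ i) = b i := by
    simp [L, -EuclideanSpace.basisFun_apply, OrthonormalBasis.equiv_apply_basis]
  simpa [ac] using this

theorem gr_one {m : ℕ} {u : Eu (m+1)} (hu : ‖u‖ = 1) : ∃ h : Gr m, ac h (e1 m) = u := by
  obtain ⟨b, hb⟩ := Orthonormal.exists_orthonormalBasis_extension_of_card_eq (𝕜 := ℝ) (E := Eu (m+1)) (ι := Fin (m+1))
    (by simp) (v := fun _ => u) (s := {0}) (by
      rw [orthonormal_iff_ite]
      rintro ⟨i, hi⟩ ⟨j, hj⟩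
      have hi' : i = 0 := hi
      have hj' : j = 0 := hj
      subst hi' hj'
      simp [hu])
  obtain ⟨h, hh⟩ := gr_of_basis b
  exact ⟨h, by rw [e1, hh, hb 0 rfl]⟩

theorem gr_two {m : ℕ} (hm : 1 ≤ m) {u v : Eu (m+1)} (hu : ‖u‖ = 1) (hv : ‖v‖ = 1) (huv : inner ℝ u v = 0) :
    ∃ h : Gr m, ac h (e1 m) = u ∧ ac h (e2 m) = v := by
  have h0 : (0 : Fin (m+1)) ≠ Fin.last m := by
    intro h; have := congrArg Fin.val h; simp at this; omega
  have hvu : inner ℝ v u = 0 := by rw [real_inner_comm]; exact huv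
  obtain ⟨b, hb⟩ := Orthonormal.exists_orthonormalBasis_extension_of_card_eq (𝕜 := ℝ) (E := Eu (m+1)) (ι := Fin (m+1))
    (by simp) (v := fun i => if i = 0 then u else v) (s := {0, Fin.last m}) (by
      rw [orthonormal_iff_ite]
      rintro ⟨i, hi⟩ ⟨j, hj⟩
      rcases hi with hi | hi <;> rcases hj with hj | hj
      · subst hi hj; simp [hu]
      · have hj' : j = Fin.last m := hj
        subst hi hj'
        rw [if_neg (fun h => h0 (congrArg Subtype.val h))]; simp [h0.symm, huv]
      · have hi' : i = Fin.last m := hi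
        subst hi' hj
        rw [if_neg (fun h => h0.symm (congrArg Subtype.val h))]; simp [h0.symm, hvu]
      · have hi' : i = Fin.last m := hi
        have hj' : j = Fin.last m := hj
        subst hi' hj'; simp [h0.symm, hv])
  obtain ⟨h, hh⟩ := gr_of_basis b
  exact ⟨h, by rw [e1, hh, hb 0 (by simp)]; simp, by rw [e2, hh, hb _ (by simp)]; simp [h0.symm]⟩

theorem lint_gr_pair {m : ℕ} (hm : 1 ≤ m) {u v : Eu (m+1)} (hu : ‖u‖ = 1) (hv : ‖v‖ = 1) (huv : inner ℝ u v = 0)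
    (Φ : Eu (m+1) → Eu (m+1) → ℝ≥0∞) :
    ∫⁻ g, Φ (ac g u) (ac g v) ∂(hg m) = ∫⁻ g, Φ (ac g (e1 m)) (ac g (e2 m)) ∂(hg m) := by
  obtain ⟨h, rfl, rfl⟩ := gr_two hm hu hv huv
  have := lint_gr_mul h (fun g => Φ (ac g (e1 m)) (ac g (e2 m)))
  simpa [ac_mul] using this

theorem lint_gr_one {m : ℕ} {u : Eu (m+1)} (hu : ‖u‖ = 1) (Φ : Eu (m+1) → ℝ≥0∞) :
    ∫⁻ g, Φ (ac g u) ∂(hg m) = ∫⁻ g, Φ (ac g (e1 m)) ∂(hg m) := by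
  obtain ⟨h, rfl⟩ := gr_one hu
  have := lint_gr_mul h (fun g => Φ (ac g (e1 m)))
  simpa [ac_mul] using this

/-! radial integration -/

theorem lint_radial {m : ℕ} {φ : ℝ → ℝ≥0∞} (hφ : Measurable φ) :
    ∫⁻ x : Eu (m+1), φ ‖x‖ = ((m:ℝ≥0∞)+1) * volume (ball (0:Eu (m+1)) 1) *
      ∫⁻ t in Set.Ioi (0:ℝ), ENNReal.ofReal (t^m) * φ t := by
  set μ : Measure (Eu (m+1)) := volume
  have h1 : ∫⁻ x : Eu (m+1), φ ‖x‖ ∂μ = ∫⁻ x : ({0}ᶜ : Set (Eu (m+1))), φ ‖x.1‖ ∂(μ.comap (↑)) := by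
    rw [lintegral_subtype_comap (measurableSet_singleton _).compl (fun x : Eu (m+1) => φ ‖x‖)]
    rw [restrict_compl_singleton]
  have h2 := μ.measurePreserving_homeomorphUnitSphereProd.lintegral_comp_emb
    (Homeomorph.measurableEmbedding _) (fun q => φ q.2.1)
  have h3 : ∫⁻ q, φ q.2.1 ∂(μ.toSphere.prod (.volumeIoiPow (Module.finrank ℝ (Eu (m+1)) - 1))) =
      μ.toSphere Set.univ * ∫⁻ t : Set.Ioi (0:ℝ), φ t ∂(.volumeIoiPow (Module.finrank ℝ (Eu (m+1)) - 1)) := by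
    rw [lintegral_prod _ (by fun_prop)]
    simp only []
    rw [lintegral_const, mul_comm]
  rw [h1]
  simp only [homeomorphUnitSphereProd_apply_snd_coe] at h2
  rw [h2, h3, Measure.toSphere_apply_univ]
  simp only [finrank_euclideanSpace, Fintype.card_fin, Nat.add_sub_cancel]
  push_cast
  congr 1
  rw [Measure.volumeIoiPow, lintegral_withDensity_eq_lintegral_mul _ (by fun_prop) (by fun_prop)]
  rw [← lintegral_subtype_comap measurableSet_Ioi]
  rfl


/-! sealed version of the group -/
def GG (m : ℕ) : Type := Gr m
instance GG_ms (m : ℕ) : MeasurableSpace (GG m) := inferInstanceAs (MeasurableSpace (Gr m))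
def hG (m : ℕ) : Measure (GG m) := hg m
instance hG_prob (m : ℕ) : IsProbabilityMeasure (hG m) := hg_prob m
def av {m : ℕ} (g : GG m) : Eu (m+1) →L[ℝ] Eu (m+1) := ac (m := m) g
theorem av_norm {m : ℕ} (g : GG m) (x : Eu (m+1)) : ‖av g x‖ = ‖x‖ := ac_norm (m := m) g x
theorem av_meas {m : ℕ} : Measurable fun q : GG m × Eu (m+1) => av q.1 q.2 :=
  (ac_cont (m := m)).measurable
theorem lint_av {m : ℕ} (g : GG m) (f : Eu (m+1) → ℝ≥0∞) : ∫⁻ x, f (av g x) = ∫⁻ x, f x :=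
  lint_ac (m := m) g f
theorem lint_pair {m : ℕ} (hm : 1 ≤ m) {u v : Eu (m+1)} (hu : ‖u‖ = 1) (hv : ‖v‖ = 1) (huv : inner ℝ u v = 0)
    (Φ : Eu (m+1) → Eu (m+1) → ℝ≥0∞) :
    ∫⁻ g, Φ (av g u) (av g v) ∂(hG m) = ∫⁻ g, Φ (av g (e1 m)) (av g (e2 m)) ∂(hG m) :=
  lint_gr_pair hm hu hv huv Φ
theorem lint_one {m : ℕ} {u : Eu (m+1)} (hu : ‖u‖ = 1) (Φ : Eu (m+1) → ℝ≥0∞) :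
    ∫⁻ g, Φ (av g u) ∂(hG m) = ∫⁻ g, Φ (av g (e1 m)) ∂(hG m) := lint_gr_one hu Φ

theorem av_one {m : ℕ} {u : Eu (m+1)} (hu : ‖u‖ = 1) : ∃ h : GG m, av h (e1 m) = u := gr_one hu
theorem av_two {m : ℕ} (hm : 1 ≤ m) {u v : Eu (m+1)} (hu : ‖u‖ = 1) (hv : ‖v‖ = 1) (huv : inner ℝ u v = 0) :
    ∃ h : GG m, av h (e1 m) = u ∧ av h (e2 m) = v := gr_two hm hu hv huv
theorem av_mp {m : ℕ} (g : GG m) : MeasurePreserving (av g) (volume : Measure (Eu (m+1))) volume :=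
  ac_mp (m := m) g
theorem av_emb {m : ℕ} (g : GG m) : MeasurableEmbedding (av g) := ac_emb (m := m) g

theorem av_surj {m : ℕ} (g : GG m) : Function.Surjective (av g) := (acE (m := m) g).surjective

attribute [irreducible] GG hG av

theorem av_meas_comp {m : ℕ} {T : Type} [MeasurableSpace T] {f : T → GG m} {h : T → Eu (m+1)}
    (hf : Measurable f) (hh : Measurable h) : Measurable fun q => av (f q) (h q) :=
  (av_meas (m := m)).comp (hf.prodMk hh)

theorem av_meas_left {m : ℕ} (x : Eu (m+1)) : Measurable fun g : GG m => av g x :=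
  av_meas_comp measurable_id measurable_const

/-- polar coordinates via the group -/
theorem lint_polar {m : ℕ} {F : Eu (m+1) → ℝ≥0∞} (hF : Measurable F) :
    ∫⁻ x, F x = ((m:ℝ≥0∞)+1) * volume (ball (0:Eu (m+1)) 1) *
      ∫⁻ t in Set.Ioi (0:ℝ), ENNReal.ofReal (t^m) * ∫⁻ g, F (t • av g (e1 m)) ∂(hG m) := by
  have hm1 : Measurable fun q : GG m × Eu (m+1) => F (av q.1 q.2) := hF.comp (av_meas_comp measurable_fst measurable_snd)
  have hc : Measurable fun q : ℝ × GG m => q.1 • av q.2 (e1 m) :=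
    measurable_fst.smul (av_meas_comp measurable_snd measurable_const)
  have hm2 : Measurable fun q : ℝ × GG m => F (q.1 • av q.2 (e1 m)) := hF.comp hc
  rw [← lint_radial (m := m) (φ := fun t => ∫⁻ g, F (t • av g (e1 m)) ∂(hG m)) hm2.lintegral_prod_right']
  calc ∫⁻ x, F x = ∫⁻ g, (∫⁻ x, F (av g x)) ∂(hG m) := by
        simp_rw [lint_av]; simp
    _ = ∫⁻ x, ∫⁻ g, F (av g x) ∂(hG m) := by
        exact lintegral_lintegral_swap hm1.aemeasurable
    _ = _ := by
        have hne : ∀ᵐ x : Eu (m+1), x ≠ 0 := by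
          exact Measure.ae_ne volume 0
        refine lintegral_congr_ae ?_
        filter_upwards [hne] with x hx
        have hx' : ‖x‖ ≠ 0 := norm_ne_zero_iff.2 hx
        have hu : ‖(‖x‖⁻¹ • x)‖ = 1 := by
          rw [norm_smul, norm_inv, norm_norm, inv_mul_cancel₀ hx']
        rw [← lint_one hu (fun z => F (‖x‖ • z))]
        refine lintegral_congr fun g => ?_
        rw [map_smul, smul_smul, mul_inv_cancel₀ hx', one_smul]


/-! ## Section D1: decomposition of the Riesz kernel into balls -/

def kb {m : ℕ} (ρ : ℝ) (z : Eu (m+1)) : ℝ≥0∞ := volume (ball (0:Eu (m+1)) ρ ∩ ball z ρ)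

theorem kb_meas {m : ℕ} : Measurable fun q : ℝ × Eu (m+1) => kb q.1 q.2 := by
  have hS : MeasurableSet {w : (ℝ × Eu (m+1)) × Eu (m+1) | dist w.2 0 < w.1.1 ∧ dist w.2 w.1.2 < w.1.1} := by
    have h1 : MeasurableSet {w : (ℝ × Eu (m+1)) × Eu (m+1) | dist w.2 0 < w.1.1} :=
      measurableSet_lt (by fun_prop) (by fun_prop)
    have h2 : MeasurableSet {w : (ℝ × Eu (m+1)) × Eu (m+1) | dist w.2 w.1.2 < w.1.1} :=
      measurableSet_lt (by fun_prop) (by fun_prop)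
    exact h1.inter h2
  exact measurable_measure_prodMk_left hS

theorem kb_meas_right {m : ℕ} (ρ : ℝ) : Measurable (kb (m := m) ρ) :=
  kb_meas.comp (measurable_const.prodMk measurable_id)

theorem kb_meas_comp {m : ℕ} {T : Type*} [MeasurableSpace T] {f : T → ℝ} {h : T → Eu (m+1)}
    (hf : Measurable f) (hh : Measurable h) : Measurable fun q => kb (f q) (h q) :=
  kb_meas.comp (hf.prodMk hh)

theorem kb_sub {m : ℕ} (ρ : ℝ) (x y : Eu (m+1)) : kb ρ (x - y) = volume (ball x ρ ∩ ball y ρ) := by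
  have : (fun w => w + y) ⁻¹' (ball x ρ ∩ ball y ρ) = ball 0 ρ ∩ ball (x - y) ρ := by
    ext w
    simp only [Set.mem_preimage, Set.mem_inter_iff, mem_ball, dist_eq_norm]
    rw [and_comm, show w + y - y = w - 0 by abel, show w + y - x = w - (x - y) by abel]
  rw [kb, ← this]
  exact measure_preimage_add_right volume y _

theorem kb_swap {m : ℕ} (ρ : ℝ) (x y : Eu (m+1)) : kb ρ (x - y) = kb ρ (y - x) := by
  rw [kb_sub, kb_sub, Set.inter_comm]

theorem kb_av {m : ℕ} (ρ : ℝ) (g : GG m) (z : Eu (m+1)) : kb ρ (av g z) = kb ρ z := by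
  have h : (av g) ⁻¹' (ball 0 ρ ∩ ball (av g z) ρ) = ball 0 ρ ∩ ball z ρ := by
    ext w
    simp only [Set.mem_preimage, Set.mem_inter_iff, mem_ball, dist_eq_norm, sub_zero, ← map_sub, av_norm]
  rw [kb, kb, ← h]
  exact ((av_mp g).measure_preimage_emb (av_emb g) _).symm

theorem exists_av {m : ℕ} {z : Eu (m+1)} (hz : z ≠ 0) : ∃ g : GG m, z = ‖z‖ • av g (e1 m) := by
  have hz' : ‖z‖ ≠ 0 := norm_ne_zero_iff.2 hz
  obtain ⟨g, hg⟩ := av_one (m := m) (u := ‖z‖⁻¹ • z) (by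
    rw [norm_smul, norm_inv, norm_norm, inv_mul_cancel₀ hz'])
  exact ⟨g, by rw [hg, smul_smul, mul_inv_cancel₀ hz', one_smul]⟩

theorem kb_le {m : ℕ} (ρ : ℝ) (z : Eu (m+1)) : kb ρ z ≤ volume (ball (0:Eu (m+1)) ρ) :=
  measure_mono Set.inter_subset_left

theorem vol_ball {m : ℕ} {ρ : ℝ} (hρ : 0 ≤ ρ) (x : Eu (m+1)) :
    volume (ball x ρ) = ENNReal.ofReal (ρ^(m+1)) * volume (ball (0:Eu (m+1)) 1) := by
  rw [Measure.addHaar_ball volume x hρ]; simp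

theorem kb_zero {m : ℕ} {ρ : ℝ} {z : Eu (m+1)} (h : 2*ρ ≤ ‖z‖) : kb ρ z = 0 := by
  have : ball (0:Eu (m+1)) ρ ∩ ball z ρ = ∅ := by
    ext w
    simp only [Set.mem_inter_iff, mem_ball, dist_eq_norm, Set.mem_empty_iff_false, iff_false, not_and, sub_zero]
    intro h1 h2
    have : ‖z‖ ≤ ‖w‖ + ‖w - z‖ := by
      have := norm_sub_le w (w - z)
      simpa using this
    linarith
  rw [kb, this, measure_empty]

open scoped Pointwise in
theorem kb_scale {m : ℕ} {t : ℝ} (ht : 0 < t) (ρ : ℝ) (z : Eu (m+1)) :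
    kb (t*ρ) (t • z) = ENNReal.ofReal (t^(m+1)) * kb ρ z := by
  have : ball (0:Eu (m+1)) (t*ρ) ∩ ball (t•z) (t*ρ) = t • (ball (0:Eu (m+1)) ρ ∩ ball z ρ) := by
    rw [Set.smul_set_inter₀ ht.ne', _root_.smul_ball ht.ne', _root_.smul_ball ht.ne', Real.norm_of_nonneg ht.le, smul_zero]
  rw [kb, this, Measure.addHaar_smul]
  simp [abs_of_pos ht, kb]

theorem kb_int {m : ℕ} (ρ : ℝ) : ∫⁻ z : Eu (m+1), kb ρ z = volume (ball (0:Eu (m+1)) ρ) ^ 2 := by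
  have hS : MeasurableSet {w : Eu (m+1) × Eu (m+1) | w.2 ∈ ball (0:Eu (m+1)) ρ ∧ dist w.2 w.1 < ρ} := by
    have h2 : MeasurableSet {w : Eu (m+1) × Eu (m+1) | dist w.2 w.1 < ρ} :=
      measurableSet_lt (by fun_prop) (by fun_prop)
    exact (measurableSet_ball.preimage measurable_snd).inter h2
  have h1 : ∫⁻ z : Eu (m+1), kb ρ z = (volume.prod volume) {w : Eu (m+1) × Eu (m+1) | w.2 ∈ ball (0:Eu (m+1)) ρ ∧ dist w.2 w.1 < ρ} := by
    rw [Measure.prod_apply hS]; rfl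
  rw [h1, Measure.prod_apply_symm hS]
  have h2 : ∀ y : Eu (m+1), volume ((fun x => (x, y)) ⁻¹' {w : Eu (m+1) × Eu (m+1) | w.2 ∈ ball (0:Eu (m+1)) ρ ∧ dist w.2 w.1 < ρ})
      = (ball (0:Eu (m+1)) ρ).indicator (fun _ => volume (ball (0:Eu (m+1)) ρ)) y := by
    intro y
    by_cases hy : y ∈ ball (0:Eu (m+1)) ρ
    · rw [Set.indicator_of_mem hy]
      have : (fun x => (x, y)) ⁻¹' {w : Eu (m+1) × Eu (m+1) | w.2 ∈ ball (0:Eu (m+1)) ρ ∧ dist w.2 w.1 < ρ} = ball y ρ := by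
        ext x
        have hy2 := mem_ball.1 hy
        simp only [Set.mem_preimage, Set.mem_ofPred_eq, hy2, true_and, mem_ball]
        rw [dist_comm]
      rw [this, Measure.addHaar_ball_center]
    · rw [Set.indicator_of_notMem hy]
      have : (fun x => (x, y)) ⁻¹' {w : Eu (m+1) × Eu (m+1) | w.2 ∈ ball (0:Eu (m+1)) ρ ∧ dist w.2 w.1 < ρ} = ∅ := by
        ext x
        simp [-mem_ball, hy]
      rw [this, measure_empty]
  simp_rw [h2]
  rw [lintegral_indicator measurableSet_ball, setLIntegral_const, sq]

/-- the partial kernel -/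
def kI {m : ℕ} (a : ℝ) (s : Set ℝ) (z : Eu (m+1)) : ℝ≥0∞ :=
  ∫⁻ ρ in s, ENNReal.ofReal (ρ ^ (a - 2*((m:ℝ)+1) - 1)) * kb ρ z

theorem kI_meas {m : ℕ} (a : ℝ) (s : Set ℝ) : Measurable (kI (m := m) a s) := by
  unfold kI
  refine Measurable.lintegral_prod_right' (f := fun q : Eu (m+1) × ℝ => ENNReal.ofReal (q.2 ^ (a - 2*((m:ℝ)+1) - 1)) * kb q.2 q.1) ?_
  exact (by fun_prop : Measurable _).mul (kb_meas_comp measurable_snd measurable_fst)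

def cc (m : ℕ) (a : ℝ) : ℝ≥0∞ := kI a (Set.Ioi 0) (e1 m)

theorem vol1_pos (m : ℕ) : volume (ball (0:Eu (m+1)) 1) ≠ 0 := (measure_ball_pos _ _ one_pos).ne'
theorem vol1_top (m : ℕ) : volume (ball (0:Eu (m+1)) 1) ≠ ∞ := measure_ball_lt_top.ne

theorem lint_rpow_Ioi {c p : ℝ} (hc : 0 < c) (hp : p < -1) :
    ∫⁻ t in Set.Ioi c, ENNReal.ofReal (t^p) = ENNReal.ofReal (-c^(p+1)/(p+1)) := by
  rw [← integral_Ioi_rpow_of_lt hp hc]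
  rw [ofReal_integral_eq_lintegral_ofReal (integrableOn_Ioi_rpow_of_lt hp hc)]
  refine (ae_restrict_iff' measurableSet_Ioi).2 (Eventually.of_forall fun t ht => ?_)
  exact Real.rpow_nonneg (hc.le.trans (le_of_lt ht)) _

theorem lint_rpow_Ioc {c p : ℝ} (hc : 0 ≤ c) (hp : -1 < p) :
    ∫⁻ t in Set.Ioc 0 c, ENNReal.ofReal (t^p) = ENNReal.ofReal (c^(p+1)/(p+1)) := by
  have h := integral_rpow (a := 0) (b := c) (r := p) (Or.inl hp)
  rw [Real.zero_rpow (by linarith), sub_zero] at h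
  rw [← h, intervalIntegral.integral_of_le hc]
  have hi := (intervalIntegral.intervalIntegrable_rpow' (a := 0) (b := c) hp).1
  rw [ofReal_integral_eq_lintegral_ofReal hi]
  refine (ae_restrict_iff' measurableSet_Ioc).2 (Eventually.of_forall fun t ht => ?_)
  exact Real.rpow_nonneg ht.1.le _

theorem wkb_le {m : ℕ} (a : ℝ) {ρ : ℝ} (hρ : 0 < ρ) (z : Eu (m+1)) :
    ENNReal.ofReal (ρ ^ (a - 2*((m:ℝ)+1) - 1)) * kb ρ z ≤
      volume (ball (0:Eu (m+1)) 1) * ENNReal.ofReal (ρ ^ (a - ((m:ℝ)+1) - 1)) := by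
  refine (mul_le_mul_right (kb_le ρ z) _).trans ?_
  rw [vol_ball hρ.le, ← mul_assoc, ← ENNReal.ofReal_mul (by positivity), mul_comm]
  rw [← Real.rpow_natCast, ← Real.rpow_add hρ]
  apply le_of_eq
  congr 3
  push_cast; ring

theorem cc_ne_top {m : ℕ} {a : ℝ} (ha : a < m+1) : cc m a ≠ ∞ := by
  have h1 : cc m a ≤ ∫⁻ ρ in Set.Ioi (1/2:ℝ), volume (ball (0:Eu (m+1)) 1) * ENNReal.ofReal (ρ ^ (a - ((m:ℝ)+1) - 1)) := by
    rw [cc, kI]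
    rw [← lintegral_indicator measurableSet_Ioi, ← lintegral_indicator measurableSet_Ioi]
    refine lintegral_mono fun ρ => ?_
    by_cases h0 : ρ ∈ Set.Ioi (0:ℝ)
    · rw [Set.indicator_of_mem h0]
      by_cases h : ρ ∈ Set.Ioi (1/2:ℝ)
      · rw [Set.indicator_of_mem h]
        exact wkb_le a h0 _
      · rw [Set.indicator_of_notMem h, kb_zero, mul_zero]
        rw [e1_norm]
        have : ρ ≤ 1/2 := not_lt.1 h
        linarith
    · rw [Set.indicator_of_notMem h0]; exact zero_le
  refine ne_top_of_le_ne_top ?_ h1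
  rw [lintegral_const_mul' _ _ (vol1_top m), lint_rpow_Ioi (by norm_num) (by linarith)]
  exact ENNReal.mul_ne_top (vol1_top m) ofReal_ne_top

theorem cc_ne_zero {m : ℕ} {a : ℝ} : cc m a ≠ 0 := by
  have h1 : ∫⁻ ρ in Set.Ioo (2:ℝ) 3, ENNReal.ofReal (ρ ^ (a - 2*((m:ℝ)+1) - 1)) * volume (ball (0:Eu (m+1)) 1) ≤ cc m a := by
    rw [cc, kI]
    refine le_trans ?_ (lintegral_mono_set (s := Set.Ioo (2:ℝ) 3) ?_)
    · refine setLIntegral_mono ?_ fun ρ hρ => ?_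
      · exact (by fun_prop : Measurable _).mul (kb_meas_comp measurable_id measurable_const)
      · refine mul_le_mul_right (measure_mono ?_) _
        intro w hw
        simp only [Set.mem_inter_iff, mem_ball, dist_eq_norm, sub_zero] at hw ⊢
        have := norm_sub_le w (e1 m)
        rw [e1_norm] at this
        exact ⟨by linarith [hρ.1], by linarith [hρ.1]⟩
    · intro x hx; exact lt_trans (by norm_num) hx.1
  intro h0
  rw [h0, nonpos_iff_eq_zero, lintegral_mul_const' _ _ (vol1_top m), mul_eq_zero, or_iff_left (vol1_pos m)] at h1
  rw [lintegral_eq_zero_iff (by fun_prop)] at h1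
  have h2 := (ae_restrict_iff' measurableSet_Ioo).1 h1
  have h3 : volume (Set.Ioo (2:ℝ) 3) = 0 := by
    refine measure_mono_null ?_ h2
    intro x hx
    simp only [Set.mem_compl_iff, Set.mem_ofPred_eq, Classical.not_imp, Pi.zero_apply]
    refine ⟨hx, ?_⟩
    have : (0:ℝ) < x := lt_trans (by norm_num) hx.1
    simp only [ENNReal.ofReal_eq_zero, not_le]
    positivity
  rw [Real.volume_Ioo] at h3
  norm_num at h3

theorem lint_scale_Ioi {t : ℝ} (ht : 0 < t) (f : ℝ → ℝ≥0∞) :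
    ∫⁻ x in Set.Ioi (0:ℝ), f x = ∫⁻ x in Set.Ioi (0:ℝ), ENNReal.ofReal t * f (t * x) := by
  have h := lintegral_image_eq_lintegral_abs_deriv_mul (s := Set.Ioi (0:ℝ)) (f := fun x => t * x) (f' := fun _ => t)
    measurableSet_Ioi (fun x _ => by simpa using ((hasDerivAt_id x).const_mul t).hasDerivWithinAt)
    (fun x _ y _ h => by simpa [ht.ne'] using h) f
  have hi : (fun x => t * x) '' Set.Ioi (0:ℝ) = Set.Ioi 0 := by
    ext y
    simp only [Set.mem_image, Set.mem_Ioi]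
    constructor
    · rintro ⟨x, hx, rfl⟩; positivity
    · intro hy; exact ⟨y / t, by positivity, by field_simp⟩
  rw [hi] at h
  rw [h, abs_of_pos ht]

theorem kI_full {m : ℕ} (a : ℝ) {z : Eu (m+1)} (hz : z ≠ 0) :
    kI a (Set.Ioi 0) z = ENNReal.ofReal (‖z‖ ^ (a - ((m:ℝ)+1))) * cc m a := by
  obtain ⟨g, hg⟩ := exists_av hz
  have hz' : 0 < ‖z‖ := norm_pos_iff.2 hz
  rw [kI, lint_scale_Ioi hz', cc, kI, ← lintegral_const_mul' _ _ ofReal_ne_top]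
  refine setLIntegral_congr_fun measurableSet_Ioi fun ρ hρ => ?_
  have hρ' : (0:ℝ) < ρ := hρ
  have h1 : kb (‖z‖ * ρ) z = ENNReal.ofReal (‖z‖^(m+1)) * kb ρ (e1 m) := by
    conv_lhs => rw [hg]
    rw [norm_smul, av_norm, e1_norm, norm_norm, mul_one, kb_scale hz', kb_av]
  rw [h1, Real.mul_rpow hz'.le hρ'.le, ← mul_assoc, ← mul_assoc, ← mul_assoc,
    ← ENNReal.ofReal_mul (by positivity), ← ENNReal.ofReal_mul (by positivity),
    ← ENNReal.ofReal_mul (by positivity)]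
  congr 2
  have : ‖z‖ ^ (a - ((m:ℝ)+1)) = ‖z‖ * ‖z‖ ^ (a - 2*((m:ℝ)+1) - 1) * ‖z‖^(m+1) := by
    rw [← Real.rpow_natCast ‖z‖ (m+1)]
    nth_rewrite 2 [← Real.rpow_one ‖z‖]
    rw [← Real.rpow_add hz', ← Real.rpow_add hz']
    congr 1; push_cast; ring
  rw [this]; ring

def k1 (m : ℕ) (a δ : ℝ) (z : Eu (m+1)) : ℝ≥0∞ := (cc m a)⁻¹ * kI a (Set.Ioc 0 δ) z
def k2 (m : ℕ) (a δ : ℝ) (z : Eu (m+1)) : ℝ≥0∞ := (cc m a)⁻¹ * kI a (Set.Ioi δ) z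

theorem k1_meas (m : ℕ) (a δ : ℝ) : Measurable (k1 m a δ) := (kI_meas _ _).const_mul _
theorem k2_meas (m : ℕ) (a δ : ℝ) : Measurable (k2 m a δ) := (kI_meas _ _).const_mul _

theorem k12 {m : ℕ} {a δ : ℝ} (ha : a < m+1) (hδ : 0 < δ) {z : Eu (m+1)} (hz : z ≠ 0) :
    k1 m a δ z + k2 m a δ z = ENNReal.ofReal (‖z‖ ^ (a - ((m:ℝ)+1))) := by
  have : kI a (Set.Ioi 0) z = kI a (Set.Ioc 0 δ) z + kI a (Set.Ioi δ) z := by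
    rw [kI, ← Set.Ioc_union_Ioi_eq_Ioi hδ.le, lintegral_union measurableSet_Ioi (Set.Ioc_disjoint_Ioi le_rfl)]
    rfl
  rw [k1, k2, ← mul_add, ← this, kI_full a hz, mul_comm, mul_assoc, ENNReal.mul_inv_cancel cc_ne_zero (cc_ne_top ha), mul_one]

theorem k1_le {m : ℕ} {a δ : ℝ} (ha : a < m+1) (hδ : 0 < δ) {z : Eu (m+1)} (hz : z ≠ 0) :
    k1 m a δ z ≤ ENNReal.ofReal (‖z‖ ^ (a - ((m:ℝ)+1))) := by
  rw [← k12 ha hδ hz]; exact le_self_add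

theorem k1_zero {m : ℕ} {a δ : ℝ} {z : Eu (m+1)} (hz : 2*δ ≤ ‖z‖) : k1 m a δ z = 0 := by
  rw [k1, kI, setLIntegral_congr_fun (g := fun _ => 0) measurableSet_Ioc]
  · simp
  · intro ρ hρ
    simp only []
    rw [kb_zero, mul_zero]
    linarith [hρ.2]

theorem k1_swap {m : ℕ} (a δ : ℝ) (x y : Eu (m+1)) : k1 m a δ (x - y) = k1 m a δ (y - x) := by
  simp only [k1, kI, kb_swap _ x y]
theorem k2_swap {m : ℕ} (a δ : ℝ) (x y : Eu (m+1)) : k2 m a δ (x - y) = k2 m a δ (y - x) := by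
  simp only [k2, kI, kb_swap _ x y]
theorem k1_av {m : ℕ} (a δ : ℝ) (g : GG m) (x : Eu (m+1)) : k1 m a δ (av g x) = k1 m a δ x := by
  simp only [k1, kI, kb_av]
theorem k2_av {m : ℕ} (a δ : ℝ) (g : GG m) (x : Eu (m+1)) : k2 m a δ (av g x) = k2 m a δ x := by
  simp only [k2, kI, kb_av]

theorem k1_int {m : ℕ} {a δ : ℝ} (ha : 0 < a) (hδ : 0 < δ) :
    ∫⁻ z, k1 m a δ z = (cc m a)⁻¹ * volume (ball (0:Eu (m+1)) 1) ^ 2 * ENNReal.ofReal (δ^a/a) := by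
  have hinv : (cc m a)⁻¹ ≠ ∞ := ENNReal.inv_ne_top.2 cc_ne_zero
  simp only [k1]
  rw [lintegral_const_mul' _ _ hinv, mul_assoc]
  congr 1
  simp only [kI]
  rw [lintegral_lintegral_swap]
  · have h : ∀ ρ ∈ Set.Ioc 0 δ, ∫⁻ z : Eu (m+1), ENNReal.ofReal (ρ ^ (a - 2*((m:ℝ)+1) - 1)) * kb ρ z
        = volume (ball (0:Eu (m+1)) 1) ^ 2 * ENNReal.ofReal (ρ^(a-1)) := by
      intro ρ hρ
      have hρ' := hρ.1
      rw [lintegral_const_mul' _ _ ofReal_ne_top, kb_int, vol_ball hρ.1.le, mul_pow, mul_comm, mul_assoc, mul_comm, mul_assoc,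
        ← ENNReal.ofReal_pow (by positivity), ← ENNReal.ofReal_mul (by positivity)]
      congr 2
      rw [← pow_mul, ← Real.rpow_natCast, ← Real.rpow_add hρ']
      congr 1; push_cast; ring
    rw [setLIntegral_congr_fun measurableSet_Ioc h, lintegral_const_mul' _ _ (ENNReal.pow_ne_top (vol1_top m)),
      lint_rpow_Ioc hδ.le (by linarith)]
    simp
  · refine Measurable.aemeasurable ?_
    exact (by fun_prop : Measurable _).mul (kb_meas_comp measurable_snd measurable_fst)


/-! ## Section D2: the long range part -/

theorem two_mul_le_sq (a b : ℝ≥0∞) : 2 * (a * b) ≤ a * a + b * b := by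
  rcases eq_or_ne a ∞ with rfl | ha
  · simp
  rcases eq_or_ne b ∞ with rfl | hb
  · simp
  lift a to NNReal using ha
  lift b to NNReal using hb
  norm_cast
  have := two_mul_le_add_sq (a:ℝ) b
  have h2 : ((2 * (a * b) : NNReal) : ℝ) ≤ ((a*a+b*b : NNReal) : ℝ) := by push_cast; nlinarith
  exact_mod_cast h2

/-- interaction energy -/
def EK {m : ℕ} (k : Eu (m+1) → ℝ≥0∞) (F G : Set (Eu (m+1))) : ℝ≥0∞ := ∫⁻ x in F, ∫⁻ y in G, k (x - y)

/-- indicator of `dist w x < ρ` -/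
def ii {m : ℕ} (ρ : ℝ) (w x : Eu (m+1)) : ℝ≥0∞ := (ball (0:Eu (m+1)) ρ).indicator 1 (w - x)

theorem ii_eq {m : ℕ} (ρ : ℝ) (w x : Eu (m+1)) : ii ρ w x = (ball x ρ).indicator 1 w := by
  unfold ii
  by_cases h : w ∈ ball x ρ
  · rw [Set.indicator_of_mem h, Set.indicator_of_mem]
    · rfl
    · simpa [dist_eq_norm] using h
  · rw [Set.indicator_of_notMem h, Set.indicator_of_notMem]
    simpa [dist_eq_norm] using h

theorem ii_meas {m : ℕ} : Measurable fun q : ℝ × Eu (m+1) × Eu (m+1) => ii q.1 q.2.1 q.2.2 := by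
  have hS : MeasurableSet {q : ℝ × Eu (m+1) × Eu (m+1) | dist (q.2.1 - q.2.2) 0 < q.1} :=
    measurableSet_lt (by fun_prop) (by fun_prop)
  have : (fun q : ℝ × Eu (m+1) × Eu (m+1) => ii q.1 q.2.1 q.2.2) =
      {q : ℝ × Eu (m+1) × Eu (m+1) | dist (q.2.1 - q.2.2) 0 < q.1}.indicator 1 := by
    funext q
    unfold ii
    by_cases h : dist (q.2.1 - q.2.2) 0 < q.1
    · rw [Set.indicator_of_mem (show q ∈ {q : ℝ × Eu (m+1) × Eu (m+1) | dist (q.2.1 - q.2.2) 0 < q.1} from h), Set.indicator_of_mem (by exact h)]; rfl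
    · rw [Set.indicator_of_notMem (show q ∉ {q : ℝ × Eu (m+1) × Eu (m+1) | dist (q.2.1 - q.2.2) 0 < q.1} from h), Set.indicator_of_notMem (by exact h)]
  rw [this]
  exact measurable_one.indicator hS

theorem ii_meas_comp {m : ℕ} {T : Type*} [MeasurableSpace T] {f : T → ℝ} {h k : T → Eu (m+1)}
    (hf : Measurable f) (hh : Measurable h) (hk : Measurable k) : Measurable fun q => ii (f q) (h q) (k q) :=
  by have := (ii_meas (m := m)).comp (hf.prodMk (hh.prodMk hk)); exact this

theorem kb_eq_ii {m : ℕ} (ρ : ℝ) (x y : Eu (m+1)) : kb ρ (x - y) = ∫⁻ w, ii ρ w x * ii ρ w y := by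
  rw [kb_sub]
  simp_rw [ii_eq]
  rw [← lintegral_indicator_one (measurableSet_ball.inter measurableSet_ball)]
  refine lintegral_congr fun w => ?_
  by_cases h1 : w ∈ ball x ρ
  · by_cases h2 : w ∈ ball y ρ
    · rw [Set.indicator_of_mem h1, Set.indicator_of_mem h2, Set.indicator_of_mem (show w ∈ ball x ρ ∩ ball y ρ from ⟨h1, h2⟩)]; simp
    · rw [Set.indicator_of_notMem h2, Set.indicator_of_notMem (fun h : w ∈ ball x ρ ∩ ball y ρ => h2 h.2), mul_zero]
  · rw [Set.indicator_of_notMem h1, Set.indicator_of_notMem (fun h : w ∈ ball x ρ ∩ ball y ρ => h1 h.1), zero_mul]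

def NN {m : ℕ} (F : Set (Eu (m+1))) (ρ : ℝ) (w : Eu (m+1)) : ℝ≥0∞ := ∫⁻ x in F, ii ρ w x

theorem NN_meas {m : ℕ} (F : Set (Eu (m+1))) : Measurable fun q : ℝ × Eu (m+1) => NN F q.1 q.2 := by
  unfold NN
  refine Measurable.lintegral_prod_right' (f := fun p : (ℝ × Eu (m+1)) × Eu (m+1) => ii p.1.1 p.1.2 p.2) ?_
  exact ii_meas_comp (by fun_prop) (by fun_prop) (by fun_prop)

theorem NN_meas1 {m : ℕ} (F : Set (Eu (m+1))) (ρ : ℝ) : Measurable fun w : Eu (m+1) => NN F ρ w := by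
  have := (NN_meas F).comp (measurable_const (a := ρ) |>.prodMk measurable_id)
  exact this

attribute [irreducible] ii

theorem NN_le {m : ℕ} (F : Set (Eu (m+1))) (ρ : ℝ) (w : Eu (m+1)) :
    NN F ρ w ≤ min (volume F) (volume (ball (0:Eu (m+1)) ρ)) := by
  have h : ∀ x, ii ρ w x = (ball w ρ).indicator 1 x := by
    intro x; rw [ii_eq]
    by_cases h : w ∈ ball x ρ
    · rw [Set.indicator_of_mem h, Set.indicator_of_mem (mem_ball_comm.1 h)]; rfl
    · rw [Set.indicator_of_notMem h, Set.indicator_of_notMem (fun h' => h (mem_ball_comm.1 h'))]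
  unfold NN
  refine le_min ?_ ?_
  · calc _ ≤ ∫⁻ x in F, 1 := by
          refine lintegral_mono fun x => ?_
          rw [h]; exact Set.indicator_le_self' (fun _ _ => zero_le) x
      _ = _ := by simp
  · refine (setLIntegral_le_lintegral _ _).trans ?_
    simp_rw [h]
    rw [lintegral_indicator_one measurableSet_ball, Measure.addHaar_ball_center]

theorem u_eq {m : ℕ} (G : Set (Eu (m+1))) (ρ : ℝ) (x : Eu (m+1)) :
    ∫⁻ y in G, kb ρ (x - y) = ∫⁻ w, ii ρ w x * NN G ρ w := by
  simp_rw [kb_eq_ii]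
  rw [lintegral_lintegral_swap]
  · refine lintegral_congr fun w => ?_
    rw [NN, lintegral_const_mul _ (ii_meas_comp (by fun_prop) (by fun_prop) (by fun_prop))]
  · refine Measurable.aemeasurable ?_
    exact (ii_meas_comp (by fun_prop) (by fun_prop) (by fun_prop)).mul (ii_meas_comp (by fun_prop) (by fun_prop) (by fun_prop))

theorem EK_kb {m : ℕ} (F G : Set (Eu (m+1))) (ρ : ℝ) :
    EK (kb ρ) F G = ∫⁻ w, NN F ρ w * NN G ρ w := by
  have hN : Measurable fun w => NN G ρ w := NN_meas1 G ρ
  unfold EK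
  simp_rw [u_eq]
  rw [lintegral_lintegral_swap]
  · refine lintegral_congr fun w => ?_
    rw [lintegral_mul_const _ (ii_meas_comp (by fun_prop) (by fun_prop) (by fun_prop))]
    rfl
  · refine Measurable.aemeasurable ?_
    exact (ii_meas_comp (by fun_prop) (by fun_prop) (by fun_prop)).mul (hN.comp measurable_snd)

theorem v_kI {m : ℕ} (a : ℝ) (s : Set ℝ) (G : Set (Eu (m+1))) (x : Eu (m+1)) :
    ∫⁻ y in G, kI a s (x - y) = ∫⁻ ρ in s, ENNReal.ofReal (ρ ^ (a - 2*((m:ℝ)+1) - 1)) * ∫⁻ y in G, kb ρ (x - y) := by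
  unfold kI
  rw [lintegral_lintegral_swap]
  · refine lintegral_congr fun w => ?_
    rw [lintegral_const_mul' _ _ ofReal_ne_top]
  · refine Measurable.aemeasurable ?_
    exact (by fun_prop : Measurable _).mul (kb_meas_comp (by fun_prop) (by fun_prop))

theorem EK_kI {m : ℕ} (a : ℝ) (s : Set ℝ) (F G : Set (Eu (m+1))) :
    EK (kI a s) F G = ∫⁻ ρ in s, ENNReal.ofReal (ρ ^ (a - 2*((m:ℝ)+1) - 1)) * EK (kb ρ) F G := by
  unfold EK
  simp_rw [v_kI]
  rw [lintegral_lintegral_swap]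
  · refine lintegral_congr fun w => ?_
    rw [lintegral_const_mul' _ _ ofReal_ne_top]
  · refine Measurable.aemeasurable ?_
    refine (by fun_prop : Measurable _).mul ?_
    refine Measurable.lintegral_prod_right' (f := fun p : (Eu (m+1) × ℝ) × Eu (m+1) => kb p.1.2 (p.1.1 - p.2)) ?_
    exact kb_meas_comp (by fun_prop) (by fun_prop)

theorem EK_const_mul {m : ℕ} {c : ℝ≥0∞} (hc : c ≠ ∞) (k : Eu (m+1) → ℝ≥0∞) (F G : Set (Eu (m+1))) :
    EK (fun z => c * k z) F G = c * EK k F G := by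
  unfold EK
  simp_rw [lintegral_const_mul' _ _ hc]

theorem EK_kI_pos {m : ℕ} (a : ℝ) (s : Set ℝ) (F G : Set (Eu (m+1))) :
    2 * EK (kI a s) F G ≤ EK (kI a s) F F + EK (kI a s) G G := by
  rw [EK_kI, EK_kI, EK_kI]
  have hm : ∀ F : Set (Eu (m+1)), Measurable fun ρ : ℝ => EK (kb ρ) F F := by
    intro F
    simp_rw [EK_kb]
    exact ((NN_meas F).mul (NN_meas F)).lintegral_prod_right'
  have hm1 : ∀ F : Set (Eu (m+1)), Measurable fun ρ : ℝ => ENNReal.ofReal (ρ ^ (a - 2*((m:ℝ)+1) - 1)) * EK (kb ρ) F F :=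
    fun F => (by fun_prop : Measurable _).mul (hm F)
  rw [← lintegral_add_left (hm1 F), ← lintegral_const_mul' _ _ (by simp)]
  refine lintegral_mono fun ρ => ?_
  rw [← mul_add, mul_left_comm]
  refine mul_le_mul_right ?_ _
  have hN : ∀ F : Set (Eu (m+1)), Measurable fun w => NN F ρ w :=
    fun F => NN_meas1 F ρ
  have hNN : Measurable fun w => NN F ρ w * NN F ρ w := (hN F).mul (hN F)
  rw [EK_kb, EK_kb, EK_kb, ← lintegral_add_left hNN, ← lintegral_const_mul' _ _ (by simp)]
  exact lintegral_mono fun w => two_mul_le_sq _ _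

theorem EK_k2_pos {m : ℕ} (a δ : ℝ) (F G : Set (Eu (m+1))) :
    2 * EK (k2 m a δ) F G ≤ EK (k2 m a δ) F F + EK (k2 m a δ) G G := by
  have hinv : (cc m a)⁻¹ ≠ ∞ := ENNReal.inv_ne_top.2 cc_ne_zero
  have h : ∀ F G, EK (k2 m a δ) F G = (cc m a)⁻¹ * EK (kI a (Set.Ioi δ)) F G := fun F G => EK_const_mul hinv _ _ _
  rw [h, h, h, ← mul_add, mul_left_comm]
  exact mul_le_mul_right (EK_kI_pos _ _ _ _) _

theorem pow_sub_le {n : ℕ} {s t : ℝ} (hs : 0 ≤ s) (hst : s ≤ t) : t^(n+1) - s^(n+1) ≤ (n+1) * t^n * (t - s) := by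
  induction n with
  | zero => simp
  | succ k ih =>
    have h1 : s^(k+1) ≤ t^(k+1) := pow_le_pow_left₀ hs hst _
    have ht : 0 ≤ t := hs.trans hst
    have : t^(k+1+1) - s^(k+1+1) = t * (t^(k+1) - s^(k+1)) + s^(k+1) * (t - s) := by ring
    rw [this]
    have h2 := mul_le_mul_of_nonneg_left ih ht
    have h3 := mul_le_mul_of_nonneg_right h1 (sub_nonneg.2 hst)
    push_cast
    calc _ ≤ t * (((k:ℝ) + 1) * t ^ k * (t - s)) + t^(k+1) * (t-s) := add_le_add h2 h3
      _ = _ := by ring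

theorem vol_diff {m : ℕ} {ρ : ℝ} (hρ : 0 < ρ) (x x' : Eu (m+1)) :
    volume (ball x ρ \ ball x' ρ) ≤ volume (ball (0:Eu (m+1)) 1) * ENNReal.ofReal (((m:ℝ)+1) * ρ^m * dist x x') := by
  set ω := volume (ball (0:Eu (m+1)) 1)
  rcases le_or_gt ρ (dist x x') with h | h
  · refine (measure_mono Set.sdiff_subset).trans ?_
    rw [vol_ball hρ.le, mul_comm]
    refine mul_le_mul_right (ENNReal.ofReal_le_ofReal ?_) _
    have : ρ^(m+1) = ρ^m * ρ := pow_succ _ _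
    rw [this]
    have h1 : ρ^m * ρ ≤ ρ^m * dist x x' := by gcongr
    have h2 : 0 ≤ (m:ℝ) * (ρ^m * dist x x') := by positivity
    linarith
  · have hsub : ball x ρ \ ball x' ρ ⊆ ball x ρ \ ball x (ρ - dist x x') := by
      refine Set.sdiff_subset_sdiff_right ?_
      intro w hw
      rw [mem_ball] at hw ⊢
      linarith [dist_triangle w x x']
    refine (measure_mono hsub).trans ?_
    rw [measure_sdiff (ball_subset_ball (by linarith [dist_nonneg (x := x) (y := x')])) measurableSet_ball.nullMeasurableSet measure_ball_lt_top.ne]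
    rw [vol_ball hρ.le, vol_ball (by linarith : 0 ≤ ρ - dist x x'), ← ENNReal.sub_mul (fun _ _ => vol1_top m), mul_comm,
      ← ENNReal.ofReal_sub _ (by have := h.le; have : 0 ≤ ρ - dist x x' := by linarith
                                 positivity)]
    refine mul_le_mul_right (ENNReal.ofReal_le_ofReal ?_) _
    have := pow_sub_le (n := m) (s := ρ - dist x x') (t := ρ) (by linarith) (by linarith [dist_nonneg (x := x) (y := x')])
    simpa using this

theorem min_pow {m : ℕ} {R ρ e : ℝ} (hR : 0 < R) (hρ : 0 < ρ) (he : 0 ≤ e) (he' : e ≤ m+1) :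
    min (R^(m+1)) (ρ^(m+1)) ≤ ρ^((m:ℝ)+1-e) * R^e := by
  have key : ∀ t : ℝ, 0 < t → t^(m+1) = t^((m:ℝ)+1-e) * t^e := by
    intro t ht
    rw [← Real.rpow_natCast, ← Real.rpow_add ht]; congr 1; push_cast; ring
  rcases le_total R ρ with h | h
  · refine (min_le_left _ _).trans ?_
    rw [key R hR]
    have : R^((m:ℝ)+1-e) ≤ ρ^((m:ℝ)+1-e) := Real.rpow_le_rpow hR.le h (by linarith)
    gcongr
  · refine (min_le_right _ _).trans ?_
    rw [key ρ hρ]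
    have : ρ^e ≤ R^e := Real.rpow_le_rpow hρ.le h he
    gcongr

theorem u_lip {m : ℕ} {R ρ e : ℝ} (hR : 0 < R) (hρ : 0 < ρ) (he : 0 ≤ e) (he' : e ≤ m+1) (x x' : Eu (m+1)) :
    ∫⁻ y in ball (0:Eu (m+1)) R, kb ρ (x - y) ≤ (∫⁻ y in ball (0:Eu (m+1)) R, kb ρ (x' - y)) +
      volume (ball (0:Eu (m+1)) 1)^2 * ENNReal.ofReal (((m:ℝ)+1) * ρ^m * (ρ^((m:ℝ)+1-e) * R^e) * dist x x') := by
  set ω := volume (ball (0:Eu (m+1)) 1)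
  set G := ball (0:Eu (m+1)) R
  rw [u_eq, u_eq]
  have hN : ∀ w, NN G ρ w ≤ ω * ENNReal.ofReal (ρ^((m:ℝ)+1-e) * R^e) := by
    intro w
    refine (NN_le G ρ w).trans ?_
    rw [vol_ball hR.le, vol_ball hρ.le]
    have hmp := min_pow hR hρ he he'
    rcases min_le_iff.1 hmp with h | h
    · refine (min_le_left _ _).trans ?_
      rw [mul_comm]
      exact mul_le_mul_right (ENNReal.ofReal_le_ofReal h) _
    · refine (min_le_right _ _).trans ?_
      rw [mul_comm]
      exact mul_le_mul_right (ENNReal.ofReal_le_ofReal h) _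
  have hNm : Measurable fun w => NN G ρ w := NN_meas1 G ρ
  calc ∫⁻ w, ii ρ w x * NN G ρ w ≤ ∫⁻ w, (ii ρ w x' * NN G ρ w + (ball x ρ \ ball x' ρ).indicator (fun _ => ω * ENNReal.ofReal (ρ^((m:ℝ)+1-e) * R^e)) w) := by
        refine lintegral_mono fun w => ?_
        rw [ii_eq, ii_eq]
        by_cases h1 : w ∈ ball x ρ
        · by_cases h2 : w ∈ ball x' ρ
          · rw [Set.indicator_of_mem h1, Set.indicator_of_mem h2]; exact le_self_add
          · rw [Set.indicator_of_mem h1, Set.indicator_of_notMem h2, Set.indicator_of_mem (show w ∈ ball x ρ \ ball x' ρ from ⟨h1, h2⟩)]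
            simpa using hN w
        · rw [Set.indicator_of_notMem h1, zero_mul]; exact zero_le
    _ = (∫⁻ w, ii ρ w x' * NN G ρ w) + (ω * ENNReal.ofReal (ρ^((m:ℝ)+1-e) * R^e)) * volume (ball x ρ \ ball x' ρ) := by
        have h0 : Measurable fun w => ii ρ w x' * NN G ρ w :=
          (ii_meas_comp (by fun_prop) (by fun_prop) (by fun_prop)).mul hNm
        rw [lintegral_add_left h0]
        rw [lintegral_indicator (measurableSet_ball.diff measurableSet_ball), setLIntegral_const]
    _ ≤ _ := by
        refine add_le_add le_rfl ?_
        refine (mul_le_mul_right (vol_diff hρ x x') _).trans (le_of_eq ?_)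
        have h3 : 0 ≤ ρ^((m:ℝ)+1-e) * R^e := by positivity
        rw [mul_mul_mul_comm, ← sq, ← ENNReal.ofReal_mul h3]
        congr 2; ring

def CK2 (m : ℕ) (a δ e : ℝ) : ℝ≥0∞ := (cc m a)⁻¹ * (volume (ball (0:Eu (m+1)) 1)^2 * ENNReal.ofReal (((m:ℝ)+1) * (-δ^(a-1-e)/(a-1-e))))

theorem CK2_ne_top (m : ℕ) (a δ e : ℝ) : CK2 m a δ e ≠ ∞ :=
  ENNReal.mul_ne_top (ENNReal.inv_ne_top.2 cc_ne_zero) (ENNReal.mul_ne_top (ENNReal.pow_ne_top (vol1_top m)) ofReal_ne_top)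

theorem v2_lip {m : ℕ} {a δ R e : ℝ} (hδ : 0 < δ) (hR : 0 < R) (he : 0 ≤ e) (he' : e ≤ m+1) (hae : a - 1 < e) (x x' : Eu (m+1)) :
    ∫⁻ y in ball (0:Eu (m+1)) R, k2 m a δ (x - y) ≤ (∫⁻ y in ball (0:Eu (m+1)) R, k2 m a δ (x' - y)) +
      CK2 m a δ e * ENNReal.ofReal (R^e * dist x x') := by
  have hinv : (cc m a)⁻¹ ≠ ∞ := ENNReal.inv_ne_top.2 cc_ne_zero
  set ω := volume (ball (0:Eu (m+1)) 1)
  unfold k2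
  rw [lintegral_const_mul' _ _ hinv, lintegral_const_mul' _ _ hinv, CK2, mul_assoc, ← mul_add]
  refine mul_le_mul_right ?_ _
  rw [v_kI, v_kI]
  have hm : Measurable fun ρ : ℝ => ENNReal.ofReal (ρ ^ (a - 2*((m:ℝ)+1) - 1)) * ∫⁻ y in ball (0:Eu (m+1)) R, kb ρ (x' - y) := by
    refine (by fun_prop : Measurable _).mul ?_
    refine Measurable.lintegral_prod_right' (f := fun p : ℝ × Eu (m+1) => kb p.1 (x' - p.2)) ?_
    exact kb_meas_comp (by fun_prop) (by fun_prop)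
  have h1 : ω^2 * ENNReal.ofReal (((m:ℝ)+1) * (-δ^(a-1-e)/(a-1-e))) * ENNReal.ofReal (R^e * dist x x')
      = ∫⁻ ρ in Set.Ioi δ, ω^2 * ENNReal.ofReal (((m:ℝ)+1) * (R^e * dist x x')) * ENNReal.ofReal (ρ^(a-2-e)) := by
    have hp : 0 ≤ R^e * dist x x' := by positivity
    rw [lintegral_const_mul' _ _ (ENNReal.mul_ne_top (ENNReal.pow_ne_top (vol1_top m)) ofReal_ne_top),
      lint_rpow_Ioi hδ (by linarith), mul_assoc, mul_assoc, ← ENNReal.ofReal_mul' hp, ← ENNReal.ofReal_mul (by positivity)]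
    congr 2
    rw [show a - 2 - e + 1 = a - 1 - e by ring]; ring
  rw [h1, ← lintegral_add_left hm]
  refine setLIntegral_mono' measurableSet_Ioi fun ρ hρ => ?_
  have hρ' : 0 < ρ := hδ.trans hρ
  refine (mul_le_mul_right (u_lip hR hρ' he he' x x') _).trans ?_
  rw [mul_add]
  refine add_le_add le_rfl (le_of_eq ?_)
  rw [mul_left_comm, mul_assoc (ω^2), ← ENNReal.ofReal_mul (by positivity), ← ENNReal.ofReal_mul (by positivity)]
  congr 2
  have : ρ^(a-2-e) = ρ ^ (a - 2*((m:ℝ)+1) - 1) * ρ^m * ρ^((m:ℝ)+1-e) := by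
    rw [← Real.rpow_natCast ρ m, ← Real.rpow_add hρ', ← Real.rpow_add hρ']; congr 1; ring
  rw [this]; ring

theorem v2_rad {m : ℕ} (a δ R : ℝ) (g : GG m) (x : Eu (m+1)) :
    ∫⁻ y in ball (0:Eu (m+1)) R, k2 m a δ (av g x - y) = ∫⁻ y in ball (0:Eu (m+1)) R, k2 m a δ (x - y) := by
  have h := (av_mp g).setLIntegral_comp_emb (av_emb g) (fun y => k2 m a δ (av g x - y)) (ball (0:Eu (m+1)) R)
  have hi : av g '' ball (0:Eu (m+1)) R = ball 0 R := by
    have h2 : av g ⁻¹' ball (0:Eu (m+1)) R = ball 0 R := by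
      ext w; simp [av_norm]
    conv_lhs => rw [← h2]
    exact Set.image_preimage_eq _ (av_surj g)
  rw [hi] at h
  simp_rw [← map_sub, k2_av] at h
  exact h.symm

theorem v2_sphere {m : ℕ} (a δ R : ℝ) {x : Eu (m+1)} (hx : x ≠ 0) :
    ∫⁻ y in ball (0:Eu (m+1)) R, k2 m a δ (x - y) = ∫⁻ y in ball (0:Eu (m+1)) R, k2 m a δ (‖x‖ • e1 m - y) := by
  obtain ⟨g, hg⟩ := exists_av hx
  conv_lhs => rw [hg, ← map_smul]
  exact v2_rad a δ R g _

theorem v2_lip_rad {m : ℕ} {a δ R e : ℝ} (hδ : 0 < δ) (hR : 0 < R) (he : 0 ≤ e) (he' : e ≤ m+1) (hae : a - 1 < e) (x : Eu (m+1)) :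
    (∫⁻ y in ball (0:Eu (m+1)) R, k2 m a δ (x - y) ≤ (∫⁻ y in ball (0:Eu (m+1)) R, k2 m a δ (R • e1 m - y)) +
      CK2 m a δ e * ENNReal.ofReal (R^e * |‖x‖ - R|)) ∧
    (∫⁻ y in ball (0:Eu (m+1)) R, k2 m a δ (R • e1 m - y) ≤ (∫⁻ y in ball (0:Eu (m+1)) R, k2 m a δ (x - y)) +
      CK2 m a δ e * ENNReal.ofReal (R^e * |‖x‖ - R|)) := by
  have hd : dist (‖x‖ • e1 m) (R • e1 m) = |‖x‖ - R| := by
    rw [dist_eq_norm, ← sub_smul, norm_smul, e1_norm, mul_one, Real.norm_eq_abs]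
  have hx : ∫⁻ y in ball (0:Eu (m+1)) R, k2 m a δ (x - y) = ∫⁻ y in ball (0:Eu (m+1)) R, k2 m a δ (‖x‖ • e1 m - y) := by
    rcases eq_or_ne x 0 with rfl | h
    · simp
    · exact v2_sphere a δ R h
  rw [hx, ← hd]
  refine ⟨v2_lip hδ hR he he' hae _ _, ?_⟩
  rw [dist_comm]
  exact v2_lip hδ hR he he' hae _ _

theorem k2_bdd {m : ℕ} {a δ : ℝ} (ha : a < m+1) (hδ : 0 < δ) : ∃ C : ℝ≥0∞, C ≠ ∞ ∧ ∀ z, k2 m a δ z ≤ C := by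
  refine ⟨(cc m a)⁻¹ * ∫⁻ ρ in Set.Ioi δ, volume (ball (0:Eu (m+1)) 1) * ENNReal.ofReal (ρ ^ (a - ((m:ℝ)+1) - 1)), ?_, fun z => ?_⟩
  · refine ENNReal.mul_ne_top (ENNReal.inv_ne_top.2 cc_ne_zero) ?_
    rw [lintegral_const_mul' _ _ (vol1_top m), lint_rpow_Ioi hδ (by linarith)]
    exact ENNReal.mul_ne_top (vol1_top m) ofReal_ne_top
  · refine mul_le_mul_right ?_ _
    exact setLIntegral_mono' measurableSet_Ioi fun ρ hρ => wkb_le a (hδ.trans hρ) z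

/-- the basic deficit `∫ |χF - χB| | |x| - R |` -/
def SS {m : ℕ} (R : ℝ) (F : Set (Eu (m+1))) : ℝ≥0∞ :=
  (∫⁻ x in F \ ball 0 R, ENNReal.ofReal |‖x‖ - R|) + ∫⁻ x in ball 0 R \ F, ENNReal.ofReal |‖x‖ - R|

/-- comparison of integrals of a function with a deviation bound. -/
theorem compare_int {m : ℕ} {R : ℝ} {F : Set (Eu (m+1))} (hF : MeasurableSet F) (hv : volume F = volume (ball (0:Eu (m+1)) R))
    {v : Eu (m+1) → ℝ≥0∞} (hvm : Measurable v) {c C : ℝ≥0∞} (hC : C ≠ ∞)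
    (h1 : ∀ x, v x ≤ c + C * ENNReal.ofReal |‖x‖ - R|) (h2 : ∀ x, c ≤ v x + C * ENNReal.ofReal |‖x‖ - R|) :
    ∫⁻ x in ball (0:Eu (m+1)) R, v x ≤ (∫⁻ x in F, v x) + C * SS R F := by
  set B := ball (0:Eu (m+1)) R
  have hB : MeasurableSet B := measurableSet_ball
  have hBf : volume B ≠ ∞ := measure_ball_lt_top.ne
  have e1 : ∫⁻ x in B, v x = (∫⁻ x in B ∩ F, v x) + ∫⁻ x in B \ F, v x := (lintegral_inter_add_sdiff v B hF).symm
  have e2 : ∫⁻ x in F, v x = (∫⁻ x in F ∩ B, v x) + ∫⁻ x in F \ B, v x := (lintegral_inter_add_sdiff v F hB).symm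
  have hvd : volume (B \ F) = volume (F \ B) := by
    have h3 := measure_inter_add_sdiff (μ := volume) B hF
    have h4 := measure_inter_add_sdiff (μ := volume) F hB
    rw [Set.inter_comm, hv, ← h3] at h4
    refine ((ENNReal.add_right_inj ?_).1 h4).symm
    exact ne_top_of_le_ne_top hBf (measure_mono Set.inter_subset_left)
  have h5 : ∫⁻ x in B \ F, v x ≤ c * volume (B \ F) + C * ∫⁻ x in B \ F, ENNReal.ofReal |‖x‖ - R| := by
    refine (lintegral_mono h1).trans (le_of_eq ?_)
    rw [lintegral_add_left measurable_const, lintegral_const_mul' _ _ hC, setLIntegral_const]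
  have h6 : c * volume (F \ B) ≤ (∫⁻ x in F \ B, v x) + C * ∫⁻ x in F \ B, ENNReal.ofReal |‖x‖ - R| := by
    rw [← setLIntegral_const, ← lintegral_const_mul' _ _ hC, ← lintegral_add_left hvm]
    exact lintegral_mono h2
  rw [e1, e2, Set.inter_comm, SS, mul_add]
  refine (add_le_add le_rfl h5).trans ?_
  rw [hvd]
  refine (add_le_add le_rfl (add_le_add h6 le_rfl)).trans (le_of_eq ?_)
  ring

theorem K2 {m : ℕ} {a δ R e : ℝ} (ha : a < m+1) (hδ : 0 < δ) (hR : 0 < R) (he : 0 ≤ e) (he' : e ≤ m+1) (hae : a - 1 < e)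
    {F : Set (Eu (m+1))} (hF : MeasurableSet F) (hv : volume F = volume (ball (0:Eu (m+1)) R)) :
    EK (k2 m a δ) (ball 0 R) (ball 0 R) ≤ EK (k2 m a δ) F F + 2 * (CK2 m a δ e * ENNReal.ofReal (R^e) * SS R F) := by
  set B := ball (0:Eu (m+1)) R
  obtain ⟨C, hC, hk⟩ := k2_bdd ha hδ
  have hBf : volume B ≠ ∞ := measure_ball_lt_top.ne
  have hfin : EK (k2 m a δ) B B ≠ ∞ := by
    have : EK (k2 m a δ) B B ≤ ∫⁻ x in B, ∫⁻ y in B, C := lintegral_mono fun x => lintegral_mono fun y => hk _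
    refine ne_top_of_le_ne_top ?_ this
    rw [setLIntegral_const, setLIntegral_const]
    exact ENNReal.mul_ne_top (ENNReal.mul_ne_top hC hBf) hBf
  have hvm : Measurable fun x => ∫⁻ y in B, k2 m a δ (x - y) := by
    refine Measurable.lintegral_prod_right' (f := fun p : Eu (m+1) × Eu (m+1) => k2 m a δ (p.1 - p.2)) ?_
    exact (k2_meas m a δ).comp (by fun_prop)
  have hRe : 0 ≤ R^e := by positivity
  have h1 := compare_int hF hv hvm (C := CK2 m a δ e * ENNReal.ofReal (R^e)) (c := ∫⁻ y in B, k2 m a δ (R • e1 m - y))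
    (ENNReal.mul_ne_top (CK2_ne_top _ _ _ _) ofReal_ne_top)
    (fun x => by
      have := (v2_lip_rad hδ hR he he' hae x).1
      rwa [ENNReal.ofReal_mul hRe, ← mul_assoc] at this)
    (fun x => by
      have := (v2_lip_rad hδ hR he he' hae x).2
      rwa [ENNReal.ofReal_mul hRe, ← mul_assoc] at this)
  have h2 := EK_k2_pos a δ F B
  have h3 : 2 * EK (k2 m a δ) B B ≤ 2 * EK (k2 m a δ) F B + 2 * (CK2 m a δ e * ENNReal.ofReal (R^e) * SS R F) := by
    rw [← mul_add]; exact mul_le_mul_right h1 _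
  have h4 := h3.trans (add_le_add h2 le_rfl)
  rw [two_mul, add_right_comm] at h4
  exact (ENNReal.add_le_add_iff_right hfin).1 h4


/-! ## Section C1: averaging along spirals -/

def aa {m : ℕ} (f : Eu (m+1) → ℝ) (t : ℝ) (g : GG m) : ℝ := |fderiv ℝ f (t • av g (e1 m)) (av g (e1 m))|
def bb {m : ℕ} (f : Eu (m+1) → ℝ) (t : ℝ) (g : GG m) : ℝ := |fderiv ℝ f (t • av g (e1 m)) (av g (e2 m))|

theorem dfapp_meas {m : ℕ} {f : Eu (m+1) → ℝ} (hf : ContDiff ℝ 1 f) {T : Type*} [MeasurableSpace T] {x v : T → Eu (m+1)}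
    (hx : Measurable x) (hv : Measurable v) : Measurable fun q => fderiv ℝ f (x q) (v q) := by
  have hc : Continuous fun p : Eu (m+1) × Eu (m+1) => fderiv ℝ f p.1 p.2 :=
    ((hf.continuous_fderiv one_ne_zero).comp continuous_fst).clm_apply continuous_snd
  have := hc.measurable.comp (hx.prodMk hv)
  exact this

theorem avp_meas {m : ℕ} (v : Eu (m+1)) : Measurable fun q : ℝ × GG m => av q.2 v :=
  av_meas_comp measurable_snd measurable_const

theorem aa_meas {m : ℕ} {f : Eu (m+1) → ℝ} (hf : ContDiff ℝ 1 f) : Measurable fun q : ℝ × GG m => aa f q.1 q.2 := by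
  have := (dfapp_meas hf (measurable_fst.smul (avp_meas (e1 m))) (avp_meas (e1 m)))
  have h2 := continuous_abs.measurable.comp this
  exact h2

theorem bb_meas {m : ℕ} {f : Eu (m+1) → ℝ} (hf : ContDiff ℝ 1 f) : Measurable fun q : ℝ × GG m => bb f q.1 q.2 := by
  have := (dfapp_meas hf (measurable_fst.smul (avp_meas (e1 m))) (avp_meas (e2 m)))
  have h2 := continuous_abs.measurable.comp this
  exact h2

theorem aa_nonneg {m : ℕ} (f : Eu (m+1) → ℝ) (t : ℝ) (g : GG m) : 0 ≤ aa f t g := abs_nonneg _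
theorem bb_nonneg {m : ℕ} (f : Eu (m+1) → ℝ) (t : ℝ) (g : GG m) : 0 ≤ bb f t g := abs_nonneg _

def AA {m : ℕ} (f : Eu (m+1) → ℝ) (t : ℝ) : ℝ≥0∞ := ∫⁻ g, ENNReal.ofReal (aa f t g) ∂(hG m)

theorem AA_meas {m : ℕ} {f : Eu (m+1) → ℝ} (hf : ContDiff ℝ 1 f) : Measurable (AA f) := by
  have : Measurable fun q : ℝ × GG m => ENNReal.ofReal (aa f q.1 q.2) := (aa_meas hf).ennreal_ofReal
  exact this.lintegral_prod_right'

theorem av_inner {m : ℕ} (g : GG m) (x y : Eu (m+1)) : inner ℝ (av g x) (av g y) = inner ℝ x y := by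
  have h1 := norm_add_sq_real (av g x) (av g y)
  have h2 := norm_add_sq_real x y
  rw [← map_add, av_norm, av_norm, av_norm] at h1
  linarith

theorem exists_frame {m : ℕ} (hm : 1 ≤ m) {σ τ : Eu (m+1)} (hσ : ‖σ‖ = 1) (hτ : ‖τ‖ = 1) :
    ∃ (u : Eu (m+1)) (θ : ℝ), ‖u‖ = 1 ∧ inner ℝ σ u = 0 ∧ τ = Real.cos θ • σ + Real.sin θ • u ∧ 0 ≤ θ ∧
      θ ≤ Real.pi / 2 * ‖σ - τ‖ := by
  set θ := InnerProductGeometry.angle σ τ with hθ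
  have hc : Real.cos θ = inner ℝ σ τ := by
    have := InnerProductGeometry.cos_angle_mul_norm_mul_norm σ τ
    rw [hσ, hτ] at this; simpa using this
  have h0 : 0 ≤ θ := InnerProductGeometry.angle_nonneg _ _
  have hpi : θ ≤ Real.pi := InnerProductGeometry.angle_le_pi _ _
  have hsn : 0 ≤ Real.sin θ := Real.sin_nonneg_of_nonneg_of_le_pi h0 hpi
  have hbound : θ ≤ Real.pi / 2 * ‖σ - τ‖ := by
    have h1 : ‖σ - τ‖^2 = 2 - 2 * Real.cos θ := by
      rw [norm_sub_sq_real, hσ, hτ, hc]; ring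
    have h2 : Real.cos θ = 1 - 2 * Real.sin (θ/2)^2 := by
      have := Real.cos_two_mul' (θ/2)
      rw [show 2 * (θ/2) = θ by ring] at this
      have h3 := Real.sin_sq_add_cos_sq (θ/2)
      linarith
    have h4 : 2 / Real.pi * (θ/2) ≤ Real.sin (θ/2) := Real.mul_le_sin (by linarith) (by linarith)
    have hpos := Real.pi_pos
    have h5 : ‖σ - τ‖ = 2 * Real.sin (θ/2) := by
      have h6 : 0 ≤ Real.sin (θ/2) := le_trans (by positivity) h4
      have : ‖σ - τ‖^2 = (2 * Real.sin (θ/2))^2 := by rw [h1, h2]; ring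
      exact (pow_left_inj₀ (norm_nonneg _) (by positivity) two_ne_zero).1 this
    rw [h5]
    have h7 : Real.pi * (2 / Real.pi * (θ/2)) ≤ Real.pi * Real.sin (θ/2) := by gcongr
    have h8 : Real.pi * (2 / Real.pi * (θ/2)) = θ := by field_simp
    linarith
  set v := τ - Real.cos θ • σ with hv
  have hvs : inner ℝ σ v = 0 := by
    rw [hv, inner_sub_right, inner_smul_right, real_inner_self_eq_norm_sq, hσ, hc]; ring
  have hvn : ‖v‖ = Real.sin θ := by
    have h1 : ‖v‖^2 = Real.sin θ^2 := by
      rw [hv, norm_sub_sq_real, norm_smul, inner_smul_right, hσ, hτ, real_inner_comm, ← hc, Real.norm_eq_abs, mul_one, sq_abs, Real.sin_sq]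
      ring
    exact (pow_left_inj₀ (norm_nonneg _) hsn two_ne_zero).1 h1
  by_cases hv0 : v = 0
  · obtain ⟨h, hh⟩ := av_one (m := m) hσ
    refine ⟨av h (e2 m), θ, by rw [av_norm, e2_norm], by rw [← hh, av_inner, e12 hm], ?_, h0, hbound⟩
    rw [← hvn, hv0, norm_zero, zero_smul, add_zero]
    exact sub_eq_zero.1 hv0
  · have hv1 : ‖v‖ ≠ 0 := norm_ne_zero_iff.2 hv0
    refine ⟨‖v‖⁻¹ • v, θ, ?_, ?_, ?_, h0, hbound⟩
    · rw [norm_smul, norm_inv, norm_norm, inv_mul_cancel₀ hv1]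
    · rw [inner_smul_right, hvs, mul_zero]
    · rw [← hvn, smul_smul, mul_inv_cancel₀ hv1, one_smul, hv]; abel

theorem enorm_sub_le_lint {m : ℕ} {f : Eu (m+1) → ℝ} (hf : ContDiff ℝ 1 f) {γ γ' : ℝ → Eu (m+1)}
    (hγ : ∀ s, HasDerivAt γ (γ' s) s) (hc : Continuous γ') :
    ‖f (γ 0) - f (γ 1)‖ₑ ≤ ∫⁻ s in Set.Ioo (0:ℝ) 1, ENNReal.ofReal |fderiv ℝ f (γ s) (γ' s)| := by
  have hd : ∀ s, HasDerivAt (f ∘ γ) (fderiv ℝ f (γ s) (γ' s)) s := fun s =>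
    ((hf.differentiable one_ne_zero) (γ s)).hasFDerivAt.comp_hasDerivAt s (hγ s)
  have hγc : Continuous γ := continuous_iff_continuousAt.2 fun s => (hγ s).continuousAt
  have hcont : Continuous fun s => fderiv ℝ f (γ s) (γ' s) :=
    ((hf.continuous_fderiv one_ne_zero).comp hγc).clm_apply hc
  have h := intervalIntegral.integral_eq_sub_of_hasDerivAt (a := 0) (b := 1) (fun s _ => hd s) (hcont.intervalIntegrable _ _)
  have h2 : f (γ 1) - f (γ 0) = ∫ s in Set.Ioo (0:ℝ) 1, fderiv ℝ f (γ s) (γ' s) := by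
    rw [← integral_Ioc_eq_integral_Ioo, ← intervalIntegral.integral_of_le zero_le_one, h]; rfl
  rw [← enorm_neg, neg_sub, h2]
  refine (enorm_integral_le_lintegral_enorm _).trans (le_of_eq ?_)
  refine lintegral_congr fun s => ?_
  rw [← ofReal_norm, Real.norm_eq_abs]

theorem max_avg (u v : ℝ) : |u + v| + |u - v| = 2 * max |u| |v| := by
  rcases le_total |u| |v| with h | h
  · rw [max_eq_right h]
    rcases abs_cases u with hu | hu <;> rcases abs_cases v with hv | hv <;>
      rcases abs_cases (u+v) with h1 | h1 <;> rcases abs_cases (u-v) with h2 | h2 <;> linarith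
  · rw [max_eq_left h]
    rcases abs_cases u with hu | hu <;> rcases abs_cases v with hv | hv <;>
      rcases abs_cases (u+v) with h1 | h1 <;> rcases abs_cases (u-v) with h2 | h2 <;> linarith

theorem C1_core {m : ℕ} (hm : 1 ≤ m) {f : Eu (m+1) → ℝ} (hf : ContDiff ℝ 1 f) {N T : Eu (m+1)}
    (hN : ‖N‖ = 1) (hT : ‖T‖ = 1) (hNT : inner ℝ N T = 0) (t p q Q : ℝ) (hQ : |q| ≤ Q) :
    ∫⁻ g, ENNReal.ofReal |fderiv ℝ f (t • av g N) (p • av g N + q • av g T)| ∂(hG m) ≤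
      ENNReal.ofReal |p| * AA f t + ∫⁻ g, ENNReal.ofReal (Q * bb f t g - |p| * aa f t g) ∂(hG m) := by
  have h1 := lint_pair hm hN hT hNT (fun x y => ENNReal.ofReal |fderiv ℝ f (t • x) (p • x + q • y)|)
  have h2 := lint_pair hm hN (v := -T) (by rw [norm_neg, hT]) (by rw [inner_neg_right, hNT, neg_zero]) 
    (fun x y => ENNReal.ofReal |fderiv ℝ f (t • x) (p • x - q • y)|)
  simp only [map_neg, smul_neg, sub_neg_eq_add] at h2
  set I := ∫⁻ g, ENNReal.ofReal |fderiv ℝ f (t • av g N) (p • av g N + q • av g T)| ∂(hG m)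
  have hmm : Measurable fun g : GG m => ENNReal.ofReal |fderiv ℝ f (t • av g (e1 m)) (p • av g (e1 m) + q • av g (e2 m))| := by
    have := dfapp_meas hf ((av_meas_left (e1 m)).const_smul t) (((av_meas_left (e1 m)).const_smul p).add ((av_meas_left (e2 m)).const_smul q))
    have h3 := (continuous_abs.measurable.comp this).ennreal_ofReal
    exact h3
  have ham : Measurable fun g : GG m => ENNReal.ofReal (aa f t g) := by
    have := ((aa_meas hf).comp (measurable_const (a := t) |>.prodMk measurable_id)).ennreal_ofReal
    exact this
  have h3 : 2 * I ≤ 2 * (ENNReal.ofReal |p| * AA f t + ∫⁻ g, ENNReal.ofReal (Q * bb f t g - |p| * aa f t g) ∂(hG m)) := by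
    rw [two_mul]
    nth_rewrite 1 [h1]
    rw [h2, ← lintegral_add_left hmm, AA, ← lintegral_const_mul' _ _ ofReal_ne_top, ← lintegral_add_left (ham.const_mul _),
      ← lintegral_const_mul' _ _ (by simp)]
    refine lintegral_mono fun g => ?_
    rw [← ENNReal.ofReal_add (abs_nonneg _) (abs_nonneg _), map_add, map_sub, map_smul, map_smul, smul_eq_mul, smul_eq_mul, max_avg,
      ENNReal.ofReal_mul (by norm_num), ENNReal.ofReal_ofNat]
    refine mul_le_mul_right ?_ _
    rw [← ENNReal.ofReal_mul (abs_nonneg _)]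
    rcases le_total |p * fderiv ℝ f (t • av g (e1 m)) (av g (e1 m))| |q * fderiv ℝ f (t • av g (e1 m)) (av g (e2 m))| with h | h
    · rw [max_eq_right h]
      refine le_trans ?_ ENNReal.ofReal_add_le
      apply ENNReal.ofReal_le_ofReal
      rw [abs_mul]
      have : |q| * bb f t g ≤ Q * bb f t g := mul_le_mul_of_nonneg_right hQ (bb_nonneg _ _ _)
      unfold bb at *
      linarith
    · rw [max_eq_left h, abs_mul]
      exact le_self_add
  exact (ENNReal.mul_le_mul_iff_right (by simp) (by simp)).1 h3

theorem C1_main {m : ℕ} (hm : 1 ≤ m) {f : Eu (m+1) → ℝ} (hf : ContDiff ℝ 1 f) {R : ℝ} (hR : 2 ≤ R) {x y : Eu (m+1)}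
    (hx : R - 1 < ‖x‖) (hx' : ‖x‖ < R + 1) (hy : R - 1 < ‖y‖) (hy' : ‖y‖ < R + 1) :
    ∫⁻ g, ‖f (av g x) - f (av g y)‖ₑ ∂(hG m) ≤
      ∫⁻ s in Set.Ioo (0:ℝ) 1, (ENNReal.ofReal |‖y‖ - ‖x‖| * AA f ((1-s) * ‖x‖ + s * ‖y‖) +
        ∫⁻ g, ENNReal.ofReal (4 * (R * ‖‖x‖⁻¹ • x - ‖y‖⁻¹ • y‖) * bb f ((1-s) * ‖x‖ + s * ‖y‖) g
          - |‖y‖ - ‖x‖| * aa f ((1-s) * ‖x‖ + s * ‖y‖) g) ∂(hG m)) := by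
  set r := ‖x‖ with hr
  set ρ := ‖y‖ with hρ
  have hr0 : r ≠ 0 := by linarith
  have hρ0 : ρ ≠ 0 := by linarith
  set σ := r⁻¹ • x with hσ
  set τ := ρ⁻¹ • y with hτ
  have hσ1 : ‖σ‖ = 1 := by rw [hσ, norm_smul, norm_inv, hr, norm_norm, inv_mul_cancel₀ hr0]
  have hτ1 : ‖τ‖ = 1 := by rw [hτ, norm_smul, norm_inv, hρ, norm_norm, inv_mul_cancel₀ hρ0]
  obtain ⟨u, θ, hu, hσu, hτe, hθ0, hθ⟩ := exists_frame hm hσ1 hτ1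
  have hxe : x = r • σ := by rw [hσ, smul_smul, mul_inv_cancel₀ hr0, one_smul]
  have hye : y = ρ • τ := by rw [hτ, smul_smul, mul_inv_cancel₀ hρ0, one_smul]
  set c : ℝ → ℝ := fun s => (1-s) * r + s * ρ with hc
  set N : ℝ → Eu (m+1) := fun s => Real.cos (s*θ) • σ + Real.sin (s*θ) • u with hN
  set T : ℝ → Eu (m+1) := fun s => (-Real.sin (s*θ)) • σ + Real.cos (s*θ) • u with hT
  have huu : inner ℝ u u = (1:ℝ) := by rw [real_inner_self_eq_norm_sq, hu]; norm_num
  have hss : inner ℝ σ σ = (1:ℝ) := by rw [real_inner_self_eq_norm_sq, hσ1]; norm_num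
  have hus : inner ℝ u σ = (0:ℝ) := by rw [real_inner_comm, hσu]
  have hN1 : ∀ s, ‖N s‖ = 1 := fun s => by
    have : ‖N s‖^2 = 1^2 := by
      rw [← real_inner_self_eq_norm_sq, hN]
      simp only [inner_add_left, inner_add_right, inner_smul_left, inner_smul_right, huu, hss, hus, hσu, RCLike.conj_to_real]
      have := Real.sin_sq_add_cos_sq (s*θ); linarith
    exact (pow_left_inj₀ (norm_nonneg _) (by norm_num) two_ne_zero).1 this
  have hT1 : ∀ s, ‖T s‖ = 1 := fun s => by
    have : ‖T s‖^2 = 1^2 := by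
      rw [← real_inner_self_eq_norm_sq, hT]
      simp only [inner_add_left, inner_add_right, inner_smul_left, inner_smul_right, huu, hss, hus, hσu, RCLike.conj_to_real]
      have := Real.sin_sq_add_cos_sq (s*θ); linarith
    exact (pow_left_inj₀ (norm_nonneg _) (by norm_num) two_ne_zero).1 this
  have hNT : ∀ s, inner ℝ (N s) (T s) = 0 := fun s => by
    simp only [hN, hT, inner_add_left, inner_add_right, inner_smul_left, inner_smul_right, huu, hss, hus, hσu, RCLike.conj_to_real]
    ring
  have hNd : ∀ s, HasDerivAt N (θ • T s) s := fun s => by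
    have h0 : HasDerivAt (fun s : ℝ => s * θ) θ s := by simpa using (hasDerivAt_id s).mul_const θ
    have h1 := (h0.cos.smul_const σ).add (h0.sin.smul_const u)
    have he : θ • T s = (-Real.sin (s * θ) * θ) • σ + (Real.cos (s * θ) * θ) • u := by
      simp only [hT, smul_add, smul_smul]
      congr 2 <;> ring
    rw [he]; exact h1
  have hcd : ∀ s, HasDerivAt c (ρ - r) s := fun s => by
    have h1 := (((hasDerivAt_id s).const_sub 1).mul_const r).add ((hasDerivAt_id s).mul_const ρ)
    have he : ρ - r = (-1 * r + 1 * ρ) := by ring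
    rw [he]; exact h1
  have hNc : Continuous N := by fun_prop
  have hTc : Continuous T := by fun_prop
  have hcc : Continuous c := by fun_prop
  have hstep : ∀ g : GG m, ‖f (av g x) - f (av g y)‖ₑ ≤ ∫⁻ s in Set.Ioo (0:ℝ) 1,
      ENNReal.ofReal |fderiv ℝ f (c s • av g (N s)) ((ρ - r) • av g (N s) + (c s * θ) • av g (T s))| := fun g => by
    have hγ : ∀ s, HasDerivAt (fun s => c s • av g (N s)) ((ρ - r) • av g (N s) + (c s * θ) • av g (T s)) s := fun s => by
      have h1 := (av g).hasFDerivAt.comp_hasDerivAt s (hNd s)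
      have h2 := (hcd s).smul h1
      have he : (ρ - r) • av g (N s) + (c s * θ) • av g (T s) = c s • (av g) (θ • T s) + (ρ - r) • (⇑(av g) ∘ N) s := by
        rw [map_smul, smul_smul]; exact add_comm _ _
      rw [he]; exact h2
    have := enorm_sub_le_lint hf hγ (by fun_prop)
    convert this using 4
    · congr 1; simp [hc, hN, hxe]
    · congr 1; simp [hc, hN, hye, hτe]
  refine (lintegral_mono hstep).trans ?_
  rw [lintegral_lintegral_swap]
  · refine setLIntegral_mono' measurableSet_Ioo fun s hs => ?_
    refine C1_core hm hf (hN1 s) (hT1 s) (hNT s) (c s) (ρ - r) (c s * θ) _ ?_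
    have hcs : 0 ≤ c s := by
      have := hs.1; have := hs.2
      have h1 : 0 ≤ (1-s) * r := mul_nonneg (by linarith) (by linarith)
      have h2 : 0 ≤ s * ρ := mul_nonneg (by linarith) (by linarith)
      exact add_nonneg h1 h2
    have hcs2 : c s ≤ R + 1 := by
      have := hs.1; have := hs.2
      simp only [hc]; nlinarith
    rw [abs_of_nonneg (mul_nonneg hcs hθ0)]
    have hpi := Real.pi_le_four
    have hn := norm_nonneg (σ - τ)
    have h1 : θ ≤ 2 * ‖σ - τ‖ := hθ.trans (by nlinarith)
    calc c s * θ ≤ (R+1) * (2 * ‖σ - τ‖) := mul_le_mul hcs2 h1 hθ0 (by linarith)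
      _ ≤ (2 * R) * (2 * ‖σ - τ‖) := mul_le_mul_of_nonneg_right (by linarith) (by positivity)
      _ = 4 * (R * ‖σ - τ‖) := by ring
  · have hm1 : Measurable fun q : GG m × ℝ => av q.1 (N q.2) := av_meas_comp measurable_fst (hNc.measurable.comp measurable_snd)
    have hm2 : Measurable fun q : GG m × ℝ => av q.1 (T q.2) := av_meas_comp measurable_fst (hTc.measurable.comp measurable_snd)
    have hm3 : Measurable fun q : GG m × ℝ => c q.2 := hcc.measurable.comp measurable_snd
    have := dfapp_meas hf (hm3.smul hm1) ((hm1.const_smul (ρ - r)).add ((hm3.mul_const θ).smul hm2))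
    have h2 := (continuous_abs.measurable.comp this).ennreal_ofReal
    exact h2.aemeasurable


/-! ## Section D3: the nonlocal perimeter of balls -/

theorem lint_smul {m : ℕ} {t : ℝ} (ht : 0 < t) (f : Eu (m+1) → ℝ≥0∞) :
    ∫⁻ x, f x = ENNReal.ofReal (t^(m+1)) * ∫⁻ x, f (t • x) := by
  have h := Measure.map_addHaar_smul (volume : Measure (Eu (m+1))) ht.ne'
  have h2 : ∫⁻ x, f (t • x) = ∫⁻ x, f x ∂(Measure.map (fun x => t • x) volume) :=
    ((Homeomorph.smulOfNeZero t ht.ne').measurableEmbedding.lintegral_map f).symm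
  rw [h2]
  have h3 : Measure.map (fun x : Eu (m+1) => t • x) volume = ENNReal.ofReal ((t^(m+1))⁻¹) • volume := by
    have := h
    rw [finrank_euclideanSpace, Fintype.card_fin, abs_of_pos (by positivity)] at this
    exact this
  rw [h3, lintegral_smul_measure, smul_eq_mul, ← mul_assoc, ← ENNReal.ofReal_mul (by positivity),
    mul_inv_cancel₀ (by positivity), ENNReal.ofReal_one, one_mul]

theorem setlint_smul {m : ℕ} {t : ℝ} (ht : 0 < t) {S S' : Set (Eu (m+1))} (hS : MeasurableSet S) (hS' : MeasurableSet S')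
    (h : ∀ x, t • x ∈ S ↔ x ∈ S') (f : Eu (m+1) → ℝ≥0∞) :
    ∫⁻ x in S, f x = ENNReal.ofReal (t^(m+1)) * ∫⁻ x in S', f (t • x) := by
  rw [← lintegral_indicator hS, ← lintegral_indicator hS', lint_smul ht]
  congr 1
  refine lintegral_congr fun x => ?_
  by_cases hx : x ∈ S'
  · rw [Set.indicator_of_mem hx, Set.indicator_of_mem ((h x).2 hx)]
  · rw [Set.indicator_of_notMem hx, Set.indicator_of_notMem (fun h' => hx ((h x).1 h'))]

def hh (m : ℕ) (ρ R : ℝ) : ℝ≥0∞ := EK (m := m) (kb ρ) (ball 0 R) (ball 0 R)ᶜ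

theorem hh_scale (m : ℕ) {t : ℝ} (ht : 0 < t) (ρ R : ℝ) : hh m (t*ρ) (t*R) = ENNReal.ofReal (t^(3*(m+1))) * hh m ρ R := by
  have hb : ∀ x : Eu (m+1), t • x ∈ ball (0:Eu (m+1)) (t*R) ↔ x ∈ ball (0:Eu (m+1)) R := fun x => by
    rw [mem_ball_zero_iff, mem_ball_zero_iff, norm_smul, Real.norm_eq_abs, abs_of_pos ht, mul_lt_mul_iff_right₀ ht]
  unfold hh EK
  rw [setlint_smul ht measurableSet_ball measurableSet_ball hb]
  simp_rw [setlint_smul ht measurableSet_ball.compl measurableSet_ball.compl (fun x => not_congr (hb x)), ← smul_sub, kb_scale ht]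
  simp_rw [lintegral_const_mul' _ _ ofReal_ne_top]
  rw [← mul_assoc, ← mul_assoc, ← ENNReal.ofReal_mul (by positivity), ← ENNReal.ofReal_mul (by positivity)]
  congr 2
  ring

def ww (m : ℕ) (a R ρ : ℝ) : ℝ≥0∞ := ENNReal.ofReal (ρ ^ (a - 2*((m:ℝ)+1) - 1)) * hh m ρ R

def phat (m : ℕ) (a δ t : ℝ) : ℝ≥0∞ := EK (k1 m a δ) (ball 0 t) (ball 0 t)ᶜ

theorem phat_eq (m : ℕ) (a δ t : ℝ) : phat m a δ t = (cc m a)⁻¹ * ∫⁻ ρ in Set.Ioc 0 δ, ww m a t ρ := by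
  have hinv : (cc m a)⁻¹ ≠ ∞ := ENNReal.inv_ne_top.2 cc_ne_zero
  have : phat m a δ t = (cc m a)⁻¹ * EK (kI a (Set.Ioc 0 δ)) (ball 0 t) (ball 0 t)ᶜ := EK_const_mul hinv _ _ _
  rw [this, EK_kI]
  rfl

theorem ww_scale (m : ℕ) (a : ℝ) {t ρ : ℝ} (ht : 0 < t) (hρ : 0 ≤ ρ) (R : ℝ) :
    ENNReal.ofReal t * ww m a (t*R) (t*ρ) = ENNReal.ofReal (t ^ (a + ((m:ℝ)+1))) * ww m a R ρ := by
  unfold ww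
  rw [hh_scale m ht, Real.mul_rpow ht.le hρ, ENNReal.ofReal_mul (by positivity)]
  have : t ^ (a + ((m:ℝ)+1)) = t * t ^ (a - 2*((m:ℝ)+1) - 1) * t ^ (3*(m+1)) := by
    have h1 : a + ((m:ℝ)+1) = 1 + (a - 2*((m:ℝ)+1) - 1) + ((3*(m+1) : ℕ):ℝ) := by push_cast; ring
    rw [h1, Real.rpow_add ht, Real.rpow_add ht, Real.rpow_one, Real.rpow_natCast]
  rw [this, ENNReal.ofReal_mul (by positivity), ENNReal.ofReal_mul (by positivity)]
  ring

theorem phat_scale (m : ℕ) (a δ R : ℝ) {t : ℝ} (ht : 0 < t) :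
    phat m a δ (t*R) = ENNReal.ofReal (t ^ (a + ((m:ℝ)+1))) * ((cc m a)⁻¹ * ∫⁻ ρ in Set.Ioc 0 (δ/t), ww m a R ρ) := by
  rw [phat_eq]
  have h1 : ∀ (u : ℝ) (f : ℝ → ℝ≥0∞), ∫⁻ ρ in Set.Ioc 0 u, f ρ = ∫⁻ ρ in Set.Ioi 0, (Set.Iic u).indicator f ρ := fun u f => by
    rw [setLIntegral_indicator measurableSet_Iic, Set.inter_comm]; rfl
  rw [h1, h1, lint_scale_Ioi ht, mul_left_comm, ← lintegral_const_mul' _ _ ofReal_ne_top]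
  congr 1
  refine setLIntegral_congr_fun measurableSet_Ioi fun ρ hρ => ?_
  by_cases h : ρ ≤ δ/t
  · have h' : t * ρ ≤ δ := by rw [le_div_iff₀ ht] at h; linarith
    rw [Set.indicator_of_mem (show t*ρ ∈ Set.Iic δ from h'), Set.indicator_of_mem (show ρ ∈ Set.Iic (δ/t) from h)]
    exact ww_scale m a ht (le_of_lt hρ) R
  · have h' : ¬ t * ρ ≤ δ := fun h' => h (by rw [le_div_iff₀ ht]; linarith)
    rw [Set.indicator_of_notMem (show t*ρ ∉ Set.Iic δ from h'), Set.indicator_of_notMem (show ρ ∉ Set.Iic (δ/t) from h), mul_zero, mul_zero]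

theorem EK_shell {m : ℕ} {k : Eu (m+1) → ℝ≥0∞} {d t : ℝ} (hk : ∀ z, d ≤ ‖z‖ → k z = 0) (hd : 0 ≤ d) (ht : 0 ≤ t) :
    EK k (ball 0 t) (ball 0 t)ᶜ ≤ ((m:ℝ≥0∞)+1) * volume (ball (0:Eu (m+1)) 1) * ENNReal.ofReal (t^m * d) * ∫⁻ z, k z := by
  set s := max (t - d) 0 with hs
  have hst : s ≤ t := max_le (by linarith) ht
  have hs0 : 0 ≤ s := le_max_right _ _
  have h1 : EK k (ball 0 t) (ball 0 t)ᶜ ≤ ∫⁻ x in ball (0:Eu (m+1)) t \ ball 0 s, ∫⁻ z, k z := by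
    unfold EK
    rw [← lintegral_inter_add_sdiff _ (ball (0:Eu (m+1)) t) (measurableSet_ball (x := (0:Eu (m+1))) (ε := s))]
    have h0 : ∫⁻ x in ball 0 t ∩ ball 0 s, ∫⁻ y in (ball 0 t)ᶜ, k (x - y) = 0 := by
      rw [setLIntegral_congr_fun (g := fun _ => 0) (measurableSet_ball.inter measurableSet_ball), lintegral_zero]
      intro x hx
      simp only
      rw [setLIntegral_congr_fun (g := fun _ => 0) measurableSet_ball.compl, lintegral_zero]
      intro y hy
      apply hk
      have hxs : ‖x‖ < s := mem_ball_zero_iff.1 hx.2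
      have hy' : t ≤ ‖y‖ := by simpa using hy
      have h3 : ‖y‖ - ‖x‖ ≤ ‖x - y‖ := by rw [norm_sub_rev]; exact norm_sub_norm_le _ _
      have h4 : s = t - d := by
        rcases max_choice (t-d) 0 with h | h
        · rw [hs, h]
        · rw [hs, h] at hxs; linarith [norm_nonneg x]
      linarith
    rw [h0, zero_add]
    refine lintegral_mono fun x => ?_
    refine (setLIntegral_le_lintegral _ _).trans ?_
    rw [lintegral_sub_left_eq_self]
  refine h1.trans ?_
  rw [setLIntegral_const, mul_comm]
  refine mul_le_mul_left ?_ _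
  rw [measure_sdiff (ball_subset_ball hst) measurableSet_ball.nullMeasurableSet measure_ball_lt_top.ne, vol_ball ht, vol_ball hs0]
  rw [← ENNReal.sub_mul (fun _ _ => vol1_top m), ← ENNReal.ofReal_sub _ (by positivity), mul_comm (_ + _) _, mul_assoc, mul_comm]
  refine mul_le_mul_right ?_ _
  have h5 := pow_sub_le (n := m) hs0 hst
  have h6 : t - s ≤ d := by have := le_max_left (t-d) 0; linarith
  have : ((m:ℝ≥0∞)+1) = ENNReal.ofReal ((m:ℝ)+1) := by rw [ENNReal.ofReal_add (by positivity) (by norm_num)]; simp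
  rw [this, ← ENNReal.ofReal_mul (by positivity)]
  apply ENNReal.ofReal_le_ofReal
  calc _ ≤ _ := h5
    _ ≤ (m+1) * t^m * d := by gcongr
    _ = _ := by ring

def Lh (m : ℕ) (δ : ℝ) : ℝ≥0∞ := ((m:ℝ≥0∞)+1) * volume (ball (0:Eu (m+1)) 1) * ENNReal.ofReal (4*δ) *
  (volume (ball (0:Eu (m+1)) 1)^2 * ENNReal.ofReal ((2*m+2) * (2*δ)^(2*m+1)))

theorem Lh_ne_top (m : ℕ) (δ : ℝ) : Lh m δ ≠ ∞ := by
  have := vol1_top m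
  unfold Lh
  finiteness

theorem hh_lip (m : ℕ) {δ ρ₁ ρ₂ R : ℝ} (h0 : 0 ≤ ρ₁) (h1 : ρ₁ ≤ ρ₂) (h2 : ρ₂ ≤ 2*δ) (hR : 0 ≤ R) :
    hh m ρ₂ R ≤ hh m ρ₁ R + Lh m δ * ENNReal.ofReal (R^m * (ρ₂ - ρ₁)) := by
  have hmono : ∀ z : Eu (m+1), kb ρ₁ z ≤ kb ρ₂ z := fun z =>
    measure_mono (Set.inter_subset_inter (ball_subset_ball h1) (ball_subset_ball h1))
  have hz : ∀ z : Eu (m+1), 2*ρ₂ ≤ ‖z‖ → kb ρ₂ z - kb ρ₁ z = 0 := fun z hz => by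
    rw [kb_zero hz, zero_tsub]
  have hE := EK_shell (t := R) hz (by linarith) hR
  have hadd : hh m ρ₂ R = hh m ρ₁ R + EK (fun z => kb ρ₂ z - kb ρ₁ z) (ball (0:Eu (m+1)) R) (ball 0 R)ᶜ := by
    unfold hh EK
    rw [← lintegral_add_left]
    · refine lintegral_congr fun x => ?_
      rw [← lintegral_add_left]
      · refine lintegral_congr fun y => ?_
        exact (add_tsub_cancel_of_le (hmono _)).symm
      · exact kb_meas_comp measurable_const (by fun_prop)
    · refine Measurable.lintegral_prod_right' (f := fun p : Eu (m+1) × Eu (m+1) => kb ρ₁ (p.1 - p.2)) ?_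
      exact kb_meas_comp measurable_const (by fun_prop)
  rw [hadd]
  refine add_le_add le_rfl (hE.trans ?_)
  have hρ2 : 0 ≤ ρ₂ := h0.trans h1
  have hInt0 : ∫⁻ z : Eu (m+1), (kb ρ₂ z - kb ρ₁ z) ≤ volume (ball (0:Eu (m+1)) 1)^2 * ENNReal.ofReal ((2*m+2) * (2*δ)^(2*m+1)) * ENNReal.ofReal (ρ₂ - ρ₁) := by
    rw [lintegral_sub (kb_meas_right ρ₁) _ (Eventually.of_forall hmono), kb_int, kb_int, vol_ball (h0.trans h1), vol_ball h0, mul_pow, mul_pow,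
      ← ENNReal.sub_mul (fun _ _ => by have := vol1_top m; finiteness), ← ENNReal.ofReal_pow (by positivity), ← ENNReal.ofReal_pow (by positivity), ← ENNReal.ofReal_sub _ (by positivity), mul_comm, mul_assoc]
    · refine mul_le_mul_right ?_ _
      rw [← ENNReal.ofReal_mul (by have : 0 ≤ δ := by linarith
                                   positivity)]
      apply ENNReal.ofReal_le_ofReal
      have h3 := pow_sub_le (n := 2*m+1) h0 h1
      rw [← pow_mul, ← pow_mul, show (m+1)*2 = 2*m+1+1 by ring]
      refine h3.trans ?_
      push_cast
      have h4 : 0 ≤ ρ₂ - ρ₁ := by linarith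
      have h5 : ρ₂^(2*m+1) ≤ (2*δ)^(2*m+1) := pow_le_pow_left₀ (by linarith) h2 _
      have h6 : (2*(m:ℝ)+1+1) = 2*m+2 := by ring
      rw [h6]
      gcongr
    · rw [kb_int]
      exact pow_ne_top measure_ball_lt_top.ne
  have hd : ENNReal.ofReal (R^m * (2*ρ₂)) ≤ ENNReal.ofReal (R^m) * ENNReal.ofReal (4*δ) := by
    rw [← ENNReal.ofReal_mul (by positivity)]
    apply ENNReal.ofReal_le_ofReal
    have : 0 ≤ R^m := by positivity
    nlinarith
  calc _ ≤ ((m:ℝ≥0∞)+1) * volume (ball (0:Eu (m+1)) 1) * (ENNReal.ofReal (R^m) * ENNReal.ofReal (4*δ)) * (volume (ball (0:Eu (m+1)) 1)^2 * ENNReal.ofReal ((2*m+2) * (2*δ)^(2*m+1)) * ENNReal.ofReal (ρ₂ - ρ₁)) := by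
        refine mul_le_mul' (mul_le_mul_right hd _) hInt0
    _ = _ := by
        rw [ENNReal.ofReal_mul (p := R^m) (q := ρ₂ - ρ₁) (by positivity)]
        unfold Lh
        ring

def K0 (m : ℕ) (a δ : ℝ) : ℝ≥0∞ := ((m:ℝ≥0∞)+1) * volume (ball (0:Eu (m+1)) 1) * ENNReal.ofReal (2*δ) * ∫⁻ z, k1 m a δ z

theorem K0_ne_top (m : ℕ) {a δ : ℝ} (ha : 0 < a) (hδ : 0 < δ) : K0 m a δ ≠ ∞ := by
  unfold K0
  rw [k1_int ha hδ]
  have := vol1_top m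
  have := ENNReal.inv_ne_top.2 (cc_ne_zero (m := m) (a := a))
  finiteness

theorem phat_le (m : ℕ) (a : ℝ) {δ t : ℝ} (hδ : 0 ≤ δ) (ht : 0 ≤ t) : phat m a δ t ≤ K0 m a δ * ENNReal.ofReal (t^m) := by
  refine (EK_shell (d := 2*δ) (fun z hz => k1_zero hz) (by linarith) ht).trans (le_of_eq ?_)
  rw [ENNReal.ofReal_mul (by positivity)]
  unfold K0
  ring

def W0c (m : ℕ) (a δ : ℝ) : ℝ≥0∞ := ENNReal.ofReal (δ ^ (a - 2*((m:ℝ)+1) - 1)) * (((m:ℝ≥0∞)+1) * volume (ball (0:Eu (m+1)) 1) * ENNReal.ofReal (2*δ) * volume (ball (0:Eu (m+1)) δ)^2)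

theorem W0c_ne_top (m : ℕ) (a δ : ℝ) : W0c m a δ ≠ ∞ := by
  have := vol1_top m
  have h2 : volume (ball (0:Eu (m+1)) δ) ≠ ∞ := measure_ball_lt_top.ne
  unfold W0c
  finiteness

theorem ww_le (m : ℕ) (a : ℝ) {δ R : ℝ} (hδ : 0 ≤ δ) (hR : 0 ≤ R) : ww m a R δ ≤ W0c m a δ * ENNReal.ofReal (R^m) := by
  unfold ww W0c
  rw [mul_assoc]
  refine mul_le_mul_right ?_ _
  refine (EK_shell (d := 2*δ) (fun z hz => kb_zero hz) (by linarith) hR).trans (le_of_eq ?_)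
  rw [ENNReal.ofReal_mul (by positivity), kb_int]
  ring

def GI (m : ℕ) (a R u : ℝ) : ℝ≥0∞ := ∫⁻ ρ in Set.Ioc 0 u, ww m a R ρ

theorem GI_ne_top (m : ℕ) {a R u : ℝ} (ha : 0 < a) (ha' : a < (m:ℝ)+1) (hR : 0 ≤ R) (hu : 0 < u) : GI m a R u ≠ ∞ := by
  intro h
  have h1 := phat_eq m a u R
  have h2 := phat_le m a hu.le hR
  rw [h1, show ∫⁻ ρ in Set.Ioc 0 u, ww m a R ρ = ∞ from h, ENNReal.mul_top (ENNReal.inv_ne_zero.2 (cc_ne_top ha'))] at h2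
  exact (ENNReal.mul_ne_top (K0_ne_top m ha hu) ofReal_ne_top) (top_le_iff.1 h2)

theorem GI_quad (m : ℕ) {a R δ u : ℝ} (ha : 0 < a) (ha' : a < (m:ℝ)+1) (hR : 0 ≤ R) (hδ : 0 < δ) (hu : 0 < u) (hu' : u ≤ 2*δ) :
    (GI m a R u).toReal ≤ (GI m a R δ).toReal + (ww m a R δ).toReal * (u - δ)
      + (ENNReal.ofReal (δ ^ (a - 2*((m:ℝ)+1) - 1)) * Lh m δ).toReal * R^m * (u - δ)^2 := by
  set e := a - 2*((m:ℝ)+1) - 1 with he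
  have he0 : e ≤ 0 := by have : (0:ℝ) ≤ m := Nat.cast_nonneg m
                         linarith
  have hGδ := GI_ne_top m ha ha' hR hδ
  have hGu := GI_ne_top m ha ha' hR hu
  set D := ENNReal.ofReal (δ ^ e) * Lh m δ with hD
  have hDt : D ≠ ∞ := ENNReal.mul_ne_top ofReal_ne_top (Lh_ne_top _ _)
  have hwt : ww m a R δ ≠ ∞ := ne_top_of_le_ne_top (ENNReal.mul_ne_top (W0c_ne_top m a δ) ofReal_ne_top) (ww_le m a hδ.le hR)
  rcases le_total δ u with h | h
  · have hsplit : GI m a R u ≤ GI m a R δ + ∫⁻ ρ in Set.Ioc δ u, ww m a R ρ := by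
      unfold GI
      rw [← Set.Ioc_union_Ioc_eq_Ioc hδ.le h]
      exact lintegral_union_le _ _ _
    have hb : ∫⁻ ρ in Set.Ioc δ u, ww m a R ρ ≤ (ww m a R δ + D * ENNReal.ofReal (R^m * (u - δ))) * ENNReal.ofReal (u - δ) := by
      calc _ ≤ ∫⁻ ρ in Set.Ioc δ u, (ww m a R δ + D * ENNReal.ofReal (R^m * (u - δ))) := by
            refine setLIntegral_mono' measurableSet_Ioc fun ρ hρ => ?_
            unfold ww
            rw [hD, mul_assoc, ← mul_add]
            refine mul_le_mul' (ENNReal.ofReal_le_ofReal (Real.rpow_le_rpow_of_nonpos hδ hρ.1.le he0)) ?_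
            refine (hh_lip m hδ.le hρ.1.le (hρ.2.trans hu') hR).trans (add_le_add le_rfl (mul_le_mul_right (ENNReal.ofReal_le_ofReal ?_) _))
            have := hρ.2
            gcongr
        _ = _ := by rw [setLIntegral_const, Real.volume_Ioc]
    have h3 := ENNReal.toReal_mono (by finiteness) (hsplit.trans (add_le_add le_rfl hb))
    have h4 : 0 ≤ u - δ := by linarith
    rw [ENNReal.toReal_add hGδ (by finiteness), ENNReal.toReal_mul, ENNReal.toReal_add hwt (by finiteness), ENNReal.toReal_mul,
      ENNReal.toReal_ofReal h4, ENNReal.toReal_ofReal (by positivity)] at h3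
    refine h3.trans (le_of_eq (by ring))
  · have hsplit : GI m a R δ = GI m a R u + ∫⁻ ρ in Set.Ioc u δ, ww m a R ρ := by
      unfold GI
      rw [← Set.Ioc_union_Ioc_eq_Ioc hu.le h, lintegral_union measurableSet_Ioc (Set.Ioc_disjoint_Ioc_of_le le_rfl)]
    have hb : ww m a R δ * ENNReal.ofReal (δ - u) ≤ (∫⁻ ρ in Set.Ioc u δ, ww m a R ρ) + D * ENNReal.ofReal (R^m * (δ - u)) * ENNReal.ofReal (δ - u) := by
      calc _ = ∫⁻ ρ in Set.Ioc u δ, ww m a R δ := by rw [setLIntegral_const, Real.volume_Ioc]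
        _ ≤ ∫⁻ ρ in Set.Ioc u δ, (ww m a R ρ + D * ENNReal.ofReal (R^m * (δ - u))) := by
            refine setLIntegral_mono' measurableSet_Ioc fun ρ hρ => ?_
            have hρ0 : 0 < ρ := hu.trans hρ.1
            refine le_trans ?_ (add_le_add (mul_le_mul_left (ENNReal.ofReal_le_ofReal (Real.rpow_le_rpow_of_nonpos hρ0 hρ.2 he0)) _) le_rfl)
            unfold ww
            rw [hD, mul_assoc, ← mul_add]
            refine mul_le_mul_right ?_ _
            refine (hh_lip m hρ0.le hρ.2 (by linarith) hR).trans (add_le_add le_rfl (mul_le_mul_right (ENNReal.ofReal_le_ofReal ?_) _))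
            have := hρ.1
            gcongr
        _ = _ := by rw [lintegral_add_right _ measurable_const, setLIntegral_const, Real.volume_Ioc]
    have hIt : ∫⁻ ρ in Set.Ioc u δ, ww m a R ρ ≠ ∞ := ne_top_of_le_ne_top hGδ (hsplit ▸ le_add_self)
    have h4 : 0 ≤ δ - u := by linarith
    have h3 := ENNReal.toReal_mono (by finiteness) hb
    rw [ENNReal.toReal_add hIt (by finiteness), ENNReal.toReal_mul, ENNReal.toReal_mul, ENNReal.toReal_mul,
      ENNReal.toReal_ofReal h4, ENNReal.toReal_ofReal (by positivity)] at h3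
    rw [hsplit, ENNReal.toReal_add hGu hIt]
    nlinarith

theorem quad_alg {k x δ X0 w L y E μ : ℝ} (hk : 0 ≤ k) (hkx : |k * x| ≤ 1) (hx : |x| ≤ 1/2) (hδ : 0 ≤ δ) (hw : 0 ≤ w) (hL : 0 ≤ L)
    (hy : 0 ≤ y) (hE0 : 0 ≤ E) (hE : E ≤ 1 + k*x + (k*x)^2) (hμ : μ = -δ*x/(1+x)) (hyy : y ≤ X0 + w*μ + L*μ^2) :
    E * y ≤ X0 + (k*X0 - w*δ)*x + (k^2*X0 + w*δ*(2+4*k) + 12*L*δ^2)*x^2 := by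
  have hx' := abs_le.1 hx
  have hkx' := abs_le.1 hkx
  have h1x : 0 < 1 + x := by linarith
  set F := 1 + k*x + (k*x)^2 with hF
  have hF3 : F ≤ 3 := by nlinarith
  have hF0 : 0 ≤ F := hE0.trans hE
  have h1 : E * y ≤ F * (X0 + w*μ + L*μ^2) := by
    calc E * y ≤ F * y := mul_le_mul_of_nonneg_right hE hy
      _ ≤ _ := mul_le_mul_of_nonneg_left hyy hF0
  have hμ2 : μ = -δ*x + δ*x^2/(1+x) := by rw [hμ]; field_simp; ring
  have hz : x^2/(1+x) ≤ 2*x^2 := by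
    rw [div_le_iff₀ h1x]; nlinarith [sq_nonneg x]
  have hμle : μ ≤ -δ*x + 2*δ*x^2 := by
    rw [hμ2, mul_div_assoc]; nlinarith
  have hμabs : |μ| ≤ 2*δ*|x| := by
    rw [hμ, abs_div, abs_mul, abs_neg, abs_of_nonneg hδ, abs_of_pos h1x, div_le_iff₀ h1x]
    have : 0 ≤ δ * |x| := by positivity
    nlinarith
  have hμsq : μ^2 ≤ 4*δ^2*x^2 := by
    have := pow_le_pow_left₀ (abs_nonneg _) hμabs 2
    rw [sq_abs, mul_pow, sq_abs] at this
    nlinarith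
  have hFm : F * μ ≤ -δ*x + (2+4*k)*δ*x^2 := by
    have h2 : F * μ = μ + (k*x)*(1+k*x)*μ := by rw [hF]; ring
    have h3 : (k*x)*(1+k*x)*μ ≤ (k*|x|)*2*(2*δ*|x|) := by
      refine (le_abs_self _).trans ?_
      rw [abs_mul, abs_mul, abs_mul, abs_of_nonneg hk]
      have : |1 + k*x| ≤ 2 := abs_le.2 ⟨by linarith, by linarith⟩
      gcongr
    have h4 : (k*|x|)*2*(2*δ*|x|) = 4*k*δ*x^2 := by rw [← sq_abs x]; ring
    rw [h2]; linarith
  have h5 : F * (L*μ^2) ≤ 3*(L*(4*δ^2*x^2)) := by gcongr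
  have h6 : w*(F*μ) ≤ w*(-δ*x + (2+4*k)*δ*x^2) := mul_le_mul_of_nonneg_left hFm hw
  have h7 : F * X0 = X0 + k*X0*x + k^2*X0*x^2 := by rw [hF]; ring
  nlinarith

theorem phat_quad (m : ℕ) {a δ : ℝ} (ha : 0 < a) (ha' : a < (m:ℝ)+1) (hδ : 0 < δ) :
    ∃ C : ℝ, 0 ≤ C ∧ ∀ R : ℝ, 2 ≤ R → a + ((m:ℝ)+1) ≤ R → ∃ b : ℝ, |b| ≤ C * R^m ∧ ∀ s : ℝ, |s| ≤ 1/2 →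
      (phat m a δ (R+s)).toReal ≤ (phat m a δ R).toReal + b * s + C * R^m * s^2 := by
  set k := a + ((m:ℝ)+1) with hk
  have hk0 : 0 ≤ k := by positivity
  set c := ((cc m a)⁻¹).toReal with hc
  have hinv : (cc m a)⁻¹ ≠ ∞ := ENNReal.inv_ne_top.2 cc_ne_zero
  set L := (ENNReal.ofReal (δ ^ (a - 2*((m:ℝ)+1) - 1)) * Lh m δ).toReal with hL
  set K := (K0 m a δ).toReal with hK
  set W := (W0c m a δ).toReal with hW
  have hK0 : 0 ≤ K := toReal_nonneg
  have hW0 : 0 ≤ W := toReal_nonneg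
  have hL0 : 0 ≤ L := toReal_nonneg
  have hc0 : 0 ≤ c := toReal_nonneg
  refine ⟨(k + k^2) * K + c*W*δ*(3+4*k) + 12*(c*L)*δ^2, by positivity, fun R hR2 hRk => ?_⟩
  have hR0 : 0 < R := by linarith
  set X0 := (phat m a δ R).toReal with hX0
  set w := (ww m a R δ).toReal with hw
  have hw0 : 0 ≤ w := toReal_nonneg
  have hX00 : 0 ≤ X0 := toReal_nonneg
  have hXK : X0 ≤ K * R^m := by
    have := ENNReal.toReal_mono (ENNReal.mul_ne_top (K0_ne_top m ha hδ) ofReal_ne_top) (phat_le m a hδ.le hR0.le)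
    rwa [ENNReal.toReal_mul, ENNReal.toReal_ofReal (by positivity)] at this
  have hwW : w ≤ W * R^m := by
    have := ENNReal.toReal_mono (ENNReal.mul_ne_top (W0c_ne_top m a δ) ofReal_ne_top) (ww_le m a hδ.le hR0.le)
    rwa [ENNReal.toReal_mul, ENNReal.toReal_ofReal (by positivity)] at this
  have hRm : 0 < R^m := by positivity
  have hR1 : 1 ≤ R := by linarith
  refine ⟨(k*X0 - c*w*δ)/R, ?_, fun s hs => ?_⟩
  · rw [abs_div, abs_of_pos hR0]
    refine (div_le_self (abs_nonneg _) hR1).trans ?_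
    refine (abs_sub _ _).trans ?_
    rw [abs_of_nonneg (by positivity), abs_of_nonneg (by positivity)]
    have h1 : k * X0 ≤ k * (K * R^m) := by gcongr
    have h2 : c*w*δ ≤ c*(W*R^m)*δ := by gcongr
    have h3 : 0 ≤ k^2*K*R^m := by positivity
    have h4 : 0 ≤ c*W*δ*(2+4*k)*R^m := by positivity
    have h5 : 0 ≤ 12*(c*L)*δ^2*R^m := by positivity
    nlinarith
  · have hs' := abs_le.1 hs
    set x := s/R with hx
    have hxs : |x| ≤ |s| := by
      rw [hx, abs_div, abs_of_pos hR0]; exact div_le_self (abs_nonneg _) hR1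
    have hx2 : |x| ≤ 1/2 := hxs.trans hs
    have hx2' := abs_le.1 hx2
    have h1x : 0 < 1 + x := by linarith
    have hkx : |k*x| ≤ 1 := by
      rw [hx, abs_mul, abs_div, abs_of_nonneg hk0, abs_of_pos hR0, mul_div_assoc', div_le_one hR0]
      nlinarith [abs_nonneg s]
    have hts : R + s = (1+x) * R := by rw [hx]; field_simp
    have hph : (phat m a δ (R+s)).toReal = (1+x)^k * (c * (GI m a R (δ/(1+x))).toReal) := by
      rw [hts, phat_scale m a δ R h1x, ENNReal.toReal_mul, ENNReal.toReal_mul, ENNReal.toReal_ofReal (by positivity)]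
      rfl
    have hX0e : X0 = c * (GI m a R δ).toReal := by
      rw [hX0, phat_eq, ENNReal.toReal_mul]; rfl
    have hu' : δ/(1+x) ≤ 2*δ := by rw [div_le_iff₀ h1x]; nlinarith
    have hG := GI_quad m (R := R) ha ha' hR0.le hδ (div_pos hδ h1x) hu'
    have hμ : δ/(1+x) - δ = -δ*x/(1+x) := by field_simp; ring
    have hE : (1+x)^k ≤ 1 + k*x + (k*x)^2 := by
      have h1 : (1+x)^k ≤ Real.exp (k*x) := by
        have h2 : 1 + x ≤ Real.exp x := by linarith [Real.add_one_le_exp x]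
        calc (1+x)^k ≤ (Real.exp x)^k := Real.rpow_le_rpow h1x.le h2 hk0
          _ = _ := by rw [← Real.exp_mul, mul_comm]
      have h3 := (abs_le.1 (Real.abs_exp_sub_one_sub_id_le hkx)).2
      linarith
    rw [hph]
    have hmain := quad_alg (k := k) (x := x) (δ := δ) (X0 := X0) (w := c*w) (L := c*L*R^m) (y := c * (GI m a R (δ/(1+x))).toReal)
      (E := (1+x)^k) (μ := δ/(1+x) - δ) hk0 hkx hx2 hδ.le (by positivity) (by positivity) (by positivity) (by positivity) hE hμ (by
        have := mul_le_mul_of_nonneg_left hG hc0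
        rw [hX0e]
        refine this.trans (le_of_eq ?_)
        ring)
    refine hmain.trans ?_
    have hxsq : x^2 ≤ s^2 := sq_le_sq.2 hxs
    have hxx : (k*X0 - c*w*δ)/R*s = (k*X0 - c*w*δ)*x := by rw [hx]; ring
    rw [hxx]
    have hq : (k^2*X0 + c*w*δ*(2+4*k) + 12*(c*L*R^m)*δ^2)*x^2 ≤ (k^2*(K*R^m) + c*(W*R^m)*δ*(2+4*k) + 12*(c*L*R^m)*δ^2)*s^2 := by
      gcongr
    have h6 : 0 ≤ k*K*R^m*s^2 := by positivity
    have h7 : 0 ≤ c*W*δ*R^m*s^2 := by positivity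
    have h8 : ((k + k^2) * K + c*W*δ*(3+4*k) + 12*(c*L)*δ^2) * R^m * s^2 = (k^2*(K*R^m) + c*(W*R^m)*δ*(2+4*k) + 12*(c*L*R^m)*δ^2)*s^2
        + k*K*R^m*s^2 + c*W*δ*R^m*s^2 := by ring
    rw [h8]
    linarith only [hq, h6, h7]


/-! ## Section C2: estimates of the tangential part -/

def Sh (m : ℕ) (R : ℝ) : Set (Eu (m+1)) := {x | ‖x‖ ∈ Set.Ioo (R-1) (R+1)}

theorem Sh_meas (m : ℕ) (R : ℝ) : MeasurableSet (Sh m R) := measurable_norm measurableSet_Ioo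

theorem norm_smul_av {m : ℕ} {t : ℝ} (ht : 0 < t) (g : GG m) : ‖t • av g (e1 m)‖ = t := by
  rw [norm_smul, av_norm, e1_norm, mul_one, Real.norm_eq_abs, abs_of_pos ht]

theorem polar_Sh {m : ℕ} {R : ℝ} (hR : 1 ≤ R) {φ : Eu (m+1) → ℝ≥0∞} (hφ : Measurable φ) :
    ∫⁻ x in Sh m R, φ x = ((m:ℝ≥0∞)+1) * volume (ball (0:Eu (m+1)) 1) *
      ∫⁻ t in Set.Ioo (R-1) (R+1), ENNReal.ofReal (t^m) * ∫⁻ g, φ (t • av g (e1 m)) ∂(hG m) := by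
  rw [← lintegral_indicator (Sh_meas m R), lint_polar (hφ.indicator (Sh_meas m R))]
  congr 1
  rw [← lintegral_indicator measurableSet_Ioi, ← lintegral_indicator measurableSet_Ioo]
  refine lintegral_congr fun t => ?_
  by_cases h0 : 0 < t
  · rw [Set.indicator_of_mem (show t ∈ Set.Ioi 0 from h0)]
    by_cases h : t ∈ Set.Ioo (R-1) (R+1)
    · rw [Set.indicator_of_mem h]
      congr 1
      refine lintegral_congr fun g => ?_
      rw [Set.indicator_of_mem]
      rw [Sh, Set.mem_ofPred_eq, norm_smul_av h0]; exact h
    · rw [Set.indicator_of_notMem h]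
      have : ∀ g : GG m, (Sh m R).indicator φ (t • av g (e1 m)) = 0 := fun g => by
        rw [Set.indicator_of_notMem]
        rw [Sh, Set.mem_ofPred_eq, norm_smul_av h0]; exact h
      simp_rw [this]
      simp
  · rw [Set.indicator_of_notMem (show t ∉ Set.Ioi 0 from h0), Set.indicator_of_notMem]
    intro h
    exact h0 (by have := h.1; linarith)

theorem sphere_est {m : ℕ} {b ε : ℝ} (hm : 1 ≤ m) (hb : 0 < b) (hb' : b ≤ 1/2) (hε : 0 ≤ ε) {σ : Eu (m+1)} (hσ : ‖σ‖ = 1) :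
    ∫⁻ g in {g : GG m | ‖σ - av g (e1 m)‖ ≤ ε}, ENNReal.ofReal (‖σ - av g (e1 m)‖ ^ (1 - (m:ℝ) + b)) ∂(hG m) ≤
      ENNReal.ofReal (2^(m+1) * ε^(1+b)) := by
  have hm' : (1:ℝ) ≤ m := by exact_mod_cast hm
  set S : Set (GG m) := {g : GG m | ‖σ - av g (e1 m)‖ ≤ ε} with hS
  have hSm : MeasurableSet S := measurableSet_le ((measurable_const.sub (av_meas_left _)).norm) measurable_const
  set φ : ℝ → ℝ≥0∞ := (Set.Iic (2*ε)).indicator fun t => ENNReal.ofReal (t ^ (b - m)) with hφ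
  have hφm : Measurable φ := Measurable.indicator (by fun_prop) measurableSet_Iic
  have h1 : ∫⁻ x : Eu (m+1), φ ‖x - σ‖ = ∫⁻ x : Eu (m+1), φ ‖x‖ :=
    lintegral_sub_right_eq_self (fun x : Eu (m+1) => φ ‖x‖) σ
  have hF : Measurable fun x : Eu (m+1) => φ ‖x - σ‖ := hφm.comp (by fun_prop)
  rw [lint_polar hF, lint_radial hφm] at h1
  have hc0 : ((m:ℝ≥0∞)+1) * volume (ball (0:Eu (m+1)) 1) ≠ 0 := mul_ne_zero (by simp) (vol1_pos m)
  have hct : ((m:ℝ≥0∞)+1) * volume (ball (0:Eu (m+1)) 1) ≠ ∞ := by have := vol1_top m; finiteness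
  rw [ENNReal.mul_right_inj hc0 hct] at h1
  have h2 : ∫⁻ t in Set.Ioi (0:ℝ), ENNReal.ofReal (t^m) * φ t = ENNReal.ofReal ((2*ε)^(b+1)/(b+1)) := by
    rw [← lint_rpow_Ioc (by linarith) (by linarith)]
    have : Set.Ioc 0 (2*ε) = Set.Iic (2*ε) ∩ Set.Ioi 0 := by ext t; simp [and_comm]
    rw [this, ← setLIntegral_indicator measurableSet_Iic]
    refine setLIntegral_congr_fun measurableSet_Ioi fun t ht => ?_
    by_cases h : t ∈ Set.Iic (2*ε)
    · simp only [hφ]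
      rw [Set.indicator_of_mem h, Set.indicator_of_mem h, ← ENNReal.ofReal_mul (pow_nonneg (le_of_lt ht) _), ← Real.rpow_natCast, ← Real.rpow_add ht]
      congr 2; ring
    · simp only [hφ]
      rw [Set.indicator_of_notMem h, Set.indicator_of_notMem h, mul_zero]
  rw [h2] at h1
  have hav : Measurable fun q : ℝ × GG m => q.1 • av q.2 (e1 m) := measurable_fst.smul (avp_meas (e1 m))
  have h3 : ∫⁻ t in Set.Ioi (0:ℝ), ENNReal.ofReal (t^m) * ∫⁻ g, φ ‖t • av g (e1 m) - σ‖ ∂(hG m) =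
      ∫⁻ g, (∫⁻ t in Set.Ioi (0:ℝ), ENNReal.ofReal (t^m) * φ ‖t • av g (e1 m) - σ‖) ∂(hG m) := by
    simp_rw [← lintegral_const_mul' _ _ ofReal_ne_top]
    rw [lintegral_lintegral_swap]
    refine Measurable.aemeasurable ?_
    have h4 : Measurable fun q : ℝ × GG m => φ ‖q.1 • av q.2 (e1 m) - σ‖ := hF.comp hav
    have h5 : Measurable fun q : ℝ × GG m => ENNReal.ofReal (q.1^m) := by fun_prop
    exact h5.mul h4
  rw [h3] at h1
  have h6 : ENNReal.ofReal (2 ^ (b - m)) * ∫⁻ g in S, ENNReal.ofReal (‖σ - av g (e1 m)‖ ^ (1 - (m:ℝ) + b)) ∂(hG m) ≤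
      ∫⁻ g, (∫⁻ t in Set.Ioi (0:ℝ), ENNReal.ofReal (t^m) * φ ‖t • av g (e1 m) - σ‖) ∂(hG m) := by
    rw [← lintegral_const_mul' _ _ ofReal_ne_top]
    refine le_trans ?_ (setLIntegral_le_lintegral S _)
    refine setLIntegral_mono' hSm fun g hg => ?_
    set d := ‖σ - av g (e1 m)‖ with hd
    have hdε : d ≤ ε := hg
    rcases (norm_nonneg (σ - av g (e1 m))).eq_or_lt with h0 | h0
    · rw [← hd] at h0
      rw [← h0, Real.zero_rpow, ENNReal.ofReal_zero, mul_zero]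
      · exact zero_le
      · rcases hm.eq_or_lt with h | h
        · rw [← h]; push_cast; linarith
        · have : (2:ℝ) ≤ m := by exact_mod_cast h
          linarith
    · rw [← hd] at h0
      calc _ = ∫⁻ t in Set.Ioc 1 (1+d), ENNReal.ofReal ((2*d)^(b-m)) := by
            rw [setLIntegral_const, Real.volume_Ioc, ← ENNReal.ofReal_mul (by positivity), ← ENNReal.ofReal_mul (by positivity)]
            congr 1
            rw [Real.mul_rpow (by norm_num) h0.le, show 1 - (m:ℝ) + b = (b - m) + 1 by ring, Real.rpow_add h0, Real.rpow_one]
            ring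
        _ ≤ ∫⁻ t in Set.Ioc 1 (1+d), ENNReal.ofReal (t^m) * φ ‖t • av g (e1 m) - σ‖ := by
            refine setLIntegral_mono' measurableSet_Ioc fun t ht => ?_
            have ht1 : 1 < t := ht.1
            have h7 : ‖t • av g (e1 m) - σ‖ ≤ 2*d := by
              calc ‖t • av g (e1 m) - σ‖ = ‖(t-1) • av g (e1 m) + (av g (e1 m) - σ)‖ := by
                    congr 1; rw [sub_smul, one_smul]; abel
                _ ≤ ‖(t-1) • av g (e1 m)‖ + ‖av g (e1 m) - σ‖ := norm_add_le _ _
                _ ≤ d + d := by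
                    rw [norm_smul_av (by linarith), norm_sub_rev (av g (e1 m))]
                    have := ht.2
                    linarith
                _ = _ := by ring
            have h8 : 0 < ‖t • av g (e1 m) - σ‖ := by
              have := norm_sub_norm_le (t • av g (e1 m)) σ
              rw [norm_smul_av (by linarith), hσ] at this
              linarith
            have h9 : (1:ℝ≥0∞) ≤ ENNReal.ofReal (t^m) := by
              rw [← ENNReal.ofReal_one]
              exact ENNReal.ofReal_le_ofReal (one_le_pow₀ ht1.le)
            refine le_trans ?_ (mul_le_mul_left h9 _)
            rw [one_mul, hφ, Set.indicator_of_mem (show _ ∈ Set.Iic (2*ε) from h7.trans (by linarith))]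
            exact ENNReal.ofReal_le_ofReal (Real.rpow_le_rpow_of_nonpos h8 h7 (by linarith))
        _ ≤ _ := lintegral_mono_set (fun t ht => lt_trans one_pos ht.1)
  rw [h1] at h6
  have h10 : ∫⁻ g in S, ENNReal.ofReal (‖σ - av g (e1 m)‖ ^ (1 - (m:ℝ) + b)) ∂(hG m) =
      ENNReal.ofReal (2 ^ ((m:ℝ) - b)) * (ENNReal.ofReal (2 ^ (b - m)) * ∫⁻ g in S, ENNReal.ofReal (‖σ - av g (e1 m)‖ ^ (1 - (m:ℝ) + b)) ∂(hG m)) := by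
    rw [← mul_assoc, ← ENNReal.ofReal_mul (by positivity), ← Real.rpow_add (by norm_num)]
    simp
  rw [h10]
  refine (mul_le_mul_right h6 _).trans ?_
  rw [← ENNReal.ofReal_mul (by positivity)]
  apply ENNReal.ofReal_le_ofReal
  have h11 : (2:ℝ)^(m+1) * ε^(1+b) = 2 ^ ((m:ℝ) - b) * (2*ε)^(b+1) := by
    rw [Real.mul_rpow (by norm_num) hε, ← mul_assoc, ← Real.rpow_add (by norm_num), show (m:ℝ) - b + (b+1) = ((m+1:ℕ):ℝ) by push_cast; ring, Real.rpow_natCast, add_comm 1 b]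
  rw [h11]
  gcongr
  exact div_le_self (by positivity) (by linarith)


theorem sqrt_gap {a b : ℝ} (ha : 0 ≤ a) (hb : 0 ≤ b) :
    (b ≤ a → b^2 ≤ 3 * a * (Real.sqrt (a^2+b^2) - a)) ∧ (a ≤ b → b ≤ 3 * (Real.sqrt (a^2+b^2) - a)) := by
  set S := Real.sqrt (a^2+b^2) with hS
  have h0 : 0 ≤ S := Real.sqrt_nonneg _
  have h1 : S^2 = a^2+b^2 := Real.sq_sqrt (by positivity)
  have h2 : a ≤ S := Real.le_sqrt_of_sq_le (by nlinarith)
  constructor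
  · intro h
    have h3 : S ≤ 2*a := by
      rw [hS]; apply Real.sqrt_le_iff.2; constructor <;> nlinarith
    nlinarith
  · intro h
    by_contra hc
    push Not at hc
    nlinarith

theorem lint_abs (φ : ℝ → ℝ≥0∞) : ∫⁻ p : ℝ, φ |p| = 2 * ∫⁻ p in Set.Ioi (0:ℝ), φ p := by
  have h1 : ∫⁻ p : ℝ, φ |p| = (∫⁻ p in Set.Iic (0:ℝ), φ |p|) + ∫⁻ p in Set.Ioi (0:ℝ), φ |p| := by
    have := lintegral_add_compl (μ := volume) (fun p : ℝ => φ |p|) (measurableSet_Iic (a := (0:ℝ)))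
    rw [Set.compl_Iic] at this
    exact this.symm
  have h2 : ∫⁻ p in Set.Iic (0:ℝ), φ |p| = ∫⁻ p in Set.Ioi (0:ℝ), φ |p| := by
    rw [← setLIntegral_congr (Ioi_ae_eq_Ici (a := (0:ℝ))).symm, ← lintegral_indicator measurableSet_Iic, ← lintegral_indicator measurableSet_Ici,
      ← lintegral_neg_eq_self]
    refine lintegral_congr fun p => ?_
    by_cases hp : 0 ≤ p
    · rw [Set.indicator_of_mem (by simpa using hp), Set.indicator_of_mem (by simpa using hp), abs_neg]
    · rw [Set.indicator_of_notMem (by simpa using hp), Set.indicator_of_notMem (by simpa using hp)]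
  rw [h1, h2, ← two_mul]
  congr 1
  refine setLIntegral_congr_fun measurableSet_Ioi fun p hp => ?_
  rw [abs_of_pos hp]

theorem line_est {ℓ a b γ : ℝ} (hℓ : 0 < ℓ) (ha : 0 ≤ a) (hb : 0 ≤ b) (hγ : 3/2 ≤ γ) :
    ∫⁻ p : ℝ, ENNReal.ofReal ((|p| + ℓ)^(-γ)) * ENNReal.ofReal (4*ℓ*b - |p| * a) ≤
      ENNReal.ofReal (96 * ℓ^(2-γ)) * ENNReal.ofReal (Real.sqrt (a^2+b^2) - a) := by
  have hgap := sqrt_gap ha hb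
  have hS : 0 ≤ Real.sqrt (a^2+b^2) - a := sub_nonneg.2 (Real.le_sqrt_of_sq_le (by nlinarith))
  have hl2 : ℓ^(2-γ) = ℓ^2 * ℓ^(-γ) := by
    rw [show 2 - γ = 2 + -γ by ring, Real.rpow_add hℓ]; norm_num
  have hlp : 0 < ℓ^(-γ) := by positivity
  rw [← ENNReal.ofReal_mul (by positivity)]
  rcases le_or_gt b a with h | h
  · rcases ha.eq_or_lt with h0 | h0
    · have hb0 : b = 0 := by linarith
      subst hb0; subst h0
      simp
    · have h1 : ∀ p : ℝ, ENNReal.ofReal ((|p| + ℓ)^(-γ)) * ENNReal.ofReal (4*ℓ*b - |p| * a) ≤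
          (Set.Icc (-(4*ℓ*b/a)) (4*ℓ*b/a)).indicator (fun _ => ENNReal.ofReal (ℓ^(-γ) * (4*ℓ*b))) p := fun p => by
        by_cases hp : |p| ≤ 4*ℓ*b/a
        · rw [Set.indicator_of_mem (show p ∈ Set.Icc (-(4*ℓ*b/a)) (4*ℓ*b/a) from abs_le.1 hp), ENNReal.ofReal_mul (by positivity)]
          refine mul_le_mul' (ENNReal.ofReal_le_ofReal (Real.rpow_le_rpow_of_nonpos hℓ (by linarith [abs_nonneg p]) (by linarith))) (ENNReal.ofReal_le_ofReal ?_)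
          have : 0 ≤ |p| * a := by positivity
          linarith
        · have : 4*ℓ*b - |p| * a ≤ 0 := by
            push Not at hp
            rw [div_lt_iff₀ h0] at hp
            linarith
          rw [ENNReal.ofReal_of_nonpos this, mul_zero]
          exact zero_le
      refine (lintegral_mono h1).trans ?_
      rw [lintegral_indicator measurableSet_Icc, setLIntegral_const, Real.volume_Icc, ← ENNReal.ofReal_mul (by positivity)]
      apply ENNReal.ofReal_le_ofReal
      rw [hl2]
      have h2 := hgap.1 h
      have h3 : b^2/a ≤ 3 * (Real.sqrt (a^2+b^2) - a) := by
        rw [div_le_iff₀ h0]; linarith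
      calc ℓ^(-γ) * (4*ℓ*b) * (4*ℓ*b/a - -(4*ℓ*b/a)) = 32 * (ℓ^2*ℓ^(-γ)) * (b^2/a) := by field_simp; ring
        _ ≤ 32 * (ℓ^2*ℓ^(-γ)) * (3 * (Real.sqrt (a^2+b^2) - a)) := by gcongr
        _ = _ := by ring
  · have h1 : ∀ p : ℝ, ENNReal.ofReal ((|p| + ℓ)^(-γ)) * ENNReal.ofReal (4*ℓ*b - |p| * a) ≤
        ENNReal.ofReal (4*ℓ*b) * ENNReal.ofReal ((|p| + ℓ)^(-γ)) := fun p => by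
      rw [mul_comm]
      refine mul_le_mul_left (ENNReal.ofReal_le_ofReal ?_) _
      have : 0 ≤ |p| * a := by positivity
      linarith
    refine (lintegral_mono h1).trans ?_
    rw [lintegral_const_mul' _ _ ofReal_ne_top, lint_abs (fun p => ENNReal.ofReal ((p + ℓ)^(-γ)))]
    have h2 : ∫⁻ p in Set.Ioi (0:ℝ), ENNReal.ofReal ((p + ℓ)^(-γ)) = ENNReal.ofReal (-ℓ^(-γ+1)/(-γ+1)) := by
      rw [← lint_rpow_Ioi hℓ (by linarith), ← lintegral_indicator measurableSet_Ioi, ← lintegral_indicator measurableSet_Ioi,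
        ← lintegral_add_right_eq_self (fun t => (Set.Ioi ℓ).indicator (fun t => ENNReal.ofReal (t^(-γ))) t) ℓ]
      refine lintegral_congr fun p => ?_
      by_cases hp : 0 < p
      · rw [Set.indicator_of_mem (by simpa using hp), Set.indicator_of_mem (by simpa using hp)]
      · rw [Set.indicator_of_notMem (by simpa using hp), Set.indicator_of_notMem (by simpa using hp)]
    rw [h2, ← ENNReal.ofReal_ofNat, ← ENNReal.ofReal_mul (by norm_num), ← ENNReal.ofReal_mul (by positivity)]
    apply ENNReal.ofReal_le_ofReal
    rw [hl2, Real.rpow_add hℓ, Real.rpow_one]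
    have h3 := hgap.2 h.le
    have h4 : -(ℓ^(-γ) * ℓ)/(-γ+1) ≤ 2 * (ℓ^(-γ) * ℓ) := by
      rw [show -(ℓ^(-γ) * ℓ)/(-γ+1) = (ℓ^(-γ) * ℓ)/(γ-1) by rw [show -γ+1 = -(γ-1) by ring, neg_div_neg_eq]]
      rw [div_le_iff₀ (by linarith)]
      have : 0 < ℓ^(-γ) * ℓ := by positivity
      nlinarith
    have h5 : 0 ≤ ℓ^2 * ℓ^(-γ) := by positivity
    calc 4*ℓ*b * (2 * (-(ℓ^(-γ) * ℓ)/(-γ+1))) ≤ 4*ℓ*b * (2 * (2 * (ℓ^(-γ) * ℓ))) := by gcongr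
      _ = 16 * (ℓ^2 * ℓ^(-γ)) * b := by ring
      _ ≤ 16 * (ℓ^2 * ℓ^(-γ)) * (3 * (Real.sqrt (a^2+b^2) - a)) := by gcongr
      _ ≤ _ := by nlinarith [mul_nonneg h5 hS]

theorem ker_far {m : ℕ} {R : ℝ} (hR : 2 ≤ R) {x y : Eu (m+1)} (hx : x ∈ Sh m R) (hy : y ∈ Sh m R) :
    (|‖y‖ - ‖x‖| + R * ‖nrm x - nrm y‖) / 4 ≤ ‖x - y‖ ∧ R * ‖nrm x - nrm y‖ ≤ 2 * ‖x - y‖ := by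
  have hx1 : R - 1 < ‖x‖ := hx.1
  have hy1 : R - 1 < ‖y‖ := hy.1
  have hx0 : x ≠ 0 := norm_pos_iff.1 (by linarith)
  have hy0 : y ≠ 0 := norm_pos_iff.1 (by linarith)
  have h := norm_sub_sq_polar x y hx0 hy0
  change _ = _ + _ * ‖nrm x - nrm y‖^2 at h
  set d := ‖nrm x - nrm y‖
  have hd : 0 ≤ d := norm_nonneg _
  have h1 : (R/2)*(R/2) ≤ ‖x‖*‖y‖ := mul_le_mul (by linarith) (by linarith) (by linarith) (norm_nonneg _)
  have h2 : (R/2)*(R/2)*d^2 ≤ ‖x‖*‖y‖*d^2 := by gcongr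
  have h3 : (‖x‖ - ‖y‖)^2 = |‖y‖ - ‖x‖|^2 := by rw [sq_abs]; ring
  rw [h3] at h
  have h4 := abs_nonneg (‖y‖ - ‖x‖)
  have h0 := norm_nonneg (x - y)
  constructor
  · refine (pow_le_pow_iff_left₀ (by positivity) h0 two_ne_zero).1 ?_
    rw [h]
    nlinarith [sq_nonneg (|‖y‖ - ‖x‖| - R * d)]
  · refine (pow_le_pow_iff_left₀ (by positivity) (by positivity) two_ne_zero).1 ?_
    rw [mul_pow 2, h]
    nlinarith [sq_nonneg (|‖y‖ - ‖x‖|)]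


/-! ## Section C4: double polar coordinates -/

/-- the constant `n ω_n` -/
def nw (m : ℕ) : ℝ≥0∞ := ((m:ℝ≥0∞)+1) * volume (ball (0:Eu (m+1)) 1)

theorem nw_ne_zero (m : ℕ) : nw m ≠ 0 := mul_ne_zero (by simp) (vol1_pos m)
theorem nw_ne_top (m : ℕ) : nw m ≠ ∞ := by have := vol1_top m; unfold nw; finiteness

theorem shell_pow {m : ℕ} {R t : ℝ} (hR : 2 ≤ R) (ht : t ∈ Set.Ioo (R-1) (R+1)) :
    ENNReal.ofReal (t^m) ≤ ENNReal.ofReal ((3*R/2)^m) := by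
  refine ENNReal.ofReal_le_ofReal (pow_le_pow_left₀ ?_ ?_ _)
  · have := ht.1; linarith
  · have := ht.2; linarith

theorem nrm_av {m : ℕ} {t : ℝ} (ht : 0 < t) (g : GG m) : nrm (t • av g (e1 m)) = av g (e1 m) := by
  rw [nrm_smul _ ht, nrm, av_norm, e1_norm, inv_one, one_smul]

theorem polar2a {m : ℕ} {R : ℝ} (hR : 2 ≤ R) {Φ : ℝ × ℝ × ℝ → ℝ≥0∞} (hΦ : Measurable Φ) :
    ∫⁻ x in Sh m R, ∫⁻ y in Sh m R, Φ (‖x‖, ‖y‖, R * ‖nrm x - nrm y‖) ≤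
      (nw m * ENNReal.ofReal ((3*R/2)^m))^2 * ∫⁻ r in Set.Ioo (R-1) (R+1), ∫⁻ ρ in Set.Ioo (R-1) (R+1),
        ∫⁻ g, (∫⁻ h, Φ (r, ρ, R * ‖av g (e1 m) - av h (e1 m)‖) ∂(hG m)) ∂(hG m) := by
  set M := ENNReal.ofReal ((3*R/2)^m) with hM
  set J := Set.Ioo (R-1) (R+1) with hJ
  have hMt : M ≠ ∞ := ofReal_ne_top
  have hct := nw_ne_top m
  -- generic shell bound
  have key : ∀ φ : Eu (m+1) → ℝ≥0∞, Measurable φ → ∫⁻ x in Sh m R, φ x ≤ nw m * M * ∫⁻ t in J, ∫⁻ g, φ (t • av g (e1 m)) ∂(hG m) := by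
    intro φ hφ
    rw [polar_Sh (by linarith) hφ, mul_assoc (nw m), ← lintegral_const_mul' _ _ hMt]
    refine mul_le_mul_right (setLIntegral_mono' measurableSet_Ioo fun t ht => ?_) _
    exact mul_le_mul_left (shell_pow hR ht) _
  have hgm : Measurable fun g : GG m => av g (e1 m) := av_meas_left _
  set Ξ : Eu (m+1) → ℝ≥0∞ := fun x => ∫⁻ ρ in J, ∫⁻ h, Φ (‖x‖, ρ, R * ‖nrm x - av h (e1 m)‖) ∂(hG m) with hΞ
  have m1 : Measurable fun q : (Eu (m+1) × ℝ) × GG m => Φ (‖q.1.1‖, q.1.2, R * ‖nrm q.1.1 - av q.2 (e1 m)‖) := by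
    refine hΦ.comp ?_
    have a1 : Measurable fun q : (Eu (m+1) × ℝ) × GG m => nrm q.1.1 := nrm_meas.comp (measurable_fst.comp measurable_fst)
    have a2 : Measurable fun q : (Eu (m+1) × ℝ) × GG m => av q.2 (e1 m) := hgm.comp measurable_snd
    have a3 : Measurable fun q : (Eu (m+1) × ℝ) × GG m => R * ‖nrm q.1.1 - av q.2 (e1 m)‖ := ((a1.sub a2).norm).const_mul R
    exact Measurable.prodMk (by fun_prop) (Measurable.prodMk (by fun_prop) a3)
  have m2 : Measurable fun q : Eu (m+1) × ℝ => ∫⁻ h, Φ (‖q.1‖, q.2, R * ‖nrm q.1 - av h (e1 m)‖) ∂(hG m) :=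
    m1.lintegral_prod_right'
  have hΞm : Measurable Ξ := m2.lintegral_prod_right'
  have step1 : ∀ x ∈ Sh m R, ∫⁻ y in Sh m R, Φ (‖x‖, ‖y‖, R * ‖nrm x - nrm y‖) ≤ nw m * M * Ξ x := by
    intro x _
    have hmy : Measurable fun y : Eu (m+1) => Φ (‖x‖, ‖y‖, R * ‖nrm x - nrm y‖) := by
      refine hΦ.comp ?_
      have a3 : Measurable fun y : Eu (m+1) => R * ‖nrm x - nrm y‖ := ((measurable_const.sub nrm_meas).norm).const_mul R
      exact Measurable.prodMk (by fun_prop) (Measurable.prodMk (by fun_prop) a3)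
    refine (key _ hmy).trans (le_of_eq ?_)
    congr 1
    refine setLIntegral_congr_fun measurableSet_Ioo fun t ht => ?_
    have ht0 : 0 < t := by have := ht.1; linarith
    refine lintegral_congr fun h => ?_
    rw [norm_smul_av ht0, nrm_av ht0]
  calc _ ≤ ∫⁻ x in Sh m R, nw m * M * Ξ x := setLIntegral_mono' (Sh_meas m R) step1
    _ = nw m * M * ∫⁻ x in Sh m R, Ξ x := lintegral_const_mul' _ _ (by finiteness)
    _ ≤ nw m * M * (nw m * M * ∫⁻ t in J, ∫⁻ g, Ξ (t • av g (e1 m)) ∂(hG m)) := mul_le_mul_right (key _ hΞm) _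
    _ = _ := by
        rw [sq, mul_assoc (nw m * M)]
        congr 2
        refine setLIntegral_congr_fun measurableSet_Ioo fun t ht => ?_
        have ht0 : 0 < t := by have := ht.1; linarith
        simp only [hΞ, norm_smul_av ht0, nrm_av ht0]
        rw [lintegral_lintegral_swap]
        have hc : Measurable fun q : GG m × ℝ => ((t • av q.1 (e1 m), q.2) : Eu (m+1) × ℝ) :=
          Measurable.prodMk ((hgm.comp measurable_fst).const_smul t) measurable_snd
        have h3 := m2.comp hc
        refine Measurable.aemeasurable ?_
        refine Eq.mp ?_ h3
        congr 1
        funext q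
        simp only [Function.comp, Function.uncurry, norm_smul_av ht0, nrm_av ht0]

theorem polar2 {m : ℕ} {R : ℝ} (hR : 2 ≤ R) {H : ℝ × ℝ × ℝ → ℝ≥0∞} (hH : Measurable H) :
    ∫⁻ x in Sh m R, ∫⁻ y in Sh m R, ∫⁻ s in Set.Ioo (0:ℝ) 1,
      H (‖y‖ - ‖x‖, (1-s) * ‖x‖ + s * ‖y‖, R * ‖nrm x - nrm y‖) ≤
      (nw m * ENNReal.ofReal ((3*R/2)^m))^2 * ∫⁻ t in Set.Ioo (R-1) (R+1), ∫⁻ p : ℝ,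
        ∫⁻ g, (∫⁻ h, H (p, t, R * ‖av g (e1 m) - av h (e1 m)‖) ∂(hG m)) ∂(hG m) := by
  set J := Set.Ioo (R-1) (R+1) with hJ
  set N := (nw m * ENNReal.ofReal ((3*R/2)^m))^2 with hN
  have hgm : Measurable fun g : GG m => av g (e1 m) := av_meas_left _
  set A : ℝ × ℝ → ℝ≥0∞ := fun q => ∫⁻ g, (∫⁻ h, H (q.1, q.2, R * ‖av g (e1 m) - av h (e1 m)‖) ∂(hG m)) ∂(hG m) with hA
  have hAm : Measurable A := by
    have a1 : Measurable fun q : ((ℝ × ℝ) × GG m) × GG m => H (q.1.1.1, q.1.1.2, R * ‖av q.1.2 (e1 m) - av q.2 (e1 m)‖) := by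
      refine hH.comp ?_
      have b1 : Measurable fun q : ((ℝ × ℝ) × GG m) × GG m => av q.1.2 (e1 m) := hgm.comp (measurable_snd.comp measurable_fst)
      have b2 : Measurable fun q : ((ℝ × ℝ) × GG m) × GG m => av q.2 (e1 m) := hgm.comp measurable_snd
      have b3 : Measurable fun q : ((ℝ × ℝ) × GG m) × GG m => R * ‖av q.1.2 (e1 m) - av q.2 (e1 m)‖ := ((b1.sub b2).norm).const_mul R
      exact Measurable.prodMk (by fun_prop) (Measurable.prodMk (by fun_prop) b3)
    have a2 : Measurable fun q : (ℝ × ℝ) × GG m => ∫⁻ h, H (q.1.1, q.1.2, R * ‖av q.2 (e1 m) - av h (e1 m)‖) ∂(hG m) :=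
      a1.lintegral_prod_right'
    exact a2.lintegral_prod_right'
  have hmeas : Measurable fun q : (Eu (m+1) × Eu (m+1)) × ℝ =>
      H (‖q.1.2‖ - ‖q.1.1‖, (1-q.2) * ‖q.1.1‖ + q.2 * ‖q.1.2‖, R * ‖nrm q.1.1 - nrm q.1.2‖) := by
    refine hH.comp ?_
    have b1 : Measurable fun q : (Eu (m+1) × Eu (m+1)) × ℝ => nrm q.1.1 := nrm_meas.comp (measurable_fst.comp measurable_fst)
    have b2 : Measurable fun q : (Eu (m+1) × Eu (m+1)) × ℝ => nrm q.1.2 := nrm_meas.comp (measurable_snd.comp measurable_fst)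
    have b3 : Measurable fun q : (Eu (m+1) × Eu (m+1)) × ℝ => R * ‖nrm q.1.1 - nrm q.1.2‖ := ((b1.sub b2).norm).const_mul R
    exact Measurable.prodMk (by fun_prop) (Measurable.prodMk (by fun_prop) b3)
  have sw : ∫⁻ x in Sh m R, ∫⁻ y in Sh m R, ∫⁻ s in Set.Ioo (0:ℝ) 1,
      H (‖y‖ - ‖x‖, (1-s) * ‖x‖ + s * ‖y‖, R * ‖nrm x - nrm y‖) =
      ∫⁻ s in Set.Ioo (0:ℝ) 1, ∫⁻ x in Sh m R, ∫⁻ y in Sh m R,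
      H (‖y‖ - ‖x‖, (1-s) * ‖x‖ + s * ‖y‖, R * ‖nrm x - nrm y‖) := by
    have s1 : ∀ x : Eu (m+1), ∫⁻ y in Sh m R, ∫⁻ s in Set.Ioo (0:ℝ) 1,
        H (‖y‖ - ‖x‖, (1-s) * ‖x‖ + s * ‖y‖, R * ‖nrm x - nrm y‖) = ∫⁻ s in Set.Ioo (0:ℝ) 1, ∫⁻ y in Sh m R,
        H (‖y‖ - ‖x‖, (1-s) * ‖x‖ + s * ‖y‖, R * ‖nrm x - nrm y‖) := by
      intro x
      rw [lintegral_lintegral_swap]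
      have hc : Measurable fun q : Eu (m+1) × ℝ => (((x, q.1), q.2) : (Eu (m+1) × Eu (m+1)) × ℝ) := by fun_prop
      have := hmeas.comp hc
      exact this.aemeasurable
    simp_rw [s1]
    rw [lintegral_lintegral_swap]
    have hc : Measurable fun q : (Eu (m+1) × ℝ) × Eu (m+1) => (((q.1.1, q.2), q.1.2) : (Eu (m+1) × Eu (m+1)) × ℝ) := by fun_prop
    have h1 := hmeas.comp hc
    have h2 : Measurable fun q : Eu (m+1) × ℝ => ∫⁻ y in Sh m R, H (‖y‖ - ‖q.1‖, (1-q.2) * ‖q.1‖ + q.2 * ‖y‖, R * ‖nrm q.1 - nrm y‖) :=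
      h1.lintegral_prod_right'
    exact h2.aemeasurable
  rw [sw]
  have fixed : ∀ s ∈ Set.Ioo (0:ℝ) 1, ∫⁻ x in Sh m R, ∫⁻ y in Sh m R,
      H (‖y‖ - ‖x‖, (1-s) * ‖x‖ + s * ‖y‖, R * ‖nrm x - nrm y‖) ≤ N * ∫⁻ t in J, ∫⁻ p : ℝ, A (p, t) := by
    intro s hs
    have hΦ : Measurable fun q : ℝ × ℝ × ℝ => H (q.2.1 - q.1, (1-s) * q.1 + s * q.2.1, q.2.2) := hH.comp (by fun_prop)
    refine (polar2a hR hΦ).trans (mul_le_mul_right ?_ _)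
    have hAs : Measurable fun q : ℝ × ℝ => J.indicator (fun t => A (q.2, t)) (q.1 + s * q.2) := by
      have h1 : Measurable fun q : ℝ × ℝ => A (q.2, q.1 + s * q.2) := hAm.comp (by fun_prop)
      have h2 : MeasurableSet {q : ℝ × ℝ | q.1 + s * q.2 ∈ J} :=
        (show Measurable fun q : ℝ × ℝ => q.1 + s * q.2 by fun_prop) measurableSet_Ioo
      exact h1.indicator h2
    calc _ ≤ ∫⁻ r : ℝ, ∫⁻ ρ : ℝ, J.indicator (fun t => A (ρ - r, t)) (r + s * (ρ - r)) := by
          refine le_trans ?_ (setLIntegral_le_lintegral J _)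
          refine setLIntegral_mono' measurableSet_Ioo fun r hr => ?_
          refine le_trans ?_ (setLIntegral_le_lintegral J _)
          refine setLIntegral_mono' measurableSet_Ioo fun ρ hρ => ?_
          have hmem : r + s * (ρ - r) ∈ J := by
            have h1 := hr.1; have h2 := hr.2; have h3 := hρ.1; have h4 := hρ.2
            have h5 := hs.1; have h6 := hs.2
            constructor <;> nlinarith
          rw [Set.indicator_of_mem hmem]
          apply le_of_eq
          simp only [hA]
          rw [show (1 - s) * r + s * ρ = r + s * (ρ - r) by ring]
      _ = ∫⁻ r : ℝ, ∫⁻ p : ℝ, J.indicator (fun t => A (p, t)) (r + s * p) := by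
          refine lintegral_congr fun r => ?_
          exact lintegral_sub_right_eq_self (fun p : ℝ => J.indicator (fun t => A (p, t)) (r + s * p)) r
      _ = ∫⁻ p : ℝ, ∫⁻ r : ℝ, J.indicator (fun t => A (p, t)) (r + s * p) := by
          rw [lintegral_lintegral_swap]
          exact hAs.aemeasurable
      _ = ∫⁻ p : ℝ, ∫⁻ t in J, A (p, t) := by
          refine lintegral_congr fun p => ?_
          rw [← lintegral_indicator measurableSet_Ioo]
          exact lintegral_add_right_eq_self (fun r : ℝ => J.indicator (fun t => A (p, t)) r) (s * p)
      _ = ∫⁻ t in J, ∫⁻ p : ℝ, A (p, t) := by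
          rw [lintegral_lintegral_swap]
          exact hAm.aemeasurable
  calc _ ≤ ∫⁻ s in Set.Ioo (0:ℝ) 1, N * ∫⁻ t in J, ∫⁻ p : ℝ, A (p, t) := setLIntegral_mono' measurableSet_Ioo fixed
    _ = _ := by rw [setLIntegral_const, Real.volume_Ioo, sub_zero, ENNReal.ofReal_one, mul_one]


/-! ## Section C5: the tangential term -/

def kk (γ δ : ℝ) (p ℓ : ℝ) : ℝ≥0∞ :=
  {q : ℝ × ℝ | 0 < q.2 ∧ q.2 ≤ 4*δ}.indicator (fun q => ENNReal.ofReal (4^γ) * ENNReal.ofReal ((|q.1| + q.2)^(-γ))) (p, ℓ)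

theorem kk_set_meas (δ : ℝ) : MeasurableSet {q : ℝ × ℝ | 0 < q.2 ∧ q.2 ≤ 4*δ} :=
  (measurableSet_lt measurable_const measurable_snd).inter (measurableSet_le measurable_snd measurable_const)

theorem kk_meas (γ δ : ℝ) : Measurable fun q : ℝ × ℝ => kk γ δ q.1 q.2 := by
  unfold kk
  refine Measurable.indicator ?_ (kk_set_meas δ)
  have : Measurable fun q : ℝ × ℝ => |q.1| + q.2 := by fun_prop
  exact ((this.pow_const _).ennreal_ofReal).const_mul _

/-- tangential excess -/
def Ps {m : ℕ} (f : Eu (m+1) → ℝ) (p t ℓ : ℝ) : ℝ≥0∞ :=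
  ∫⁻ g, ENNReal.ofReal (4 * ℓ * bb f t g - |p| * aa f t g) ∂(hG m)

/-- averaged gap between the gradient and its radial part -/
def DD {m : ℕ} (f : Eu (m+1) → ℝ) (t : ℝ) : ℝ≥0∞ :=
  ∫⁻ g, ENNReal.ofReal (Real.sqrt (aa f t g ^ 2 + bb f t g ^ 2) - aa f t g) ∂(hG m)

theorem Ps_meas0 {m : ℕ} {f : Eu (m+1) → ℝ} (hf : ContDiff ℝ 1 f) :
    Measurable fun q : (ℝ × ℝ × ℝ) × GG m => ENNReal.ofReal (4 * q.1.2.2 * bb f q.1.2.1 q.2 - |q.1.1| * aa f q.1.2.1 q.2) := by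
  have hc : Measurable fun q : (ℝ × ℝ × ℝ) × GG m => ((q.1.2.1, q.2) : ℝ × GG m) := by fun_prop
  have ha : Measurable fun q : (ℝ × ℝ × ℝ) × GG m => aa f q.1.2.1 q.2 := (aa_meas hf).comp hc
  have hb : Measurable fun q : (ℝ × ℝ × ℝ) × GG m => bb f q.1.2.1 q.2 := (bb_meas hf).comp hc
  have h1 : Measurable fun q : (ℝ × ℝ × ℝ) × GG m => 4 * q.1.2.2 := by fun_prop
  have h2 : Measurable fun q : (ℝ × ℝ × ℝ) × GG m => |q.1.1| := by fun_prop
  exact ((h1.mul hb).sub (h2.mul ha)).ennreal_ofReal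

theorem Ps_meas {m : ℕ} {f : Eu (m+1) → ℝ} (hf : ContDiff ℝ 1 f) :
    Measurable fun q : ℝ × ℝ × ℝ => Ps f q.1 q.2.1 q.2.2 := (Ps_meas0 hf).lintegral_prod_right'

theorem k1_kk {m : ℕ} {a δ b R : ℝ} (ha' : a < m+1) (hba : b ≤ a) (_hbm : b < m + 1) (hδ : 0 < δ) (hδ' : 2*δ ≤ 1) (hR : 2 ≤ R)
    (f : Eu (m+1) → ℝ) {x y : Eu (m+1)} (hx : x ∈ Sh m R) (hy : y ∈ Sh m R) (t : ℝ) :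
    k1 m a δ (x - y) * Ps f (‖y‖ - ‖x‖) t (R * ‖nrm x - nrm y‖) ≤
      kk (m + 1 - b) δ (‖y‖ - ‖x‖) (R * ‖nrm x - nrm y‖) * Ps f (‖y‖ - ‖x‖) t (R * ‖nrm x - nrm y‖) := by
  obtain ⟨h1, h2⟩ := ker_far hR hx hy
  set ℓ := R * ‖nrm x - nrm y‖ with hℓ
  set p := ‖y‖ - ‖x‖ with hp
  have hℓ0 : 0 ≤ ℓ := by positivity
  rcases hℓ0.eq_or_lt with h0 | h0
  · have : Ps f p t ℓ = 0 := by
      unfold Ps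
      rw [← h0]
      have : ∀ g : GG m, ENNReal.ofReal (4 * 0 * bb f t g - |p| * aa f t g) = 0 := fun g => by
        refine ENNReal.ofReal_of_nonpos ?_
        have := mul_nonneg (abs_nonneg p) (aa_nonneg f t g)
        linarith
      simp_rw [this]
      simp
    rw [this, mul_zero, mul_zero]
  by_cases hz : 2*δ ≤ ‖x - y‖
  · rw [k1_zero hz, zero_mul]; exact zero_le
  push Not at hz
  refine mul_le_mul_left ?_ _
  have hpl : 0 < (|p| + ℓ)/4 := by have := abs_nonneg p; linarith
  have hz0 : 0 < ‖x - y‖ := lt_of_lt_of_le hpl h1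
  have hmem : (p, ℓ) ∈ {q : ℝ × ℝ | 0 < q.2 ∧ q.2 ≤ 4*δ} := ⟨h0, by show ℓ ≤ 4*δ; linarith⟩
  rw [kk, Set.indicator_of_mem hmem]
  refine (k1_le ha' hδ (norm_pos_iff.1 hz0)).trans ?_
  rw [← ENNReal.ofReal_mul (by positivity)]
  refine ENNReal.ofReal_le_ofReal ?_
  calc ‖x - y‖ ^ (a - ((m:ℝ)+1)) ≤ ‖x - y‖ ^ (-((m:ℝ)+1-b)) :=
        Real.rpow_le_rpow_of_exponent_ge hz0 (by linarith) (by linarith)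
    _ ≤ ((|p| + ℓ)/4) ^ (-((m:ℝ)+1-b)) := Real.rpow_le_rpow_of_nonpos hpl h1 (by linarith)
    _ = _ := by
        rw [Real.div_rpow (by linarith) (by norm_num), Real.rpow_neg (by norm_num : (0:ℝ) ≤ 4), div_inv_eq_mul, mul_comm]

def CT (m : ℕ) (b : ℝ) : ℝ := 4^((m:ℝ)+1-b) * 96 * (2^(m+1) * 4^(1+b)) * (9/4)^m * 2^m

set_option maxHeartbeats 1000000 in
theorem T2_est {m : ℕ} {a δ b R : ℝ} (hm : 1 ≤ m) (ha' : a < m+1) (hba : b ≤ a) (hb : 0 < b) (hb' : b ≤ 1/2)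
    (hδ : 0 < δ) (hδ' : 2*δ ≤ 1) (hR : 2 ≤ R) {f : Eu (m+1) → ℝ} (hf : ContDiff ℝ 1 f) :
    ∫⁻ x in Sh m R, ∫⁻ y in Sh m R, k1 m a δ (x - y) * ∫⁻ s in Set.Ioo (0:ℝ) 1,
      Ps f (‖y‖ - ‖x‖) ((1-s) * ‖x‖ + s * ‖y‖) (R * ‖nrm x - nrm y‖) ≤
      nw m ^ 2 * ENNReal.ofReal (CT m b * δ^(1+b)) * ∫⁻ t in Set.Ioo (R-1) (R+1), ENNReal.ofReal (t^m) * DD f t := by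
  have hm1 : (1:ℝ) ≤ m := by exact_mod_cast hm
  set γ : ℝ := (m:ℝ) + 1 - b with hγ
  have hgm : Measurable fun g : GG m => av g (e1 m) := av_meas_left _
  set H : ℝ × ℝ × ℝ → ℝ≥0∞ := fun q => kk γ δ q.1 q.2.2 * Ps f q.1 q.2.1 q.2.2 with hH
  have hHm : Measurable H := by
    have h1 : Measurable fun q : ℝ × ℝ × ℝ => kk γ δ q.1 q.2.2 :=
      (kk_meas γ δ).comp (show Measurable fun q : ℝ × ℝ × ℝ => (q.1, q.2.2) by fun_prop)
    exact h1.mul (Ps_meas hf)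
  have hPsx : ∀ x y : Eu (m+1), Measurable fun s : ℝ => Ps f (‖y‖ - ‖x‖) ((1-s) * ‖x‖ + s * ‖y‖) (R * ‖nrm x - nrm y‖) := by
    intro x y
    exact (Ps_meas hf).comp (show Measurable fun s : ℝ => ((‖y‖ - ‖x‖, (1-s) * ‖x‖ + s * ‖y‖, R * ‖nrm x - nrm y‖) : ℝ × ℝ × ℝ) by fun_prop)
  have step1 : ∫⁻ x in Sh m R, ∫⁻ y in Sh m R, k1 m a δ (x - y) * ∫⁻ s in Set.Ioo (0:ℝ) 1,
      Ps f (‖y‖ - ‖x‖) ((1-s) * ‖x‖ + s * ‖y‖) (R * ‖nrm x - nrm y‖) ≤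
      ∫⁻ x in Sh m R, ∫⁻ y in Sh m R, ∫⁻ s in Set.Ioo (0:ℝ) 1,
        H (‖y‖ - ‖x‖, (1-s) * ‖x‖ + s * ‖y‖, R * ‖nrm x - nrm y‖) := by
    refine setLIntegral_mono' (Sh_meas m R) fun x hx => setLIntegral_mono' (Sh_meas m R) fun y hy => ?_
    rw [← lintegral_const_mul _ (hPsx x y)]
    refine lintegral_mono fun s => ?_
    exact k1_kk ha' hba (by linarith) hδ hδ' hR f hx hy _
  refine step1.trans ((polar2 hR hHm).trans ?_)
  -- inner estimate
  have inner : ∀ t ∈ Set.Ioo (R-1) (R+1), ∫⁻ p : ℝ, ∫⁻ g, (∫⁻ h, H (p, t, R * ‖av g (e1 m) - av h (e1 m)‖) ∂(hG m)) ∂(hG m) ≤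
      ENNReal.ofReal (4^γ * 96 * (R^(1-(m:ℝ)+b) * (2^(m+1) * (4*δ/R)^(1+b)))) * DD f t := by
    intro t ht
    set ℓ : GG m → GG m → ℝ := fun g h => R * ‖av g (e1 m) - av h (e1 m)‖ with hℓ
    have mℓ : Measurable fun q : GG m × GG m => ℓ q.1 q.2 := by
      have b1 : Measurable fun q : GG m × GG m => av q.1 (e1 m) := hgm.comp measurable_fst
      have b2 : Measurable fun q : GG m × GG m => av q.2 (e1 m) := hgm.comp measurable_snd
      exact ((b1.sub b2).norm).const_mul R
    have mH : Measurable fun q : (ℝ × GG m) × GG m => H (q.1.1, t, ℓ q.1.2 q.2) := by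
      have h1 : Measurable fun q : (ℝ × GG m) × GG m => ℓ q.1.2 q.2 := by
        have h0 : Measurable fun q : (ℝ × GG m) × GG m => (q.1.2, q.2) := (measurable_snd.comp measurable_fst).prodMk measurable_snd
        have h00 := mℓ.comp h0
        exact h00
      have h2 : Measurable fun q : (ℝ × GG m) × GG m => q.1.1 := measurable_fst.comp measurable_fst
      have h3 : Measurable fun q : (ℝ × GG m) × GG m => ((q.1.1, t, ℓ q.1.2 q.2) : ℝ × ℝ × ℝ) :=
        h2.prodMk (measurable_const.prodMk h1)
      exact hHm.comp h3
    have sw1 : ∫⁻ p : ℝ, ∫⁻ g, (∫⁻ h, H (p, t, ℓ g h) ∂(hG m)) ∂(hG m) =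
        ∫⁻ g, (∫⁻ p : ℝ, (∫⁻ h, H (p, t, ℓ g h) ∂(hG m))) ∂(hG m) := by
      rw [lintegral_lintegral_swap]
      have : Measurable fun q : ℝ × GG m => ∫⁻ h, H (q.1, t, ℓ q.2 h) ∂(hG m) := mH.lintegral_prod_right'
      exact this.aemeasurable
    have sw2 : ∀ g, ∫⁻ p : ℝ, (∫⁻ h, H (p, t, ℓ g h) ∂(hG m)) = ∫⁻ h, (∫⁻ p : ℝ, H (p, t, ℓ g h)) ∂(hG m) := by
      intro g
      rw [lintegral_lintegral_swap]
      have := mH.comp (show Measurable fun q : ℝ × GG m => ((q.1, g), q.2) by fun_prop)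
      exact this.aemeasurable
    rw [sw1]
    simp_rw [sw2]
    -- integral over p
    have hp : ∀ l : ℝ, ∫⁻ p : ℝ, H (p, t, l) ≤ {l : ℝ | 0 < l ∧ l ≤ 4*δ}.indicator
        (fun l => ENNReal.ofReal (4^γ * 96) * ENNReal.ofReal (l^(1-(m:ℝ)+b)) * DD f t) l := by
      intro l
      by_cases hl : 0 < l ∧ l ≤ 4*δ
      · rw [Set.indicator_of_mem (show l ∈ {l : ℝ | 0 < l ∧ l ≤ 4*δ} from hl)]
        have mPs : Measurable fun q : ℝ × GG m => ENNReal.ofReal (4 * l * bb f t q.2 - |q.1| * aa f t q.2) :=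
          (Ps_meas0 hf).comp (show Measurable fun q : ℝ × GG m => (((q.1, t, l), q.2) : (ℝ × ℝ × ℝ) × GG m) by fun_prop)
        have mG : Measurable fun q : ℝ × GG m => ENNReal.ofReal ((|q.1| + l)^(-γ)) * ENNReal.ofReal (4 * l * bb f t q.2 - |q.1| * aa f t q.2) := by
          have h1 : Measurable fun q : ℝ × GG m => |q.1| + l := by fun_prop
          exact ((h1.pow_const _).ennreal_ofReal).mul mPs
        calc ∫⁻ p : ℝ, H (p, t, l) = ∫⁻ p : ℝ, ENNReal.ofReal (4^γ) * ∫⁻ g, ENNReal.ofReal ((|p| + l)^(-γ)) *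
              ENNReal.ofReal (4 * l * bb f t g - |p| * aa f t g) ∂(hG m) := by
              refine lintegral_congr fun p => ?_
              simp only [hH, kk]
              rw [Set.indicator_of_mem (show (p, l) ∈ {q : ℝ × ℝ | 0 < q.2 ∧ q.2 ≤ 4*δ} from hl), mul_assoc, Ps,
                ← lintegral_const_mul' _ _ ofReal_ne_top]
          _ = ENNReal.ofReal (4^γ) * ∫⁻ g, (∫⁻ p : ℝ, ENNReal.ofReal ((|p| + l)^(-γ)) *
              ENNReal.ofReal (4 * l * bb f t g - |p| * aa f t g)) ∂(hG m) := by
              rw [lintegral_const_mul' _ _ ofReal_ne_top, lintegral_lintegral_swap]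
              exact mG.aemeasurable
          _ ≤ ENNReal.ofReal (4^γ) * ∫⁻ g, ENNReal.ofReal (96 * l^(2-γ)) *
              ENNReal.ofReal (Real.sqrt (aa f t g ^ 2 + bb f t g ^ 2) - aa f t g) ∂(hG m) :=
              mul_le_mul_right (lintegral_mono fun g => line_est hl.1 (aa_nonneg f t g) (bb_nonneg f t g) (by rw [hγ]; linarith)) _
          _ = _ := by
              rw [lintegral_const_mul' _ _ ofReal_ne_top, ← DD, show 2 - γ = 1 - (m:ℝ) + b by rw [hγ]; ring,
                ENNReal.ofReal_mul (p := (4:ℝ)^γ) (q := 96) (by positivity), ENNReal.ofReal_mul (p := 96) (by norm_num)]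
              ring
      · rw [Set.indicator_of_notMem (show l ∉ {l : ℝ | 0 < l ∧ l ≤ 4*δ} from hl)]
        have : ∀ p, H (p, t, l) = 0 := fun p => by
          simp only [hH, kk]
          rw [Set.indicator_of_notMem (show (p, l) ∉ {q : ℝ × ℝ | 0 < q.2 ∧ q.2 ≤ 4*δ} from hl), zero_mul]
        simp_rw [this]
        simp
    have hgest : ∀ g : GG m, ∫⁻ h, (∫⁻ p : ℝ, H (p, t, ℓ g h)) ∂(hG m) ≤
        ENNReal.ofReal (4^γ * 96 * (R^(1-(m:ℝ)+b) * (2^(m+1) * (4*δ/R)^(1+b)))) * DD f t := by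
      intro g
      set σ := av g (e1 m) with hσ
      have hσ1 : ‖σ‖ = 1 := by rw [hσ, av_norm, e1_norm]
      set S : Set (GG m) := {h : GG m | ‖σ - av h (e1 m)‖ ≤ 4*δ/R} with hS
      have hSm : MeasurableSet S := measurableSet_le ((measurable_const.sub (av_meas_left _)).norm) measurable_const
      have mr : Measurable fun h : GG m => ENNReal.ofReal (‖σ - av h (e1 m)‖ ^ (1-(m:ℝ)+b)) :=
        (((measurable_const.sub (av_meas_left _)).norm).pow_const _).ennreal_ofReal
      calc ∫⁻ h, (∫⁻ p : ℝ, H (p, t, ℓ g h)) ∂(hG m) ≤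
            ∫⁻ h in S, ENNReal.ofReal (4^γ * 96) * (ENNReal.ofReal (R^(1-(m:ℝ)+b)) * ENNReal.ofReal (‖σ - av h (e1 m)‖ ^ (1-(m:ℝ)+b))) * DD f t ∂(hG m) := by
            rw [← lintegral_indicator hSm]
            refine lintegral_mono fun h => (hp _).trans ?_
            by_cases hl : 0 < ℓ g h ∧ ℓ g h ≤ 4*δ
            · have hhS : h ∈ S := by
                show ‖σ - av h (e1 m)‖ ≤ 4*δ/R
                rw [le_div_iff₀ (by linarith)]
                have := hl.2
                simp only [hℓ] at this
                linarith
              rw [Set.indicator_of_mem (show ℓ g h ∈ {l : ℝ | 0 < l ∧ l ≤ 4*δ} from hl), Set.indicator_of_mem hhS]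
              simp only [hℓ]
              rw [Real.mul_rpow (by linarith) (norm_nonneg _), ENNReal.ofReal_mul (p := R ^ (1-(m:ℝ)+b)) (by positivity)]
            · rw [Set.indicator_of_notMem (show ℓ g h ∉ {l : ℝ | 0 < l ∧ l ≤ 4*δ} from hl)]
              exact zero_le
        _ = ENNReal.ofReal (4^γ * 96) * (ENNReal.ofReal (R^(1-(m:ℝ)+b)) * ∫⁻ h in S, ENNReal.ofReal (‖σ - av h (e1 m)‖ ^ (1-(m:ℝ)+b)) ∂(hG m)) * DD f t := by
            rw [lintegral_mul_const _ ((mr.const_mul _).const_mul _), lintegral_const_mul' _ _ ofReal_ne_top, lintegral_const_mul' _ _ ofReal_ne_top]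
        _ ≤ ENNReal.ofReal (4^γ * 96) * (ENNReal.ofReal (R^(1-(m:ℝ)+b)) * ENNReal.ofReal (2^(m+1) * (4*δ/R)^(1+b))) * DD f t := by
            refine mul_le_mul_left (mul_le_mul_right (mul_le_mul_right ?_ _) _) _
            exact sphere_est hm hb hb' (by positivity) hσ1
        _ = _ := by
            rw [← ENNReal.ofReal_mul (by positivity), ← ENNReal.ofReal_mul (by positivity)]
    calc _ ≤ ∫⁻ g, ENNReal.ofReal (4^γ * 96 * (R^(1-(m:ℝ)+b) * (2^(m+1) * (4*δ/R)^(1+b)))) * DD f t ∂(hG m) := lintegral_mono hgest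
      _ = _ := by simp
  have hR0 : 0 < R := by linarith
  rw [mul_pow, mul_assoc, mul_assoc]
  refine mul_le_mul_right ?_ _
  rw [← ENNReal.ofReal_pow (by positivity), ← lintegral_const_mul' _ _ ofReal_ne_top, ← lintegral_const_mul' _ _ ofReal_ne_top]
  refine setLIntegral_mono' measurableSet_Ioo fun t ht => ?_
  refine (mul_le_mul_right (inner t ht) _).trans ?_
  rw [← mul_assoc, ← mul_assoc (ENNReal.ofReal (CT m b * δ^(1+b)))]
  refine mul_le_mul_left ?_ _
  have ht1 := ht.1
  have ht0 : 0 < t := by linarith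
  have hCT : 0 ≤ CT m b := by unfold CT; positivity
  rw [← ENNReal.ofReal_mul (by positivity), ← ENNReal.ofReal_mul (by positivity)]
  refine ENNReal.ofReal_le_ofReal ?_
  have e1' : R^(1-(m:ℝ)+b) * (4*δ/R)^(1+b) * R^m = 4^(1+b) * δ^(1+b) := by
    rw [Real.div_rpow (by positivity) hR0.le, Real.mul_rpow (by norm_num) hδ.le, show 1-(m:ℝ)+b = (1+b) - m by ring,
      Real.rpow_sub hR0, Real.rpow_natCast]
    field_simp
  have e2' : R^m ≤ 2^m * t^m := by
    rw [← mul_pow]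
    exact pow_le_pow_left₀ hR0.le (by linarith) _
  calc ((3*R/2)^m)^2 * (4^γ * 96 * (R^(1-(m:ℝ)+b) * (2^(m+1) * (4*δ/R)^(1+b))))
      = (9/4)^m * (4^γ * 96 * 2^(m+1)) * (R^(1-(m:ℝ)+b) * (4*δ/R)^(1+b) * R^m) * R^m := by
        have : ((3*R/2)^m)^2 = (9/4)^m * R^m * R^m := by
          rw [← pow_mul, mul_comm m 2, pow_mul, ← mul_pow, ← mul_pow]; congr 1; ring
        rw [this]; ring
    _ ≤ (9/4)^m * (4^γ * 96 * 2^(m+1)) * (R^(1-(m:ℝ)+b) * (4*δ/R)^(1+b) * R^m) * (2^m * t^m) := by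
        gcongr
    _ = _ := by rw [e1', CT]; ring


/-! ## Section C6: the nonlocal perimeter of a smooth function is controlled -/

def QK (m : ℕ) (a δ R : ℝ) (f : Eu (m+1) → ℝ) : ℝ≥0∞ :=
  ∫⁻ x in Sh m R, ∫⁻ y in Sh m R, k1 m a δ (x - y) * ‖f x - f y‖ₑ

theorem setlint_av {m : ℕ} (g : GG m) (R : ℝ) (φ : Eu (m+1) → ℝ≥0∞) :
    ∫⁻ x in Sh m R, φ (av g x) = ∫⁻ x in Sh m R, φ x := by
  rw [← lintegral_indicator (Sh_meas m R), ← lintegral_indicator (Sh_meas m R), ← lint_av g ((Sh m R).indicator φ)]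
  refine lintegral_congr fun x => ?_
  by_cases h : x ∈ Sh m R
  · have h' : av g x ∈ Sh m R := by
      rw [Sh, Set.mem_ofPred_eq, av_norm]; exact h
    rw [Set.indicator_of_mem h, Set.indicator_of_mem h']
  · have h' : av g x ∉ Sh m R := by
      rw [Sh, Set.mem_ofPred_eq, av_norm]; exact h
    rw [Set.indicator_of_notMem h, Set.indicator_of_notMem h']

theorem QK_av {m : ℕ} (a δ R : ℝ) (f : Eu (m+1) → ℝ) (g : GG m) :
    QK m a δ R f = ∫⁻ x in Sh m R, ∫⁻ y in Sh m R, k1 m a δ (x - y) * ‖f (av g x) - f (av g y)‖ₑ := by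
  unfold QK
  rw [← setlint_av g R]
  refine lintegral_congr fun x => ?_
  rw [← setlint_av g R]
  refine lintegral_congr fun y => ?_
  rw [← map_sub, k1_av]

theorem QK_avg {m : ℕ} (a δ R : ℝ) {f : Eu (m+1) → ℝ} (hf : Measurable f) :
    QK m a δ R f = ∫⁻ x in Sh m R, ∫⁻ y in Sh m R, k1 m a δ (x - y) * ∫⁻ g, ‖f (av g x) - f (av g y)‖ₑ ∂(hG m) := by
  have h1 : QK m a δ R f = ∫⁻ g, (∫⁻ x in Sh m R, ∫⁻ y in Sh m R, k1 m a δ (x - y) * ‖f (av g x) - f (av g y)‖ₑ) ∂(hG m) := by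
    rw [lintegral_congr (fun g => (QK_av a δ R f g).symm)]
    simp
  have hm : Measurable fun q : (GG m × Eu (m+1)) × Eu (m+1) => k1 m a δ (q.1.2 - q.2) * ‖f (av q.1.1 q.1.2) - f (av q.1.1 q.2)‖ₑ := by
    have a1 : Measurable fun q : (GG m × Eu (m+1)) × Eu (m+1) => q.1.2 - q.2 := by fun_prop
    have a2 : Measurable fun q : (GG m × Eu (m+1)) × Eu (m+1) => av q.1.1 q.1.2 :=
      av_meas_comp (measurable_fst.comp measurable_fst) (measurable_snd.comp measurable_fst)
    have a3 : Measurable fun q : (GG m × Eu (m+1)) × Eu (m+1) => av q.1.1 q.2 :=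
      av_meas_comp (measurable_fst.comp measurable_fst) measurable_snd
    have a4 := (k1_meas m a δ).comp a1
    have a5 := ((hf.comp a2).sub (hf.comp a3)).enorm
    exact a4.mul a5
  rw [h1]
  have sw1 : ∫⁻ g, (∫⁻ x in Sh m R, ∫⁻ y in Sh m R, k1 m a δ (x - y) * ‖f (av g x) - f (av g y)‖ₑ) ∂(hG m) =
      ∫⁻ x in Sh m R, (∫⁻ g, (∫⁻ y in Sh m R, k1 m a δ (x - y) * ‖f (av g x) - f (av g y)‖ₑ) ∂(hG m)) := by
    rw [lintegral_lintegral_swap]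
    have : Measurable fun q : GG m × Eu (m+1) => ∫⁻ y in Sh m R, k1 m a δ (q.2 - y) * ‖f (av q.1 q.2) - f (av q.1 y)‖ₑ :=
      hm.lintegral_prod_right'
    exact this.aemeasurable
  rw [sw1]
  refine lintegral_congr fun x => ?_
  rw [lintegral_lintegral_swap]
  · refine lintegral_congr fun y => ?_
    rw [lintegral_const_mul]
    have a2 : Measurable fun g : GG m => av g x := av_meas_left x
    have a3 : Measurable fun g : GG m => av g y := av_meas_left y
    exact ((hf.comp a2).sub (hf.comp a3)).enorm
  · have h0 : Measurable fun q : GG m × Eu (m+1) => (((q.1, x), q.2) : (GG m × Eu (m+1)) × Eu (m+1)) :=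
      (measurable_fst.prodMk measurable_const).prodMk measurable_snd
    have h00 := hm.comp h0
    exact h00.aemeasurable

theorem EK_flip {m : ℕ} {a δ : ℝ} (F G : Set (Eu (m+1))) : EK (k1 m a δ) F G = EK (k1 m a δ) G F := by
  unfold EK
  rw [lintegral_lintegral_swap]
  · refine lintegral_congr fun x => lintegral_congr fun y => k1_swap a δ _ _
  · have : Measurable fun q : Eu (m+1) × Eu (m+1) => q.1 - q.2 := by fun_prop
    have h := (k1_meas m a δ).comp this
    exact h.aemeasurable

/-- the segment integral -/
theorem seg_int (φ : ℝ → ℝ≥0∞) {r ρ R : ℝ} (hr : r ∈ Set.Ioo (R-1) (R+1)) (hρ : ρ ∈ Set.Ioo (R-1) (R+1)) :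
    ∫⁻ s in Set.Ioo (0:ℝ) 1, ENNReal.ofReal |ρ - r| * φ ((1-s)*r + s*ρ) ≤
      ∫⁻ t in Set.Ioo (R-1) (R+1), {t : ℝ | r < t ∧ t ≤ ρ ∨ t ≤ r ∧ ρ < t}.indicator φ t := by
  rcases eq_or_ne r ρ with h | h
  · subst h; simp
  have hd : ∀ s ∈ Set.Ioo (0:ℝ) 1, HasDerivWithinAt (fun s => (1-s)*r + s*ρ) (ρ - r) (Set.Ioo 0 1) s := by
    intro s _
    have h1 : HasDerivAt (fun s : ℝ => r + s*(ρ-r)) (1 * (ρ - r)) s := ((hasDerivAt_id s).mul_const (ρ-r)).const_add r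
    rw [one_mul] at h1
    have h2 : (fun s : ℝ => (1-s)*r + s*ρ) = fun s => r + s*(ρ-r) := by funext s; ring
    rw [h2]
    exact h1.hasDerivWithinAt
  have hinj : Set.InjOn (fun s : ℝ => (1-s)*r + s*ρ) (Set.Ioo 0 1) := by
    intro s _ s' _ hss
    have h3 : (s - s') * (ρ - r) = 0 := by simp only at hss; linarith
    rcases mul_eq_zero.1 h3 with h4 | h4
    · linarith
    · exact absurd (by linarith) h
  have key := lintegral_image_eq_lintegral_abs_deriv_mul measurableSet_Ioo hd hinj φ
  rw [← key]
  have hS : MeasurableSet {t : ℝ | r < t ∧ t ≤ ρ ∨ t ≤ r ∧ ρ < t} :=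
    ((measurableSet_lt measurable_const measurable_id).inter (measurableSet_le measurable_id measurable_const)).union
      ((measurableSet_le measurable_id measurable_const).inter (measurableSet_lt measurable_const measurable_id))
  rw [setLIntegral_indicator hS]
  refine lintegral_mono_set ?_
  rintro t ⟨s, ⟨hs0, hs1⟩, rfl⟩
  obtain ⟨h1, h2⟩ := hr
  obtain ⟨h3, h4⟩ := hρ
  refine ⟨?_, ?_, ?_⟩
  · rcases lt_or_gt_of_ne h with h5 | h5
    · left; constructor <;> simp only <;> nlinarith
    · right; constructor <;> simp only <;> nlinarith
  · simp only; nlinarith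
  · simp only; nlinarith

theorem T1_est {m : ℕ} {a δ R : ℝ} {f : Eu (m+1) → ℝ} (hf : ContDiff ℝ 1 f) :
    ∫⁻ x in Sh m R, ∫⁻ y in Sh m R, k1 m a δ (x - y) * ∫⁻ s in Set.Ioo (0:ℝ) 1,
      ENNReal.ofReal |‖y‖ - ‖x‖| * AA f ((1-s) * ‖x‖ + s * ‖y‖) ≤
      2 * ∫⁻ t in Set.Ioo (R-1) (R+1), AA f t * phat m a δ t := by
  set J := Set.Ioo (R-1) (R+1) with hJ
  have hAm := AA_meas hf
  set Φ : (Eu (m+1) × Eu (m+1)) × ℝ → ℝ≥0∞ := fun q => {q : (Eu (m+1) × Eu (m+1)) × ℝ | ‖q.1.1‖ < q.2 ∧ q.2 ≤ ‖q.1.2‖ ∨ q.2 ≤ ‖q.1.1‖ ∧ ‖q.1.2‖ < q.2}.indicator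
    (fun q => k1 m a δ (q.1.1 - q.1.2) * AA f q.2) q with hΦ
  have hn1 : Measurable fun q : (Eu (m+1) × Eu (m+1)) × ℝ => ‖q.1.1‖ := by fun_prop
  have hn2 : Measurable fun q : (Eu (m+1) × Eu (m+1)) × ℝ => ‖q.1.2‖ := by fun_prop
  have hS : MeasurableSet {q : (Eu (m+1) × Eu (m+1)) × ℝ | ‖q.1.1‖ < q.2 ∧ q.2 ≤ ‖q.1.2‖ ∨ q.2 ≤ ‖q.1.1‖ ∧ ‖q.1.2‖ < q.2} :=
    ((measurableSet_lt hn1 measurable_snd).inter (measurableSet_le measurable_snd hn2)).union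
      ((measurableSet_le measurable_snd hn1).inter (measurableSet_lt hn2 measurable_snd))
  have hΦm : Measurable Φ := by
    have a1 : Measurable fun q : (Eu (m+1) × Eu (m+1)) × ℝ => q.1.1 - q.1.2 := by fun_prop
    have a2 := (k1_meas m a δ).comp a1
    have a3 : Measurable fun q : (Eu (m+1) × Eu (m+1)) × ℝ => AA f q.2 := hAm.comp measurable_snd
    exact (a2.mul a3).indicator hS
  have step1 : ∫⁻ x in Sh m R, ∫⁻ y in Sh m R, k1 m a δ (x - y) * ∫⁻ s in Set.Ioo (0:ℝ) 1,
      ENNReal.ofReal |‖y‖ - ‖x‖| * AA f ((1-s) * ‖x‖ + s * ‖y‖) ≤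
      ∫⁻ x in Sh m R, ∫⁻ y in Sh m R, ∫⁻ t in J, Φ ((x, y), t) := by
    refine setLIntegral_mono' (Sh_meas m R) fun x hx => setLIntegral_mono' (Sh_meas m R) fun y hy => ?_
    refine (mul_le_mul_right (seg_int (AA f) hx hy) _).trans (le_of_eq ?_)
    have hS' : MeasurableSet {t : ℝ | ‖x‖ < t ∧ t ≤ ‖y‖ ∨ t ≤ ‖x‖ ∧ ‖y‖ < t} :=
      ((measurableSet_lt measurable_const measurable_id).inter (measurableSet_le measurable_id measurable_const)).union
        ((measurableSet_le measurable_id measurable_const).inter (measurableSet_lt measurable_const measurable_id))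
    rw [← lintegral_const_mul _ (hAm.indicator hS')]
    refine lintegral_congr fun t => ?_
    simp only [hΦ]
    by_cases ht : ‖x‖ < t ∧ t ≤ ‖y‖ ∨ t ≤ ‖x‖ ∧ ‖y‖ < t
    · rw [Set.indicator_of_mem (show t ∈ {t : ℝ | ‖x‖ < t ∧ t ≤ ‖y‖ ∨ t ≤ ‖x‖ ∧ ‖y‖ < t} from ht), Set.indicator_of_mem]
      exact ht
    · rw [Set.indicator_of_notMem (show t ∉ {t : ℝ | ‖x‖ < t ∧ t ≤ ‖y‖ ∨ t ≤ ‖x‖ ∧ ‖y‖ < t} from ht), Set.indicator_of_notMem, mul_zero]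
      exact ht
  have sw : ∫⁻ x in Sh m R, ∫⁻ y in Sh m R, ∫⁻ t in J, Φ ((x, y), t) = ∫⁻ t in J, ∫⁻ x in Sh m R, ∫⁻ y in Sh m R, Φ ((x, y), t) := by
    have s1 : ∀ x : Eu (m+1), ∫⁻ y in Sh m R, ∫⁻ t in J, Φ ((x, y), t) = ∫⁻ t in J, ∫⁻ y in Sh m R, Φ ((x, y), t) := by
      intro x
      rw [lintegral_lintegral_swap]
      have hc : Measurable fun q : Eu (m+1) × ℝ => (((x, q.1), q.2) : (Eu (m+1) × Eu (m+1)) × ℝ) := by fun_prop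
      have := hΦm.comp hc
      exact this.aemeasurable
    simp_rw [s1]
    rw [lintegral_lintegral_swap]
    have hc : Measurable fun q : (Eu (m+1) × ℝ) × Eu (m+1) => (((q.1.1, q.2), q.1.2) : (Eu (m+1) × Eu (m+1)) × ℝ) := by fun_prop
    have h1 := hΦm.comp hc
    have h2 : Measurable fun q : Eu (m+1) × ℝ => ∫⁻ y in Sh m R, Φ ((q.1, y), q.2) := h1.lintegral_prod_right'
    exact h2.aemeasurable
  have hin : ∀ t, ∫⁻ x in Sh m R, ∫⁻ y in Sh m R, Φ ((x, y), t) ≤ 2 * (AA f t * phat m a δ t) := by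
    intro t
    have hball : MeasurableSet (ball (0:Eu (m+1)) t) := measurableSet_ball
    have kmx : ∀ x : Eu (m+1), Measurable fun y : Eu (m+1) => k1 m a δ (x - y) := fun x =>
      (k1_meas m a δ).comp (measurable_const.sub measurable_id)
    have km2 : Measurable fun q : Eu (m+1) × Eu (m+1) => k1 m a δ (q.1 - q.2) :=
      (k1_meas m a δ).comp (measurable_fst.sub measurable_snd)
    have hP1 : AA f t * phat m a δ t = ∫⁻ x in ball (0:Eu (m+1)) t, ∫⁻ y in (ball (0:Eu (m+1)) t)ᶜ, k1 m a δ (x - y) * AA f t := by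
      rw [phat, EK, mul_comm, ← lintegral_mul_const]
      · refine lintegral_congr fun x => ?_
        rw [lintegral_mul_const _ (kmx x)]
      · exact km2.lintegral_prod_right'
    have hP2 : AA f t * phat m a δ t = ∫⁻ x in (ball (0:Eu (m+1)) t)ᶜ, ∫⁻ y in ball (0:Eu (m+1)) t, k1 m a δ (x - y) * AA f t := by
      rw [phat, EK_flip, EK, mul_comm, ← lintegral_mul_const]
      · refine lintegral_congr fun x => ?_
        rw [lintegral_mul_const _ (kmx x)]
      · exact km2.lintegral_prod_right'
    rw [two_mul]
    nth_rewrite 1 [hP1]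
    rw [hP2, ← lintegral_indicator hball, ← lintegral_indicator hball.compl]
    refine le_trans (setLIntegral_le_lintegral _ _) ?_
    rw [← lintegral_add_left']
    swap
    · refine Measurable.aemeasurable ?_
      refine Measurable.indicator ?_ hball
      have : Measurable fun q : Eu (m+1) × Eu (m+1) => k1 m a δ (q.1 - q.2) * AA f t := km2.mul_const _
      exact this.lintegral_prod_right'
    refine lintegral_mono fun x => ?_
    refine le_trans (setLIntegral_le_lintegral _ _) ?_
    by_cases hx : ‖x‖ < t
    · have hxb : x ∈ ball (0:Eu (m+1)) t := mem_ball_zero_iff.2 hx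
      simp only
      rw [Set.indicator_of_mem hxb, Set.indicator_of_notMem (by simpa using hxb), add_zero, ← lintegral_indicator hball.compl]
      refine lintegral_mono fun y => ?_
      simp only [hΦ]
      by_cases hy : t ≤ ‖y‖
      · rw [Set.indicator_of_mem (show y ∈ (ball (0:Eu (m+1)) t)ᶜ by simpa using hy)]
        exact Set.indicator_le_self _ _ _
      · rw [Set.indicator_of_notMem]
        · exact zero_le
        · rintro (h | h)
          · exact hy h.2
          · exact absurd hx (not_lt.2 h.1)
    · have hxb : x ∉ ball (0:Eu (m+1)) t := by simpa using hx
      simp only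
      rw [Set.indicator_of_notMem hxb, Set.indicator_of_mem (show x ∈ (ball (0:Eu (m+1)) t)ᶜ from hxb), zero_add, ← lintegral_indicator hball]
      refine lintegral_mono fun y => ?_
      simp only [hΦ]
      by_cases hy : ‖y‖ < t
      · rw [Set.indicator_of_mem (show y ∈ (ball (0:Eu (m+1)) t) from mem_ball_zero_iff.2 hy)]
        exact Set.indicator_le_self _ _ _
      · rw [Set.indicator_of_notMem]
        · exact zero_le
        · rintro (h | h)
          · exact hx h.1
          · exact hy h.2
  calc _ ≤ _ := step1
    _ = _ := sw
    _ ≤ ∫⁻ t in J, 2 * (AA f t * phat m a δ t) := lintegral_mono hin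
    _ = _ := lintegral_const_mul' _ _ (by norm_num)


theorem grad_pair {m : ℕ} (hm : 1 ≤ m) (f : Eu (m+1) → ℝ) (t : ℝ) (g : GG m) :
    Real.sqrt (aa f t g ^ 2 + bb f t g ^ 2) ≤ ‖fderiv ℝ f (t • av g (e1 m))‖ := by
  set L := fderiv ℝ f (t • av g (e1 m)) with hL
  set u := av g (e1 m) with hu
  set v := av g (e2 m) with hv
  have hun : ‖u‖ = 1 := by rw [hu, av_norm, e1_norm]
  have hvn : ‖v‖ = 1 := by rw [hv, av_norm, e2_norm]
  have huv : inner ℝ u v = 0 := by rw [hu, hv, av_inner, e12 hm]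
  have haa : aa f t g ^ 2 = L u ^ 2 := by rw [aa, sq_abs]
  have hbb : bb f t g ^ 2 = L v ^ 2 := by rw [bb, sq_abs]
  rw [haa, hbb]
  set S := Real.sqrt (L u ^ 2 + L v ^ 2) with hS
  have hS0 : 0 ≤ S := Real.sqrt_nonneg _
  have hS2 : S^2 = L u ^ 2 + L v ^ 2 := Real.sq_sqrt (by positivity)
  set w := L u • u + L v • v with hw
  have hwn : ‖w‖^2 = S^2 := by
    rw [hw, norm_add_sq_real, norm_smul, norm_smul, hun, hvn, inner_smul_left, inner_smul_right, huv, hS2, mul_one, mul_one,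
      Real.norm_eq_abs, Real.norm_eq_abs, sq_abs, sq_abs]
    ring
  have hwn' : ‖w‖ = S := (pow_left_inj₀ (norm_nonneg _) hS0 two_ne_zero).1 hwn
  have hLw : L w = S^2 := by
    rw [hw, map_add, map_smul, map_smul, hS2, smul_eq_mul, smul_eq_mul]; ring
  have h1 := L.le_opNorm w
  rw [hLw, hwn', Real.norm_eq_abs, abs_of_nonneg (by positivity)] at h1
  rcases hS0.eq_or_lt with h0 | h0
  · rw [← h0]; exact norm_nonneg _
  · nlinarith

theorem DD_meas {m : ℕ} {f : Eu (m+1) → ℝ} (hf : ContDiff ℝ 1 f) : Measurable (DD f) := by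
  have h1 : Measurable fun q : ℝ × GG m => ENNReal.ofReal (Real.sqrt (aa f q.1 q.2 ^ 2 + bb f q.1 q.2 ^ 2) - aa f q.1 q.2) :=
    (((((aa_meas hf).pow_const 2).add ((bb_meas hf).pow_const 2)).sqrt).sub (aa_meas hf)).ennreal_ofReal
  exact h1.lintegral_prod_right'

theorem grad_lower {m : ℕ} (hm : 1 ≤ m) {R : ℝ} (hR : 2 ≤ R) {f : Eu (m+1) → ℝ} (hf : ContDiff ℝ 1 f) :
    nw m * ∫⁻ t in Set.Ioo (R-1) (R+1), ENNReal.ofReal (t^m) * (AA f t + DD f t) ≤ ∫⁻ x, ‖fderiv ℝ f x‖ₑ := by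
  have hfm : Measurable fun x : Eu (m+1) => ‖fderiv ℝ f x‖ₑ := (hf.continuous_fderiv one_ne_zero).measurable.enorm
  refine le_trans ?_ (setLIntegral_le_lintegral (Sh m R) _)
  rw [polar_Sh (by linarith) hfm]
  refine mul_le_mul_right (lintegral_mono fun t => mul_le_mul_right ?_ _) _
  have hat : Measurable fun g : GG m => ENNReal.ofReal (aa f t g) :=
    ((aa_meas hf).comp (show Measurable fun g : GG m => (t, g) from measurable_const.prodMk measurable_id)).ennreal_ofReal
  rw [AA, DD, ← lintegral_add_left hat]
  refine lintegral_mono fun g => ?_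
  have h1 := grad_pair hm f t g
  have h2 : aa f t g ≤ Real.sqrt (aa f t g ^ 2 + bb f t g ^ 2) :=
    Real.le_sqrt_of_sq_le (by have := sq_nonneg (bb f t g); linarith)
  rw [← ENNReal.ofReal_add (aa_nonneg _ _ _) (by linarith), ← ofReal_norm]
  exact ENNReal.ofReal_le_ofReal (by linarith)

/-- the calibration weight -/
def Th (m : ℕ) (a δ t : ℝ) : ℝ≥0∞ := kap m * nw m * ENNReal.ofReal (t^m) - phat m a δ t

theorem phat_le_Th {m : ℕ} {a δ t : ℝ} (hδ : 0 ≤ δ) (ht : 0 ≤ t) (hK : K0 m a δ ≤ kap m * nw m) :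
    phat m a δ t ≤ kap m * nw m * ENNReal.ofReal (t^m) :=
  (phat_le m a hδ ht).trans (mul_le_mul_left hK _)

theorem QK_main {m : ℕ} {a δ b R : ℝ} (hm : 1 ≤ m) (ha' : a < m+1) (hba : b ≤ a) (hb : 0 < b) (hb' : b ≤ 1/2)
    (hδ : 0 < δ) (hδ' : 2*δ ≤ 1) (hR : 2 ≤ R) (hC : nw m * ENNReal.ofReal (CT m b * δ^(1+b)) ≤ 2 * kap m)
    (hK : K0 m a δ ≤ kap m * nw m) {f : Eu (m+1) → ℝ} (hf : ContDiff ℝ 1 f) :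
    QK m a δ R f + 2 * ∫⁻ t in Set.Ioo (R-1) (R+1), Th m a δ t * AA f t ≤ 2 * (kap m * ∫⁻ x, ‖fderiv ℝ f x‖ₑ) := by
  set J := Set.Ioo (R-1) (R+1) with hJ
  have hAm := AA_meas hf
  have hDm := DD_meas hf
  have hkt := kap_ne_top m
  have hnt := nw_ne_top m
  have step1 : QK m a δ R f ≤ 2 * (∫⁻ t in J, AA f t * phat m a δ t) +
      nw m ^ 2 * ENNReal.ofReal (CT m b * δ^(1+b)) * ∫⁻ t in J, ENNReal.ofReal (t^m) * DD f t := by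
    refine le_trans ?_ (add_le_add (T1_est (a := a) (δ := δ) (R := R) hf) (T2_est hm ha' hba hb hb' hδ hδ' hR hf))
    rw [QK_avg a δ R hf.continuous.measurable]
    have mk : Measurable fun q : Eu (m+1) × Eu (m+1) => k1 m a δ (q.1 - q.2) :=
      (k1_meas m a δ).comp (measurable_fst.sub measurable_snd)
    have m0 : Measurable fun q : (Eu (m+1) × Eu (m+1)) × ℝ => ENNReal.ofReal |‖q.1.2‖ - ‖q.1.1‖| * AA f ((1-q.2) * ‖q.1.1‖ + q.2 * ‖q.1.2‖) := by
      have c1 : Measurable fun q : (Eu (m+1) × Eu (m+1)) × ℝ => (1-q.2) * ‖q.1.1‖ + q.2 * ‖q.1.2‖ := by fun_prop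
      have c2 : Measurable fun q : (Eu (m+1) × Eu (m+1)) × ℝ => ENNReal.ofReal |‖q.1.2‖ - ‖q.1.1‖| := by fun_prop
      have c3 := hAm.comp c1
      exact c2.mul c3
    have m1 : Measurable fun q : Eu (m+1) × Eu (m+1) => k1 m a δ (q.1 - q.2) * ∫⁻ s in Set.Ioo (0:ℝ) 1,
        ENNReal.ofReal |‖q.2‖ - ‖q.1‖| * AA f ((1-s) * ‖q.1‖ + s * ‖q.2‖) := by
      have c4 : Measurable fun q : Eu (m+1) × Eu (m+1) => ∫⁻ s in Set.Ioo (0:ℝ) 1,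
        ENNReal.ofReal |‖q.2‖ - ‖q.1‖| * AA f ((1-s) * ‖q.1‖ + s * ‖q.2‖) := m0.lintegral_prod_right'
      exact mk.mul c4
    rw [← lintegral_add_left (m1.lintegral_prod_right')]
    refine setLIntegral_mono' (Sh_meas m R) fun x hx => ?_
    have m1x : Measurable fun y : Eu (m+1) => k1 m a δ (x - y) * ∫⁻ s in Set.Ioo (0:ℝ) 1,
        ENNReal.ofReal |‖y‖ - ‖x‖| * AA f ((1-s) * ‖x‖ + s * ‖y‖) := by
      have h0 : Measurable fun y : Eu (m+1) => (x, y) := measurable_const.prodMk measurable_id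
      have h00 := m1.comp h0
      exact h00
    rw [← lintegral_add_left m1x]
    refine setLIntegral_mono' (Sh_meas m R) fun y hy => ?_
    rw [← mul_add]
    refine mul_le_mul_right ?_ _
    refine (C1_main hm hf hR hx.1 hx.2 hy.1 hy.2).trans (le_of_eq ?_)
    have m0x : Measurable fun s : ℝ => ENNReal.ofReal |‖y‖ - ‖x‖| * AA f ((1-s) * ‖x‖ + s * ‖y‖) := by
      have h0 : Measurable fun s : ℝ => ((x, y), s) := measurable_const.prodMk measurable_id
      have h00 := m0.comp h0
      exact h00
    rw [lintegral_add_left m0x]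
    rfl
  set I1 := ∫⁻ t in J, AA f t * phat m a δ t with hI1
  set I2 := ∫⁻ t in J, ENNReal.ofReal (t^m) * DD f t with hI2
  set I3 := ∫⁻ t in J, Th m a δ t * AA f t with hI3
  set I4 := ∫⁻ t in J, ENNReal.ofReal (t^m) * AA f t with hI4
  have h13 : I1 + I3 ≤ kap m * nw m * I4 := by
    have hphm : Measurable fun t => phat m a δ t := by
      have mk : Measurable fun q : Eu (m+1) × Eu (m+1) => k1 m a δ (q.1 - q.2) :=
        (k1_meas m a δ).comp (measurable_fst.sub measurable_snd)
      have hs : MeasurableSet {q : (ℝ × Eu (m+1)) × Eu (m+1) | ‖q.1.2‖ < q.1.1 ∧ q.1.1 ≤ ‖q.2‖} := by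
        have n1 : Measurable fun q : (ℝ × Eu (m+1)) × Eu (m+1) => ‖q.1.2‖ := by fun_prop
        have n2 : Measurable fun q : (ℝ × Eu (m+1)) × Eu (m+1) => ‖q.2‖ := by fun_prop
        have n3 : Measurable fun q : (ℝ × Eu (m+1)) × Eu (m+1) => q.1.1 := by fun_prop
        exact (measurableSet_lt n1 n3).inter (measurableSet_le n3 n2)
      have mm : Measurable fun q : (ℝ × Eu (m+1)) × Eu (m+1) =>
          {q : (ℝ × Eu (m+1)) × Eu (m+1) | ‖q.1.2‖ < q.1.1 ∧ q.1.1 ≤ ‖q.2‖}.indicator (fun q => k1 m a δ (q.1.2 - q.2)) q := by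
        refine Measurable.indicator ?_ hs
        have n4 : Measurable fun q : (ℝ × Eu (m+1)) × Eu (m+1) => q.1.2 - q.2 := by fun_prop
        have := (k1_meas m a δ).comp n4
        exact this
      have m2 : Measurable fun q : ℝ × Eu (m+1) => ∫⁻ y, {q : (ℝ × Eu (m+1)) × Eu (m+1) | ‖q.1.2‖ < q.1.1 ∧ q.1.1 ≤ ‖q.2‖}.indicator
          (fun q => k1 m a δ (q.1.2 - q.2)) (q, y) := mm.lintegral_prod_right'
      have m3 : Measurable fun t : ℝ => ∫⁻ x, ∫⁻ y, {q : (ℝ × Eu (m+1)) × Eu (m+1) | ‖q.1.2‖ < q.1.1 ∧ q.1.1 ≤ ‖q.2‖}.indicator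
          (fun q => k1 m a δ (q.1.2 - q.2)) ((t, x), y) := m2.lintegral_prod_right'
      have he : (fun t => phat m a δ t) = fun t : ℝ => ∫⁻ x, ∫⁻ y, {q : (ℝ × Eu (m+1)) × Eu (m+1) | ‖q.1.2‖ < q.1.1 ∧ q.1.1 ≤ ‖q.2‖}.indicator
          (fun q => k1 m a δ (q.1.2 - q.2)) ((t, x), y) := by
        funext t
        rw [phat, EK, ← lintegral_indicator measurableSet_ball]
        refine lintegral_congr fun x => ?_
        by_cases hx : ‖x‖ < t
        · rw [Set.indicator_of_mem (mem_ball_zero_iff.2 hx), ← lintegral_indicator measurableSet_ball.compl]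
          refine lintegral_congr fun y => ?_
          by_cases hy : t ≤ ‖y‖
          · rw [Set.indicator_of_mem (by simpa using hy), Set.indicator_of_mem]
            exact ⟨hx, hy⟩
          · rw [Set.indicator_of_notMem (by simpa using hy), Set.indicator_of_notMem]
            exact fun h => hy h.2
        · rw [Set.indicator_of_notMem (by simpa using hx)]
          symm
          refine (lintegral_congr fun y => ?_).trans lintegral_zero
          rw [Set.indicator_of_notMem]
          exact fun h => hx h.1
      rw [he]; exact m3
    have hprod : Measurable fun t => AA f t * phat m a δ t := hAm.mul hphm
    rw [hI1, hI3, ← lintegral_add_left hprod, hI4, ← lintegral_const_mul' _ _ (by finiteness)]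
    refine setLIntegral_mono' measurableSet_Ioo fun t ht => ?_
    have ht0 : 0 ≤ t := by have := ht.1; linarith
    have h5 : phat m a δ t + Th m a δ t = kap m * nw m * ENNReal.ofReal (t^m) :=
      add_tsub_cancel_of_le (phat_le_Th hδ.le ht0 hK)
    rw [mul_comm (AA f t), ← add_mul, h5, mul_assoc]
  have hgl := grad_lower hm hR hf
  have hsum : ∫⁻ t in J, ENNReal.ofReal (t^m) * (AA f t + DD f t) = I4 + I2 := by
    simp_rw [mul_add]
    rw [lintegral_add_left]
    have : Measurable fun t : ℝ => ENNReal.ofReal (t^m) := by fun_prop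
    exact this.mul hAm
  rw [hsum] at hgl
  calc QK m a δ R f + 2 * I3 ≤ (2 * I1 + nw m ^ 2 * ENNReal.ofReal (CT m b * δ^(1+b)) * I2) + 2 * I3 := add_le_add_left step1 _
    _ = 2 * (I1 + I3) + nw m * (nw m * ENNReal.ofReal (CT m b * δ^(1+b))) * I2 := by ring
    _ ≤ 2 * (kap m * nw m * I4) + nw m * (2 * kap m) * I2 :=
        add_le_add (mul_le_mul_right h13 _) (mul_le_mul_left (mul_le_mul_right hC _) _)
    _ = 2 * (kap m * (nw m * (I4 + I2))) := by ring
    _ ≤ _ := mul_le_mul_right (mul_le_mul_right hgl _) _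


/-- real calibration data -/
structure Cal (m : ℕ) (a δ R c D : ℝ) (q q' : ℝ → ℝ) : Prop where
  der : ∀ t, HasDerivAt q (q' t) t
  cont : Continuous q'
  left : q (R-c) = 0
  right : q (R+c) = 0
  nn : ∀ t, |t - R| ≤ c → 0 ≤ q t
  le : ∀ t, |t - R| ≤ c → ENNReal.ofReal (q t) ≤ Th m a δ t
  at0 : ENNReal.ofReal (q R) + phat m a δ R = kap m * nw m * ENNReal.ofReal (R^m)
  bd : |q' R| ≤ D * R^m
  lip : ∀ t, |t - R| ≤ c → |q' t - q' R| ≤ D * R^m * |t - R|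

theorem bern {m : ℕ} (hm : 1 ≤ m) {R s : ℝ} (hR : 2 ≤ R) (hs : |s| ≤ 1/2) :
    R^m + m * R^(m-1) * s ≤ (R+s)^m := by
  have hR0 : 0 < R := by linarith
  have h1 := one_add_mul_le_pow (a := s/R) (by rw [le_div_iff₀ hR0]; have := (abs_le.1 hs).1; linarith) m
  have h2 := mul_le_mul_of_nonneg_left h1 (pow_pos hR0 m).le
  rw [← mul_pow] at h2
  have e1 : R * (1 + s/R) = R + s := by field_simp
  rw [e1] at h2
  refine le_trans (le_of_eq ?_) h2
  obtain ⟨k, rfl⟩ : ∃ k, m = k+1 := ⟨m-1, by omega⟩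
  simp only [Nat.add_sub_cancel]
  field_simp
  ring

set_option maxHeartbeats 1000000 in
theorem exists_cal {m : ℕ} (hm : 1 ≤ m) {a δ : ℝ} (ha : 0 < a) (ha' : a < (m:ℝ)+1) (hδ : 0 < δ)
    (hK : 2 * K0 m a δ ≤ kap m * nw m) :
    ∃ c D R0 : ℝ, 0 < c ∧ c ≤ 1/2 ∧ 0 ≤ D ∧ 2 ≤ R0 ∧ ∀ R, R0 ≤ R → ∃ q q' : ℝ → ℝ, Cal m a δ R c D q q' := by
  obtain ⟨C, hC, hC2⟩ := phat_quad m ha ha' hδ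
  set N := (kap m * nw m).toReal with hN
  have hNt : kap m * nw m ≠ ∞ := ENNReal.mul_ne_top (kap_ne_top m) (nw_ne_top m)
  have hN0 : 0 < N := ENNReal.toReal_pos (mul_ne_zero (kap_ne_zero m) (nw_ne_zero m)) hNt
  have hK0 := K0_ne_top m ha hδ
  have hKN : K0 m a δ ≤ kap m * nw m := le_trans (by rw [two_mul]; exact le_self_add) hK
  have hKr : 2 * (K0 m a δ).toReal ≤ N := by
    have := ENNReal.toReal_mono hNt hK
    rwa [ENNReal.toReal_mul, ENNReal.toReal_ofNat, ← hN] at this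
  set E := N * m + C with hE
  have hE0 : 0 ≤ E := by positivity
  set c := min (1/2) (N / (4 * (E+1))) with hc
  have hc0 : 0 < c := lt_min (by norm_num) (by positivity)
  have hc1 : c ≤ 1/2 := min_le_left _ _
  have hc2 : (E+1) * c ≤ N/4 := by
    have : c ≤ N / (4 * (E+1)) := min_le_right _ _
    rw [le_div_iff₀ (by positivity)] at this
    linarith
  refine ⟨c, (E + E/c^2 + (N + E*c)*2/c^2), max 2 (a + ((m:ℝ)+1)), hc0, hc1, by positivity, le_max_left _ _, fun R hR => ?_⟩
  have hR2 : 2 ≤ R := (le_max_left _ _).trans hR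
  have hR0 : 0 < R := by linarith
  obtain ⟨b, hb, hph⟩ := hC2 R hR2 ((le_max_right _ _).trans hR)
  set p := (phat m a δ R).toReal with hp
  have hpt : ∀ t, 0 ≤ t → phat m a δ t ≠ ∞ := fun t ht =>
    ne_top_of_le_ne_top (ENNReal.mul_ne_top hK0 ENNReal.ofReal_ne_top) (phat_le m a hδ.le ht)
  have hRm : 0 < R^m := by positivity
  have hp0 : 0 ≤ p := ENNReal.toReal_nonneg
  have hpK : p ≤ (K0 m a δ).toReal * R^m := by
    have := ENNReal.toReal_mono (ENNReal.mul_ne_top hK0 ENNReal.ofReal_ne_top) (phat_le m a hδ.le hR0.le)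
    rwa [ENNReal.toReal_mul, ENNReal.toReal_ofReal hRm.le] at this
  set Q0 := N * R^m - p with hQ0
  have hQ0l : N/2 * R^m ≤ Q0 := by nlinarith
  have hQ0u : Q0 ≤ N * R^m := by linarith
  set Q1 := N * (m * R^(m-1)) - b with hQ1
  have hR1 : R^(m-1) ≤ R^m := pow_le_pow_right₀ (by linarith) (by omega)
  have hQ1b : |Q1| ≤ E * R^m := by
    have h1 : |Q1| ≤ |N * (m * R^(m-1))| + |b| := abs_sub _ _
    have h2 : |N * (m * R^(m-1))| = N * (m * R^(m-1)) := abs_of_nonneg (by positivity)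
    have h3 : N * (m * R^(m-1)) ≤ N * (m * R^m) := by gcongr
    rw [hE]; linarith only [h1, h2, h3, hb]
  have hlin : ∀ s, |s| ≤ c → N/4 * R^m ≤ Q0 + Q1 * s := by
    intro s hs
    have h1 : |Q1 * s| ≤ E * R^m * c := by
      rw [abs_mul]; exact mul_le_mul hQ1b hs (abs_nonneg _) (by positivity)
    have h2 := (abs_le.1 h1).1
    have h3 : E * R^m * c ≤ N/4 * R^m := by nlinarith
    linarith
  have hsq : ∀ s, |s| ≤ c → s^2 ≤ c^2 := fun s hs => by
    rw [← sq_abs s]; exact pow_le_pow_left₀ (abs_nonneg _) hs 2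
  refine ⟨fun t => (Q0 + Q1 * (t - R)) * (1 - (t-R)^2/c^2), fun t => Q1 * (1 - (t-R)^2/c^2) + (Q0 + Q1*(t-R)) * (-(2*(t-R))/c^2), ?_⟩
  refine ⟨fun t => ?_, by fun_prop, ?_, ?_, fun t ht => ?_, fun t ht => ?_, ?_, ?_, fun t ht => ?_⟩
  · have h0 : HasDerivAt (fun t : ℝ => t - R) 1 t := (hasDerivAt_id t).sub_const R
    have h1 : HasDerivAt (fun t : ℝ => Q0 + Q1 * (t - R)) (Q1 * 1) t := (h0.const_mul Q1).const_add Q0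
    have h2 : HasDerivAt (fun t : ℝ => 1 - (t-R)^2/c^2) (-((2:ℕ) * (t-R)^(2-1) * 1 / c^2)) t :=
      ((h0.pow 2).div_const (c^2)).const_sub 1
    have h3 := h1.mul h2
    refine h3.congr_deriv ?_
    push_cast
    ring
  · have : (R - c - R)^2/c^2 = 1 := by
      rw [div_eq_one_iff_eq (by positivity)]; ring
    simp only [this]; ring
  · have : (R + c - R)^2/c^2 = 1 := by
      rw [div_eq_one_iff_eq (by positivity)]; ring
    simp only [this]; ring
  · have h1 := hlin _ ht
    have h2 : (t-R)^2/c^2 ≤ 1 := by rw [div_le_one (by positivity)]; exact hsq _ ht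
    exact mul_nonneg (le_trans (by positivity) h1) (by linarith)
  · have hs2 : |t - R| ≤ 1/2 := ht.trans hc1
    have ht0 : 0 < t := by have := (abs_le.1 hs2).1; linarith
    set s := t - R with hs
    have hts : t = R + s := by rw [hs]; ring
    rw [Th, ← ENNReal.ofReal_toReal (hpt t ht0.le), ← ENNReal.ofReal_toReal hNt, ← hN, ← ENNReal.ofReal_mul hN0.le,
      ← ENNReal.ofReal_sub _ ENNReal.toReal_nonneg]
    refine ENNReal.ofReal_le_ofReal ?_
    have h1 := hph s hs2
    rw [← hts] at h1
    have h2 := bern hm hR2 hs2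
    rw [← hts] at h2
    have h3 := mul_le_mul_of_nonneg_left h2 hN0.le
    have h4 := hlin s ht
    have h5 : C * R^m * s^2 ≤ (Q0 + Q1*s) * (s^2/c^2) := by
      have : C * R^m ≤ (Q0 + Q1*s)/c^2 := by
        rw [le_div_iff₀ (by positivity)]
        have e1 : C * c^2 ≤ (E+1) * c := by
          have : C ≤ E + 1 := by rw [hE]; have : 0 ≤ N*m := by positivity
                                 linarith
          have h6 : C * c^2 ≤ (E+1) * c^2 := by gcongr
          have h7 : c^2 ≤ c := by nlinarith
          have h8 : (E+1) * c^2 ≤ (E+1) * c := by gcongr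
          linarith
        have e2 : C * c^2 ≤ N/4 := e1.trans hc2
        have e3 := mul_le_mul_of_nonneg_right e2 hRm.le
        linarith
      have := mul_le_mul_of_nonneg_right this (sq_nonneg s)
      calc _ ≤ _ := this
        _ = _ := by ring
    rw [hQ0, hQ1] at *
    linarith only [h1, h3, h5]
  · have h0 : (Q0 + Q1 * (R - R)) * (1 - (R-R)^2/c^2) = Q0 := by simp
    simp only [h0]
    rw [← ENNReal.ofReal_toReal (hpt R hR0.le), ← ENNReal.ofReal_toReal hNt, ← hN, ← ENNReal.ofReal_mul hN0.le, ← hp,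
      ← ENNReal.ofReal_add (le_trans (by positivity) hQ0l) hp0]
    congr 1
    rw [hQ0]; ring
  · have h0 : Q1 * (1 - (R-R)^2/c^2) + (Q0 + Q1*(R-R)) * (-(2*(R-R))/c^2) = Q1 := by simp
    simp only [h0]
    refine hQ1b.trans ?_
    have : 0 ≤ E/c^2 + (N + E*c)*2/c^2 := by positivity
    nlinarith
  · have h0 : Q1 * (1 - (R-R)^2/c^2) + (Q0 + Q1*(R-R)) * (-(2*(R-R))/c^2) = Q1 := by simp
    simp only [h0]
    set s := t - R with hs
    have e : Q1 * (1 - s^2/c^2) + (Q0 + Q1*s) * (-(2*s)/c^2) - Q1 = -(Q1 * (s^2/c^2) + (Q0 + Q1*s) * (2 * s/c^2)) := by ring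
    rw [e, abs_neg]
    have hQ00 : 0 ≤ Q0 := le_trans (by positivity) hQ0l
    have a1 : |Q1 * (s^2/c^2)| ≤ E * R^m * (c * |s| / c^2) := by
      rw [abs_mul, abs_of_nonneg (a := s^2/c^2) (by positivity)]
      refine mul_le_mul hQ1b ?_ (by positivity) (by positivity)
      gcongr
      rw [← sq_abs, sq]; gcongr
    have a2 : |(Q0 + Q1*s) * (2 * s/c^2)| ≤ (N * R^m + E * R^m * c) * (2*|s|/c^2) := by
      rw [abs_mul]
      refine mul_le_mul ?_ ?_ (abs_nonneg _) (by positivity)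
      · refine (abs_add_le _ _).trans (add_le_add ?_ ?_)
        · rwa [abs_of_nonneg hQ00]
        · rw [abs_mul]; exact mul_le_mul hQ1b ht (abs_nonneg _) (by positivity)
      · rw [abs_div, abs_mul, abs_of_pos (a := c^2) (by positivity), abs_two]
    refine (abs_add_le _ _).trans ((add_le_add a1 a2).trans ?_)
    have a3 : c * |s| / c^2 ≤ |s|/c^2 := by
      refine div_le_div_of_nonneg_right ?_ (by positivity)
      nlinarith [abs_nonneg s]
    have a4 : E * R^m * (c * |s| / c^2) ≤ E * R^m * (|s|/c^2) := by gcongr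
    have a5 : 0 ≤ E * R^m * |s| := by positivity
    have a6 : (E + E/c^2 + (N + E*c)*2/c^2) * R^m * |s| =
        E * R^m * |s| + E * R^m * (|s|/c^2) + (N * R^m + E * R^m * c) * (2*|s|/c^2) := by ring
    rw [a6]; linarith only [a4, a5]


theorem cal_ray {R c M : ℝ} {m : ℕ} {q q' u u' : ℝ → ℝ} (hc : 0 < c) (hcR : c ≤ R) (hq : ∀ t, HasDerivAt q (q' t) t) (hq' : Continuous q')
    (hl : q (R-c) = 0) (hr : q (R+c) = 0) (hn : ∀ t, |t - R| ≤ c → 0 ≤ q t)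
    (hu : ∀ t, HasDerivAt u (u' t) t) (hu' : Continuous u') (hu0 : ∀ t, 0 ≤ u t) (hM0 : 0 ≤ M)
    (hM : ∀ t, |t - R| ≤ c → 0 ≤ q' t + M * t^m) :
    ∫⁻ t in Set.Ioo (R-c) (R+c), ENNReal.ofReal (u t * (q' t + M * t^m)) ≤
      (∫⁻ t in Set.Ioo (R-c) (R+c), ENNReal.ofReal (q t) * ENNReal.ofReal |u' t|) +
        ∫⁻ t in Set.Ioo (R-c) (R+c), ENNReal.ofReal (u t * (M * t^m)) := by
  have cq : Continuous q := continuous_iff_continuousAt.2 fun t => (hq t).continuousAt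
  have cu : Continuous u := continuous_iff_continuousAt.2 fun t => (hu t).continuousAt
  have hle : R - c ≤ R + c := by linarith
  have hab : ∀ t ∈ Set.Ioc (R-c) (R+c), |t - R| ≤ c := fun t ht => abs_le.2 ⟨by linarith [ht.1], by linarith [ht.2]⟩
  have key : ∀ v : ℝ → ℝ, Continuous v → (∀ t, |t - R| ≤ c → 0 ≤ v t) →
      ∫⁻ t in Set.Ioo (R-c) (R+c), ENNReal.ofReal (v t) = ENNReal.ofReal (∫ t in (R-c)..(R+c), v t) := by
    intro v hv hv0
    rw [intervalIntegral.integral_of_le hle, ofReal_integral_eq_lintegral_ofReal]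
    · exact setLIntegral_congr Ioo_ae_eq_Ioc
    · exact (hv.integrableOn_Icc).mono_set Set.Ioc_subset_Icc_self
    · exact (ae_restrict_iff' measurableSet_Ioc).2 (Eventually.of_forall fun t ht => hv0 t (hab t ht))
  have e1 := intervalIntegral.integral_deriv_mul_eq_sub (a := R-c) (b := R+c) (u := u) (v := q) (u' := u') (v' := q')
    (fun t _ => hu t) (fun t _ => hq t) (hu'.intervalIntegrable _ _) (hq'.intervalIntegrable _ _)
  rw [hl, hr, mul_zero, mul_zero, sub_zero] at e1
  have e2 : ∫⁻ t in Set.Ioo (R-c) (R+c), ENNReal.ofReal (q t) * ENNReal.ofReal |u' t| =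
      ∫⁻ t in Set.Ioo (R-c) (R+c), ENNReal.ofReal (q t * |u' t|) := by
    refine setLIntegral_congr_fun measurableSet_Ioo fun t ht => ?_
    exact (ENNReal.ofReal_mul (hn t (hab t (Set.Ioo_subset_Ioc_self ht)))).symm
  have tn : ∀ t, |t - R| ≤ c → 0 ≤ t := fun t ht => by have := (abs_le.1 ht).1; linarith
  rw [e2, key _ (by fun_prop) (fun t ht => mul_nonneg (hu0 t) (hM t ht)),
    key _ (by fun_prop) (fun t ht => mul_nonneg (hn t ht) (abs_nonneg _)),
    key _ (by fun_prop) (fun t ht => mul_nonneg (hu0 t) (mul_nonneg hM0 (pow_nonneg (tn t ht) _))),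
    ← ENNReal.ofReal_add]
  · refine ENNReal.ofReal_le_ofReal ?_
    have i1 : IntervalIntegrable (fun t => u' t * q t + u t * q' t) volume (R-c) (R+c) := by
      apply Continuous.intervalIntegrable; fun_prop
    have i2 : IntervalIntegrable (fun t => q t * |u' t|) volume (R-c) (R+c) := by
      apply Continuous.intervalIntegrable; fun_prop
    have i3 : IntervalIntegrable (fun t => u t * (M * t^m)) volume (R-c) (R+c) := by
      apply Continuous.intervalIntegrable; fun_prop
    have i4 : IntervalIntegrable (fun t => u t * (q' t + M * t^m)) volume (R-c) (R+c) := by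
      apply Continuous.intervalIntegrable; fun_prop
    have h5 : ∫ t in (R-c)..(R+c), u t * (q' t + M * t^m) ≤
        ∫ t in (R-c)..(R+c), ((u' t * q t + u t * q' t) + (q t * |u' t| + u t * (M * t^m))) := by
      refine intervalIntegral.integral_mono_on hle i4 (i1.add (i2.add i3)) fun t ht => ?_
      have h0 := hn t (abs_le.2 ⟨by linarith [ht.1], by linarith [ht.2]⟩)
      have := mul_le_mul_of_nonneg_left (neg_abs_le (u' t)) h0
      linarith
    rw [intervalIntegral.integral_add i1 (i2.add i3), e1, zero_add, intervalIntegral.integral_add i2 i3] at h5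
    exact h5
  · exact intervalIntegral.integral_nonneg hle fun t ht => mul_nonneg (hn t (abs_le.2 ⟨by linarith [ht.1], by linarith [ht.2]⟩)) (abs_nonneg _)
  · exact intervalIntegral.integral_nonneg hle fun t ht => mul_nonneg (hu0 t) (mul_nonneg hM0 (pow_nonneg (by linarith [ht.1]) _))

def Sc (m : ℕ) (R c : ℝ) : Set (Eu (m+1)) := {x | ‖x‖ ∈ Set.Ioo (R-c) (R+c)}

theorem Sc_meas (m : ℕ) (R c : ℝ) : MeasurableSet (Sc m R c) := measurable_norm measurableSet_Ioo

def nu (m : ℕ) : ℝ := (nw m).toReal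

theorem nu_pos (m : ℕ) : 0 < nu m := ENNReal.toReal_pos (nw_ne_zero m) (nw_ne_top m)
theorem ofReal_nu (m : ℕ) : ENNReal.ofReal (nu m) = nw m := ENNReal.ofReal_toReal (nw_ne_top m)

def calw (m : ℕ) (q' : ℝ → ℝ) (t : ℝ) : ℝ := q' t / (nu m * t^m)

/-- polar coordinates over a set of radii -/
theorem polar_set {m : ℕ} {s : Set ℝ} (hs : MeasurableSet s) (hs0 : s ⊆ Set.Ioi 0) {φ : Eu (m+1) → ℝ≥0∞} (hφ : Measurable φ) :
    ∫⁻ x in {x : Eu (m+1) | ‖x‖ ∈ s}, φ x = ∫⁻ g, (∫⁻ t in s, ENNReal.ofReal (nu m * t^m) * φ (t • av g (e1 m))) ∂(hG m) := by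
  have hS : MeasurableSet {x : Eu (m+1) | ‖x‖ ∈ s} := measurable_norm hs
  have hc : Measurable fun q : ℝ × GG m => q.1 • av q.2 (e1 m) :=
    measurable_fst.smul (av_meas_comp measurable_snd measurable_const)
  have hm2 : Measurable fun q : ℝ × GG m => φ (q.1 • av q.2 (e1 m)) := hφ.comp hc
  have hm3 : Measurable fun q : ℝ × GG m => ENNReal.ofReal (nu m * q.1^m) := by fun_prop
  have hm4 : Measurable fun q : ℝ × GG m => ENNReal.ofReal (nu m * q.1^m) * φ (q.1 • av q.2 (e1 m)) := hm3.mul hm2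
  rw [lintegral_lintegral_swap]
  rotate_left
  · have h0 := hm4.comp measurable_swap
    exact h0.aemeasurable
  rw [← lintegral_indicator hS, lint_polar (hφ.indicator hS), ← nw, ← lintegral_const_mul' _ _ (nw_ne_top m),
    ← lintegral_indicator measurableSet_Ioi, ← lintegral_indicator hs]
  refine lintegral_congr fun t => ?_
  by_cases h0 : 0 < t
  · rw [Set.indicator_of_mem (show t ∈ Set.Ioi 0 from h0)]
    by_cases h1 : t ∈ s
    · rw [Set.indicator_of_mem h1, lintegral_const_mul' _ _ ENNReal.ofReal_ne_top, ← mul_assoc]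
      congr 1
      · rw [ENNReal.ofReal_mul (nu_pos m).le, ofReal_nu]
      · refine lintegral_congr fun g => ?_
        rw [Set.indicator_of_mem]
        show ‖t • av g (e1 m)‖ ∈ s
        rwa [norm_smul_av h0]
    · rw [Set.indicator_of_notMem h1]
      have : ∀ g : GG m, {x : Eu (m+1) | ‖x‖ ∈ s}.indicator φ (t • av g (e1 m)) = 0 := fun g => by
        rw [Set.indicator_of_notMem]
        show ¬ ‖t • av g (e1 m)‖ ∈ s
        rwa [norm_smul_av h0]
      simp [this]
  · rw [Set.indicator_of_notMem (show t ∉ Set.Ioi 0 from h0), Set.indicator_of_notMem fun h => h0 (hs0 h)]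

theorem cal_parts {m : ℕ} {a δ R c D M : ℝ} {q q' : ℝ → ℝ} (hR : 2 ≤ R) (hc : 0 < c) (hc' : c ≤ 1/2) (h : Cal m a δ R c D q q')
    (hM0 : 0 ≤ M) (hM : ∀ t, |t - R| ≤ c → 0 ≤ calw m q' t + M)
    {f : Eu (m+1) → ℝ} (hf : ContDiff ℝ 1 f) (hf0 : ∀ x, 0 ≤ f x) :
    ∫⁻ x in Sc m R c, ENNReal.ofReal (f x * (calw m q' ‖x‖ + M)) ≤
      (∫⁻ t in Set.Ioo (R-1) (R+1), Th m a δ t * AA f t) + ∫⁻ x in Sc m R c, ENNReal.ofReal (f x * M) := by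
  have hs0 : Set.Ioo (R-c) (R+c) ⊆ Set.Ioi 0 := fun t ht => by
    have := ht.1; simp only [Set.mem_Ioi]; linarith
  have hfm : Measurable f := hf.continuous.measurable
  have hq'm : Measurable q' := h.cont.measurable
  have m1 : Measurable fun x : Eu (m+1) => ENNReal.ofReal (f x * (calw m q' ‖x‖ + M)) := by
    unfold calw; fun_prop
  have m2 : Measurable fun x : Eu (m+1) => ENNReal.ofReal (f x * M) := by fun_prop
  have hab : ∀ t ∈ Set.Ioo (R-c) (R+c), |t - R| ≤ c := fun t ht => abs_le.2 ⟨by linarith [ht.1], by linarith [ht.2]⟩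
  unfold Sc
  rw [polar_set measurableSet_Ioo hs0 m1, polar_set measurableSet_Ioo hs0 m2]
  have haam : Measurable fun x : GG m × ℝ => ENNReal.ofReal (q x.2) * ENNReal.ofReal (aa f x.2 x.1) := by
    have cq : Continuous q := continuous_iff_continuousAt.2 fun t => (h.der t).continuousAt
    have h1 := (aa_meas hf).comp measurable_swap
    have h2 : Measurable fun x : GG m × ℝ => ENNReal.ofReal (aa f x.2 x.1) := h1.ennreal_ofReal
    have h3 : Measurable fun x : GG m × ℝ => ENNReal.ofReal (q x.2) := by fun_prop
    exact h3.mul h2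
  have hsw : ∫⁻ g, (∫⁻ t in Set.Ioo (R-c) (R+c), ENNReal.ofReal (q t) * ENNReal.ofReal (aa f t g)) ∂(hG m) ≤
      ∫⁻ t in Set.Ioo (R-1) (R+1), Th m a δ t * AA f t := by
    rw [lintegral_lintegral_swap haam.aemeasurable]
    calc _ ≤ ∫⁻ t in Set.Ioo (R-c) (R+c), Th m a δ t * AA f t := by
          refine setLIntegral_mono' measurableSet_Ioo fun t ht => ?_
          rw [lintegral_const_mul' _ _ ENNReal.ofReal_ne_top]
          exact mul_le_mul_left (h.le t (hab t ht)) _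
      _ ≤ _ := lintegral_mono_set (Set.Ioo_subset_Ioo (by linarith) (by linarith))
  refine le_trans ?_ (add_le_add_left hsw _)
  rw [← lintegral_add_left]
  · refine lintegral_mono fun g => ?_
    have hne : ∀ t, |t - R| ≤ c → 0 < nu m * t^m := fun t ht => by
      have h1 := (abs_le.1 ht).1
      have : 0 < t := by linarith
      have := nu_pos m
      positivity
    have hww : ∀ t, |t - R| ≤ c → nu m * t^m * (calw m q' t + M) = q' t + nu m * M * t^m := fun t ht => by
      have := hne t ht
      unfold calw; rw [mul_add, mul_div_cancel₀ _ this.ne']; ring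
    have hu : ∀ t, HasDerivAt (fun t : ℝ => f (t • av g (e1 m))) (fderiv ℝ f (t • av g (e1 m)) (av g (e1 m))) t := by
      intro t
      have h1 : HasDerivAt (fun t : ℝ => t • av g (e1 m)) ((1:ℝ) • av g (e1 m)) t := (hasDerivAt_id t).smul_const _
      rw [one_smul] at h1
      exact (hf.differentiable one_ne_zero _).hasFDerivAt.comp_hasDerivAt t h1
    have hu' : Continuous fun t : ℝ => fderiv ℝ f (t • av g (e1 m)) (av g (e1 m)) := by
      have := hf.continuous_fderiv one_ne_zero
      fun_prop
    have key := cal_ray (m := m) (M := nu m * M) hc (by linarith) h.der h.cont h.left h.right h.nn hu hu' (fun t => hf0 _)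
      (mul_nonneg (nu_pos m).le hM0) (fun t ht => by rw [← hww t ht]; exact mul_nonneg (hne t ht).le (hM t ht))
    refine le_trans (le_of_eq ?_) (key.trans (le_of_eq ?_))
    · refine setLIntegral_congr_fun measurableSet_Ioo fun t ht => ?_
      have ht' := hab t ht
      rw [norm_smul_av (hs0 ht), ← ENNReal.ofReal_mul (hne t ht').le, ← hww t ht']
      congr 1; ring
    · congr 1
      refine setLIntegral_congr_fun measurableSet_Ioo fun t ht => ?_
      have ht' := hab t ht
      rw [← ENNReal.ofReal_mul (hne t ht').le]
      congr 1; ring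
  · exact haam.lintegral_prod_right'


theorem k1_shift {m : ℕ} (a δ : ℝ) (x : Eu (m+1)) : ∫⁻ y, k1 m a δ (x - y) = ∫⁻ z, k1 m a δ z :=
  lintegral_sub_left_eq_self (fun z => k1 m a δ z) x

theorem k1_shift' {m : ℕ} (a δ : ℝ) (y : Eu (m+1)) : ∫⁻ x, k1 m a δ (x - y) = ∫⁻ z, k1 m a δ z :=
  lintegral_sub_right_eq_self (fun z => k1 m a δ z) y

theorem k1_pm (m : ℕ) (a δ : ℝ) : Measurable fun q : Eu (m+1) × Eu (m+1) => k1 m a δ (q.1 - q.2) :=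
  (k1_meas m a δ).comp (measurable_fst.sub measurable_snd)

theorem QK_diff {m : ℕ} {a δ R : ℝ} {f h : Eu (m+1) → ℝ} (hf : Measurable f) (hh : Measurable h) :
    QK m a δ R f ≤ QK m a δ R h + 2 * ((∫⁻ z, k1 m a δ z) * ∫⁻ x, ‖h x - f x‖ₑ) := by
  set S := Sh m R
  set p : Eu (m+1) → ℝ≥0∞ := fun x => ‖h x - f x‖ₑ with hp
  have hpm : Measurable p := (hh.sub hf).enorm
  have mk := k1_pm m a δ
  have mkx : Measurable fun q : Eu (m+1) × Eu (m+1) => k1 m a δ (q.1 - q.2) * p q.1 := mk.mul (hpm.comp measurable_fst)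
  have mky : Measurable fun q : Eu (m+1) × Eu (m+1) => k1 m a δ (q.1 - q.2) * p q.2 := mk.mul (hpm.comp measurable_snd)
  have I1 : ∫⁻ x in S, ∫⁻ y in S, k1 m a δ (x - y) * p x ≤ (∫⁻ z, k1 m a δ z) * ∫⁻ x, p x := by
    calc _ ≤ ∫⁻ x, ∫⁻ y, k1 m a δ (x - y) * p x :=
          (setLIntegral_le_lintegral _ _).trans (lintegral_mono fun x => setLIntegral_le_lintegral _ _)
      _ = ∫⁻ x, (∫⁻ z, k1 m a δ z) * p x := by
          refine lintegral_congr fun x => ?_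
          rw [lintegral_mul_const, k1_shift]
          have h0 : Measurable fun y : Eu (m+1) => x - y := by fun_prop
          exact (k1_meas m a δ).comp h0
      _ = _ := lintegral_const_mul _ hpm
  have I2 : ∫⁻ x in S, ∫⁻ y in S, k1 m a δ (x - y) * p y ≤ (∫⁻ z, k1 m a δ z) * ∫⁻ x, p x := by
    calc _ ≤ ∫⁻ x, ∫⁻ y, k1 m a δ (x - y) * p y :=
          (setLIntegral_le_lintegral _ _).trans (lintegral_mono fun x => setLIntegral_le_lintegral _ _)
      _ = ∫⁻ y, ∫⁻ x, k1 m a δ (x - y) * p y := lintegral_lintegral_swap mky.aemeasurable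
      _ = ∫⁻ y, (∫⁻ z, k1 m a δ z) * p y := by
          refine lintegral_congr fun y => ?_
          rw [lintegral_mul_const, k1_shift']
          have h0 : Measurable fun x : Eu (m+1) => x - y := by fun_prop
          exact (k1_meas m a δ).comp h0
      _ = _ := lintegral_const_mul _ hpm
  have hsl : ∀ (φ : Eu (m+1) × Eu (m+1) → ℝ≥0∞) (x : Eu (m+1)), Measurable φ → Measurable fun y => φ (x, y) :=
    fun φ x h => h.comp measurable_prodMk_left
  calc QK m a δ R f ≤ ∫⁻ x in S, ∫⁻ y in S, (k1 m a δ (x - y) * p x + k1 m a δ (x - y) * p y + k1 m a δ (x - y) * ‖h x - h y‖ₑ) := by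
        refine lintegral_mono fun x => lintegral_mono fun y => ?_
        simp only
        rw [← mul_add, ← mul_add]
        refine mul_le_mul_right ?_ _
        have e : f x - f y = -(h x - f x) + (h y - f y) + (h x - h y) := by ring
        rw [e, hp]
        refine (enorm_add_le _ _).trans (add_le_add_left ((enorm_add_le _ _).trans ?_) _)
        rw [enorm_neg]
    _ = (∫⁻ x in S, ∫⁻ y in S, k1 m a δ (x - y) * p x) + (∫⁻ x in S, ∫⁻ y in S, k1 m a δ (x - y) * p y) + QK m a δ R h := by
        have e1 : ∀ x, ∫⁻ y in S, (k1 m a δ (x - y) * p x + k1 m a δ (x - y) * p y + k1 m a δ (x - y) * ‖h x - h y‖ₑ) =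
            (∫⁻ y in S, k1 m a δ (x - y) * p x) + (∫⁻ y in S, k1 m a δ (x - y) * p y) + ∫⁻ y in S, k1 m a δ (x - y) * ‖h x - h y‖ₑ := by
          intro x
          rw [lintegral_add_left, lintegral_add_left]
          · exact hsl _ x mkx
          · exact (hsl _ x mkx).add (hsl _ x mky)
        simp_rw [e1]
        rw [lintegral_add_left, lintegral_add_left]
        · rfl
        · exact mkx.lintegral_prod_right'
        · exact (Measurable.lintegral_prod_right' mkx).add (Measurable.lintegral_prod_right' mky)
    _ ≤ (∫⁻ z, k1 m a δ z) * (∫⁻ x, p x) + (∫⁻ z, k1 m a δ z) * (∫⁻ x, p x) + QK m a δ R h := by gcongr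
    _ = _ := by rw [← two_mul, add_comm]

theorem lim_zero {X Y C : ℝ≥0∞} (hC : C ≠ ∞) (h : ∀ ε : ℝ, 0 < ε → X ≤ Y + C * ENNReal.ofReal (ε + ε)) : X ≤ Y := by
  have h1 : Tendsto (fun ε : ℝ => Y + C * ENNReal.ofReal (ε + ε)) (nhdsWithin 0 (Set.Ioi 0)) (nhds (Y + C * ENNReal.ofReal (0 + 0))) := by
    refine Tendsto.const_add _ (ENNReal.Tendsto.const_mul ?_ (Or.inr hC))
    have h3 : Continuous fun ε : ℝ => ε + ε := by fun_prop
    have : Continuous fun ε : ℝ => ENNReal.ofReal (ε + ε) := ENNReal.continuous_ofReal.comp h3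
    exact (this.tendsto 0).mono_left nhdsWithin_le_nhds
  have h2 : Y + C * ENNReal.ofReal (0 + 0) = Y := by simp
  rw [h2] at h1
  exact ge_of_tendsto h1 (eventually_nhdsWithin_of_forall fun ε hε => h ε hε)

theorem int_diff {m : ℕ} {S : Set (Eu (m+1))} (hS : MeasurableSet S) {f h w : Eu (m+1) → ℝ} (hf : Measurable f) (hh : Measurable h)
    (hf0 : ∀ x, 0 ≤ f x) {M : ℝ} (hw0 : ∀ x ∈ S, 0 ≤ w x) (hw : ∀ x ∈ S, w x ≤ M) :
    ∫⁻ x in S, ENNReal.ofReal (h x * w x) ≤ (∫⁻ x in S, ENNReal.ofReal (f x * w x)) + ENNReal.ofReal M * ∫⁻ x, ‖f x - h x‖ₑ := by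
  have hpm : Measurable fun x => ENNReal.ofReal M * ‖f x - h x‖ₑ := ((hf.sub hh).enorm).const_mul _
  calc _ ≤ ∫⁻ x in S, (ENNReal.ofReal (f x * w x) + ENNReal.ofReal M * ‖f x - h x‖ₑ) := by
        refine setLIntegral_mono' hS fun x hx => ?_
        rw [Real.enorm_eq_ofReal_abs, ← ENNReal.ofReal_mul ((hw0 x hx).trans (hw x hx)),
          ← ENNReal.ofReal_add (mul_nonneg (hf0 x) (hw0 x hx)) (mul_nonneg ((hw0 x hx).trans (hw x hx)) (abs_nonneg _))]
        refine ENNReal.ofReal_le_ofReal ?_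
        have h1 : h x - f x ≤ |f x - h x| := by rw [abs_sub_comm]; exact le_abs_self _
        have h2 := mul_le_mul_of_nonneg_right h1 (hw0 x hx)
        have h3 := mul_le_mul_of_nonneg_right (hw x hx) (abs_nonneg (f x - h x))
        linarith
    _ = (∫⁻ x in S, ENNReal.ofReal (f x * w x)) + ∫⁻ x in S, ENNReal.ofReal M * ‖f x - h x‖ₑ := lintegral_add_right _ hpm
    _ ≤ _ := by
        refine add_le_add_right ((setLIntegral_le_lintegral _ _).trans (le_of_eq ?_)) _
        exact lintegral_const_mul' _ _ ENNReal.ofReal_ne_top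

theorem cal_limit {m : ℕ} {a b δ R c D M : ℝ} {q q' : ℝ → ℝ} (hm : 1 ≤ m) (ha : 0 < a) (ha' : a < m+1) (hba : b ≤ a) (hb : 0 < b) (hb' : b ≤ 1/2)
    (hδ : 0 < δ) (hδ' : 2*δ ≤ 1) (hR : 2 ≤ R) (hC : nw m * ENNReal.ofReal (CT m b * δ^(1+b)) ≤ 2 * kap m)
    (hK : K0 m a δ ≤ kap m * nw m) (hc : 0 < c) (hc' : c ≤ 1/2) (h : Cal m a δ R c D q q')
    (hM0 : 0 ≤ M) (hM : ∀ t, |t - R| ≤ c → |calw m q' t| ≤ M)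
    {F : Set (Eu (m+1))} (hF : MeasurableSet F) (hP : perimeter F ≠ ∞) :
    QK m a δ R (chi F) + 2 * ∫⁻ x in Sc m R c, ENNReal.ofReal (chi F x * (calw m q' ‖x‖ + M)) ≤
      2 * perimeter F + 2 * ∫⁻ x in Sc m R c, ENNReal.ofReal (chi F x * M) := by
  set K := ∫⁻ z, k1 m a δ z with hKd
  have hKt : K ≠ ∞ := by
    rw [hKd, k1_int ha hδ]
    have := vol1_top m
    have := ENNReal.inv_ne_top.2 (cc_ne_zero (m := m) (a := a))
    finiteness
  have hki : (kap m)⁻¹ ≠ ∞ := ENNReal.inv_ne_top.2 (kap_ne_zero m)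
  have hSc : ∀ x ∈ Sc m R c, |‖x‖ - R| ≤ c := fun x hx => abs_le.2 ⟨by linarith [hx.1], by linarith [hx.2]⟩
  refine lim_zero (C := (2 * K + 2 * ENNReal.ofReal (2*M) + 2 * ENNReal.ofReal M) * ((kap m)⁻¹ * perimeter F)) (by finiteness) fun ε hε => ?_
  obtain ⟨f, hf, hf0, hf1, hfP, hfL⟩ := mollify hF hP hε
  have hfm : Measurable f := hf.continuous.measurable
  have hχ := chi_meas hF
  have s1 := QK_main hm ha' hba hb hb' hδ hδ' hR hC hK hf
  have s2 := cal_parts hR hc hc' h hM0 (fun t ht => by have := (abs_le.1 (hM t ht)).1; linarith) hf hf0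
  have s3 : QK m a δ R (chi F) ≤ _ := QK_diff (h := f) hχ hfm
  have s4 := int_diff (Sc_meas m R c) (f := f) (h := chi F) (w := fun x => calw m q' ‖x‖ + M) (M := 2*M) hfm hχ hf0
    (fun x hx => by have := (abs_le.1 (hM _ (hSc x hx))).1; linarith) (fun x hx => by have := (abs_le.1 (hM _ (hSc x hx))).2; linarith)
  have s5 := int_diff (Sc_meas m R c) (f := chi F) (h := f) (w := fun x => M) (M := M) hχ hfm (chi_nonneg F)
    (fun x hx => hM0) (fun x hx => le_rfl)
  have e5 : ∫⁻ x, ‖chi F x - f x‖ₑ = ∫⁻ x, ‖f x - chi F x‖ₑ := lintegral_congr fun x => enorm_sub_rev _ _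
  rw [e5] at s5
  set L := ∫⁻ x, ‖f x - chi F x‖ₑ
  set J := ∫⁻ t in Set.Ioo (R-1) (R+1), Th m a δ t * AA f t
  calc _ ≤ (QK m a δ R f + 2 * (K * L)) + 2 * ((J + ((∫⁻ x in Sc m R c, ENNReal.ofReal (chi F x * M)) + ENNReal.ofReal M * L)) + ENNReal.ofReal (2*M) * L) := by
        refine add_le_add s3 (mul_le_mul_right (s4.trans (add_le_add_left (s2.trans (add_le_add_right s5 _)) _)) _)
    _ = (QK m a δ R f + 2 * J) + 2 * (∫⁻ x in Sc m R c, ENNReal.ofReal (chi F x * M)) + (2 * K + 2 * ENNReal.ofReal (2*M) + 2 * ENNReal.ofReal M) * L := by ring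
    _ ≤ 2 * perimeter F + 2 * (∫⁻ x in Sc m R c, ENNReal.ofReal (chi F x * M)) + (2 * K + 2 * ENNReal.ofReal (2*M) + 2 * ENNReal.ofReal M) * ((kap m)⁻¹ * ENNReal.ofReal (ε + ε) * perimeter F) := by
        refine add_le_add (add_le_add_left (s1.trans (mul_le_mul_right hfP _)) _) (mul_le_mul_right hfL _)
    _ = _ := by ring


theorem QK_chi {m : ℕ} {a δ R : ℝ} {F : Set (Eu (m+1))} (hF : MeasurableSet F) :
    2 * EK (k1 m a δ) (Sh m R ∩ F) (Sh m R \ F) ≤ QK m a δ R (chi F) := by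
  have h1 : QK m a δ R (chi F) = (∫⁻ x in Sh m R ∩ F, ∫⁻ y in Sh m R, k1 m a δ (x - y) * ‖chi F x - chi F y‖ₑ) +
      ∫⁻ x in Sh m R \ F, ∫⁻ y in Sh m R, k1 m a δ (x - y) * ‖chi F x - chi F y‖ₑ :=
    (lintegral_inter_add_sdiff _ (Sh m R) hF).symm
  rw [h1, two_mul]
  nth_rewrite 2 [EK_flip]
  unfold EK
  refine add_le_add ?_ ?_
  · refine setLIntegral_mono' ((Sh_meas m R).inter hF) fun x hx => ?_
    refine le_trans ?_ (lintegral_mono_set (Set.sdiff_subset : Sh m R \ F ⊆ Sh m R))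
    refine setLIntegral_mono' ((Sh_meas m R).diff hF) fun y hy => ?_
    rw [chi_of_mem hx.2, chi_of_notMem hy.2]; simp
  · refine setLIntegral_mono' ((Sh_meas m R).diff hF) fun x hx => ?_
    refine le_trans ?_ (lintegral_mono_set (Set.inter_subset_left : Sh m R ∩ F ⊆ Sh m R))
    refine setLIntegral_mono' ((Sh_meas m R).inter hF) fun y hy => ?_
    rw [chi_of_mem hy.2, chi_of_notMem hx.2]; simp

open Classical in
def Wt (m : ℕ) (q' : ℝ → ℝ) (R c M : ℝ) (x : Eu (m+1)) : ℝ≥0∞ :=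
  if x ∈ Sc m R c then ENNReal.ofReal (calw m q' ‖x‖ + M) else ENNReal.ofReal M

theorem Wt_meas {m : ℕ} {q' : ℝ → ℝ} (hq' : Continuous q') (R c M : ℝ) : Measurable (Wt m q' R c M) := by
  have hq'm := hq'.measurable
  unfold Wt
  refine Measurable.ite (Sc_meas m R c) ?_ measurable_const
  unfold calw; fun_prop

theorem Wt_int {m : ℕ} (q' : ℝ → ℝ) (R c M : ℝ) (F : Set (Eu (m+1))) (hF : MeasurableSet F) :
    ∫⁻ x in F, Wt m q' R c M x = (∫⁻ x in F ∩ Sc m R c, ENNReal.ofReal (calw m q' ‖x‖ + M)) + ENNReal.ofReal M * volume (F \ Sc m R c) := by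
  rw [← lintegral_inter_add_sdiff (Wt m q' R c M) F (Sc_meas m R c)]
  congr 1
  · refine setLIntegral_congr_fun (hF.inter (Sc_meas m R c)) fun x hx => ?_
    simp only [Wt, if_pos hx.2]
  · rw [← setLIntegral_const]
    refine setLIntegral_congr_fun (hF.diff (Sc_meas m R c)) fun x hx => ?_
    simp only [Wt, if_neg hx.2]

theorem chi_int {m : ℕ} {S F : Set (Eu (m+1))} (hF : MeasurableSet F) (w : Eu (m+1) → ℝ) :
    ∫⁻ x in S, ENNReal.ofReal (chi F x * w x) = ∫⁻ x in F ∩ S, ENNReal.ofReal (w x) := by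
  rw [← Measure.restrict_restrict hF, ← lintegral_indicator hF]
  refine lintegral_congr fun x => ?_
  by_cases hx : x ∈ F
  · rw [chi_of_mem hx, Set.indicator_of_mem hx, one_mul]
  · rw [chi_of_notMem hx, Set.indicator_of_notMem hx, zero_mul, ENNReal.ofReal_zero]

/-- the lower bound for the perimeter -/
theorem per_lower {m : ℕ} {a b δ R c D M : ℝ} {q q' : ℝ → ℝ} (hm : 1 ≤ m) (ha : 0 < a) (ha' : a < m+1) (hba : b ≤ a) (hb : 0 < b) (hb' : b ≤ 1/2)
    (hδ : 0 < δ) (hδ' : 2*δ ≤ 1) (hR : 2 ≤ R) (hC : nw m * ENNReal.ofReal (CT m b * δ^(1+b)) ≤ 2 * kap m)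
    (hK : K0 m a δ ≤ kap m * nw m) (hc : 0 < c) (hc' : c ≤ 1/2) (h : Cal m a δ R c D q q')
    (hM0 : 0 ≤ M) (hM : ∀ t, |t - R| ≤ c → |calw m q' t| ≤ M)
    {F : Set (Eu (m+1))} (hF : MeasurableSet F) (hP : perimeter F ≠ ∞) :
    EK (k1 m a δ) (Sh m R ∩ F) (Sh m R \ F) + ∫⁻ x in F, Wt m q' R c M x ≤ perimeter F + ENNReal.ofReal M * volume F := by
  have h1 := cal_limit hm ha ha' hba hb hb' hδ hδ' hR hC hK hc hc' h hM0 hM hF hP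
  rw [chi_int hF, chi_int hF, setLIntegral_const] at h1
  have h2 := (add_le_add_left (QK_chi (m := m) (a := a) (δ := δ) (R := R) hF) _).trans h1
  rw [← mul_add, ← mul_add] at h2
  rw [ENNReal.mul_le_mul_iff_right (by simp) (by simp)] at h2
  rw [Wt_int q' R c M F hF, ← add_assoc]
  refine (add_le_add_left h2 _).trans (le_of_eq ?_)
  rw [add_assoc, ← mul_add, measure_inter_add_sdiff _ (Sc_meas m R c)]

theorem ball_W {m : ℕ} {a δ R c D M : ℝ} {q q' : ℝ → ℝ} (hR : 2 ≤ R) (hc : 0 < c) (hc' : c ≤ 1/2) (h : Cal m a δ R c D q q')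
    (hM0 : 0 ≤ M) (hM : ∀ t, |t - R| ≤ c → |calw m q' t| ≤ M) :
    ∫⁻ x in ball (0:Eu (m+1)) R, Wt m q' R c M x = ENNReal.ofReal (q R) + ENNReal.ofReal M * volume (ball (0:Eu (m+1)) R) := by
  rw [Wt_int q' R c M _ measurableSet_ball, ← measure_inter_add_sdiff (ball (0:Eu (m+1)) R) (Sc_meas m R c), mul_add, ← add_assoc]
  congr 1
  rw [← setLIntegral_const]
  have hset : ball (0:Eu (m+1)) R ∩ Sc m R c = {x : Eu (m+1) | ‖x‖ ∈ Set.Ioo (R-c) R} := by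
    ext x
    simp only [Set.mem_inter_iff, mem_ball_zero_iff, Sc, Set.mem_ofPred_eq, Set.mem_Ioo]
    constructor
    · rintro ⟨h1, h2, h3⟩; exact ⟨h2, h1⟩
    · rintro ⟨h1, h2⟩; exact ⟨h2, h1, by linarith⟩
  rw [hset]
  have hs0 : Set.Ioo (R-c) R ⊆ Set.Ioi 0 := fun t ht => by
    have := ht.1; simp only [Set.mem_Ioi]; linarith
  have hq'm := h.cont.measurable
  have m1 : Measurable fun x : Eu (m+1) => ENNReal.ofReal (calw m q' ‖x‖ + M) := by unfold calw; fun_prop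
  rw [polar_set measurableSet_Ioo hs0 m1, polar_set measurableSet_Ioo hs0 measurable_const]
  have hab : ∀ t ∈ Set.Ioc (R-c) R, |t - R| ≤ c := fun t ht => abs_le.2 ⟨by linarith [ht.1], by linarith [ht.2]⟩
  have hle : R - c ≤ R := by linarith
  have key : ∀ v : ℝ → ℝ, Continuous v → (∀ t, |t - R| ≤ c → 0 ≤ v t) →
      ∫⁻ t in Set.Ioo (R-c) R, ENNReal.ofReal (v t) = ENNReal.ofReal (∫ t in (R-c)..R, v t) := by
    intro v hv hv0
    rw [intervalIntegral.integral_of_le hle, ofReal_integral_eq_lintegral_ofReal]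
    · exact setLIntegral_congr Ioo_ae_eq_Ioc
    · exact (hv.integrableOn_Icc).mono_set Set.Ioc_subset_Icc_self
    · exact (ae_restrict_iff' measurableSet_Ioc).2 (Eventually.of_forall fun t ht => hv0 t (hab t ht))
  have hne : ∀ t, |t - R| ≤ c → 0 < nu m * t^m := fun t ht => by
    have h1 := (abs_le.1 ht).1
    have : 0 < t := by linarith
    have := nu_pos m
    positivity
  have hww : ∀ t, |t - R| ≤ c → nu m * t^m * (calw m q' t + M) = q' t + nu m * M * t^m := fun t ht => by
    have := hne t ht
    unfold calw; rw [mul_add, mul_div_cancel₀ _ this.ne']; ring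
  have E1 : ∀ g : GG m, ∫⁻ t in Set.Ioo (R-c) R, ENNReal.ofReal (nu m * t^m) * ENNReal.ofReal (calw m q' ‖t • av g (e1 m)‖ + M) =
      ENNReal.ofReal (∫ t in (R-c)..R, (q' t + nu m * M * t^m)) := by
    intro g
    have hcq := h.cont
    rw [← key _ (by fun_prop) (fun t ht => ?_)]
    · refine setLIntegral_congr_fun measurableSet_Ioo fun t ht => ?_
      have ht' := hab t (Set.Ioo_subset_Ioc_self ht)
      rw [norm_smul_av (hs0 ht), ← ENNReal.ofReal_mul (hne t ht').le, ← hww t ht']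
    · rw [← hww t ht]
      refine mul_nonneg (hne t ht).le ?_
      have := (abs_le.1 (hM t ht)).1; linarith
  have E2 : ∫⁻ t in Set.Ioo (R-c) R, ENNReal.ofReal (nu m * t^m) * ENNReal.ofReal M =
      ENNReal.ofReal (∫ t in (R-c)..R, nu m * M * t^m) := by
    rw [← key _ (by fun_prop) (fun t ht => ?_)]
    · refine setLIntegral_congr_fun measurableSet_Ioo fun t ht => ?_
      have ht' := hab t (Set.Ioo_subset_Ioc_self ht)
      rw [← ENNReal.ofReal_mul (hne t ht').le]
      congr 1; ring
    · have := mul_nonneg (hne t ht).le hM0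
      calc 0 ≤ _ := this
        _ = _ := by ring
  simp_rw [E1, E2]
  rw [lintegral_const, lintegral_const, measure_univ, mul_one, mul_one, intervalIntegral.integral_add
    (h.cont.intervalIntegrable _ _) (by apply Continuous.intervalIntegrable; fun_prop),
    intervalIntegral.integral_eq_sub_of_hasDerivAt (fun t _ => h.der t) (h.cont.intervalIntegrable _ _), h.left, sub_zero,
    ENNReal.ofReal_add (h.nn R (by simp [hc.le]))]
  refine intervalIntegral.integral_nonneg hle fun t ht => ?_
  have ht0 : 0 ≤ t := by have := ht.1; linarith
  have := nu_pos m
  positivity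


theorem calw_bd {m : ℕ} {a δ R c D : ℝ} {q q' : ℝ → ℝ} (hR : 2 ≤ R) (hc : 0 < c) (hc' : c ≤ 1/2) (hD : 0 ≤ D) (h : Cal m a δ R c D q q')
    {t : ℝ} (ht : |t - R| ≤ c) :
    |calw m q' t| ≤ 2 * D * 2^m / nu m ∧ |calw m q' t - calw m q' R| ≤ (D * 2^m + D * m * 4^m) / nu m * |t - R| := by
  have hν := nu_pos m
  have hR0 : 0 < R := by linarith
  have h1 := abs_le.1 ht
  have ht0 : 0 < t := by linarith
  have htm : 0 < t^m := by positivity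
  have hRm : 0 < R^m := by positivity
  have hRt : R^m ≤ 2^m * t^m := by
    rw [← mul_pow]; exact pow_le_pow_left₀ hR0.le (by linarith) m
  have hl := h.lip t ht
  have hb := h.bd
  constructor
  · unfold calw
    rw [abs_div, abs_of_pos (mul_pos hν htm), div_le_div_iff₀ (by positivity) hν]
    have e1 : |q' t| ≤ 2 * D * R^m := by
      have e2 : |q' t| ≤ |q' t - q' R| + |q' R| := by
        have := abs_add_le (q' t - q' R) (q' R); simpa using this
      have e3 : D * R^m * |t - R| ≤ D * R^m * 1 := by gcongr; linarith
      linarith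
    calc |q' t| * nu m ≤ 2 * D * R^m * nu m := by gcongr
      _ ≤ 2 * D * (2^m * t^m) * nu m := by gcongr
      _ = _ := by ring
  · have e0 : calw m q' t - calw m q' R = (q' t - q' R) / (nu m * t^m) + q' R * (R^m - t^m) / (nu m * t^m * R^m) := by
      unfold calw; field_simp; ring
    have e1 : |(q' t - q' R) / (nu m * t^m)| ≤ D * 2^m / nu m * |t - R| := by
      rw [abs_div, abs_of_pos (mul_pos hν htm), div_le_iff₀ (by positivity)]
      calc _ ≤ D * R^m * |t - R| := hl
        _ ≤ D * (2^m * t^m) * |t - R| := by gcongr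
        _ = _ := by field_simp
    have e2 : |R^m - t^m| ≤ |t - R| * (m * (2^m * R^m)) := by
      have h3 := abs_pow_sub_pow_le R t m
      rw [abs_sub_comm R t, abs_of_pos hR0, abs_of_pos ht0] at h3
      refine h3.trans ?_
      rw [mul_assoc]
      refine mul_le_mul_of_nonneg_left (mul_le_mul_of_nonneg_left ?_ (by positivity)) (abs_nonneg _)
      have h4 : max R t ≤ 2 * R := max_le (by linarith) (by linarith)
      calc _ ≤ (2*R)^(m-1) := pow_le_pow_left₀ (le_max_of_le_left hR0.le) h4 _
        _ ≤ (2*R)^m := pow_le_pow_right₀ (by linarith) (by omega)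
        _ = _ := mul_pow _ _ _
    have e3 : |q' R * (R^m - t^m) / (nu m * t^m * R^m)| ≤ D * m * 4^m / nu m * |t - R| := by
      rw [abs_div, abs_mul, abs_of_pos (mul_pos (mul_pos hν htm) hRm), div_le_iff₀ (by positivity)]
      calc _ ≤ D * R^m * (|t - R| * (m * (2^m * R^m))) := by gcongr
        _ ≤ D * (2^m * t^m) * (|t - R| * (m * (2^m * R^m))) := by gcongr
        _ = _ := by
          have : (4:ℝ)^m = 2^m * 2^m := by rw [← mul_pow]; norm_num
          rw [this]; field_simp
    rw [e0]
    refine (abs_add_le _ _).trans ((add_le_add e1 e3).trans (le_of_eq ?_))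
    ring

theorem W_compare {m : ℕ} {c D : ℝ} (hc : 0 < c) (hc' : c ≤ 1/2) (hD : 0 ≤ D) :
    ∃ M C : ℝ, 0 ≤ M ∧ 0 ≤ C ∧ ∀ (a δ R : ℝ) (q q' : ℝ → ℝ), 2 ≤ R → Cal m a δ R c D q q' →
      (∀ t, |t - R| ≤ c → |calw m q' t| ≤ M) ∧
      ∀ F : Set (Eu (m+1)), MeasurableSet F → volume F = volume (ball (0:Eu (m+1)) R) →
        ∫⁻ x in ball (0:Eu (m+1)) R, Wt m q' R c M x ≤ (∫⁻ x in F, Wt m q' R c M x) + ENNReal.ofReal C * SS R F := by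
  have hν := nu_pos m
  set M := 2 * D * 2^m / nu m with hMd
  set C1 := (D * 2^m + D * m * 4^m) / nu m with hC1
  have hM0 : 0 ≤ M := by positivity
  have hC10 : 0 ≤ C1 := by positivity
  refine ⟨M, C1 + M/c, hM0, by positivity, fun a δ R q q' hR h => ?_⟩
  have hb := fun t (ht : |t - R| ≤ c) => (calw_bd hR hc hc' hD h ht).1
  have hl := fun t (ht : |t - R| ≤ c) => (calw_bd hR hc hc' hD h ht).2
  have hR' : |R - R| ≤ c := by simp [hc.le]
  have hbR := abs_le.1 (hb R hR')
  refine ⟨hb, fun F hF hv => ?_⟩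
  have hWr : ∀ x : Eu (m+1), ∃ w : ℝ, 0 ≤ w ∧ Wt m q' R c M x = ENNReal.ofReal w ∧ |w - (calw m q' R + M)| ≤ (C1 + M/c) * |‖x‖ - R| := by
    intro x
    by_cases hx : x ∈ Sc m R c
    · have hx' : |‖x‖ - R| ≤ c := abs_le.2 ⟨by linarith [hx.1], by linarith [hx.2]⟩
      refine ⟨calw m q' ‖x‖ + M, by have := (abs_le.1 (hb _ hx')).1; linarith, by simp only [Wt, if_pos hx], ?_⟩
      have e : calw m q' ‖x‖ + M - (calw m q' R + M) = calw m q' ‖x‖ - calw m q' R := by ring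
      rw [e]
      refine (hl _ hx').trans (mul_le_mul_of_nonneg_right ?_ (abs_nonneg _))
      have : 0 ≤ M/c := by positivity
      linarith
    · refine ⟨M, hM0, by simp only [Wt, if_neg hx], ?_⟩
      have hx' : c ≤ |‖x‖ - R| := by
        by_contra hlt
        push Not at hlt
        have := abs_lt.1 hlt
        exact hx ⟨by linarith, by linarith⟩
      have e : M - (calw m q' R + M) = - calw m q' R := by ring
      rw [e, abs_neg]
      refine (hb R hR').trans ?_
      have e1 : M = M/c * c := by field_simp
      have e2 : M/c * c ≤ M/c * |‖x‖ - R| := by gcongr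
      have e3 : 0 ≤ C1 * |‖x‖ - R| := by positivity
      linarith
  have hCnn : 0 ≤ C1 + M/c := by positivity
  refine compare_int hF hv (Wt_meas h.cont R c M) (c := ENNReal.ofReal (calw m q' R + M)) ENNReal.ofReal_ne_top (fun x => ?_) (fun x => ?_)
  · obtain ⟨w, hw0, hw1, hw2⟩ := hWr x
    rw [hw1, ← ENNReal.ofReal_mul hCnn, ← ENNReal.ofReal_add (by linarith [hbR.1]) (by positivity)]
    exact ENNReal.ofReal_le_ofReal (by linarith [(abs_le.1 hw2).2])
  · obtain ⟨w, hw0, hw1, hw2⟩ := hWr x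
    rw [hw1, ← ENNReal.ofReal_mul hCnn, ← ENNReal.ofReal_add hw0 (by positivity)]
    exact ENNReal.ofReal_le_ofReal (by linarith [(abs_le.1 hw2).1])

/-- localisation -/
theorem EK_local {m : ℕ} {a δ R : ℝ} (hδ' : 2*δ ≤ 1/2) {F : Set (Eu (m+1))} (hF : MeasurableSet F) :
    EK (k1 m a δ) F Fᶜ ≤ EK (k1 m a δ) (Sh m R ∩ F) (Sh m R \ F) + 2 * (∫⁻ z, k1 m a δ z) * SS R F := by
  set K := ∫⁻ z, k1 m a δ z
  set B := ball (0:Eu (m+1)) R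
  set S := Sh m R
  have hB : MeasurableSet B := measurableSet_ball
  have hS : MeasurableSet S := Sh_meas m R
  set d : Eu (m+1) → ℝ≥0∞ := fun x => ENNReal.ofReal |‖x‖ - R| with hd
  have hdm : Measurable d := by rw [hd]; fun_prop
  -- deviation weights
  set p : Eu (m+1) → ℝ≥0∞ := (F \ B).indicator (fun x => 2 * d x) with hp
  set r : Eu (m+1) → ℝ≥0∞ := (B \ F).indicator (fun x => 2 * d x) with hr
  have hpm : Measurable p := (hdm.const_mul 2).indicator (hF.diff hB)
  have hrm : Measurable r := (hdm.const_mul 2).indicator (hB.diff hF)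
  have h2d : ∀ x : Eu (m+1), 1/2 ≤ |‖x‖ - R| → 1 ≤ 2 * d x := by
    intro x hx
    have : (1:ℝ≥0∞) = 2 * ENNReal.ofReal (1/2) := by
      rw [ENNReal.ofReal_div_of_pos (by norm_num)]; simp [ENNReal.mul_inv_cancel]
    rw [this, hd]
    exact mul_le_mul_right (ENNReal.ofReal_le_ofReal hx) _
  have key : ∀ x y : Eu (m+1), x ∈ F → y ∈ Fᶜ → k1 m a δ (x - y) ≤ 
      k1 m a δ (x - y) * ((S ∩ F).indicator 1 x * (S \ F).indicator 1 y) + (k1 m a δ (x - y) * p x + k1 m a δ (x - y) * r y) := by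
    intro x y hx hy
    rw [← mul_add, ← mul_add]
    by_cases hz : 2*δ ≤ ‖x - y‖
    · rw [k1_zero hz]; simp
    push Not at hz
    refine le_mul_of_one_le_right' ?_
    have hn := abs_le.1 ((abs_norm_sub_norm_le x y).trans (hz.le.trans hδ'))
    by_cases hxS : x ∈ S ∧ y ∈ S
    · rw [Set.indicator_of_mem (show x ∈ S ∩ F from ⟨hxS.1, hx⟩), Set.indicator_of_mem (show y ∈ S \ F from ⟨hxS.2, hy⟩)]
      simp
    have hcase : R + 1/2 ≤ ‖x‖ ∨ ‖y‖ ≤ R - 1/2 := by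
      by_contra hcon
      push Not at hcon
      exact hxS ⟨⟨by linarith, by linarith⟩, ⟨by linarith, by linarith⟩⟩
    rcases hcase with h | h
    · have : 1 ≤ p x := by
        rw [hp, Set.indicator_of_mem]
        · exact h2d x (le_abs.2 (Or.inl (by linarith)))
        · exact ⟨hx, by simp only [B, mem_ball_zero_iff]; linarith⟩
      exact this.trans (le_add_left le_self_add)
    · have : 1 ≤ r y := by
        rw [hr, Set.indicator_of_mem]
        · exact h2d y (le_abs.2 (Or.inr (by linarith)))
        · exact ⟨by simp only [B, mem_ball_zero_iff]; linarith, hy⟩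
      exact this.trans (le_add_left le_add_self)
  have mk := k1_pm m a δ
  have mkx : Measurable fun q : Eu (m+1) × Eu (m+1) => k1 m a δ (q.1 - q.2) * p q.1 := mk.mul (hpm.comp measurable_fst)
  have mky : Measurable fun q : Eu (m+1) × Eu (m+1) => k1 m a δ (q.1 - q.2) * r q.2 := mk.mul (hrm.comp measurable_snd)
  have hsl : ∀ (φ : Eu (m+1) × Eu (m+1) → ℝ≥0∞) (x : Eu (m+1)), Measurable φ → Measurable fun y => φ (x, y) :=
    fun φ x h => h.comp measurable_prodMk_left
  have I1 : ∫⁻ x, ∫⁻ y, k1 m a δ (x - y) * p x = K * ∫⁻ x, p x := by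
    rw [← lintegral_const_mul _ hpm]
    refine lintegral_congr fun x => ?_
    rw [lintegral_mul_const, k1_shift]
    have h0 : Measurable fun y : Eu (m+1) => x - y := by fun_prop
    exact (k1_meas m a δ).comp h0
  have I2 : ∫⁻ x, ∫⁻ y, k1 m a δ (x - y) * r y = K * ∫⁻ x, r x := by
    rw [lintegral_lintegral_swap mky.aemeasurable, ← lintegral_const_mul _ hrm]
    refine lintegral_congr fun y => ?_
    rw [lintegral_mul_const, k1_shift']
    have h0 : Measurable fun x : Eu (m+1) => x - y := by fun_prop
    exact (k1_meas m a δ).comp h0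
  have I3 : ∫⁻ x, ∫⁻ y, k1 m a δ (x - y) * ((S ∩ F).indicator 1 x * (S \ F).indicator 1 y) = EK (k1 m a δ) (S ∩ F) (S \ F) := by
    unfold EK
    rw [← lintegral_indicator (hS.inter hF)]
    refine lintegral_congr fun x => ?_
    by_cases hx : x ∈ S ∩ F
    · rw [Set.indicator_of_mem hx, Set.indicator_of_mem hx, ← lintegral_indicator (hS.diff hF)]
      refine lintegral_congr fun y => ?_
      by_cases hy : y ∈ S \ F
      · rw [Set.indicator_of_mem hy, Set.indicator_of_mem hy]; simp
      · rw [Set.indicator_of_notMem hy, Set.indicator_of_notMem hy]; simp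
    · rw [Set.indicator_of_notMem hx, Set.indicator_of_notMem hx]; simp
  have J1 : ∫⁻ x, p x = 2 * ∫⁻ x in F \ B, d x := by
    rw [hp, lintegral_indicator (hF.diff hB), lintegral_const_mul _ hdm]
  have J2 : ∫⁻ x, r x = 2 * ∫⁻ x in B \ F, d x := by
    rw [hr, lintegral_indicator (hB.diff hF), lintegral_const_mul _ hdm]
  calc EK (k1 m a δ) F Fᶜ ≤ ∫⁻ x in F, ∫⁻ y in Fᶜ, (k1 m a δ (x - y) * ((S ∩ F).indicator 1 x * (S \ F).indicator 1 y)
          + (k1 m a δ (x - y) * p x + k1 m a δ (x - y) * r y)) :=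
        setLIntegral_mono' hF fun x hx => setLIntegral_mono' hF.compl fun y hy => key x y hx hy
    _ ≤ ∫⁻ x, ∫⁻ y, (k1 m a δ (x - y) * ((S ∩ F).indicator 1 x * (S \ F).indicator 1 y)
          + (k1 m a δ (x - y) * p x + k1 m a δ (x - y) * r y)) :=
        (setLIntegral_le_lintegral _ _).trans (lintegral_mono fun x => setLIntegral_le_lintegral _ _)
    _ = EK (k1 m a δ) (S ∩ F) (S \ F) + (K * (∫⁻ x, p x) + K * ∫⁻ x, r x) := by
        rw [← I1, ← I2, ← I3, ← lintegral_add_left, ← lintegral_add_right]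
        · refine lintegral_congr fun x => ?_
          rw [lintegral_add_right, lintegral_add_left]
          · exact hsl _ x mkx
          · exact (hsl _ x mkx).add (hsl _ x mky)
        · exact (Measurable.lintegral_prod_right' mkx).add (Measurable.lintegral_prod_right' mky)
        · exact mkx.lintegral_prod_right'
    _ = EK (k1 m a δ) (S ∩ F) (S \ F) + 2 * K * SS R F := by
        rw [J1, J2]
        simp only [SS, d, B]
        ring

theorem EK_total {m : ℕ} {a δ : ℝ} {F : Set (Eu (m+1))} (hF : MeasurableSet F) :
    EK (k1 m a δ) F F + EK (k1 m a δ) F Fᶜ = (∫⁻ z, k1 m a δ z) * volume F := by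
  unfold EK
  rw [← lintegral_add_left, ← setLIntegral_const]
  · refine lintegral_congr fun x => ?_
    rw [lintegral_add_compl _ hF, k1_shift]
  · exact Measurable.lintegral_prod_right' (f := fun q : Eu (m+1) × Eu (m+1) => k1 m a δ (q.1 - q.2)) (k1_pm m a δ)

/-- perimeter + short range kernel -/
theorem K1 {m : ℕ} (hm : 1 ≤ m) {a b δ : ℝ} (ha : 0 < a) (ha' : a < (m:ℝ)+1) (hba : b ≤ a) (hb : 0 < b) (hb' : b ≤ 1/2)
    (hδ : 0 < δ) (hδ' : 2*δ ≤ 1/2) (hC : nw m * ENNReal.ofReal (CT m b * δ^(1+b)) ≤ 2 * kap m)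
    (hK : 2 * K0 m a δ ≤ kap m * nw m) :
    ∃ R0 : ℝ, 2 ≤ R0 ∧ ∃ C : ℝ≥0∞, C ≠ ∞ ∧ ∀ R, R0 ≤ R → ∀ F : Set (Eu (m+1)), MeasurableSet F → perimeter F ≠ ∞ →
      volume F = volume (ball (0:Eu (m+1)) R) →
      perimeter (ball (0:Eu (m+1)) R) + EK (k1 m a δ) (ball 0 R) (ball 0 R) ≤ perimeter F + EK (k1 m a δ) F F + C * SS R F := by
  obtain ⟨c, D, R0, hc, hc', hD, hR0, hcal⟩ := exists_cal hm ha ha' hδ hK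
  obtain ⟨M, C1, hM0, hC1, hW⟩ := W_compare (m := m) hc hc' hD
  set K := ∫⁻ z, k1 m a δ z with hKd
  have hKt : K ≠ ∞ := by
    rw [hKd, k1_int ha hδ]
    have := vol1_top m
    have := ENNReal.inv_ne_top.2 (cc_ne_zero (m := m) (a := a))
    finiteness
  refine ⟨R0, hR0, ENNReal.ofReal C1 + 2 * K, by finiteness, fun R hR F hF hP hv => ?_⟩
  have hR2 : 2 ≤ R := hR0.trans hR
  obtain ⟨q, q', h⟩ := hcal R hR
  obtain ⟨hM, hcmp⟩ := hW a δ R q q' hR2 h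
  have hK' : K0 m a δ ≤ kap m * nw m := le_trans (by rw [two_mul]; exact le_self_add) hK
  have s1 := per_lower hm ha ha' hba hb hb' hδ (by linarith) hR2 hC hK' hc hc' h hM0 hM hF hP
  have s2 := hcmp F hF hv
  rw [ball_W hR2 hc hc' h hM0 hM] at s2
  have s3 : perimeter (ball (0:Eu (m+1)) R) ≤ ENNReal.ofReal (q R) + phat m a δ R := by
    rw [h.at0]
    refine (perimeter_ball_le m (by linarith)).trans (le_of_eq ?_)
    unfold nw; ring
  have s4 := EK_local (m := m) (a := a) (R := R) hδ' hF
  have t1 := EK_total (a := a) (δ := δ) hF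
  have t2 := EK_total (a := a) (δ := δ) (measurableSet_ball (x := (0:Eu (m+1))) (ε := R))
  rw [← hKd] at s4 t1 t2
  set B := ball (0:Eu (m+1)) R
  have hBt : volume B ≠ ∞ := measure_ball_lt_top.ne
  rw [hv] at t1 s1
  have hph : phat m a δ R = EK (k1 m a δ) B Bᶜ := rfl
  rw [hph] at s3
  set X := EK (k1 m a δ) (Sh m R ∩ F) (Sh m R \ F)
  set IF := ∫⁻ x in F, Wt m q' R c M x
  have hMB : ENNReal.ofReal M * volume B ≠ ∞ := by finiteness
  have hIF : IF ≠ ∞ := ne_top_of_le_ne_top (by finiteness) (le_add_self.trans s1)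
  have u1 : ENNReal.ofReal (q R) + X ≤ perimeter F + ENNReal.ofReal C1 * SS R F := by
    have : (ENNReal.ofReal (q R) + X) + (ENNReal.ofReal M * volume B + IF) ≤
        (perimeter F + ENNReal.ofReal C1 * SS R F) + (ENNReal.ofReal M * volume B + IF) := by
      calc _ = (ENNReal.ofReal (q R) + ENNReal.ofReal M * volume B) + (X + IF) := by ring
        _ ≤ (IF + ENNReal.ofReal C1 * SS R F) + (perimeter F + ENNReal.ofReal M * volume B) := add_le_add s2 s1
        _ = _ := by ring
    exact (ENNReal.add_le_add_iff_right (by finiteness)).1 this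
  have hFF : EK (k1 m a δ) F Fᶜ ≠ ∞ := ne_top_of_le_ne_top (by finiteness) (le_add_self.trans t1.le)
  refine (ENNReal.add_le_add_iff_right hFF).1 ?_
  calc perimeter B + EK (k1 m a δ) B B + EK (k1 m a δ) F Fᶜ
      ≤ (ENNReal.ofReal (q R) + EK (k1 m a δ) B Bᶜ) + EK (k1 m a δ) B B + (X + 2 * K * SS R F) :=
        add_le_add (add_le_add_left s3 _) s4
    _ = (ENNReal.ofReal (q R) + X) + (EK (k1 m a δ) B B + EK (k1 m a δ) B Bᶜ) + 2 * K * SS R F := by ring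
    _ ≤ (perimeter F + ENNReal.ofReal C1 * SS R F) + (EK (k1 m a δ) F F + EK (k1 m a δ) F Fᶜ) + 2 * K * SS R F := by
        rw [t2, t1]; exact add_le_add_left (add_le_add_left u1 _) _
    _ = _ := by ring


theorem exists_delta (m : ℕ) {a b : ℝ} (ha : 0 < a) (hb : 0 < b) :
    ∃ δ : ℝ, 0 < δ ∧ 2*δ ≤ 1/2 ∧ nw m * ENNReal.ofReal (CT m b * δ^(1+b)) ≤ 2 * kap m ∧ 2 * K0 m a δ ≤ kap m * nw m := by
  have hnt := nw_ne_top m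
  have hv := vol1_top m
  have hcc := ENNReal.inv_ne_top.2 (cc_ne_zero (m := m) (a := a))
  have t1 : Tendsto (fun δ : ℝ => nw m * ENNReal.ofReal (CT m b * δ^(1+b))) (nhdsWithin 0 (Set.Ioi 0)) (nhds 0) := by
    have h1 : ContinuousAt (fun δ : ℝ => CT m b * δ^(1+b)) 0 :=
      continuousAt_const.mul (Real.continuousAt_rpow_const 0 (1+b) (Or.inr (by linarith)))
    have h2 : Tendsto (fun δ : ℝ => ENNReal.ofReal (CT m b * δ^(1+b))) (nhds 0) (nhds (ENNReal.ofReal (CT m b * 0^(1+b)))) :=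
      ENNReal.tendsto_ofReal h1.tendsto
    have h3 := ENNReal.Tendsto.const_mul (a := nw m) h2 (Or.inr hnt)
    rw [Real.zero_rpow (by linarith), mul_zero, ENNReal.ofReal_zero, mul_zero] at h3
    exact h3.mono_left nhdsWithin_le_nhds
  set Q : ℝ≥0∞ := 2 * (nw m * ((cc m a)⁻¹ * volume (ball (0:Eu (m+1)) 1) ^ 2 * ENNReal.ofReal (1/a))) with hQ
  have hQt : Q ≠ ∞ := by rw [hQ]; finiteness
  have t2 : Tendsto (fun δ : ℝ => Q * ENNReal.ofReal (2*δ)) (nhdsWithin 0 (Set.Ioi 0)) (nhds 0) := by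
    have h1 : Continuous fun δ : ℝ => 2*δ := by fun_prop
    have h2 : Tendsto (fun δ : ℝ => ENNReal.ofReal (2*δ)) (nhds 0) (nhds (ENNReal.ofReal (2*0))) :=
      ENNReal.tendsto_ofReal (h1.tendsto 0)
    have h3 := ENNReal.Tendsto.const_mul (a := Q) h2 (Or.inr hQt)
    rw [mul_zero, ENNReal.ofReal_zero, mul_zero] at h3
    exact h3.mono_left nhdsWithin_le_nhds
  have p1 : 0 < 2 * kap m := pos_iff_ne_zero.2 (mul_ne_zero (by simp) (kap_ne_zero m))
  have p2 : 0 < kap m * nw m := pos_iff_ne_zero.2 (mul_ne_zero (kap_ne_zero m) (nw_ne_zero m))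
  have e3 : ∀ᶠ δ : ℝ in nhdsWithin 0 (Set.Ioi 0), δ ∈ Set.Ioo (0:ℝ) (1/4) :=
    Ioo_mem_nhdsGT (by norm_num)
  obtain ⟨δ, h1, h2, h3⟩ := ((t1.eventually (gt_mem_nhds p1)).and ((t2.eventually (gt_mem_nhds p2)).and e3)).exists
  refine ⟨δ, h3.1, by linarith [h3.2], h1.le, le_trans ?_ h2.le⟩
  unfold K0
  rw [k1_int ha h3.1, ← nw, hQ]
  calc 2 * (nw m * ENNReal.ofReal (2 * δ) * ((cc m a)⁻¹ * volume (ball (0:Eu (m+1)) 1) ^ 2 * ENNReal.ofReal (δ ^ a / a)))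
      ≤ 2 * (nw m * ENNReal.ofReal (2 * δ) * ((cc m a)⁻¹ * volume (ball (0:Eu (m+1)) 1) ^ 2 * ENNReal.ofReal (1 / a))) := by
        refine mul_le_mul_right (mul_le_mul_right (mul_le_mul_right (ENNReal.ofReal_le_ofReal ?_) _) _) _
        refine div_le_div_of_nonneg_right ?_ ha.le
        exact Real.rpow_le_one h3.1.le (by linarith [h3.2]) ha.le
    _ = _ := by ring

theorem riesz_split {m : ℕ} {a δ : ℝ} (ha : a < m+1) (hδ : 0 < δ) (F : Set (Eu (m+1))) :
    rieszEnergy a F = EK (k1 m a δ) F F + EK (k2 m a δ) F F := by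
  unfold rieszEnergy EK
  rw [← lintegral_add_left]
  · refine lintegral_congr fun x => ?_
    rw [← lintegral_add_left]
    · refine lintegral_congr_ae (ae_restrict_of_ae ?_)
      have : ∀ᵐ y : Eu (m+1), y ≠ x := by
        rw [ae_iff]; simp
      filter_upwards [this] with y hy
      rw [k12 ha hδ (sub_ne_zero.2 (Ne.symm hy))]
      push_cast; rfl
    · have h0 : Measurable fun y : Eu (m+1) => x - y := by fun_prop
      exact (k1_meas m a δ).comp h0
  · exact Measurable.lintegral_prod_right' (f := fun q : Eu (m+1) × Eu (m+1) => k1 m a δ (q.1 - q.2)) (k1_pm m a δ)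

theorem pot_gain {m : ℕ} {β A R : ℝ} (hA : 0 < A) (hβ : 1 < β) (hR : 0 < R) {F : Set (Eu (m+1))} (hF : MeasurableSet F)
    (hv : volume F = volume (ball (0:Eu (m+1)) R)) :
    potEnergy β A (ball (0:Eu (m+1)) R) + ENNReal.ofReal (A * R^(β-1)) * SS R F ≤ potEnergy β A F := by
  unfold potEnergy
  set B := ball (0:Eu (m+1)) R
  set v : Eu (m+1) → ℝ≥0∞ := fun x => ENNReal.ofReal (A * ‖x‖^β) with hvd
  have hvm : Measurable v := by rw [hvd]; fun_prop
  set C := ENNReal.ofReal (A * R^(β-1)) with hC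
  have hCt : C ≠ ∞ := ENNReal.ofReal_ne_top
  set c := ENNReal.ofReal (A * R^β)
  have hB : MeasurableSet B := measurableSet_ball
  have hBf : volume B ≠ ∞ := measure_ball_lt_top.ne
  have e1 : ∫⁻ x in B, v x = (∫⁻ x in B ∩ F, v x) + ∫⁻ x in B \ F, v x := (lintegral_inter_add_sdiff v B hF).symm
  have e2 : ∫⁻ x in F, v x = (∫⁻ x in F ∩ B, v x) + ∫⁻ x in F \ B, v x := (lintegral_inter_add_sdiff v F hB).symm
  have hvd2 : volume (B \ F) = volume (F \ B) := by
    have h3 := measure_inter_add_sdiff (μ := volume) B hF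
    have h4 := measure_inter_add_sdiff (μ := volume) F hB
    rw [Set.inter_comm, hv, ← h3] at h4
    refine ((ENNReal.add_right_inj ?_).1 h4).symm
    exact ne_top_of_le_ne_top hBf (measure_mono Set.inter_subset_left)
  have hsplit : ∀ r : ℝ, 0 ≤ r → r^β = r^(β-1) * r := fun r hr => by
    rcases hr.eq_or_lt with h | h
    · rw [← h, mul_zero, Real.zero_rpow (by linarith)]
    · rw [← Real.rpow_add_one h.ne']; congr 1; ring
  have h5 : (∫⁻ x in B \ F, v x) + C * (∫⁻ x in B \ F, ENNReal.ofReal |‖x‖ - R|) ≤ c * volume (B \ F) := by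
    rw [← setLIntegral_const, ← lintegral_const_mul' _ _ hCt, ← lintegral_add_left hvm]
    refine setLIntegral_mono' (hB.diff hF) fun x hx => ?_
    have hxR : ‖x‖ < R := mem_ball_zero_iff.1 hx.1
    rw [hvd, hC, ← ENNReal.ofReal_mul (by positivity), ← ENNReal.ofReal_add (by positivity) (by positivity)]
    refine ENNReal.ofReal_le_ofReal ?_
    rw [abs_of_neg (by linarith), hsplit _ (norm_nonneg x), hsplit R hR.le]
    have h6 : ‖x‖^(β-1) ≤ R^(β-1) := Real.rpow_le_rpow (norm_nonneg _) hxR.le (by linarith)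
    have h7 := mul_le_mul_of_nonneg_left (mul_le_mul_of_nonneg_right h6 (norm_nonneg x)) hA.le
    linarith
  have h6 : c * volume (F \ B) + C * (∫⁻ x in F \ B, ENNReal.ofReal |‖x‖ - R|) ≤ ∫⁻ x in F \ B, v x := by
    rw [← setLIntegral_const, ← lintegral_const_mul' _ _ hCt, ← lintegral_add_left measurable_const]
    refine setLIntegral_mono' (hF.diff hB) fun x hx => ?_
    have hxR : R ≤ ‖x‖ := by
      have := hx.2
      simp only [B, mem_ball_zero_iff] at this
      linarith
    rw [hvd, hC, ← ENNReal.ofReal_mul (by positivity), ← ENNReal.ofReal_add (by positivity) (by positivity)]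
    refine ENNReal.ofReal_le_ofReal ?_
    rw [abs_of_nonneg (by linarith), hsplit _ (norm_nonneg x), hsplit R hR.le]
    have h6 : R^(β-1) ≤ ‖x‖^(β-1) := Real.rpow_le_rpow hR.le hxR (by linarith)
    have h7 := mul_le_mul_of_nonneg_left (mul_le_mul_of_nonneg_right h6 (norm_nonneg x)) hA.le
    linarith
  rw [e1, e2, SS, mul_add]
  calc _ = (∫⁻ x in B ∩ F, v x) + ((∫⁻ x in B \ F, v x) + C * (∫⁻ x in B \ F, ENNReal.ofReal |‖x‖ - R|)) +
        C * ∫⁻ x in F \ B, ENNReal.ofReal |‖x‖ - R| := by ring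
    _ ≤ (∫⁻ x in B ∩ F, v x) + c * volume (B \ F) + C * ∫⁻ x in F \ B, ENNReal.ofReal |‖x‖ - R| := by gcongr
    _ = (∫⁻ x in F ∩ B, v x) + (c * volume (F \ B) + C * ∫⁻ x in F \ B, ENNReal.ofReal |‖x‖ - R|) := by
        rw [hvd2, Set.inter_comm]; ring
    _ ≤ _ := by gcongr

theorem main_R {m : ℕ} (hm : 1 ≤ m) {α β A : ℝ} (hα0 : 0 < α) (hαn : α < (m:ℝ)+1) (hA : 0 < A) (hαβ : α < β) (hβ1 : 1 < β) :
    ∃ R0 : ℝ, 2 ≤ R0 ∧ ∀ R, R0 ≤ R → ∀ F : Set (Eu (m+1)), MeasurableSet F →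
      volume F = volume (ball (0:Eu (m+1)) R) → totalEnergy α β A (ball (0:Eu (m+1)) R) ≤ totalEnergy α β A F := by
  obtain ⟨δ, hδ, hδ', hC, hK⟩ := exists_delta m (a := α) (b := min α (1/2)) hα0 (lt_min hα0 (by norm_num))
  obtain ⟨R0, hR0, C, hCt, h1⟩ := K1 hm hα0 hαn (min_le_left _ _) (lt_min hα0 (by norm_num)) (min_le_right _ _) hδ hδ' hC hK
  have hm0 : (0:ℝ) ≤ m := by positivity
  have hlt : max (α-1) 0 < min (β-1) ((m:ℝ)+1) := by
    refine max_lt (lt_min ?_ ?_) (lt_min ?_ ?_) <;> linarith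
  obtain ⟨e, he1, he2⟩ := exists_between hlt
  have ea : α - 1 < e := (le_max_left _ _).trans_lt he1
  have e0 : 0 ≤ e := (le_max_right _ _).trans he1.le
  have eb : e < β - 1 := he2.trans_le (min_le_left _ _)
  have em : e ≤ m + 1 := he2.le.trans (min_le_right _ _)
  set L := C + 2 * CK2 m α δ e with hL
  have hLt : L ≠ ∞ := by have := CK2_ne_top m α δ e; rw [hL]; finiteness
  have ht : Tendsto (fun R : ℝ => A * R^(β-1-e)) atTop atTop :=
    (tendsto_rpow_atTop (by linarith)).const_mul_atTop hA
  obtain ⟨R1, hR1⟩ := (ht.eventually (eventually_ge_atTop L.toReal)).exists_forall_of_atTop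
  refine ⟨max R0 R1, hR0.trans (le_max_left _ _), fun R hR F hF hv => ?_⟩
  have hRR0 : R0 ≤ R := (le_max_left _ _).trans hR
  have hR2 : 2 ≤ R := hR0.trans hRR0
  have hRp : 0 < R := by linarith
  by_cases hP : perimeter F = ∞
  · unfold totalEnergy; rw [hP]; simp
  have s1 := h1 R hRR0 F hF hP hv
  have s2 := K2 (a := α) (e := e) hαn hδ hRp e0 em ea hF hv
  have s3 := pot_gain (β := β) hA hβ1 hRp hF hv
  have s4 : C + 2 * (CK2 m α δ e * ENNReal.ofReal (R^e)) ≤ ENNReal.ofReal (A * R^(β-1)) := by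
    have h3 := hR1 R ((le_max_right _ _).trans hR)
    have h4 : L ≤ ENNReal.ofReal (A * R^(β-1-e)) := by
      rw [← ENNReal.ofReal_toReal hLt]; exact ENNReal.ofReal_le_ofReal h3
    have h5 : (1:ℝ≥0∞) ≤ ENNReal.ofReal (R^e) := by
      rw [← ENNReal.ofReal_one]; exact ENNReal.ofReal_le_ofReal (Real.one_le_rpow (by linarith) e0)
    calc _ ≤ C * ENNReal.ofReal (R^e) + 2 * (CK2 m α δ e * ENNReal.ofReal (R^e)) :=
          add_le_add_left (le_mul_of_one_le_right' h5) _
      _ = L * ENNReal.ofReal (R^e) := by rw [hL]; ring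
      _ ≤ ENNReal.ofReal (A * R^(β-1-e)) * ENNReal.ofReal (R^e) := mul_le_mul_left h4 _
      _ = _ := by
        rw [← ENNReal.ofReal_mul (by positivity), mul_assoc, ← Real.rpow_add hRp]
        congr 3; ring
  unfold totalEnergy
  rw [riesz_split hαn hδ, riesz_split hαn hδ F]
  set B := ball (0:Eu (m+1)) R
  calc _ = (perimeter B + EK (k1 m α δ) B B) + EK (k2 m α δ) B B + potEnergy β A B := by ring
    _ ≤ (perimeter F + EK (k1 m α δ) F F + C * SS R F) + (EK (k2 m α δ) F F + 2 * (CK2 m α δ e * ENNReal.ofReal (R^e) * SS R F)) + potEnergy β A B := by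
        gcongr
    _ = perimeter F + (EK (k1 m α δ) F F + EK (k2 m α δ) F F) + (potEnergy β A B + (C + 2 * (CK2 m α δ e * ENNReal.ofReal (R^e))) * SS R F) := by ring
    _ ≤ perimeter F + (EK (k1 m α δ) F F + EK (k2 m α δ) F F) + (potEnergy β A B + ENNReal.ofReal (A * R^(β-1)) * SS R F) := by gcongr
    _ ≤ _ := by gcongr

theorem statement6 (n : ℕ) (hn : 2 ≤ n) (α β A : ℝ)
    (hα0 : 0 < α) (hαn : α < n) (hβ : 0 < β) (hA : 0 < A) (hαβ : α < β) (hβ1 : 1 < β) :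
    ∃ mstar : ℝ, 0 < mstar ∧
      ∀ m, mstar < m → IsL1LocalMin α β A m (ballOfVolume n m) := by
  obtain ⟨k, rfl⟩ : ∃ k, n = k + 1 := ⟨n - 1, by omega⟩
  obtain ⟨R0, hR0, h⟩ := main_R (m := k) (by omega) hα0 (by push_cast at hαn; exact hαn) hA hαβ hβ1
  set ω := (volume (unitBall (k+1))).toReal with hω
  have hωt : volume (unitBall (k+1)) ≠ ∞ := vol1_top k
  have hω0 : 0 < ω := ENNReal.toReal_pos (vol1_pos k) hωt
  refine ⟨ω * R0^(k+1), by positivity, fun M hM => ?_⟩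
  have hM0 : 0 < M := lt_trans (by positivity) hM
  set R := (M / ω) ^ (1 / ((k+1:ℕ):ℝ)) with hR
  have hRp : 0 < R := by positivity
  have hRpow : R^(k+1) = M/ω := by
    rw [hR, one_div]
    exact Real.rpow_inv_natCast_pow (by positivity) (by omega)
  have hvol : volume (ball (0:Eu (k+1)) R) = ENNReal.ofReal M := by
    rw [vol_ball hRp.le]
    have : volume (ball (0:Eu (k+1)) 1) = ENNReal.ofReal ω := (ENNReal.ofReal_toReal hωt).symm
    rw [this, hRpow, ← ENNReal.ofReal_mul (by positivity)]
    congr 1; field_simp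
  have hRR : R0 ≤ R := by
    by_contra hlt
    push Not at hlt
    have h2 : R^(k+1) ≤ R0^(k+1) := pow_le_pow_left₀ hRp.le hlt.le _
    rw [hRpow, div_le_iff₀ hω0] at h2
    linarith
  exact ⟨measurableSet_ball, hvol, 1, one_pos, fun F hF hFv _ => h R hRR F hF (hFv.trans hvol.symm)⟩
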